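/- Let p₁, p₂ be distinct primes, N = p₁p₂, and let f(τ) = Σ_n a(n)qⁿ be a weakly holomorphic modular function on the Fricke group Γ₀*(N) with a(0) = 0. For d > 0 define t_f(d) = Σ_{Q ∈ 𝒬_{d,N,h}/Γ₀(N)} f(α_Q)/|Γ̄₀(N)_Q| (this is independent of the choice of h with h² ≡ -d mod 4N), and set t_f(d) = 0 if -d is not a square mod 4N. Define t_f(0) = 2Σ_{n≥1} a(-n){σ₁(n) + p₁p₂σ₁(n/p₁p₂) + p₁σ₁(n/p₁) + p₂σ₁(n/p₂)}, and for d < 0 set t_f(d) = -2^{μ_N(κ)}·κ·Σ_{κ|m} a(-m) if d = -κ² for a positive integer κ, and t_f(d) = 0 otherwise, where μ_N(κ) is the number of prime factors of gcd(N,κ). Then Σ_{n,r∈ℤ} t_f(4Nn - r²) qⁿζʳ is a weakly holomorphic Jacobi form of weight 2 and index N. -/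

import Mathlib

open Complex Matrix

noncomputable section

/-- `SL(2, ℝ)`. -/
abbrev SL2R := Matrix.SpecialLinearGroup (Fin 2) ℝ

/-- `q = e^{2πiz}` (also used as `ζ = e^{2πiz}`). -/
def qc (z : ℂ) : ℂ := Complex.exp (2 * Real.pi * Complex.I * z)

/-- The Dedekind eta function `η(z) = q^{1/24} ∏_{n ≥ 1} (1 - q^n)` (intended for `Im z > 0`). -/
def dedekindEta (z : ℂ) : ℂ :=
  Complex.exp (Real.pi * Complex.I * z / 12) *
    ∏' n : ℕ, (1 - Complex.exp (2 * Real.pi * Complex.I * ((n : ℂ) + 1) * z))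

/-- The hauptmodul `j_N` of `Γ₀(N)` for `N ∈ {2, 3, 5, 7, 13, 6, 10}`. -/
def jn (N : ℕ) (z : ℂ) : ℂ :=
  if N = 6 then (dedekindEta (2 * z) * dedekindEta (3 * z) ^ 3 / (dedekindEta z * dedekindEta (6 * z) ^ 3)) ^ 3 - 3
  else if N = 10 then dedekindEta (2 * z) * dedekindEta (5 * z) ^ 5 / (dedekindEta z * dedekindEta (10 * z) ^ 5) - 1
  else (dedekindEta z / dedekindEta ((N : ℂ) * z)) ^ (24 / (N - 1)) + 24 / ((N : ℂ) - 1)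

/-- The hauptmodul `j_N^*` of the Fricke group `Γ₀^*(N)` for `N ∈ {2, 3, 5, 7, 13, 6, 10}`. -/
def jnStar (N : ℕ) (z : ℂ) : ℂ :=
  if N = 6 then
    (dedekindEta z * dedekindEta (3 * z) / (dedekindEta (2 * z) * dedekindEta (6 * z))) ^ 6 + 6 +
      2 ^ 6 * (dedekindEta (2 * z) * dedekindEta (6 * z) / (dedekindEta z * dedekindEta (3 * z))) ^ 6
  else if N = 10 then
    (dedekindEta z * dedekindEta (5 * z) / (dedekindEta (2 * z) * dedekindEta (10 * z))) ^ 4 + 4 +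
      2 ^ 4 * (dedekindEta (2 * z) * dedekindEta (10 * z) / (dedekindEta z * dedekindEta (5 * z))) ^ 4
  else
    (dedekindEta z / dedekindEta ((N : ℂ) * z)) ^ (24 / (N - 1)) + 24 / ((N : ℂ) - 1) +
      (N : ℂ) ^ (12 / (N - 1)) * (dedekindEta ((N : ℂ) * z) / dedekindEta z) ^ (24 / (N - 1))

/-- `f` has the `q`-expansion `f(τ) = Σ_{n ≥ n₀} (a n) q^n` on the upper half-plane. -/
def HasQExp (f : ℂ → ℂ) (a : ℤ → ℂ) (n₀ : ℤ) : Prop :=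
  (∀ n < n₀, a n = 0) ∧
    ∀ τ : ℂ, 0 < τ.im →
      HasSum (fun m : ℕ => a (n₀ + m) * qc τ ^ (n₀ + (m : ℤ))) (f τ)

/-- `Γ₀(N)` viewed as a subgroup of `SL(2, ℝ)`. -/
def Gamma0SL2R (N : ℕ) : Subgroup SL2R :=
  (CongruenceSubgroup.Gamma0 N).map
    (Matrix.SpecialLinearGroup.map (Int.castRingHom ℝ))

/-- The set of Atkin–Lehner matrices `W_e` of level `N`:
`W_e = e^{-1/2} [[xe, y], [zN, we]]`, `x, y, z, w ∈ ℤ` (determinant `1` being automatic). -/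
def atkinLehnerSet (N e : ℕ) : Set SL2R :=
  { g | ∃ x y z w : ℤ,
      g.1 = (Real.sqrt e)⁻¹ • !![(x : ℝ) * e, (y : ℝ); (z : ℝ) * N, (w : ℝ) * e] }

/-- The Fricke group `Γ₀^*(N)`, generated by `Γ₀(N)` and all Atkin–Lehner involutions `W_e`
for `e ∣ N` with `gcd(e, N/e) = 1`. -/
def FrickeGroup (N : ℕ) : Subgroup SL2R :=
  Subgroup.closure
    ((Gamma0SL2R N : Set SL2R) ∪
      ⋃ e ∈ {e : ℕ | e ∣ N ∧ Nat.Coprime e (N / e)}, atkinLehnerSet N e)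

/-- The Gram matrix of the integral binary quadratic form `[a, b, c]`. -/
def formMat (a b c : ℤ) : Matrix (Fin 2) (Fin 2) ℝ :=
  !![(a : ℝ), (b : ℝ) / 2; (b : ℝ) / 2, (c : ℝ)]

/-- `𝒬_{d,N}`: positive definite integral binary quadratic forms `[a, b, c]` of
discriminant `-d` with `N ∣ a`. -/
def QdN (d : ℤ) (N : ℕ) : Set (Matrix (Fin 2) (Fin 2) ℝ) :=
  { M | ∃ a b c : ℤ, M = formMat a b c ∧ 0 < a ∧ b ^ 2 - 4 * a * c = -d ∧ (N : ℤ) ∣ a }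

/-- `𝒬_{d,N,h}`: members of `𝒬_{d,N}` with `b ≡ h (mod 2N)`. -/
def QdNh (d : ℤ) (N : ℕ) (h : ℤ) : Set (Matrix (Fin 2) (Fin 2) ℝ) :=
  { M | ∃ a b c : ℤ, M = formMat a b c ∧ 0 < a ∧ b ^ 2 - 4 * a * c = -d ∧ (N : ℤ) ∣ a ∧
      (b : ZMod (2 * N)) = (h : ZMod (2 * N)) }

/-- Orbit relation of the (right) action `Q ↦ Q ∘ g`, i.e. `M ↦ gᵀ M g`, of `Γ ≤ SL(2, ℝ)`
on a set `S` of Gram matrices of quadratic forms. -/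
def formRel (Γ : Subgroup SL2R) (S : Set (Matrix (Fin 2) (Fin 2) ℝ)) (Q Q' : S) : Prop :=
  ∃ g ∈ Γ, Q'.1 = (g.1)ᵀ * Q.1 * g.1

/-- The CM point `α_Q` of a positive definite form (as a point of `ℂ`; it lies in the upper
half-plane): `α_Q = (-b + i √d) / (2a) = (-(b/2) + i √(det M)) / a`. -/
def cmPointC (M : Matrix (Fin 2) (Fin 2) ℝ) : ℂ :=
  ((-(M 0 1) : ℝ) + Complex.I * Real.sqrt M.det) / ((M 0 0 : ℝ) : ℂ)

/-- The order of the stabilizer of the form `M` in `Γ/{±1}` (the stabilizer in `Γ` contains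
`±1` and has twice the cardinality). -/
def stabOrder (Γ : Subgroup SL2R) (M : Matrix (Fin 2) (Fin 2) ℝ) : ℕ :=
  Nat.card { g : SL2R // g ∈ Γ ∧ (g.1)ᵀ * M * g.1 = M } / 2

/-- The modular trace `Σ_{Q ∈ S/Γ} f(α_Q) / |Γ̄_Q|`. -/
def classTrace (Γ : Subgroup SL2R) (f : ℂ → ℂ)
    (S : Set (Matrix (Fin 2) (Fin 2) ℝ)) : ℂ :=
  ∑ᶠ O : Quot (formRel Γ S),
    f (cmPointC (Quot.out O).1) / (stabOrder Γ (Quot.out O).1 : ℂ)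

/-- `t₂^{(N*)}(d)`, where `P` is the polynomial with `φ₂(j_N^*) = P(j_N^*)`;
includes the paper's conventions at nonpositive indices. -/
def t2Star (N : ℕ) (P : Polynomial ℂ) (d : ℤ) : ℂ :=
  if 0 < d then
    classTrace (FrickeGroup N) (fun z => Polynomial.eval (jnStar N z) P) (QdN d N)
  else if d = 0 then (if N = 2 then 5 else if N = 6 ∨ N = 10 then 5 / 2 else 3)
  else if d = -1 then -1
  else if d = -4 then -2
  else 0

/-- `σ₁^{(N)}(x) = Σ_{d ∣ x, N ∤ d} d` for `x ∈ ℤ_{>0}`, `(N-1)/24` at `x = 0`, and `0`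
off `ℤ_{≥0}`. -/
def sigmaN (N : ℕ) (x : ℚ) : ℂ :=
  if x = 0 then ((N : ℂ) - 1) / 24
  else if 0 < x ∧ x.den = 1 then
    ∑ d ∈ (Nat.divisors x.num.toNat).filter (fun d => ¬ N ∣ d), (d : ℂ)
  else 0

/-- `σ₁(x) = Σ_{d ∣ x} d` for `x ∈ ℤ_{>0}` and `0` otherwise. -/
def sigmaQ (x : ℚ) : ℂ :=
  if 0 < x ∧ x.den = 1 then ∑ d ∈ Nat.divisors x.num.toNat, (d : ℂ) else 0

/-- A weakly holomorphic Jacobi form of weight `k` and index `m`. -/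
structure WeakJacobiForm (k : ℤ) (m : ℕ) where
  toFun : ℂ → ℂ → ℂ
  holo : DifferentiableOn ℂ (fun p : ℂ × ℂ => toFun p.1 p.2)
      ({τ : ℂ | 0 < τ.im} ×ˢ (Set.univ : Set ℂ))
  slash_inv : ∀ a b c d : ℤ, a * d - b * c = 1 → ∀ τ z : ℂ, 0 < τ.im →
    ((c : ℂ) * τ + d) ^ (-k) *
        Complex.exp (-(2 * Real.pi * Complex.I * m * c * z ^ 2) / ((c : ℂ) * τ + d)) *
        toFun (((a : ℂ) * τ + b) / ((c : ℂ) * τ + d)) (z / ((c : ℂ) * τ + d)) =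
      toFun τ z
  elliptic : ∀ lm mu : ℤ, ∀ τ z : ℂ, 0 < τ.im →
    Complex.exp (2 * Real.pi * Complex.I * m * ((lm : ℂ) ^ 2 * τ + 2 * lm * z)) *
        toFun τ (z + lm * τ + mu) = toFun τ z
  coeff : ℤ → ℤ → ℂ
  coeff_neg_finite : {n : ℤ | n < 0 ∧ ∃ r : ℤ, coeff n r ≠ 0}.Finite
  expansion : ∀ τ z : ℂ, 0 < τ.im →
    HasSum (fun p : ℤ × ℤ => coeff p.1 p.2 * qc τ ^ p.1 * qc z ^ p.2) (toFun τ z)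

/-- Meromorphy of weight `k` at all cusps: at each cusp `γ∞`, the function `F|_k γ` has a
Fourier expansion in fractional powers of `q` with only finitely many negative terms. -/
def MeromAtCusps (k : ℤ) (F : ℂ → ℂ) : Prop :=
  ∀ a b c d : ℤ, a * d - b * c = 1 →
    ∃ (M : ℕ) (cs : ℤ → ℂ) (n₀ : ℤ), 0 < M ∧
      ∀ τ : ℂ, 0 < τ.im →
        HasSum
          (fun j : ℕ => cs (n₀ + j) *
            Complex.exp (2 * Real.pi * Complex.I * τ / M) ^ (n₀ + (j : ℤ)))
          (((c : ℂ) * τ + d) ^ (-k) * F (((a : ℂ) * τ + b) / ((c : ℂ) * τ + d)))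

/-- The Möbius action of an element of `SL(2, ℝ)` on `ℂ`. -/
def moebius (g : SL2R) (z : ℂ) : ℂ :=
  ((g.1 0 0 : ℝ) * z + ((g.1 0 1 : ℝ) : ℂ)) / ((g.1 1 0 : ℝ) * z + ((g.1 1 1 : ℝ) : ℂ))

/-- A weakly holomorphic modular function on `Γ`: holomorphic on the upper half-plane,
`Γ`-invariant, with poles only at the cusps. -/
def IsWeaklyHolModularFn (Γ : Subgroup SL2R) (f : ℂ → ℂ) : Prop :=
  DifferentiableOn ℂ f {z : ℂ | 0 < z.im} ∧
    (∀ g ∈ Γ, ∀ z : ℂ, 0 < z.im → f (moebius g z) = f z) ∧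
    MeromAtCusps 0 f

/-- The set `L_{h, d/4N}` of vectors
`X = [[b + h/2N, c/N], [-a, -(b + h/2N)]]`, `a, b, c ∈ ℤ`, of norm `q(X) = d/4N`. -/
def LhSet (N : ℕ) (h d : ℤ) : Set (Matrix (Fin 2) (Fin 2) ℝ) :=
  { X | ∃ a b c : ℤ,
      X = !![(b : ℝ) + (h : ℝ) / (2 * N), (c : ℝ) / N;
             -(a : ℝ), -((b : ℝ) + (h : ℝ) / (2 * N))] ∧
      (2 * b * N + h) ^ 2 - 4 * a * c * N = -d }

/-- The map `X ↦ N ⬝ [[0,-1],[1,0]] ⬝ X` from vectors to Gram matrices of quadratic forms. -/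
def vecToForm (N : ℕ) (X : Matrix (Fin 2) (Fin 2) ℝ) : Matrix (Fin 2) (Fin 2) ℝ :=
  (N : ℝ) • (!![(0 : ℝ), -1; 1, 0] * X)

/-- Orbit relation of `Γ` acting by conjugation `g.X = g X g⁻¹` on a set `S` of vectors. -/
def vecRel (Γ : Subgroup SL2R) (S : Set (Matrix (Fin 2) (Fin 2) ℝ)) (X X' : S) : Prop :=
  ∃ g ∈ Γ, X'.1 = g.1 * X.1 * (g⁻¹).1

/-- The Heegner point `D_X ∈ ℍ` of a vector `X` of positive norm. -/
def heegnerC (X : Matrix (Fin 2) (Fin 2) ℝ) : ℂ :=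
  ((X 0 0 / X 1 0 : ℝ) : ℂ) + Complex.I * Real.sqrt (X.det / (X 1 0) ^ 2)

/-- The order of the stabilizer of the vector `X` in `Γ/{±1}`. -/
def vecStabOrder (Γ : Subgroup SL2R) (X : Matrix (Fin 2) (Fin 2) ℝ) : ℕ :=
  Nat.card { g : SL2R // g ∈ Γ ∧ g.1 * X * (g⁻¹).1 = X } / 2

/-- The modular trace `t_f(h, m) = Σ_{X ∈ Γ\L_{h,m}} f(D_X) / |Γ̄_X|`. -/
def vecTrace (Γ : Subgroup SL2R) (f : ℂ → ℂ) (S : Set (Matrix (Fin 2) (Fin 2) ℝ)) : ℂ :=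
  ∑ᶠ O : Quot (vecRel Γ S), f (heegnerC (Quot.out O).1) / (vecStabOrder Γ (Quot.out O).1 : ℂ)

/-- The weight-2 Eisenstein series `E₂(z) = 1 - 24 Σ_{n ≥ 1} σ₁(n) qⁿ`. -/
def E2 (z : ℂ) : ℂ :=
  1 - 24 * ∑' n : ℕ, (∑ d ∈ Nat.divisors (n + 1), (d : ℂ)) * qc z ^ (n + 1)

/-- `E₂^{(N)}(z) = N E₂(Nz) - E₂(z)`. -/
def E2N (N : ℕ) (z : ℂ) : ℂ := (N : ℂ) * E2 ((N : ℂ) * z) - E2 z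

end

namespace TraceLift

open UpperHalfPlane hiding I I_im I_re
open MeasureTheory Filter
open Real (smoothTransition exp_pos pi_pos norm_eq_abs exp_le_exp)
open scoped Real Topology ComplexConjugate FourierTransform

noncomputable section

local notation "Mat₂" => Matrix (Fin 2) (Fin 2) ℝ

variable {Γ : Subgroup SL2R} {g : SL2R} {c₀ v : ℝ} {N e e' p₁ p₂ : ℕ} {D n₀ : ℤ} {f : ℂ → ℂ}
  {a : ℤ → ℂ} {τ z w : ℂ}

/-! ### Groups with one cusp -/

/-- The automorphy factor `c z + d`. -/
def autF (g : SL2R) (z : ℂ) : ℂ := ((g.1 1 0 : ℝ) : ℂ) * z + ((g.1 1 1 : ℝ) : ℂ)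

lemma coe_smul_eq_moebius (g : SL2R) (w : ℍ) : ((g • w : ℍ) : ℂ) = moebius g w := by
  rw [UpperHalfPlane.specialLinearGroup_apply]; simp [moebius]

lemma det_eq_one (g : SL2R) : g.1 0 0 * g.1 1 1 - g.1 0 1 * g.1 1 0 = 1 := by
  have h := g.2
  rwa [det_fin_two] at h

lemma autF_ne_zero (g : SL2R) (hz : 0 < z.im) : autF g z ≠ 0 := by
  intro h
  have him := congrArg Complex.im h
  have hre := congrArg Complex.re h
  simp [autF] at him hre
  have hd := det_eq_one g
  rcases him with h0 | h0
  · rw [h0] at hre hd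
    simp at hre
    rw [hre] at hd
    simp at hd
  · exact hz.ne' h0

lemma moebius_eq (g : SL2R) (z : ℂ) :
    moebius g z = (((g.1 0 0 : ℝ) : ℂ) * z + ((g.1 0 1 : ℝ) : ℂ)) / autF g z := rfl

lemma im_moebius (g : SL2R) (hz : 0 < z.im) :
    (moebius g z).im = z.im / normSq (autF g z) := by
  have hd := det_eq_one g
  have hn : normSq (autF g z) ≠ 0 := by simpa using autF_ne_zero g hz
  rw [moebius_eq, div_im]
  field_simp
  simp [autF]
  linear_combination z.im * hd

lemma im_smul (g : SL2R) (w : ℍ) : (g • w).im = w.im / normSq (autF g w) := by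
  rw [← coe_im, coe_smul_eq_moebius, im_moebius g w.coe_im_pos, coe_im]

lemma im_moebius_pos (g : SL2R) (hz : 0 < z.im) : 0 < (moebius g z).im := by
  rw [im_moebius g hz]
  exact div_pos hz (normSq_pos.mpr (autF_ne_zero g hz))

lemma moebius_mul (g h : SL2R) (hz : 0 < z.im) :
    moebius (g * h) z = moebius g (moebius h z) := by
  have := coe_smul_eq_moebius (g * h) ⟨z, hz⟩
  rw [mul_smul] at this
  rw [← this, coe_smul_eq_moebius, coe_smul_eq_moebius]

lemma moebius_one (z : ℂ) : moebius 1 z = z := by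
  simp [moebius]

/-- A discrete subgroup of `SL(2, ℝ)` whose only cusp, up to equivalence, is `∞` of width one. -/
structure OneCusp (Γ : Subgroup SL2R) (c₀ : ℝ) : Prop where
  finite_bdd : ∀ R : ℝ, {g : SL2R | g ∈ Γ ∧ ∀ i j, |g.1 i j| ≤ R}.Finite
  trans : ∀ n : ℤ, ∃ g ∈ Γ, g.1 = !![1, (n : ℝ); 0, 1]
  neg_one : -1 ∈ Γ
  cusp : ∀ g ∈ Γ, g.1 1 0 = 0 → ∃ n : ℤ, g.1 = !![1, (n : ℝ); 0, 1] ∨ -g.1 = !![1, (n : ℝ); 0, 1]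
  gap : ∀ g ∈ Γ, g.1 1 0 ≠ 0 → 1 ≤ |g.1 1 0|
  pos : 0 < c₀
  reduce : ∀ w : ℍ, ∃ g ∈ Γ, |(g • w).re| ≤ 1 / 2 ∧ c₀ ≤ (g • w).im

lemma normSq_autF_ge (g : SL2R) (z : ℂ) : (g.1 1 0 * z.im) ^ 2 ≤ normSq (autF g z) := by
  have : (autF g z).im = g.1 1 0 * z.im := by simp [autF]
  rw [← this, normSq_apply]
  nlinarith [mul_self_nonneg (autF g z).re]

lemma autF_of_lower_zero (hΓ : OneCusp Γ c₀) (hg : g ∈ Γ)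
    (h0 : g.1 1 0 = 0) (z : ℂ) : autF g z = 1 ∨ autF g z = -1 := by
  obtain ⟨n, h | h⟩ := hΓ.cusp g hg h0
  · left
    have h1 := congrFun (congrFun h 1) 1
    simp at h1
    simp [autF, h0, h1]
  · right
    have h1 := congrFun (congrFun h 1) 1
    simp at h1
    have h2 : g.1 1 1 = -1 := by linarith
    simp [autF, h0, h2]

lemma im_smul_of_lower_zero (hΓ : OneCusp Γ c₀)
    (hg : g ∈ Γ) (h0 : g.1 1 0 = 0) (w : ℍ) : (g • w).im = w.im := by
  rw [im_smul]
  rcases autF_of_lower_zero hΓ hg h0 w with h | h <;> simp [h]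

lemma im_smul_le_inv (hΓ : OneCusp Γ c₀)
    (hg : g ∈ Γ) (h0 : g.1 1 0 ≠ 0) (w : ℍ) : (g • w).im ≤ 1 / w.im := by
  rw [im_smul]
  have h1 := normSq_autF_ge g w
  have h2 := hΓ.gap g hg h0
  have hw := w.im_pos
  have h3 : w.im ^ 2 ≤ (g.1 1 0 * (w : ℂ).im) ^ 2 := by
    rw [mul_pow, ← sq_abs (g.1 1 0), coe_im]
    nlinarith [sq_nonneg w.im, mul_self_nonneg (|g.1 1 0| - 1)]
  rw [div_le_div_iff₀ (by nlinarith [sq_nonneg w.im, pow_pos hw 2]) hw]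
  nlinarith

/-- Only finitely many elements map some point of a bounded region into a fixed strip. -/
lemma OneCusp.finite_meet (hΓ : OneCusp Γ c₀) {δ c R : ℝ}
    (hδ : 0 < δ) (hc : 0 < c) :
    {g : SL2R | g ∈ Γ ∧ ∃ w : ℍ, ‖(w : ℂ)‖ ≤ R ∧ δ ≤ w.im ∧ |(g • w).re| ≤ 1 ∧
      c ≤ (g • w).im}.Finite := by
  have hA0 : 0 ≤ √(R / c) := Real.sqrt_nonneg _
  set A := √(R / c) with hA
  set B := 1 + (R + 1 / δ) with hB
  refine (hΓ.finite_bdd (max (max (A / δ) (A + A / δ * R))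
    (max (B * A / δ) (B * A + B * A / δ * R)))).subset ?_
  rintro g ⟨hg, w, hR, hw, hre, him⟩
  refine ⟨hg, ?_⟩
  have hwp := w.im_pos
  have hR0 : 0 ≤ R := le_trans (norm_nonneg _) hR
  have hyR : w.im ≤ R := le_trans (le_trans (le_abs_self _) (abs_im_le_norm (w : ℂ))) hR
  have hn : 0 < normSq (autF g w) := normSq_pos.mpr (autF_ne_zero g w.coe_im_pos)
  have hnA : ‖autF g w‖ ≤ A := by
    rw [hA]
    apply Real.le_sqrt_of_sq_le
    rw [← normSq_eq_norm_sq, le_div_iff₀ hc]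
    rw [im_smul, le_div_iff₀ hn] at him
    linarith
  have key : ∀ (p q : ℝ) (X : ℝ), ‖(p : ℂ) * w + (q : ℂ)‖ ≤ X → |p| ≤ X / δ ∧ |q| ≤ X + X / δ * R := by
    intro p q X hX
    have h1 : |p| * w.im ≤ X := by
      have := (abs_im_le_norm ((p : ℂ) * w + (q : ℂ))).trans hX
      simpa [abs_mul, abs_of_pos hwp] using this
    have hp : |p| ≤ X / δ := by
      rw [le_div_iff₀ hδ]
      exact le_trans (mul_le_mul_of_nonneg_left hw (abs_nonneg _)) h1
    refine ⟨hp, ?_⟩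
    have h2 : ‖(q : ℂ)‖ ≤ ‖(p : ℂ) * w + (q : ℂ)‖ + ‖(p : ℂ) * w‖ := by
      have : (q : ℂ) = ((p : ℂ) * w + (q : ℂ)) - (p : ℂ) * w := by ring
      conv_lhs => rw [this]
      exact norm_sub_le _ _
    rw [norm_mul, norm_real, norm_real, norm_eq_abs, norm_eq_abs] at h2
    have h3 : |p| * ‖(w : ℂ)‖ ≤ X / δ * R := mul_le_mul hp hR (norm_nonneg _) (le_trans (abs_nonneg _) hp)
    linarith
  have himB : (g • w).im ≤ R + 1 / δ := by
    by_cases h0 : g.1 1 0 = 0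
    · rw [im_smul_of_lower_zero hΓ hg h0]
      have : 0 < 1 / δ := by positivity
      linarith
    · have h1 := im_smul_le_inv hΓ hg h0 w
      have h2 : 1 / w.im ≤ 1 / δ := one_div_le_one_div_of_le hδ hw
      linarith
  have hnum : ‖((g.1 0 0 : ℝ) : ℂ) * w + ((g.1 0 1 : ℝ) : ℂ)‖ ≤ B * A := by
    have h1 : ((g.1 0 0 : ℝ) : ℂ) * w + ((g.1 0 1 : ℝ) : ℂ) = ((g • w : ℍ) : ℂ) * autF g w := by
      rw [coe_smul_eq_moebius, moebius_eq, div_mul_cancel₀ _ (autF_ne_zero g w.coe_im_pos)]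
    rw [h1, norm_mul]
    have h2 : ‖((g • w : ℍ) : ℂ)‖ ≤ B := by
      refine (Complex.norm_le_abs_re_add_abs_im _).trans ?_
      rw [coe_re, coe_im, abs_of_pos (g • w).im_pos]
      linarith
    exact mul_le_mul h2 hnA (norm_nonneg _) (le_trans (norm_nonneg _) h2)
  have k1 := key _ _ _ hnA
  have k2 := key _ _ _ hnum
  intro i j
  fin_cases i <;> fin_cases j <;> simp
  · exact Or.inr (Or.inl k2.1)
  · exact Or.inr (Or.inr k2.2)
  · exact Or.inl (Or.inl k1.1)
  · exact Or.inl (Or.inr k1.2)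

lemma OneCusp.countable (hΓ : OneCusp Γ c₀) : Countable Γ := by
  have : (Γ : Set SL2R).Countable := by
    refine Set.Countable.mono ?_ (Set.countable_iUnion fun n : ℕ => (hΓ.finite_bdd n).countable)
    intro g hg
    obtain ⟨n, hn⟩ := exists_nat_ge (∑ i, ∑ j, |g.1 i j|)
    refine Set.mem_iUnion.mpr ⟨n, hg, fun i j => le_trans ?_ hn⟩
    refine le_trans ?_ (Finset.single_le_sum (f := fun i => ∑ j, |g.1 i j|)
      (fun i _ => Finset.sum_nonneg fun j _ => abs_nonneg _) (Finset.mem_univ i))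
    exact Finset.single_le_sum (f := fun j => |g.1 i j|) (fun j _ => abs_nonneg _) (Finset.mem_univ j)
  exact this.to_subtype

instance smulInvariantSL2R : SMulInvariantMeasure SL2R ℍ volume where
  measure_preimage_smul g s hs :=
    measure_preimage_smul_of_nullMeasurableSet (G := GL (Fin 2) ℝ) (μ := (volume : Measure ℍ))
      hs.nullMeasurableSet (g : GL (Fin 2) ℝ)

lemma hasSum_of_forall_eq {ι E : Type*} [AddCommMonoid E] [TopologicalSpace E] {f g : ι → E} {a : E}
    (h : HasSum f a) (e : ∀ i, g i = f i) : HasSum g a := by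
  rwa [funext e]

/-! ### A smooth partition of unity -/

/-- A smooth bump on `[-1, 1]` whose integer translates sum to one. -/
def bumpX (x : ℝ) : ℝ := smoothTransition (x + 1) - smoothTransition x

lemma bumpX_contDiff {n : ℕ∞} : ContDiff ℝ n bumpX :=
  (smoothTransition.contDiff.comp (contDiff_id.add contDiff_const)).sub
    smoothTransition.contDiff

lemma bumpX_eq_zero {x : ℝ} (hx : 1 ≤ |x|) : bumpX x = 0 := by
  unfold bumpX
  rcases le_abs.mp hx with h | h
  · rw [smoothTransition.one_of_one_le h, smoothTransition.one_of_one_le (by linarith)]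
    simp
  · rw [smoothTransition.zero_of_nonpos (by linarith),
      smoothTransition.zero_of_nonpos (by linarith)]
    simp

lemma bumpX_pos {x : ℝ} (hx : |x| < 1) : 0 < bumpX x := by
  unfold bumpX
  rw [abs_lt] at hx
  rcases le_or_gt 0 x with h | h
  · rw [smoothTransition.one_of_one_le (by linarith)]
    linarith [smoothTransition.lt_one_of_lt_one hx.2]
  · rw [smoothTransition.zero_of_nonpos h.le]
    linarith [smoothTransition.pos_of_pos (x := x + 1) (by linarith)]

lemma bumpX_nonneg (x : ℝ) : 0 ≤ bumpX x := by
  rcases lt_or_ge |x| 1 with h | h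
  · exact (bumpX_pos h).le
  · exact (bumpX_eq_zero h).ge

lemma hasSum_bumpX (x : ℝ) : HasSum (fun n : ℤ => bumpX (x + n)) 1 := by
  have hx0 := Int.fract_nonneg x
  have hx1 := Int.fract_lt_one x
  have hfx : (x : ℝ) = ⌊x⌋ + Int.fract x := (Int.floor_add_fract x).symm
  have h1 : ∑ n ∈ ({-⌊x⌋, -⌊x⌋ - 1} : Finset ℤ), bumpX (x + n) = 1 := by
    rw [Finset.sum_pair (by omega)]
    have e1 : x + ((-⌊x⌋ : ℤ) : ℝ) = Int.fract x := by push_cast; linarith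
    have e2 : x + ((-⌊x⌋ - 1 : ℤ) : ℝ) = Int.fract x - 1 := by push_cast; linarith
    rw [e1, e2]
    unfold bumpX
    rw [smoothTransition.one_of_one_le (x := Int.fract x + 1) (by linarith),
      smoothTransition.zero_of_nonpos (x := Int.fract x - 1) (by linarith)]
    simp
  rw [← h1]
  refine hasSum_sum_of_ne_finset_zero fun n hn => bumpX_eq_zero ?_
  simp only [Finset.mem_insert, Finset.mem_singleton, not_or] at hn
  have : n + ⌊x⌋ ≤ -2 ∨ 1 ≤ n + ⌊x⌋ := by omega
  rw [le_abs]
  rcases this with h | h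
  · right
    have : ((n + ⌊x⌋ : ℤ) : ℝ) ≤ -2 := mod_cast h
    push_cast at this
    linarith
  · left
    have : (1 : ℝ) ≤ ((n + ⌊x⌋ : ℤ) : ℝ) := mod_cast h
    push_cast at this
    linarith

/-- The unnormalised bump function. -/
def rho0 (c₀ : ℝ) (z : ℂ) : ℝ := bumpX z.re * smoothTransition (2 * z.im / c₀ - 1)

lemma rho0_contDiff (c₀ : ℝ) {n : ℕ∞} : ContDiff ℝ n (rho0 c₀) := by
  have h1 : ContDiff ℝ n fun z : ℂ => 2 * z.im / c₀ - 1 :=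
    ((contDiff_const.mul Complex.imCLM.contDiff).div_const _).sub contDiff_const
  have h2 : ContDiff ℝ n fun z : ℂ => bumpX z.re := bumpX_contDiff.comp Complex.reCLM.contDiff
  exact h2.mul (smoothTransition.contDiff.comp h1)

lemma rho0_nonneg (c₀ : ℝ) (z : ℂ) : 0 ≤ rho0 c₀ z :=
  mul_nonneg (bumpX_nonneg _) (smoothTransition.nonneg _)

lemma rho0_support (hc : 0 < c₀) (h : rho0 c₀ z ≠ 0) :
    |z.re| ≤ 1 ∧ c₀ / 2 ≤ z.im := by
  constructor
  · by_contra! h1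
    exact h (by simp [rho0, bumpX_eq_zero h1.le])
  · by_contra! h1
    refine h ?_
    rw [rho0, smoothTransition.zero_of_nonpos, mul_zero]
    rw [sub_nonpos, div_le_one hc]
    linarith

/-- The sum of the bump function over the group. -/
def rhoS (Γ : Subgroup SL2R) (c₀ : ℝ) (z : ℂ) : ℝ := ∑' g : Γ, rho0 c₀ (moebius g.1 z)

/-- The normalised bump function: its translates under `Γ` sum to one. -/
def rho (Γ : Subgroup SL2R) (c₀ : ℝ) (z : ℂ) : ℝ := rho0 c₀ z / rhoS Γ c₀ z

lemma rho0_locally_finite (hΓ : OneCusp Γ c₀) {z₀ : ℂ} (hz : 0 < z₀.im) {c : ℝ} (hc : 0 < c) :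
    ∃ F : Finset Γ, ∀ᶠ z in 𝓝 z₀, ∀ g : Γ, g ∉ F →
      ¬ (|(moebius g.1 z).re| ≤ 1 ∧ c ≤ (moebius g.1 z).im) := by
  have hfin := hΓ.finite_meet (δ := z₀.im / 2) (c := c) (R := ‖z₀‖ + 1) (by positivity) hc
  have hfin' : {g : Γ | g.1 ∈ {g : SL2R | g ∈ Γ ∧ ∃ w : ℍ, ‖(w : ℂ)‖ ≤ ‖z₀‖ + 1 ∧ z₀.im / 2 ≤ w.im ∧
      |(g • w).re| ≤ 1 ∧ c ≤ (g • w).im}}.Finite := hfin.preimage Subtype.val_injective.injOn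
  refine ⟨hfin'.toFinset, ?_⟩
  have h1 : ∀ᶠ z in 𝓝 z₀, ‖z‖ < ‖z₀‖ + 1 :=
    (continuous_norm.tendsto z₀).eventually (gt_mem_nhds (by linarith))
  have h2 : ∀ᶠ z in 𝓝 z₀, z₀.im / 2 < z.im :=
    (Complex.continuous_im.tendsto z₀).eventually (lt_mem_nhds (by linarith))
  filter_upwards [h1, h2] with z hz1 hz2 g hg hh
  refine hg (hfin'.mem_toFinset.mpr ⟨g.2, ⟨z, by linarith⟩, hz1.le, hz2.le, ?_⟩)
  rw [← coe_re, ← coe_im, coe_smul_eq_moebius]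
  exact hh

lemma moebius_contDiffAt (g : SL2R) {z₀ : ℂ} (hz : 0 < z₀.im) {n : ℕ∞} :
    ContDiffAt ℝ n (moebius g) z₀ := by
  have h : ContDiffAt ℂ n (moebius g) z₀ := by
    unfold moebius
    refine ContDiffAt.div ?_ ?_ (autF_ne_zero g hz)
    · exact ((contDiff_const.mul contDiff_id).add contDiff_const).contDiffAt
    · exact ((contDiff_const.mul contDiff_id).add contDiff_const).contDiffAt
  exact h.restrict_scalars ℝ

lemma rhoS_eventuallyEq (hΓ : OneCusp Γ c₀) {z₀ : ℂ} (hz : 0 < z₀.im) :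
    ∃ F : Finset Γ, ∀ᶠ z in 𝓝 z₀, rhoS Γ c₀ z = ∑ g ∈ F, rho0 c₀ (moebius g.1 z) := by
  obtain ⟨F, hF⟩ := rho0_locally_finite hΓ hz (c := c₀ / 2) (by linarith [hΓ.pos])
  refine ⟨F, ?_⟩
  filter_upwards [hF] with z hz
  refine tsum_eq_sum fun g hg => ?_
  by_contra h
  exact hz g hg (rho0_support hΓ.pos h)

lemma summable_rho0 (hΓ : OneCusp Γ c₀) (hz : 0 < z.im) :
    Summable fun g : Γ => rho0 c₀ (moebius g.1 z) := by
  obtain ⟨F, hF⟩ := rho0_locally_finite hΓ hz (c := c₀ / 2) (by linarith [hΓ.pos])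
  refine summable_of_ne_finset_zero (s := F) fun g hg => ?_
  by_contra h
  exact hF.self_of_nhds g hg (rho0_support hΓ.pos h)

lemma rhoS_contDiffAt (hΓ : OneCusp Γ c₀) {z₀ : ℂ} (hz : 0 < z₀.im) {n : ℕ∞} :
    ContDiffAt ℝ n (rhoS Γ c₀) z₀ := by
  obtain ⟨F, hF⟩ := rhoS_eventuallyEq hΓ hz
  refine ContDiffAt.congr_of_eventuallyEq ?_ hF
  refine ContDiffAt.sum fun g _ => ?_
  exact (rho0_contDiff c₀).contDiffAt.comp z₀ (moebius_contDiffAt g.1 hz)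

lemma rhoS_pos (hΓ : OneCusp Γ c₀) (hz : 0 < z.im) : 0 < rhoS Γ c₀ z := by
  obtain ⟨g, hg, h1, h2⟩ := hΓ.reduce ⟨z, hz⟩
  refine (summable_rho0 hΓ hz).tsum_pos (fun _ => rho0_nonneg _ _) ⟨g, hg⟩ ?_
  rw [← coe_re, coe_smul_eq_moebius] at h1
  rw [← coe_im, coe_smul_eq_moebius] at h2
  refine mul_pos (bumpX_pos (lt_of_le_of_lt h1 (by norm_num))) (smoothTransition.pos_of_pos ?_)
  have hc := hΓ.pos
  rw [sub_pos, lt_div_iff₀ hc]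
  simp only at h2
  linarith

lemma rhoS_moebius (g : Γ) (hz : 0 < z.im) : rhoS Γ c₀ (moebius g.1 z) = rhoS Γ c₀ z := by
  unfold rhoS
  rw [← (Equiv.mulRight g).tsum_eq (fun h : Γ => rho0 c₀ (moebius h.1 z))]
  refine tsum_congr fun h => ?_
  simp [moebius_mul h.1 g.1 hz]

lemma rho_nonneg (hΓ : OneCusp Γ c₀) (hz : 0 < z.im) : 0 ≤ rho Γ c₀ z :=
  div_nonneg (rho0_nonneg _ _) (rhoS_pos hΓ hz).le

lemma rho_support (hΓ : OneCusp Γ c₀) (h : rho Γ c₀ z ≠ 0) :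
    |z.re| ≤ 1 ∧ c₀ / 2 ≤ z.im :=
  rho0_support hΓ.pos fun h0 => h (by simp [rho, h0])

lemma hasSum_rho (hΓ : OneCusp Γ c₀) (hz : 0 < z.im) :
    HasSum (fun g : Γ => rho Γ c₀ (moebius g.1 z)) 1 := by
  have h := (summable_rho0 hΓ hz).hasSum.div_const (rhoS Γ c₀ z)
  have h1 : (∑' g : Γ, rho0 c₀ (moebius g.1 z)) / rhoS Γ c₀ z = 1 := div_self (rhoS_pos hΓ hz).ne'
  rw [h1] at h
  refine hasSum_of_forall_eq h fun g => ?_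
  rw [rho, rhoS_moebius g hz]

lemma rho_contDiffAt (hΓ : OneCusp Γ c₀) {z₀ : ℂ} (hz : 0 < z₀.im) {n : ℕ∞} :
    ContDiffAt ℝ n (rho Γ c₀) z₀ :=
  (rho0_contDiff c₀).contDiffAt.div (rhoS_contDiffAt hΓ hz) (rhoS_pos hΓ hz).ne'

lemma rho_le_one (hΓ : OneCusp Γ c₀) (hz : 0 < z.im) : rho Γ c₀ z ≤ 1 := by
  have h := hasSum_rho hΓ hz
  have := le_hasSum h 1 (fun g _ => rho_nonneg hΓ (im_moebius_pos g.1 hz))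
  simpa [moebius_one] using this

/-- High in the cusp, the sum of the bump function is two. -/
lemma rhoS_eq_two (hΓ : OneCusp Γ c₀) (h1 : c₀ ≤ z.im) (h2 : 2 / c₀ < z.im) :
    rhoS Γ c₀ z = 2 := by
  have hc := hΓ.pos
  have hz : 0 < z.im := lt_of_lt_of_le hc h1
  choose t ht hte using hΓ.trans
  let φ : ℤ × Bool → Γ := fun p => if p.2 then ⟨t p.1, ht p.1⟩ else ⟨-t p.1, by
    rw [← neg_one_mul]; exact Γ.mul_mem hΓ.neg_one (ht p.1)⟩
  have hφ1 : ∀ p, (φ p).1.1 = (if p.2 then (1 : ℝ) else -1) • !![1, (p.1 : ℝ); 0, 1] := by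
    rintro ⟨n, s⟩
    cases s <;> simp [φ, hte]
  clear_value φ
  have hφ2 : Function.Injective φ := by
    rintro ⟨n, s⟩ ⟨m, s'⟩ h
    have h' := congrArg (fun g : Γ => g.1.1) h
    simp only [hφ1] at h'
    have h00 := congrFun (congrFun h' 0) 0
    have h01 := congrFun (congrFun h' 0) 1
    cases s <;> cases s' <;> simp at h00 h01 <;> first | (exfalso; linarith) | (simp [h01])
  have hzero : ∀ g ∉ Set.range φ, rho0 c₀ (moebius g.1 z) = 0 := by
    intro g hg
    by_contra h
    have h3 := (rho0_support hc h).2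
    by_cases h0 : g.1.1 1 0 = 0
    · obtain ⟨n, hn | hn⟩ := hΓ.cusp g.1 g.2 h0
      · refine hg ⟨(n, true), Subtype.ext (Subtype.ext ?_)⟩
        rw [hφ1, hn]; simp
      · refine hg ⟨(n, false), Subtype.ext (Subtype.ext ?_)⟩
        rw [hφ1, ← hn]; simp
    · have h4 := im_smul_le_inv hΓ g.2 h0 ⟨z, hz⟩
      rw [← coe_im, coe_smul_eq_moebius] at h4
      have h5 : 1 / z.im < c₀ / 2 := by
        rw [div_lt_iff₀ hc] at h2
        rw [div_lt_div_iff₀ hz (by norm_num)]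
        linarith
      simp only [UpperHalfPlane.im] at h4
      linarith
  unfold rhoS
  rw [← hφ2.tsum_eq (f := fun g : Γ => rho0 c₀ (moebius g.1 z))
    (fun g hg => by by_contra h; exact hg (hzero g h))]
  have hval : ∀ p, rho0 c₀ (moebius (φ p).1 z) = bumpX (z.re + p.1) := by
    intro p
    have h6 : moebius (φ p).1 z = z + p.1 := by
      rcases p with ⟨n, s⟩
      have := hφ1 (n, s)
      cases s <;> simp [moebius, this, div_neg, add_comm]
    have h7 : smoothTransition (2 * z.im / c₀ - 1) = 1 := by
      apply smoothTransition.one_of_one_le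
      rw [le_sub_iff_add_le, le_div_iff₀ hc]
      linarith
    rw [rho0, h6]
    simp [h7]
  simp only [hval]
  have h8 : HasSum (fun p : ℤ × Bool => bumpX (z.re + p.1)) 2 := by
    have h9 : Summable fun p : ℤ × Bool => bumpX (z.re + p.1) := by
      refine (summable_prod_of_nonneg fun p => bumpX_nonneg _).mpr ⟨fun n => Summable.of_finite, ?_⟩
      simpa using (hasSum_bumpX z.re).summable.mul_left 2
    have h10 := h9.hasSum.prod_fiberwise (g := fun n : ℤ => bumpX (z.re + n) * 2) fun n => by
      have := hasSum_fintype fun _ : Bool => bumpX (z.re + n)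
      simpa [mul_comm] using this
    have h11 := (hasSum_bumpX z.re).mul_right 2
    rw [one_mul] at h11
    rw [← h10.unique h11]
    exact h9.hasSum
  exact h8.tsum_eq

/-- The cut-off of the partition function at height `Y`. -/
def eta (Γ : Subgroup SL2R) (c₀ Y : ℝ) (z : ℂ) : ℝ :=
  rho Γ c₀ z * (1 - smoothTransition (z.im - Y))

lemma eta_contDiffAt (hΓ : OneCusp Γ c₀) (Y : ℝ) {z₀ : ℂ} (hz : 0 < z₀.im) {n : ℕ∞} :
    ContDiffAt ℝ n (eta Γ c₀ Y) z₀ := by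
  have h : ContDiff ℝ n fun z : ℂ => 1 - smoothTransition (z.im - Y) := by
    have h1 : ContDiff ℝ n fun z : ℂ => z.im - Y := Complex.imCLM.contDiff.sub contDiff_const
    exact contDiff_const.sub (smoothTransition.contDiff.comp h1)
  exact (rho_contDiffAt hΓ hz).mul h.contDiffAt

lemma eta_support (hΓ : OneCusp Γ c₀) {Y : ℝ} (h : eta Γ c₀ Y z ≠ 0) :
    |z.re| ≤ 1 ∧ c₀ / 2 ≤ z.im ∧ z.im ≤ Y + 1 := by
  have h1 : rho Γ c₀ z ≠ 0 := fun h0 => h (by simp [eta, h0])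
  refine ⟨(rho_support hΓ h1).1, (rho_support hΓ h1).2, ?_⟩
  by_contra! h2
  exact h (by simp [eta, smoothTransition.one_of_one_le (x := z.im - Y) (by linarith)])

lemma hasSum_eta (hΓ : OneCusp Γ c₀) {Y : ℝ} (hY : 4 / c₀ ≤ Y) (hz : c₀ / 4 < z.im) :
    HasSum (fun g : Γ => eta Γ c₀ Y (moebius g.1 z)) (1 - smoothTransition (z.im - Y)) := by
  have hc := hΓ.pos
  have hz0 : 0 < z.im := by linarith
  have h := (hasSum_rho hΓ hz0).mul_right (1 - smoothTransition (z.im - Y))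
  rw [one_mul] at h
  refine hasSum_of_forall_eq h fun g => ?_
  rw [eta]
  by_cases h0 : g.1.1 1 0 = 0
  · have := im_smul_of_lower_zero hΓ g.2 h0 ⟨z, hz0⟩
    rw [← coe_im, coe_smul_eq_moebius] at this
    simp only [UpperHalfPlane.im] at this
    rw [this]
  · have h4 := im_smul_le_inv hΓ g.2 h0 ⟨z, hz0⟩
    rw [← coe_im, coe_smul_eq_moebius] at h4
    simp only [UpperHalfPlane.im] at h4
    have h5 : 1 / z.im < 4 / c₀ := by
      rw [div_lt_div_iff₀ hz0 hc]
      linarith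
    rw [smoothTransition.zero_of_nonpos (x := (moebius g.1 z).im - Y) (by linarith)]
    rcases le_or_gt z.im Y with h6 | h6
    · rw [smoothTransition.zero_of_nonpos (x := z.im - Y) (by linarith)]
    · have h7 : 4 / c₀ < z.im := by linarith
      have h8 : 1 / z.im < c₀ / 4 := by
        rw [div_lt_iff₀ hc] at h7
        rw [div_lt_div_iff₀ hz0 (by norm_num)]
        linarith
      have h9 : rho Γ c₀ (moebius g.1 z) = 0 := by
        by_contra h9
        have := (rho_support hΓ h9).2
        linarith
      rw [h9]; simp

/-! ### The invariant measure and unfolding -/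

lemma isOpen_upper : IsOpen {z : ℂ | 0 < z.im} := isOpen_lt continuous_const Complex.continuous_im

lemma map_coe_volume : Measure.map UpperHalfPlane.coe (volume : Measure ℍ) =
    (volume.restrict {z : ℂ | 0 < z.im}).withDensity fun z => ((1 / ‖z.im‖₊) ^ 2 : NNReal) := by
  ext s hs
  rw [Measure.map_apply measurable_coe hs, volume_eq_lintegral, withDensity_apply _ hs,
    Measure.restrict_restrict hs]
  congr 2
  ext z
  constructor
  · rintro ⟨w, hw, rfl⟩
    exact ⟨hw, w.coe_im_pos⟩
  · rintro ⟨hz, hz'⟩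
    exact ⟨⟨z, hz'⟩, hz, rfl⟩

lemma measurable_density : Measurable fun z : ℂ => (1 / ‖z.im‖₊) ^ 2 :=
  (measurable_const.div (Complex.measurable_im.nnnorm)).pow_const 2

lemma density_smul {E : Type*} [NormedAddCommGroup E] [NormedSpace ℝ E] (z : ℂ) (v : E) :
    ((1 / ‖z.im‖₊) ^ 2 : NNReal) • v = ((z.im ^ 2)⁻¹ : ℝ) • v := by
  rw [NNReal.smul_def]; simp

lemma integral_uhp {E : Type*} [NormedAddCommGroup E] [NormedSpace ℝ E] (Φ : ℂ → E) :
    ∫ w : ℍ, Φ w = ∫ z in {z : ℂ | 0 < z.im}, ((z.im ^ 2)⁻¹ : ℝ) • Φ z := by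
  rw [← measurableEmbedding_coe.integral_map, map_coe_volume,
    integral_withDensity_eq_integral_smul measurable_density]
  simp_rw [density_smul]

lemma integrable_uhp_iff {E : Type*} [NormedAddCommGroup E] [NormedSpace ℝ E] (Φ : ℂ → E) :
    Integrable (fun w : ℍ => Φ w) ↔
      IntegrableOn (fun z : ℂ => ((z.im ^ 2)⁻¹ : ℝ) • Φ z) {z : ℂ | 0 < z.im} := by
  have h := MeasurableEmbedding.integrable_map_iff (μ := (volume : Measure ℍ)) (f := UpperHalfPlane.coe) (g := Φ) measurableEmbedding_coe
  rw [Function.comp_def] at h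
  rw [← h, map_coe_volume, integrable_withDensity_iff_integrable_smul measurable_density,
    IntegrableOn]
  simp_rw [density_smul]

/-- Unfolding against a partition of unity. -/
lemma hasSum_integral_unfold [Countable Γ] {χ : ℍ → ℝ} (hm : Measurable χ)
    (h0 : ∀ w, 0 ≤ χ w) (h1 : ∀ w, HasSum (fun g : Γ => χ (g • w)) 1) {Φ : ℍ → ℂ}
    (hΦ : Integrable Φ) :
    HasSum (fun g : Γ => ∫ w : ℍ, (χ w : ℂ) * Φ (g • w)) (∫ w : ℍ, Φ w) ∧
      ∫ w : ℍ, ∑' g : Γ, (χ w : ℂ) * Φ (g • w) = ∫ w : ℍ, Φ w := by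
  have hmp : ∀ g : Γ, MeasurePreserving (fun w : ℍ => g • w) volume volume := fun g =>
    measurePreserving_smul (g : SL2R) (volume : Measure ℍ)
  have hme : ∀ g : Γ, MeasurableEmbedding (fun w : ℍ => g • w) := fun g =>
    measurableEmbedding_const_smul (g : SL2R)
  have hle : ∀ w, χ w ≤ 1 := fun w => by
    have := le_hasSum (h1 w) 1 fun g _ => h0 _
    simpa using this
  have key : ∀ {E : Type} [NormedAddCommGroup E] [NormedSpace ℝ E] (g : Γ) (F : ℍ → E),
      ∫ w : ℍ, χ w • F (g • w) = ∫ w : ℍ, χ (g⁻¹ • w) • F w := by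
    intro E _ _ g F
    rw [← (hmp g).integral_comp (hme g) (fun w => χ (g⁻¹ • w) • F w)]
    simp
  have h_int : ∀ g : Γ, Integrable fun w : ℍ => χ (g • w) • Φ w := fun g => by
    have hms : AEStronglyMeasurable (fun w : ℍ => χ (g • w)) volume :=
      (hm.comp (hmp g).measurable).aestronglyMeasurable
    refine Integrable.mono hΦ (hms.smul hΦ.1) (.of_forall fun w => ?_)
    rw [norm_smul, Real.norm_of_nonneg (h0 _)]
    exact mul_le_of_le_one_left (norm_nonneg _) (hle _)
  have h3 : ∀ w, HasSum (fun g : Γ => χ (g • w) • Φ w) (Φ w) := fun w => by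
    simpa using (h1 w).smul_const (Φ w)
  have hsum : Summable fun g : Γ => ∫ w : ℍ, ‖χ (g • w) • Φ w‖ := by
    refine summable_of_sum_le (c := ∫ w : ℍ, ‖Φ w‖) (fun g => integral_nonneg fun w => norm_nonneg _)
      fun s => ?_
    rw [← integral_finsetSum _ fun g _ => (h_int g).norm]
    refine integral_mono (integrable_finsetSum _ fun g _ => (h_int g).norm) hΦ.norm fun w => ?_
    simp only [norm_smul, Real.norm_of_nonneg (h0 _)]
    rw [← Finset.sum_mul]
    exact mul_le_of_le_one_left (norm_nonneg _) (sum_le_hasSum s (fun g _ => h0 _) (h1 w))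
  have h4 := hasSum_integral_of_summable_integral_norm h_int hsum
  simp only [fun w => (h3 w).tsum_eq] at h4
  rw [← (Equiv.inv Γ).hasSum_iff] at h4
  have h6 : HasSum (fun g : Γ => ∫ w : ℍ, χ w • Φ (g • w)) (∫ w : ℍ, Φ w) := by
    refine hasSum_of_forall_eq h4 fun g => ?_
    simp only [Function.comp, Equiv.inv_apply, ← key]
  have hint2 : ∀ g : Γ, Integrable fun w : ℍ => χ w • Φ (g • w) := fun g => by
    have := (hmp g).integrable_comp_of_integrable (h_int g⁻¹)
    simpa [Function.comp_def] using this
  have hsum2 : Summable fun g : Γ => ∫ w : ℍ, ‖χ w • Φ (g • w)‖ := by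
    rw [← (Equiv.inv Γ).summable_iff] at hsum
    refine hsum.congr fun g => ?_
    have := key g (fun w => ‖Φ w‖)
    simp only [norm_smul, Real.norm_of_nonneg (h0 _), Function.comp, Equiv.inv_apply]
    simpa using this.symm
  have h7 := hasSum_integral_of_summable_integral_norm hint2 hsum2
  simp only [real_smul] at h6 h7
  exact ⟨h6, h7.unique h6⟩

/-! ### The Cauchy–Riemann operator and Stokes' theorem -/

/-- The Cauchy–Riemann operator `∂/∂z̄`. -/
def dbar (F : ℂ → ℂ) (z : ℂ) : ℂ := (fderiv ℝ F z 1 + I * fderiv ℝ F z I) / 2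

lemma dbar_mul {F G : ℂ → ℂ} (hF : DifferentiableAt ℝ F z) (hG : DifferentiableAt ℝ G z) :
    dbar (fun w => F w * G w) z = F z * dbar G z + dbar F z * G z := by
  unfold dbar
  rw [fderiv_fun_mul hF hG]
  simp
  ring

lemma dbar_congr {F G : ℂ → ℂ} (h : F =ᶠ[𝓝 z] G) : dbar F z = dbar G z := by
  unfold dbar
  rw [h.fderiv_eq]

lemma dbar_of_eventually_zero {F : ℂ → ℂ} (h : F =ᶠ[𝓝 z] fun _ => 0) : dbar F z = 0 := by
  rw [dbar_congr h]
  simp [dbar]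

lemma dbar_sum {ι : Type*} (s : Finset ι) {F : ι → ℂ → ℂ}
    (hF : ∀ i ∈ s, DifferentiableAt ℝ (F i) z) :
    dbar (fun w => ∑ i ∈ s, F i w) z = ∑ i ∈ s, dbar (F i) z := by
  unfold dbar
  rw [fderiv_fun_sum hF]
  simp only [_root_.sum_apply]
  rw [← Finset.sum_div, Finset.sum_add_distrib, Finset.mul_sum]

lemma dbar_comp_holo {F m : ℂ → ℂ} {z m' : ℂ} (hF : DifferentiableAt ℝ F (m z))
    (hm : HasDerivAt m m' z) :
    dbar (fun w => F (m w)) z = dbar F (m z) * (starRingEnd ℂ) m' := by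
  have h1 : HasFDerivAt m ((ContinuousLinearMap.toSpanSingleton ℂ m').restrictScalars ℝ) z :=
    hm.hasFDerivAt.restrictScalars ℝ
  have h2 : HasFDerivAt (fun w => F (m w)) _ z := hF.hasFDerivAt.comp z h1
  unfold dbar
  rw [h2.fderiv]
  have h3 : ∀ v : ℂ, fderiv ℝ F (m z) v = v.re * fderiv ℝ F (m z) 1 + v.im * fderiv ℝ F (m z) I := by
    intro v
    have : v = (v.re : ℝ) • (1 : ℂ) + (v.im : ℝ) • I := by
      simp
    conv_lhs => rw [this]
    rw [map_add, map_smul, map_smul]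
    simp
  simp only [ContinuousLinearMap.comp_apply, ContinuousLinearMap.coe_restrictScalars',
    ContinuousLinearMap.toSpanSingleton_apply, smul_eq_mul]
  rw [h3 (1 * m'), h3 (I * m')]
  have h4 : (starRingEnd ℂ) m' = m'.re - m'.im * I := by
    apply Complex.ext <;> simp
  rw [h4]
  simp
  linear_combination (1/2 * (m'.im * fderiv ℝ F (m z) I)) * Complex.I_sq

lemma dbar_holo {F : ℂ → ℂ} (hF : DifferentiableAt ℂ F z) : dbar F z = 0 := by
  unfold dbar
  rw [hF.fderiv_restrictScalars ℝ]
  simp [← mul_assoc]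

lemma integral_dbar_eq_zero {h : ℂ → ℂ} (hd : ContDiff ℝ 1 h) (hc : HasCompactSupport h) :
    ∫ z, dbar h z = 0 := by
  have hcont : ∀ v : ℂ, Continuous fun z => fderiv ℝ h z v := fun v =>
    (hd.continuous_fderiv one_ne_zero).clm_apply continuous_const
  have h_int : ∀ v : ℂ, Integrable fun z => fderiv ℝ h z v := fun v =>
    (hcont v).integrable_of_hasCompactSupport
      ((hc.fderiv ℝ).comp_left (g := fun L : ℂ →L[ℝ] ℂ => L v) (by simp))
  have key : ∀ v : ℂ, ∫ z, fderiv ℝ h z v = 0 := by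
    intro v
    have := integral_mul_fderiv_eq_neg_fderiv_mul_of_integrable (𝕜 := ℂ) (μ := (volume : Measure ℂ))
      (f := fun _ : ℂ => (1 : ℂ)) (g := h) (v := v) (by simp) (by simpa using h_int v)
      (by simpa using hd.continuous.integrable_of_hasCompactSupport hc)
      (fun x _ => differentiableAt_const _) (fun x _ => hd.differentiable (by norm_num) x)
    simpa using this
  unfold dbar
  rw [integral_div, integral_add (h_int 1) ((h_int I).const_mul I), integral_const_mul, key, key]
  simp

/-- Integration by parts for `∂/∂z̄` against a cut-off supported in the upper half-plane. -/
lemma integral_mul_dbar {η : ℂ → ℝ} {K : Set ℂ} (hK : IsCompact K) (hKH : K ⊆ {z | 0 < z.im})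
    (hη0 : ∀ z ∉ K, η z = 0) (hη : ∀ z : ℂ, 0 < z.im → ContDiffAt ℝ 1 η z) {ψ : ℂ → ℂ}
    (hψ : ∀ z : ℂ, 0 < z.im → ContDiffAt ℝ 1 ψ z) :
    Integrable (fun z => (η z : ℂ) * dbar ψ z) ∧
    Integrable (fun z => dbar (fun w => (η w : ℂ)) z * ψ z) ∧
    ∫ z, (η z : ℂ) * dbar ψ z = -∫ z, dbar (fun w => (η w : ℂ)) z * ψ z := by
  have hev : ∀ z : ℂ, z ∉ K → (fun w => (η w : ℂ)) =ᶠ[𝓝 z] fun _ => 0 := fun z hz => by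
    filter_upwards [hK.isClosed.isOpen_compl.mem_nhds hz] with w hw
    simp [hη0 w hw]
  have hη' : ∀ z : ℂ, 0 < z.im → ContDiffAt ℝ 1 (fun w => (η w : ℂ)) z := fun z hz =>
    Complex.ofRealCLM.contDiff.contDiffAt.comp z (hη z hz)
  have hηC : ContDiff ℝ 1 (fun w => (η w : ℂ)) := by
    rw [contDiff_iff_contDiffAt]
    intro z
    by_cases hz : z ∈ K
    · exact hη' z (hKH hz)
    · exact contDiffAt_const.congr_of_eventuallyEq (hev z hz)
  have hcd : ∀ {F : ℂ → ℂ} {z : ℂ}, ContDiffAt ℝ 1 F z → ContinuousAt (dbar F) z := by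
    intro F z h
    have h1 : ContinuousAt (fderiv ℝ F) z := h.continuousAt_fderiv (by norm_num)
    unfold dbar
    exact ((h1.clm_apply continuousAt_const).add
      (continuousAt_const.mul (h1.clm_apply continuousAt_const))).div_const 2
  have hcont1 : Continuous fun z => (η z : ℂ) * dbar ψ z := by
    rw [continuous_iff_continuousAt]
    intro z
    by_cases hz : z ∈ K
    · exact hηC.continuous.continuousAt.mul (hcd (hψ z (hKH hz)))
    · refine ContinuousAt.congr (f := fun _ => (0 : ℂ)) continuousAt_const ?_
      filter_upwards [hev z hz] with w hw
      simp [hw]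
  have hcont2 : Continuous fun z => dbar (fun w => (η w : ℂ)) z * ψ z := by
    rw [continuous_iff_continuousAt]
    intro z
    by_cases hz : z ∈ K
    · exact (hcd hηC.contDiffAt).mul (hψ z (hKH hz)).continuousAt
    · refine ContinuousAt.congr (f := fun _ => (0 : ℂ)) continuousAt_const ?_
      filter_upwards [hK.isClosed.isOpen_compl.mem_nhds hz] with w hw
      simp [dbar_of_eventually_zero (hev w hw)]
  have hs1 : HasCompactSupport fun z => (η z : ℂ) * dbar ψ z :=
    HasCompactSupport.intro hK fun z hz => by simp [hη0 z hz]
  have hs2 : HasCompactSupport fun z => dbar (fun w => (η w : ℂ)) z * ψ z :=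
    HasCompactSupport.intro hK fun z hz => by simp [dbar_of_eventually_zero (hev z hz)]
  have hi1 := hcont1.integrable_of_hasCompactSupport hs1 (μ := volume)
  have hi2 := hcont2.integrable_of_hasCompactSupport hs2 (μ := volume)
  refine ⟨hi1, hi2, ?_⟩
  have hprod : ContDiff ℝ 1 fun z => (η z : ℂ) * ψ z := by
    rw [contDiff_iff_contDiffAt]
    intro z
    by_cases hz : z ∈ K
    · exact (hη' z (hKH hz)).mul (hψ z (hKH hz))
    · refine contDiffAt_const (c := (0 : ℂ)) |>.congr_of_eventuallyEq ?_
      filter_upwards [hev z hz] with w hw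
      simp [hw]
  have h0 := integral_dbar_eq_zero hprod
    (HasCompactSupport.intro hK fun z hz => by simp [hη0 z hz])
  have h1 : ∀ z, dbar (fun z => (η z : ℂ) * ψ z) z =
      (η z : ℂ) * dbar ψ z + dbar (fun w => (η w : ℂ)) z * ψ z := by
    intro z
    by_cases hz : z ∈ K
    · exact dbar_mul ((hη' z (hKH hz)).differentiableAt (by norm_num))
        ((hψ z (hKH hz)).differentiableAt (by norm_num))
    · rw [dbar_of_eventually_zero (hev z hz), hη0 z hz, dbar_of_eventually_zero]
      · simp
      · filter_upwards [hev z hz] with w hw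
        simp [hw]
  simp only [h1] at h0
  rw [integral_add hi1 hi2] at h0
  exact eq_neg_of_add_eq_zero_left h0

/-! ### The boundary term of Stokes' theorem at the cusp -/

/-- The support of the cut-off function. -/
def boxY (c₀ Y : ℝ) : Set ℂ := Set.Icc (-1) 1 ×ℂ Set.Icc (c₀ / 2) (Y + 1)

lemma isCompact_boxY (c₀ Y : ℝ) : IsCompact (boxY c₀ Y) :=
  isCompact_Icc.reProdIm isCompact_Icc

lemma boxY_subset (hc : 0 < c₀) (Y : ℝ) : boxY c₀ Y ⊆ {z | 0 < z.im} := fun z hz => by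
  have := hz.2.1
  simp only [Set.mem_ofPred_eq]
  linarith

lemma eta_eq_zero (hΓ : OneCusp Γ c₀) {Y : ℝ} (hz : z ∉ boxY c₀ Y) : eta Γ c₀ Y z = 0 := by
  by_contra h
  obtain ⟨h1, h2, h3⟩ := eta_support hΓ h
  exact hz ⟨abs_le.mp h1, h2, h3⟩

lemma hasDerivAt_moebius (g : SL2R) (hz : 0 < z.im) :
    HasDerivAt (moebius g) ((autF g z ^ 2)⁻¹) z := by
  have h0 := autF_ne_zero g hz
  have hd : ((g.1 0 0 : ℝ) : ℂ) * ((g.1 1 1 : ℝ) : ℂ) - ((g.1 0 1 : ℝ) : ℂ) * ((g.1 1 0 : ℝ) : ℂ) = 1 := by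
    exact_mod_cast det_eq_one g
  have h1 : HasDerivAt (fun z : ℂ => ((g.1 0 0 : ℝ) : ℂ) * z + ((g.1 0 1 : ℝ) : ℂ))
      ((g.1 0 0 : ℝ) : ℂ) z := by
    simpa using ((hasDerivAt_id z).const_mul ((g.1 0 0 : ℝ) : ℂ)).add_const ((g.1 0 1 : ℝ) : ℂ)
  have h2 : HasDerivAt (autF g) ((g.1 1 0 : ℝ) : ℂ) z := by
    have := ((hasDerivAt_id z).const_mul ((g.1 1 0 : ℝ) : ℂ)).add_const ((g.1 1 1 : ℝ) : ℂ)
    rw [mul_one] at this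
    exact this
  have h3 := h1.fun_div h2 h0
  refine h3.congr_deriv ?_
  rw [div_eq_iff (pow_ne_zero 2 h0), inv_mul_cancel₀ (pow_ne_zero 2 h0)]
  simp only [autF]
  linear_combination hd

lemma dbar_ofReal_im {s : ℝ → ℝ} (hs : DifferentiableAt ℝ s z.im) :
    dbar (fun w => ((s w.im : ℝ) : ℂ)) z = I / 2 * (deriv s z.im : ℝ) := by
  have h1 : HasFDerivAt (fun w : ℂ => ((s w.im : ℝ) : ℂ)) _ z :=
    Complex.ofRealCLM.hasFDerivAt.comp z
      (hs.hasDerivAt.hasFDerivAt.comp z (Complex.imCLM.hasFDerivAt (x := z)))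
  unfold dbar
  rw [h1.fderiv]
  simp
  ring

/-- The sum of the translates of `∂η/∂z̄`. -/
lemma hasSum_dbar_eta (hΓ : OneCusp Γ c₀) {Y : ℝ} (hY : 4 / c₀ ≤ Y) (hz : c₀ / 4 < z.im) :
    HasSum (fun g : Γ => dbar (fun w => (eta Γ c₀ Y w : ℂ)) (moebius g.1 z) *
        (starRingEnd ℂ) ((autF g.1 z ^ 2)⁻¹))
      (-(I / 2) * (deriv smoothTransition (z.im - Y) : ℝ)) := by
  have hc := hΓ.pos
  have hz0 : 0 < z.im := by linarith
  have hdiff : ∀ w : ℂ, 0 < w.im → DifferentiableAt ℝ (fun w => (eta Γ c₀ Y w : ℂ)) w := fun w hw =>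
    Complex.ofRealCLM.differentiableAt.comp w
      ((eta_contDiffAt hΓ Y hw (n := 1)).differentiableAt (by norm_num))
  obtain ⟨F, hF⟩ := rho0_locally_finite hΓ hz0 (c := c₀ / 2) (by linarith)
  have hzero : ∀ g : Γ, g ∉ F → ∀ᶠ w in 𝓝 z, eta Γ c₀ Y (moebius g.1 w) = 0 := fun g hg => by
    filter_upwards [hF] with w hw
    by_contra h
    exact hw g hg ⟨(eta_support hΓ h).1, (eta_support hΓ h).2.1⟩
  have hchain : ∀ g : Γ, dbar (fun w => (eta Γ c₀ Y w : ℂ)) (moebius g.1 z) *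
      (starRingEnd ℂ) ((autF g.1 z ^ 2)⁻¹) = dbar (fun w => (eta Γ c₀ Y (moebius g.1 w) : ℂ)) z :=
    fun g => (dbar_comp_holo (hdiff _ (im_moebius_pos g.1 hz0)) (hasDerivAt_moebius g.1 hz0)).symm
  have h1 : HasSum (fun g : Γ => dbar (fun w => (eta Γ c₀ Y (moebius g.1 w) : ℂ)) z)
      (∑ g ∈ F, dbar (fun w => (eta Γ c₀ Y (moebius g.1 w) : ℂ)) z) := by
    refine hasSum_sum_of_ne_finset_zero fun g hg => ?_
    refine dbar_of_eventually_zero ?_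
    filter_upwards [hzero g hg] with w hw
    simp [hw]
  have h2 : ∑ g ∈ F, dbar (fun w => (eta Γ c₀ Y (moebius g.1 w) : ℂ)) z =
      -(I / 2) * (deriv smoothTransition (z.im - Y) : ℝ) := by
    rw [← dbar_sum]
    · have h3 : (fun w => ∑ g ∈ F, (eta Γ c₀ Y (moebius g.1 w) : ℂ)) =ᶠ[𝓝 z]
          fun w => (((fun y => 1 - smoothTransition (y - Y)) w.im : ℝ) : ℂ) := by
        have h4 : ∀ᶠ w : ℂ in 𝓝 z, c₀ / 4 < w.im :=
          (isOpen_lt continuous_const Complex.continuous_im).mem_nhds hz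
        filter_upwards [hF, h4] with w hw hw4
        have h5 := hasSum_eta hΓ hY hw4
        have h6 := h5.unique (hasSum_sum_of_ne_finset_zero (s := F) fun g hg => by
          by_contra h
          exact hw g hg ⟨(eta_support hΓ h).1, (eta_support hΓ h).2.1⟩)
        simp only [h6]
        push_cast
        rfl
      have hst : Differentiable ℝ smoothTransition :=
        (smoothTransition.contDiff (n := 1)).differentiable (by norm_num)
      have hd : HasDerivAt (fun y => 1 - smoothTransition (y - Y))
          (-deriv smoothTransition (z.im - Y)) z.im :=
        ((hst (z.im - Y)).hasDerivAt.comp_sub_const z.im Y).const_sub 1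
      rw [dbar_congr h3, dbar_ofReal_im hd.differentiableAt, hd.deriv]
      push_cast
      ring
    · intro g _
      exact (hdiff _ (im_moebius_pos g.1 hz0)).comp z
        ((moebius_contDiffAt g.1 hz0 (n := 1)).differentiableAt (by norm_num))
  rw [← h2]
  exact hasSum_of_forall_eq h1 hchain

lemma deriv_smoothTransition_eq_zero {x : ℝ} (hx : x < 0 ∨ 1 < x) :
    deriv smoothTransition x = 0 := by
  rcases hx with hx | hx
  · have : smoothTransition =ᶠ[𝓝 x] fun _ => 0 := by
      filter_upwards [Iio_mem_nhds hx] with y hy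
      exact smoothTransition.zero_of_nonpos (le_of_lt hy)
    rw [this.deriv_eq]; simp
  · have : smoothTransition =ᶠ[𝓝 x] fun _ => 1 := by
      filter_upwards [Ioi_mem_nhds hx] with y hy
      exact smoothTransition.one_of_one_le (le_of_lt hy)
    rw [this.deriv_eq]; simp

/-- Unfolding of the boundary term. -/
lemma integral_dbar_eta (hΓ : OneCusp Γ c₀) {Y : ℝ} (hY : 4 / c₀ ≤ Y) (hY' : c₀ ≤ Y) {G : ℂ → ℂ}
    (hw : ∀ g ∈ Γ, ∀ z : ℂ, 0 < z.im → G (moebius g z) = autF g z ^ 2 * G z)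
    (h_int : Integrable fun z => dbar (fun w => (eta Γ c₀ Y w : ℂ)) z * G z) :
    ∫ z, dbar (fun w => (eta Γ c₀ Y w : ℂ)) z * G z =
      -(I / 4) * ∫ z : ℂ, (bumpX z.re : ℂ) * (deriv smoothTransition (z.im - Y) : ℝ) * G z := by
  have hc := hΓ.pos
  have : Countable Γ := hΓ.countable
  set D := dbar (fun w => (eta Γ c₀ Y w : ℂ)) with hD
  have hD0 : ∀ z : ℂ, z ∉ boxY c₀ Y → D z = 0 := fun z hz => by
    refine dbar_of_eventually_zero ?_
    filter_upwards [(isCompact_boxY c₀ Y).isClosed.isOpen_compl.mem_nhds hz] with w hw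
    simp [eta_eq_zero hΓ hw]
  have hsub : ∀ z : ℂ, ¬ 0 < z.im → D z = 0 := fun z hz => hD0 z fun h => hz (boxY_subset hc Y h)
  have e1 : ∫ z, D z * G z = ∫ w : ℍ, ((w : ℂ).im ^ 2 : ℝ) • (D w * G w) := by
    rw [integral_uhp (fun z => (z.im ^ 2 : ℝ) • (D z * G z)),
      ← setIntegral_eq_integral_of_forall_compl_eq_zero (s := {z : ℂ | 0 < z.im})
        fun z hz => by rw [hsub z hz, zero_mul]]
    refine setIntegral_congr_fun isOpen_upper.measurableSet fun z hz => ?_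
    have : z.im ^ 2 ≠ 0 := pow_ne_zero 2 (ne_of_gt hz)
    simp only [smul_smul]
    rw [inv_mul_cancel₀ this, one_smul]
  have h_int' : Integrable fun w : ℍ => ((w : ℂ).im ^ 2 : ℝ) • (D w * G w) := by
    rw [integrable_uhp_iff (fun z => (z.im ^ 2 : ℝ) • (D z * G z))]
    refine (h_int.integrableOn (s := {z : ℂ | 0 < z.im})).congr_fun (fun z hz => ?_)
      isOpen_upper.measurableSet
    have : z.im ^ 2 ≠ 0 := pow_ne_zero 2 (ne_of_gt hz)
    simp only [smul_smul]
    rw [inv_mul_cancel₀ this, one_smul]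
  have hmr : Measurable fun w : ℍ => rho Γ c₀ w := by
    refine Continuous.measurable (continuous_iff_continuousAt.mpr fun w => ?_)
    exact ((rho_contDiffAt hΓ w.coe_im_pos (n := 1)).continuousAt).comp
      continuous_coe.continuousAt
  have hU := hasSum_integral_unfold hmr (fun w => rho_nonneg hΓ w.coe_im_pos)
    (fun w => by
      refine hasSum_of_forall_eq (hasSum_rho hΓ w.coe_im_pos) fun g => ?_
      exact congrArg _ (coe_smul_eq_moebius g.1 w)) h_int'
  rw [e1, ← hU.2, ← integral_const_mul]
  have e2 : ∀ w : ℍ, ∑' g : Γ, (rho Γ c₀ w : ℂ) *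
      (((((g • w : ℍ) : ℂ)).im ^ 2 : ℝ) • (D (g • w : ℍ) * G (g • w : ℍ))) =
      ((w : ℂ).im ^ 2 : ℝ) • (-(I / 4) * ((bumpX (w : ℂ).re : ℂ) *
        (deriv smoothTransition ((w : ℂ).im - Y) : ℝ) * G w)) := by
    intro w
    have hw0 := w.coe_im_pos
    by_cases hr : rho Γ c₀ w = 0
    · have h1 : bumpX (w : ℂ).re * deriv smoothTransition ((w : ℂ).im - Y) = 0 := by
        by_contra hne
        have h3 : Y ≤ (w : ℂ).im := by
          by_contra! h
          exact hne (by rw [deriv_smoothTransition_eq_zero (Or.inl (by linarith)), mul_zero])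
        have h4 := hne
        rw [rho, div_eq_zero_iff, or_iff_left (rhoS_pos hΓ hw0).ne', rho0,
          smoothTransition.one_of_one_le, mul_one] at hr
        · exact hne (by rw [hr, zero_mul])
        · rw [le_sub_iff_add_le, le_div_iff₀ hc]; linarith
      have h1' : (bumpX (w : ℂ).re : ℂ) *
        (deriv smoothTransition ((w : ℂ).im - Y) : ℝ) = 0 := mod_cast h1
      simp only [hr, h1']
      simp
    · have hsup := rho_support hΓ hr
      have h1 := (hasSum_dbar_eta hΓ hY (z := w) (by linarith)).mul_left
        ((rho Γ c₀ w : ℂ) * ((w : ℂ).im ^ 2 : ℝ) * G w)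
      have h2 : ∀ g : Γ, (rho Γ c₀ w : ℂ) *
          (((((g • w : ℍ) : ℂ)).im ^ 2 : ℝ) • (D (g • w : ℍ) * G (g • w : ℍ))) =
          (rho Γ c₀ w : ℂ) * ((w : ℂ).im ^ 2 : ℝ) * G w *
          (D (moebius g.1 w) * (starRingEnd ℂ) ((autF g.1 w ^ 2)⁻¹)) := by
        intro g
        have hj := autF_ne_zero g.1 hw0
        have e3 : ((g • w : ℍ) : ℂ) = moebius g.1 w := coe_smul_eq_moebius g.1 w
        rw [e3, hw g.1 g.2 _ hw0, im_moebius g.1 hw0, real_smul]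
        have hns : ((normSq (autF g.1 w) : ℝ) : ℂ) = autF g.1 w * (starRingEnd ℂ) (autF g.1 w) :=
          (mul_conj _).symm
        have hj' : (starRingEnd ℂ) (autF g.1 w) ≠ 0 := by simpa using hj
        push_cast
        rw [hns, map_inv₀, map_pow]
        field_simp
      rw [(hasSum_of_forall_eq h1 h2).tsum_eq, real_smul]
      by_cases h3 : Y ≤ (w : ℂ).im
      · have hr2 : rho Γ c₀ w = bumpX (w : ℂ).re / 2 := by
          rw [rho, rhoS_eq_two hΓ (by linarith), rho0, smoothTransition.one_of_one_le, mul_one]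
          · rw [le_sub_iff_add_le, le_div_iff₀ hc]; linarith
          · have : 2 / c₀ < 4 / c₀ := by gcongr; norm_num
            linarith
        rw [hr2]
        push_cast
        ring
      · rw [deriv_smoothTransition_eq_zero (Or.inl (by linarith))]
        simp
  simp only [e2]
  rw [integral_uhp (fun z => (z.im ^ 2 : ℝ) • (-(I / 4) * ((bumpX z.re : ℂ) *
        (deriv smoothTransition (z.im - Y) : ℝ) * G z)))]
  have hY0 : 0 < Y := by linarith
  rw [← setIntegral_eq_integral_of_forall_compl_eq_zero (s := {z : ℂ | 0 < z.im})
    (f := fun z : ℂ => -(I / 4) * ((bumpX z.re : ℂ) *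
        (deriv smoothTransition (z.im - Y) : ℝ) * G z))]
  · refine setIntegral_congr_fun isOpen_upper.measurableSet fun z hz => ?_
    have : z.im ^ 2 ≠ 0 := pow_ne_zero 2 (ne_of_gt hz)
    simp only [smul_smul]
    rw [inv_mul_cancel₀ this, one_smul]
  · intro z hz
    simp only [Set.mem_ofPred_eq, not_lt] at hz
    rw [deriv_smoothTransition_eq_zero (Or.inl (by linarith))]
    simp

/-- Averaging a periodic function against the partition of unity in `x`. -/
lemma integral_bumpX_mul {h : ℝ → ℂ} (hc : Continuous h) (hp : ∀ x, h (x + 1) = h x) :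
    ∫ x, (bumpX x : ℂ) * h x = ∫ x in (0 : ℝ)..1, h x := by
  have hb : Continuous fun x : ℝ => (bumpX x : ℂ) * h x :=
    (continuous_ofReal.comp (bumpX_contDiff (n := 0)).continuous).mul hc
  have h1 : ∫ x, (bumpX x : ℂ) * h x = ∫ x in (-1 : ℝ)..1, (bumpX x : ℂ) * h x := by
    rw [intervalIntegral.integral_of_le (by norm_num), setIntegral_eq_integral_of_forall_compl_eq_zero]
    intro x hx
    rw [bumpX_eq_zero]
    · simp
    · by_contra! h
      rw [abs_lt] at h
      exact hx ⟨h.1, h.2.le⟩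
  rw [h1, ← intervalIntegral.integral_add_adjacent_intervals (b := 0)
    (hb.intervalIntegrable _ _) (hb.intervalIntegrable _ _)]
  have h2 : ∫ x in (-1 : ℝ)..0, (bumpX x : ℂ) * h x = ∫ x in (0 : ℝ)..1, (bumpX (x - 1) : ℂ) * h x := by
    have := intervalIntegral.integral_comp_sub_right (a := 0) (b := 1)
      (fun x => (bumpX x : ℂ) * h x) (1 : ℝ)
    norm_num at this
    rw [← this]
    refine intervalIntegral.integral_congr fun x _ => ?_
    rw [← hp (x - 1), sub_add_cancel]
  have hb2 : Continuous fun x : ℝ => (bumpX (x - 1) : ℂ) * h x :=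
    (continuous_ofReal.comp ((bumpX_contDiff (n := 0)).continuous.comp
      (continuous_id.sub continuous_const))).mul hc
  rw [h2, ← intervalIntegral.integral_add (hb2.intervalIntegrable _ _) (hb.intervalIntegrable _ _)]
  refine intervalIntegral.integral_congr fun x hx => ?_
  rw [Set.uIcc_of_le zero_le_one] at hx
  have h3 : bumpX (x - 1) + bumpX x = 1 := by
    simp only [bumpX, sub_add_cancel]
    rw [smoothTransition.one_of_one_le (x := x + 1) (by linarith [hx.1]),
      smoothTransition.zero_of_nonpos (x := x - 1) (by linarith [hx.2])]
    ring
  rw [← add_mul, ← Complex.ofReal_add, h3]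
  simp

lemma continuous_deriv_smoothTransition : Continuous (deriv smoothTransition) :=
  (smoothTransition.contDiff (n := 1)).continuous_deriv le_rfl

lemma integral_boundary {G : ℂ → ℂ} (hG : ContinuousOn G {z | 0 < z.im})
    (hp : ∀ z : ℂ, 0 < z.im → G (z + 1) = G z) {Y : ℝ} (hY : 0 < Y) :
    ∫ z : ℂ, (bumpX z.re : ℂ) * (deriv smoothTransition (z.im - Y) : ℝ) * G z =
      ∫ y in Y..(Y + 1), ((deriv smoothTransition (y - Y) : ℝ) : ℂ) *
        ∫ x in (0 : ℝ)..1, G (x + y * I) := by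
  set F : ℂ → ℂ := fun z => (bumpX z.re : ℂ) * (deriv smoothTransition (z.im - Y) : ℝ) * G z
  set K : Set ℂ := Set.Icc (-1) 1 ×ℂ Set.Icc Y (Y + 1) with hKdef
  have hK : IsCompact K := isCompact_Icc.reProdIm isCompact_Icc
  have hF0 : ∀ z ∉ K, F z = 0 := fun z hz => by
    by_contra h
    refine hz ⟨?_, ?_⟩
    · rw [Set.mem_preimage, Set.mem_Icc, ← abs_le]
      by_contra! h1
      exact h (by simp [F, bumpX_eq_zero h1.le])
    · constructor
      · by_contra! h1
        exact h (by simp [F, deriv_smoothTransition_eq_zero (x := z.im - Y) (Or.inl (by linarith))])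
      · by_contra! h1
        exact h (by simp [F, deriv_smoothTransition_eq_zero (x := z.im - Y) (Or.inr (by linarith))])
  have hGi : ∀ y : ℝ, 0 < y → Continuous fun x : ℝ => G (x + y * I) := fun y hy =>
    hG.comp_continuous (by fun_prop) fun x => by simp [hy]
  have hcont : ContinuousOn F {z | 0 < z.im} := by
    refine ContinuousOn.mul (Continuous.continuousOn ?_) hG
    exact (continuous_ofReal.comp ((bumpX_contDiff (n := 0)).continuous.comp
      Complex.continuous_re)).mul (continuous_ofReal.comp
      (continuous_deriv_smoothTransition.comp (Complex.continuous_im.sub continuous_const)))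
  have hKH : K ⊆ {z : ℂ | 0 < z.im} := fun z hz => lt_of_lt_of_le hY hz.2.1
  have hFi : Integrable F := by
    have := (hcont.mono hKH).integrableOn_compact hK (μ := volume)
    exact (integrableOn_iff_integrable_of_support_subset fun z hz => by
      by_contra h; exact hz (hF0 z h)).mp this
  have hmp := Complex.volume_preserving_equiv_real_prod.symm
  have e1 : ∫ z, F z = ∫ p : ℝ × ℝ, F (p.1 + p.2 * I) := by
    rw [← hmp.integral_comp Complex.measurableEquivRealProd.symm.measurableEmbedding F]
    refine integral_congr_ae (.of_forall fun p => ?_)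
    exact congrArg F (Complex.mk_eq_add_mul_I p.1 p.2)
  have hFi2 : Integrable fun p : ℝ × ℝ => F (p.1 + p.2 * I) := by
    have := hmp.integrable_comp_of_integrable hFi
    refine this.congr (.of_forall fun p => ?_)
    exact congrArg F (Complex.mk_eq_add_mul_I p.1 p.2)
  have e2 : ∀ y : ℝ, ∫ x : ℝ, F (x + y * I) = if y ∈ Set.Ioc Y (Y + 1) then
      ((deriv smoothTransition (y - Y) : ℝ) : ℂ) * ∫ x in (0 : ℝ)..1, G (x + y * I) else
      ∫ x : ℝ, F (x + y * I) := fun y => by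
    split_ifs with h
    · have hy : 0 < y := lt_trans hY h.1
      rw [← integral_bumpX_mul (hGi y hy), ← integral_const_mul]
      · refine integral_congr_ae (.of_forall fun x => ?_)
        simp [F]
        ring
      · intro x
        rw [← hp (x + y * I) (by simp [hy])]
        push_cast
        congr 1
        ring
    · rfl
  rw [e1, Measure.volume_eq_prod, integral_prod_symm _ hFi2, intervalIntegral.integral_of_le (by linarith)]
  have e3 : ∀ y ∉ Set.Icc Y (Y + 1), ∫ x : ℝ, F (x + y * I) = 0 := fun y hy => by
    rw [← integral_zero ℝ ℂ]
    refine integral_congr_ae (.of_forall fun x => ?_)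
    refine hF0 _ fun h => hy ?_
    simpa using h.2
  rw [← setIntegral_eq_integral_of_forall_compl_eq_zero e3, integral_Icc_eq_integral_Ioc]
  refine setIntegral_congr_fun measurableSet_Ioc fun y hy => ?_
  rw [e2, if_pos hy]

/-- The limit of the boundary term. -/
lemma tendsto_boundary {G : ℂ → ℂ} (hG : ContinuousOn G {z | 0 < z.im})
    (hp : ∀ z : ℂ, 0 < z.im → G (z + 1) = G z) {L : ℂ}
    (hL : Tendsto (fun y : ℝ => ∫ x in (0 : ℝ)..1, G (x + y * I)) atTop (𝓝 L)) :
    Tendsto (fun Y : ℝ => ∫ z : ℂ, (bumpX z.re : ℂ) *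
      (deriv smoothTransition (z.im - Y) : ℝ) * G z) atTop (𝓝 L) := by
  have hcd := continuous_deriv_smoothTransition
  obtain ⟨C, hC⟩ := (isCompact_Icc (a := (0 : ℝ)) (b := 1)).exists_bound_of_continuousOn hcd.continuousOn
  have hC0 : 0 ≤ C := (norm_nonneg _).trans (hC 0 ⟨le_rfl, zero_le_one⟩)
  have hone : ∀ Y : ℝ, ∫ y in Y..(Y + 1), ((deriv smoothTransition (y - Y) : ℝ) : ℂ) = 1 := by
    intro Y
    rw [intervalIntegral.integral_ofReal, intervalIntegral.integral_comp_sub_right (fun y => deriv smoothTransition y) Y]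
    rw [sub_self, add_sub_cancel_left, intervalIntegral.integral_deriv_eq_sub
      (fun x _ => (smoothTransition.contDiff (n := 1)).differentiable (by norm_num) x)
      (hcd.intervalIntegrable _ _)]
    simp
  rw [Metric.tendsto_atTop] at hL ⊢
  intro ε hε
  obtain ⟨B, hB⟩ := hL (ε / (C + 1)) (by positivity)
  refine ⟨max B 1, fun Y hY => ?_⟩
  have hY0 : 0 < Y := lt_of_lt_of_le one_pos ((le_max_right _ _).trans hY)
  rw [integral_boundary hG hp hY0]
  set g : ℝ → ℂ := fun y => ∫ x in (0 : ℝ)..1, G (x + y * I) with hg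
  have hgc : ContinuousOn g (Set.uIcc Y (Y + 1)) := by
    rw [Set.uIcc_of_le (by linarith)]
    have h1 : ContinuousOn (fun p : ℝ × ℝ => G (p.2 + p.1 * I)) (Set.Icc Y (Y + 1) ×ˢ Set.univ) := by
      refine hG.comp (by fun_prop) fun p hp => ?_
      have := hp.1.1
      simp
      linarith
    simp only [hg]
    rw [continuousOn_iff_continuous_domRestrict] at h1 ⊢
    have h2 : Continuous fun p : (Set.Icc Y (Y + 1)) × ℝ => G (p.2 + (p.1 : ℝ) * I) :=
      h1.comp (f := fun p : (Set.Icc Y (Y + 1)) × ℝ => (⟨((p.1 : ℝ), p.2), p.1.2, trivial⟩ : Set.Icc Y (Y + 1) ×ˢ Set.univ))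
        (by fun_prop)
    exact intervalIntegral.continuous_parametric_intervalIntegral_of_continuous' h2 0 1
  have hsc : Continuous fun y : ℝ => ((deriv smoothTransition (y - Y) : ℝ) : ℂ) :=
    continuous_ofReal.comp (hcd.comp (continuous_id.sub continuous_const))
  have e1 : (∫ y in Y..(Y + 1), ((deriv smoothTransition (y - Y) : ℝ) : ℂ) * g y) - L =
      ∫ y in Y..(Y + 1), ((deriv smoothTransition (y - Y) : ℝ) : ℂ) * (g y - L) := by
    have : L = ∫ y in Y..(Y + 1), ((deriv smoothTransition (y - Y) : ℝ) : ℂ) * L := by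
      rw [intervalIntegral.integral_mul_const, hone, one_mul]
    conv_lhs => rw [this]
    have i1 : IntervalIntegrable (fun y => ((deriv smoothTransition (y - Y) : ℝ) : ℂ) * g y)
        volume Y (Y + 1) := (hsc.continuousOn.mul hgc).intervalIntegrable
    have i2 : IntervalIntegrable (fun y => ((deriv smoothTransition (y - Y) : ℝ) : ℂ) * L)
        volume Y (Y + 1) := (hsc.mul continuous_const).intervalIntegrable _ _
    rw [← intervalIntegral.integral_sub i1 i2]
    simp only [mul_sub]
  rw [dist_eq_norm, e1]
  refine lt_of_le_of_lt (intervalIntegral.norm_integral_le_of_norm_le_const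
    (C := C * (ε / (C + 1))) fun y hy => ?_) ?_
  · rw [Set.uIoc_of_le (by linarith)] at hy
    rw [norm_mul]
    have h1 := hB y (by linarith [hy.1, (le_max_left B 1).trans hY])
    rw [dist_eq_norm] at h1
    refine mul_le_mul ?_ h1.le (norm_nonneg _) hC0
    rw [norm_real]
    exact hC _ ⟨by linarith [hy.1], by linarith [hy.2]⟩
  · rw [add_sub_cancel_left, abs_one, mul_one, mul_div_assoc', div_lt_iff₀ (by positivity)]
    nlinarith

lemma OneCusp.periodic_of_weight_two (hΓ : OneCusp Γ c₀) {G : ℂ → ℂ}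
    (hw : ∀ g ∈ Γ, ∀ z : ℂ, 0 < z.im → G (moebius g z) = autF g z ^ 2 * G z) (z : ℂ)
    (hz : 0 < z.im) : G (z + 1) = G z := by
  obtain ⟨g, hg, hge⟩ := hΓ.trans 1
  have := hw g hg z hz
  simpa [moebius, autF, hge] using this

/-- Stokes' theorem for a locally uniformly convergent series of weight two, in the limit where the
cut-off is removed. -/
theorem stokes_limit (hΓ : OneCusp Γ c₀) {ι : Type*} [Countable ι] {ψ : ι → ℂ → ℂ}
    (hψ : ∀ i, ∀ z : ℂ, 0 < z.im → ContDiffAt ℝ 1 (ψ i) z)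
    (hb : ∀ K : Set ℂ, IsCompact K → K ⊆ {z | 0 < z.im} → ∃ M : ι → ℝ, Summable M ∧
      ∀ i, ∀ z ∈ K, ‖ψ i z‖ ≤ M i ∧ ‖dbar (ψ i) z‖ ≤ M i)
    (hw : ∀ g ∈ Γ, ∀ z : ℂ, 0 < z.im →
      ∑' i, ψ i (moebius g z) = autF g z ^ 2 * ∑' i, ψ i z) {L : ℂ}
    (hL : Tendsto (fun y : ℝ => ∫ x in (0 : ℝ)..1, ∑' i, ψ i (x + y * I)) atTop (𝓝 L)) :
    Tendsto (fun Y : ℝ => ∫ z : ℂ, (eta Γ c₀ Y z : ℂ) * ∑' i, dbar (ψ i) z)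
      atTop (𝓝 (I / 4 * L)) := by
  have hc := hΓ.pos
  have hGc : ContinuousOn (fun z => ∑' i, ψ i z) {z | 0 < z.im} := by
    intro z hz
    obtain ⟨K, hK, hKz, hKs⟩ := exists_compact_subset isOpen_upper hz
    obtain ⟨M, hM, hMb⟩ := hb K hK hKs
    have h1 : ContinuousOn (fun z => ∑' i, ψ i z) K :=
      continuousOn_tsum (fun i w hw => (hψ i w (hKs hw)).continuousAt.continuousWithinAt) hM
        fun i w hw => (hMb i w hw).1
    exact (h1.continuousAt (mem_interior_iff_mem_nhds.mp hKz)).continuousWithinAt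
  have hlim := (tendsto_boundary hGc (hΓ.periodic_of_weight_two (G := fun z => ∑' i, ψ i z) hw) hL).const_mul (I / 4)
  refine hlim.congr' ?_
  filter_upwards [eventually_ge_atTop (4 / c₀), eventually_ge_atTop c₀] with Y hY hY'
  set K := boxY c₀ Y with hKdef
  have hK : IsCompact K := isCompact_boxY c₀ Y
  have hKH := boxY_subset hc Y
  obtain ⟨M, hM, hMb⟩ := hb K hK hKH
  have hibp := fun i => integral_mul_dbar hK hKH (fun z hz => eta_eq_zero hΓ hz)
    (fun z hz => eta_contDiffAt hΓ Y hz (n := 1)) (hψ i)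
  set D := dbar (fun w => (eta Γ c₀ Y w : ℂ)) with hD
  have hD0 : ∀ z ∉ K, D z = 0 := fun z hz => by
    refine dbar_of_eventually_zero ?_
    filter_upwards [hK.isClosed.isOpen_compl.mem_nhds hz] with w hw
    simp [eta_eq_zero hΓ hw]
  have hz0 : ∀ z ∈ K, 0 < z.im := fun z hz => hKH hz
  -- a generic interchange of sum and integral on the compact set
  have hswap : ∀ (u : ℂ → ℂ) (p : ι → ℂ → ℂ), (∀ z ∉ K, u z = 0) → ContinuousOn u K →
      (∀ i, Integrable fun z => u z * p i z) → (∀ i, ∀ z ∈ K, ‖p i z‖ ≤ M i) →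
      HasSum (fun i => ∫ z, u z * p i z) (∫ z, u z * ∑' i, p i z) := by
    intro u p hu huc h_int hp
    obtain ⟨C, hC⟩ := hK.exists_bound_of_continuousOn huc
    have hsum : Summable fun i => ∫ z, ‖u z * p i z‖ := by
      refine Summable.of_nonneg_of_le (fun i => integral_nonneg fun z => norm_nonneg _) (fun i => ?_)
        (hM.mul_left (C * volume.real K))
      have h1 : ∫ z, ‖u z * p i z‖ = ∫ z in K, ‖u z * p i z‖ :=
        (setIntegral_eq_integral_of_forall_compl_eq_zero fun z hz => by simp [hu z hz]).symm
      rw [h1]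
      have h2 : ∀ z ∈ K, ‖u z * p i z‖ ≤ C * M i := fun z hz => by
        rw [norm_mul]
        exact mul_le_mul (hC z hz) (hp i z hz) (norm_nonneg _) ((norm_nonneg _).trans (hC z hz))
      have h3 := norm_setIntegral_le_of_norm_le_const (f := fun z => ‖u z * p i z‖) (μ := volume)
        hK.measure_lt_top (fun z hz => by rw [norm_norm]; exact h2 z hz)
      calc _ ≤ _ := Real.le_norm_self _
        _ ≤ _ := h3
        _ = _ := by ring
    have h4 := hasSum_integral_of_summable_integral_norm h_int hsum
    simp only [tsum_mul_left] at h4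
    exact h4
  have hηC : ∀ z : ℂ, 0 < z.im → ContDiffAt ℝ 1 (fun w => (eta Γ c₀ Y w : ℂ)) z := fun z hz =>
    Complex.ofRealCLM.contDiff.contDiffAt.comp z (eta_contDiffAt hΓ Y hz (n := 1))
  have hDc : ContinuousOn D K := fun z hz => by
    have h1 : ContinuousAt (fderiv ℝ (fun w => (eta Γ c₀ Y w : ℂ))) z :=
      (hηC z (hz0 z hz)).continuousAt_fderiv (by norm_num)
    refine ContinuousAt.continuousWithinAt ?_
    exact ((h1.clm_apply continuousAt_const).add
      (continuousAt_const.mul (h1.clm_apply continuousAt_const))).div_const 2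
  have hs1 := hswap (fun z => (eta Γ c₀ Y z : ℂ)) (fun i => dbar (ψ i))
    (fun z hz => by simp [eta_eq_zero hΓ hz])
    (fun z hz => (hηC z (hz0 z hz)).continuousAt.continuousWithinAt)
    (fun i => (hibp i).1) (fun i z hz => (hMb i z hz).2)
  have hs2 := hswap D ψ hD0 hDc (fun i => (hibp i).2.1) (fun i z hz => (hMb i z hz).1)
  have hDG : Integrable fun z => D z * ∑' i, ψ i z :=
    (integrableOn_iff_integrable_of_support_subset fun z hz => by
      by_contra h
      exact hz (by simp [hD0 z h])).mp
      ((hDc.mul (hGc.mono hKH)).integrableOn_compact hK (μ := volume))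
  have e1 : ∫ z, (eta Γ c₀ Y z : ℂ) * ∑' i, dbar (ψ i) z = -∫ z, D z * ∑' i, ψ i z := by
    refine hs1.unique ?_
    exact hasSum_of_forall_eq hs2.neg fun i => (hibp i).2.2
  rw [e1, integral_dbar_eta hΓ hY hY' (G := fun z => ∑' i, ψ i z) hw hDG]
  ring

/-! ### The Fricke group -/

lemma atkinLehner_det (he : 0 < e) (heN : e ∣ N) {x y z w : ℤ}
    (hg : g.1 = (Real.sqrt e)⁻¹ • !![(x : ℝ) * e, (y : ℝ); (z : ℝ) * N, (w : ℝ) * e]) :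
    (e : ℤ) * x * w - (N / e : ℕ) * y * z = 1 := by
  have hs : Real.sqrt e * Real.sqrt e = e := Real.mul_self_sqrt (Nat.cast_nonneg e)
  have he' : (0 : ℝ) < e := mod_cast he
  have hs0 : Real.sqrt e ≠ 0 := (Real.sqrt_pos.mpr he').ne'
  obtain ⟨k, rfl⟩ := heN
  rw [Nat.mul_div_cancel_left k he]
  have hd := det_eq_one g
  rw [hg] at hd
  simp at hd
  have : ((e : ℝ)) * x * w - k * y * z = 1 := by
    field_simp at hd
    rw [sq, hs] at hd
    have h2 : (e : ℝ) * (e * x * w - k * y * z) = e * 1 := by linear_combination hd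
    exact mul_left_cancel₀ he'.ne' h2
  exact_mod_cast this

lemma mem_atkinLehner_mul {N e f : ℕ} (hN : 0 < N) (he : e ∣ N) (hf : f ∣ N) {g h : SL2R}
    (hg : g ∈ atkinLehnerSet N e) (hh : h ∈ atkinLehnerSet N f) :
    ∃ k, k ∣ N ∧ g * h ∈ atkinLehnerSet N k := by
  obtain ⟨x, y, z, w, hg⟩ := hg
  obtain ⟨x', y', z', w', hh⟩ := hh
  have he0 : 0 < e := Nat.pos_of_dvd_of_pos he hN
  have hd0 : 0 < Nat.gcd e f := Nat.gcd_pos_of_pos_left f he0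
  have hl := Nat.lcm_dvd he hf
  obtain ⟨d, e', f', hd, hcop, rfl, rfl⟩ := Nat.exists_coprime' (m := e) (n := f) hd0
  have hlcm : (e' * d).lcm (f' * d) = e' * f' * d := by
    rw [Nat.lcm_mul_right, hcop.lcm_eq_mul]
  rw [hlcm] at hl
  obtain ⟨M, rfl⟩ := hl
  have he'0 : 0 < e' := Nat.pos_of_mul_pos_right he0
  have hf'0 : 0 < f' := by
    rcases Nat.eq_zero_or_pos f' with h | h
    · simp [h] at hN
    · exact h
  refine ⟨e' * f', ⟨d * M, by ring⟩, x * x' * d + y * z' * M, x * e' * y' + y * w' * f',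
    z * x' * f' + w * e' * z', z * y' * M + w * w' * d, ?_⟩
  have hdr : (0 : ℝ) < d := mod_cast hd
  have her : (0 : ℝ) < e' := mod_cast he'0
  have hfr : (0 : ℝ) < f' := mod_cast hf'0
  have hs : (√((e' * d : ℕ) : ℝ))⁻¹ * (√((f' * d : ℕ) : ℝ))⁻¹ =
      (d : ℝ)⁻¹ * (√((e' * f' : ℕ) : ℝ))⁻¹ := by
    rw [← mul_inv, ← mul_inv]
    congr 1
    push_cast
    rw [← Real.sqrt_mul (by positivity), ← Real.sqrt_sq hdr.le, ← Real.sqrt_mul (by positivity),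
      Real.sqrt_sq hdr.le]
    congr 1
    ring
  rw [Matrix.SpecialLinearGroup.coe_mul, hg, hh, Matrix.smul_mul, Matrix.mul_smul, smul_smul, hs, mul_comm,
    mul_smul]
  congr 1
  ext i j
  fin_cases i <;> fin_cases j <;> simp <;> field_simp

lemma mem_atkinLehner_inv (hg : g ∈ atkinLehnerSet N e) :
    g⁻¹ ∈ atkinLehnerSet N e := by
  obtain ⟨x, y, z, w, hg⟩ := hg
  refine ⟨w, -y, -z, x, ?_⟩
  rw [Matrix.SpecialLinearGroup.coe_inv, Matrix.adjugate_fin_two, hg]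
  ext i j
  fin_cases i <;> fin_cases j <;> simp

lemma mem_gamma0SL2R_iff : g ∈ Gamma0SL2R N ↔ g ∈ atkinLehnerSet N 1 := by
  constructor
  · rintro ⟨γ, hγ, rfl⟩
    have h := CongruenceSubgroup.Gamma0_mem.mp hγ
    rw [ZMod.intCast_zmod_eq_zero_iff_dvd] at h
    obtain ⟨z, hz⟩ := h
    refine ⟨γ 0 0, γ 0 1, z, γ 1 1, ?_⟩
    ext i j
    fin_cases i <;> fin_cases j <;> simp [hz, mul_comm]
  · rintro ⟨x, y, z, w, hg⟩
    have hd := atkinLehner_det one_pos (one_dvd N) hg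
    simp only [Nat.div_one, Nat.cast_one, one_mul] at hd
    have hdet : (!![x, y; z * N, w] : Matrix (Fin 2) (Fin 2) ℤ).det = 1 := by
      rw [det_fin_two_of]; linarith
    let γ : Matrix.SpecialLinearGroup (Fin 2) ℤ := ⟨!![x, y; z * N, w], hdet⟩
    have hγ : γ.1 = !![x, y; z * N, w] := rfl
    refine ⟨γ, ?_, ?_⟩
    · refine CongruenceSubgroup.Gamma0_mem.mpr ?_
      simp [hγ]
    · apply Subtype.ext
      rw [hg, Matrix.SpecialLinearGroup.map_apply_coe, hγ]
      ext i j
      fin_cases i <;> fin_cases j <;> simp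

lemma mem_fricke (hN : 0 < N) (hg : g ∈ FrickeGroup N) :
    ∃ e, e ∣ N ∧ g ∈ atkinLehnerSet N e := by
  induction hg using Subgroup.closure_induction with
  | mem x hx =>
    rcases hx with hx | hx
    · exact ⟨1, one_dvd _, mem_gamma0SL2R_iff.mp hx⟩
    · simp only [Set.mem_iUnion] at hx
      obtain ⟨e, he, hx⟩ := hx
      exact ⟨e, he.1, hx⟩
  | one => exact ⟨1, one_dvd _, mem_gamma0SL2R_iff.mp (one_mem _)⟩
  | mul x y _ _ hx hy =>
    obtain ⟨e, he, hx⟩ := hx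
    obtain ⟨f, hf, hy⟩ := hy
    exact mem_atkinLehner_mul hN he hf hx hy
  | inv x _ hx =>
    obtain ⟨e, he, hx⟩ := hx
    exact ⟨e, he, mem_atkinLehner_inv hx⟩

lemma gamma0_le_fricke (N : ℕ) : Gamma0SL2R N ≤ FrickeGroup N := fun _ hg =>
  Subgroup.subset_closure (Or.inl hg)

lemma atkinLehner_subset_fricke (hN : Squarefree N) (he : e ∣ N)
    (hg : g ∈ atkinLehnerSet N e) : g ∈ FrickeGroup N := by
  refine Subgroup.subset_closure (Or.inr ?_)
  simp only [Set.mem_iUnion]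
  refine ⟨e, ⟨he, ?_⟩, hg⟩
  obtain ⟨k, rfl⟩ := he
  have he0 : 0 < e := Nat.pos_of_ne_zero fun h => by simp [h] at hN
  rw [Nat.mul_div_cancel_left k he0]
  exact Nat.coprime_of_squarefree_mul hN

/-- Atkin–Lehner matrices with prescribed data exist. -/
lemma exists_atkinLehner (hN : 0 < N) (he : e ∣ N) {x y z w : ℤ}
    (hd : (e : ℤ) * x * w - (N / e : ℕ) * y * z = 1) :
    ∃ g : SL2R, g ∈ atkinLehnerSet N e ∧
      g.1 = (Real.sqrt e)⁻¹ • !![(x : ℝ) * e, (y : ℝ); (z : ℝ) * N, (w : ℝ) * e] := by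
  have he0 : 0 < e := Nat.pos_of_dvd_of_pos he hN
  have her : (0 : ℝ) < e := mod_cast he0
  have hs : Real.sqrt e * Real.sqrt e = e := Real.mul_self_sqrt (Nat.cast_nonneg e)
  obtain ⟨k, rfl⟩ := he
  rw [Nat.mul_div_cancel_left k he0] at hd
  have hd' : (e : ℝ) * x * w - k * y * z = 1 := mod_cast hd
  refine ⟨⟨(Real.sqrt e)⁻¹ • !![(x : ℝ) * e, (y : ℝ); (z : ℝ) * ((e * k : ℕ) : ℝ), (w : ℝ) * e], ?_⟩,
    ⟨x, y, z, w, rfl⟩, rfl⟩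
  rw [Matrix.det_smul, det_fin_two_of]
  rw [Fintype.card_fin, inv_pow, sq, hs]
  push_cast
  field_simp
  linear_combination hd'

theorem oneCusp_fricke (hN : Squarefree N) : OneCusp (FrickeGroup N) (1 / (2 * N)) := by
  have hN0 : 0 < N := Nat.pos_of_ne_zero hN.ne_zero
  have hNr : (1 : ℝ) ≤ N := mod_cast hN0
  have hsq : ∀ e : ℕ, e ∣ N → 1 ≤ Real.sqrt e ∧ Real.sqrt e ≤ N := fun e he => by
    have h1 : (1 : ℝ) ≤ e := mod_cast Nat.pos_of_dvd_of_pos he hN0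
    have h2 : (e : ℝ) ≤ N := mod_cast Nat.le_of_dvd hN0 he
    refine ⟨Real.one_le_sqrt.mpr h1, Real.sqrt_le_iff.mpr ⟨by linarith, by nlinarith⟩⟩
  have hes : ∀ e : ℕ, (Real.sqrt e)⁻¹ * e = Real.sqrt e := fun e => by
    rcases Nat.eq_zero_or_pos e with rfl | h
    · simp
    · have : (0 : ℝ) < e := mod_cast h
      rw [inv_mul_eq_div, Real.div_sqrt]
  have htrans : ∀ n : ℤ, ∃ g ∈ FrickeGroup N, g.1 = !![1, (n : ℝ); 0, 1] := fun n => by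
    obtain ⟨g, hg, hge⟩ := exists_atkinLehner (e := 1) hN0 (one_dvd N) (x := 1) (y := n) (z := 0) (w := 1)
      (by simp)
    refine ⟨g, atkinLehner_subset_fricke hN (one_dvd N) hg, ?_⟩
    rw [hge]; ext i j; fin_cases i <;> fin_cases j <;> simp
  refine ⟨fun R => ?_, htrans, ?_, ?_, ?_, by positivity, ?_⟩
  · set B : ℤ := ⌈R * N⌉ with hB
    have hfin : ((N.divisors : Set ℕ) ×ˢ (Set.Icc (-B) B ×ˢ Set.Icc (-B) B ×ˢ
        Set.Icc (-B) B ×ˢ Set.Icc (-B) B)).Finite :=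
      (Finset.finite_toSet _).prod ((Set.finite_Icc _ _).prod ((Set.finite_Icc _ _).prod
        ((Set.finite_Icc _ _).prod (Set.finite_Icc _ _))))
    refine Set.Finite.of_finite_image (f := fun g : SL2R => g.1) ((hfin.image fun p =>
      (Real.sqrt p.1)⁻¹ • !![(p.2.1 : ℝ) * p.1, (p.2.2.1 : ℝ);
        (p.2.2.2.1 : ℝ) * N, (p.2.2.2.2 : ℝ) * p.1]).subset ?_) Subtype.val_injective.injOn
    rintro _ ⟨g, ⟨hg, hgR⟩, rfl⟩
    obtain ⟨e, he, x, y, z, w, hge⟩ := mem_fricke hN0 hg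
    obtain ⟨hs1, hs2⟩ := hsq e he
    have hs0 : 0 < Real.sqrt e := by linarith
    have hmem : ∀ t : ℤ, |(t : ℝ)| ≤ R * N → t ∈ Set.Icc (-B) B := fun t ht => by
      have h1 : ((|t| : ℤ) : ℝ) ≤ B := by
        push_cast; exact ht.trans (Int.le_ceil _)
      have h2 : |t| ≤ B := mod_cast h1
      exact abs_le.mp h2
    have hR0 : 0 ≤ R := (abs_nonneg _).trans (hgR 0 0)
    have h00 := hgR 0 0
    have h01 := hgR 0 1
    have h10 := hgR 1 0
    have h11 := hgR 1 1
    simp only [hge, Matrix.smul_apply, of_apply, cons_val', cons_val_zero,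
      cons_val_one, smul_eq_mul, cons_val_fin_one] at h00 h01 h10 h11
    refine ⟨(e, x, y, z, w), ⟨by simpa using ⟨he, hN.ne_zero⟩, hmem x ?_, hmem y ?_, hmem z ?_, hmem w ?_⟩,
      hge.symm⟩
    · rw [mul_comm (x : ℝ), ← mul_assoc, hes, abs_mul, abs_of_pos hs0] at h00
      nlinarith [abs_nonneg (x : ℝ)]
    · rw [abs_mul, abs_inv, abs_of_pos hs0, inv_mul_le_iff₀ hs0] at h01
      nlinarith [abs_nonneg (y : ℝ)]
    · rw [abs_mul, abs_inv, abs_of_pos hs0, inv_mul_le_iff₀ hs0, abs_mul,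
        abs_of_nonneg (by linarith : (0 : ℝ) ≤ N)] at h10
      nlinarith [abs_nonneg (z : ℝ)]
    · rw [mul_comm (w : ℝ), ← mul_assoc, hes, abs_mul, abs_of_pos hs0] at h11
      nlinarith [abs_nonneg (w : ℝ)]
  · obtain ⟨g, hg, hge⟩ := exists_atkinLehner (e := 1) hN0 (one_dvd N) (x := -1) (y := 0) (z := 0) (w := -1)
      (by simp)
    have : g = -1 := by
      apply Subtype.ext
      rw [hge]; ext i j; fin_cases i <;> fin_cases j <;> simp
    rw [← this]
    exact atkinLehner_subset_fricke hN (one_dvd N) hg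
  · intro g hg h0
    obtain ⟨e, he, x, y, z, w, hge⟩ := mem_fricke hN0 hg
    have he0 := Nat.pos_of_dvd_of_pos he hN0
    obtain ⟨hs1, hs2⟩ := hsq e he
    have hz : z = 0 := by
      rw [hge] at h0
      simpa [he0.ne', hN0.ne'] using h0
    have hd := atkinLehner_det he0 he hge
    rw [hz, mul_zero, sub_zero, mul_assoc] at hd
    have he1 : e = 1 := by
      have := Int.eq_one_of_mul_eq_one_right (by positivity) hd
      exact_mod_cast this
    subst he1
    rw [Nat.cast_one, one_mul] at hd
    rcases Int.mul_eq_one_iff_eq_one_or_neg_one.mp hd with ⟨rfl, rfl⟩ | ⟨rfl, rfl⟩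
    · refine ⟨y, Or.inl ?_⟩
      rw [hge, hz]; ext i j; fin_cases i <;> fin_cases j <;> simp
    · refine ⟨-y, Or.inr ?_⟩
      rw [hge, hz]; ext i j; fin_cases i <;> fin_cases j <;> simp
  · intro g hg h0
    obtain ⟨e, he, x, y, z, w, hge⟩ := mem_fricke hN0 hg
    obtain ⟨hs1, hs2⟩ := hsq e he
    have hs0 : 0 < Real.sqrt e := by linarith
    rw [hge] at h0 ⊢
    simp only [Matrix.smul_apply, of_apply, cons_val', cons_val_zero,
      cons_val_one, smul_eq_mul, cons_val_fin_one] at h0 ⊢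
    have hz : z ≠ 0 := fun h => h0 (by simp [h])
    have hz1 : (1 : ℝ) ≤ |(z : ℝ)| := mod_cast Int.one_le_abs hz
    rw [abs_mul, abs_inv, abs_of_pos hs0, abs_mul, abs_of_nonneg (by linarith : (0 : ℝ) ≤ N),
      le_inv_mul_iff₀ hs0]
    nlinarith
  · intro τ
    obtain ⟨γ, hγ⟩ := ModularGroup.exists_smul_mem_fd τ
    have him : 1 / 2 ≤ (γ • τ).im := by
      have := ModularGroup.three_le_four_mul_im_sq_of_mem_fd hγ
      have := (γ • τ).im_pos
      nlinarith
    have hdet : γ 0 0 * γ 1 1 - γ 0 1 * γ 1 0 = 1 := by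
      have h := γ.2; rwa [det_fin_two] at h
    set c : ℤ := γ 1 0 with hc
    set d : ℤ := γ 1 1 with hd
    set k : ℕ := Nat.gcd c.natAbs N with hk
    have hkN : k ∣ N := Nat.gcd_dvd_right _ _
    obtain ⟨e, hke⟩ := hkN
    have hk0 : 0 < k := Nat.pos_of_ne_zero fun h => by
      rw [h, zero_mul] at hke; omega
    have hkc : (k : ℤ) ∣ c := Int.natCast_dvd.mpr (Nat.gcd_dvd_left _ _)
    obtain ⟨z, hz⟩ := hkc
    have he : e ∣ N := ⟨k, by rw [hke, mul_comm]⟩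
    have hNe : N / e = k := by
      rw [hke, Nat.mul_div_cancel]
      exact Nat.pos_of_dvd_of_pos he hN0
    have hcop1 : IsCoprime (e : ℤ) c := by
      rw [Int.isCoprime_iff_gcd_eq_one, Int.gcd_comm]
      have hke' : Nat.Coprime k e := Nat.coprime_of_squarefree_mul (hke ▸ hN)
      have h1 : Nat.gcd c.natAbs e ∣ k := Nat.dvd_gcd (Nat.gcd_dvd_left _ _)
        ((Nat.gcd_dvd_right _ _).trans he)
      have h2 : Nat.gcd c.natAbs e ∣ e := Nat.gcd_dvd_right _ _
      have h3 := Nat.dvd_gcd h1 h2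
      rw [hke'] at h3
      exact Nat.dvd_one.mp h3
    have hcop2 : IsCoprime d c := ⟨γ 0 0, -γ 0 1, by linarith⟩
    obtain ⟨x, y, hxy⟩ := hcop1.mul_left hcop2
    obtain ⟨g, hg, hge⟩ := exists_atkinLehner (N := N) (e := e) hN0 he (x := x) (y := -y) (z := z) (w := d) (by
      rw [hNe]; rw [hz] at hxy; linear_combination hxy)
    have hgF := atkinLehner_subset_fricke hN he hg
    obtain ⟨hs1, hs2⟩ := hsq e he
    have hgim : 1 / (2 * (N : ℝ)) ≤ (g • τ).im := by
      have h1 : autF g τ = (Real.sqrt e : ℂ) * ((c : ℂ) * τ + d) := by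
        have h10 : g.1 1 0 = Real.sqrt e * c := by
          rw [hge]
          simp only [Matrix.smul_apply, of_apply, cons_val', cons_val_zero,
            cons_val_one, smul_eq_mul, cons_val_fin_one]
          rw [hz]
          have hke' : (N : ℝ) = k * e := mod_cast hke
          rw [hke']
          push_cast
          linear_combination ((z : ℝ) * k) * hes e
        have h11 : g.1 1 1 = Real.sqrt e * d := by
          rw [hge]
          simp only [Matrix.smul_apply, of_apply, cons_val', 
            cons_val_one, smul_eq_mul, cons_val_fin_one]
          linear_combination (d : ℝ) * hes e
        rw [autF, h10, h11]
        push_cast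
        ring
      have h2 : (γ • τ).im = τ.im / normSq ((c : ℂ) * τ + d) := by
        rw [ModularGroup.im_smul_eq_div_normSq]
        simp [denom, hc, hd]
      rw [im_smul, h1, map_mul, normSq_ofReal, Real.mul_self_sqrt (Nat.cast_nonneg e),
        mul_comm (e : ℝ), ← div_div τ.im, ← h2]
      have h3 : (e : ℝ) ≤ N := mod_cast Nat.le_of_dvd hN0 he
      have h4 : (0 : ℝ) < e := mod_cast Nat.pos_of_dvd_of_pos he hN0
      rw [div_le_div_iff₀ (by positivity) h4]
      nlinarith
    obtain ⟨t, ht, hte⟩ := htrans (-round (g • τ).re)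
    refine ⟨t * g, mul_mem ht hgF, ?_⟩
    have h5 : ((t * g) • τ : ℍ) = (((g • τ : ℍ) : ℂ) + ((-round (g • τ).re : ℤ) : ℂ) : ℂ) := by
      rw [mul_smul, coe_smul_eq_moebius]
      simp [moebius, hte]
    have h6 := congrArg Complex.re h5
    have h7 := congrArg Complex.im h5
    simp only [coe_re, coe_im, add_re, add_im, Complex.intCast_re,
      Complex.intCast_im, add_zero] at h6 h7
    rw [h6, h7]
    refine ⟨?_, hgim⟩
    push_cast
    rw [← sub_eq_add_neg]
    exact abs_sub_round _

/-! ### Growth of modular functions -/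

lemma norm_qc_zpow (τ : ℂ) (n : ℤ) : ‖qc τ ^ n‖ = rexp (-(2 * π * n * τ.im)) := by
  rw [qc, ← exp_int_mul, norm_exp]
  congr 1
  simp
  ring

lemma qc_zpow_eq (τ : ℂ) (n : ℤ) : qc τ ^ n = cexp (2 * π * I * n * τ) := by
  rw [qc, ← exp_int_mul]
  congr 1
  ring

lemma hasSum_qExp (ha : HasQExp f a n₀)
    (hτ : 0 < τ.im) : HasSum (fun n : ℤ => a n * qc τ ^ n) (f τ) := by
  have hinj : Function.Injective (fun m : ℕ => n₀ + (m : ℤ)) := fun m m' h => by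
    simpa using h
  refine (hinj.hasSum_iff ?_).mp (ha.2 τ hτ)
  intro n hn
  rw [ha.1 n, zero_mul]
  by_contra h
  exact hn ⟨(n - n₀).toNat, by simp; omega⟩

lemma growth_cusp (ha : HasQExp f a n₀) {c : ℝ} (hc : 0 < c) :
    ∃ C, 0 ≤ C ∧ ∀ w : ℂ, c ≤ w.im → ‖f w‖ ≤ C * rexp (2 * π * |(n₀ : ℝ)| * w.im) := by
  have h0 := (hasSum_qExp ha (τ := c * I) (by simpa using hc)).summable.norm
  refine ⟨(∑' n : ℤ, ‖a n * qc (c * I) ^ n‖) * rexp (2 * π * |(n₀ : ℝ)| * c), by positivity,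
    fun w hw => ?_⟩
  have hw0 : 0 < w.im := hc.trans_le hw
  rw [← (hasSum_qExp ha hw0).tsum_eq, mul_assoc, ← tsum_mul_right]
  refine tsum_of_norm_bounded (h0.mul_right _).hasSum fun n => ?_
  rcases lt_or_ge n n₀ with hn | hn
  · simp [ha.1 n hn]
  · rw [norm_mul, norm_mul, norm_qc_zpow, norm_qc_zpow, mul_assoc ‖a n‖]
    refine mul_le_mul_of_nonneg_left ?_ (norm_nonneg (a n))
    rw [← Real.exp_add, ← Real.exp_add]
    apply exp_le_exp.mpr
    simp only [mul_im, ofReal_re, I_im, mul_one, ofReal_im, I_re, mul_zero, add_zero]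
    have hn' : (n₀ : ℝ) ≤ n := mod_cast hn
    have h1 := neg_abs_le (n₀ : ℝ)
    have h2 : 0 ≤ (w.im - c) * ((n : ℝ) + |(n₀ : ℝ)|) := mul_nonneg (by linarith) (by linarith)
    have h3 : 0 ≤ |(n₀ : ℝ)| * c := by positivity
    nlinarith [pi_pos, mul_nonneg pi_pos.le h2, mul_nonneg pi_pos.le h3]

/-- The principal part at the cusp. -/
def principalPart (a : ℤ → ℂ) (n₀ : ℤ) (w : ℂ) : ℂ :=
  ∑ m ∈ Finset.Icc 1 n₀.natAbs, a (-(m : ℤ)) * qc w ^ (-(m : ℤ))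

lemma sub_principalPart_le (ha : HasQExp f a n₀)
    (ha0 : a 0 = 0) {c : ℝ} (hc : 0 < c) :
    ∃ C, 0 ≤ C ∧ ∀ w : ℂ, c ≤ w.im →
      ‖f w - principalPart a n₀ w‖ ≤ C * rexp (-(2 * π * w.im)) := by
  have h0 := (hasSum_qExp ha (τ := c * I) (by simpa using hc)).summable.norm
  refine ⟨(∑' n : ℤ, ‖a n * qc (c * I) ^ n‖) * rexp (2 * π * c), by positivity,
    fun w hw => ?_⟩
  have hw0 : 0 < w.im := hc.trans_le hw
  set s : Finset ℤ := (Finset.Icc 1 n₀.natAbs).map ⟨fun m : ℕ => -(m : ℤ), fun m m' h => by simpa using h⟩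
    with hs
  have hp : principalPart a n₀ w = ∑ n ∈ s, a n * qc w ^ n := by
    rw [hs, Finset.sum_map]; rfl
  have hsum := hasSum_qExp ha hw0
  have h1 : HasSum (fun n : ℤ => if n ∈ s then 0 else a n * qc w ^ n) (f w - principalPart a n₀ w) := by
    have h2 : HasSum (fun n : ℤ => if n ∈ s then a n * qc w ^ n else 0) (principalPart a n₀ w) := by
      rw [hp, Finset.sum_congr rfl fun n hn => (if_pos hn).symm]
      exact hasSum_sum_of_ne_finset_zero fun n hn => if_neg hn
    refine hasSum_of_forall_eq (hsum.sub h2) fun n => ?_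
    split_ifs <;> simp
  rw [← h1.tsum_eq, mul_assoc, ← tsum_mul_right]
  refine tsum_of_norm_bounded (h0.mul_right _).hasSum fun n => ?_
  split_ifs with hn
  · rw [norm_zero]; positivity
  · rcases le_or_gt n 0 with hn0 | hn0
    · have : a n = 0 := by
        rcases eq_or_lt_of_le hn0 with rfl | hn0
        · exact ha0
        · apply ha.1
          by_contra h
          apply hn
          rw [hs, Finset.mem_map]
          refine ⟨n.natAbs, ?_, ?_⟩
          · rw [Finset.mem_Icc]; omega
          · change -(n.natAbs : ℤ) = n
            omega
      simp [this]
    · rw [norm_mul, norm_mul, norm_qc_zpow, norm_qc_zpow, mul_assoc ‖a n‖]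
      refine mul_le_mul_of_nonneg_left ?_ (norm_nonneg (a n))
      rw [← Real.exp_add, ← Real.exp_add]
      apply exp_le_exp.mpr
      simp only [mul_im, ofReal_re, I_im, mul_one, ofReal_im, I_re, mul_zero, add_zero]
      have hn' : (1 : ℝ) ≤ n := mod_cast hn0
      have h2 : 0 ≤ (w.im - c) * ((n : ℝ) - 1) := mul_nonneg (by linarith) (by linarith)
      nlinarith [pi_pos, mul_nonneg pi_pos.le h2]

lemma growth_upper (hΓ : OneCusp Γ c₀)
    (ha : HasQExp f a n₀) (hf : ∀ g ∈ Γ, ∀ z : ℂ, 0 < z.im → f (moebius g z) = f z) :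
    ∃ C, 0 ≤ C ∧ ∀ w : ℍ, ‖f w‖ ≤ C * rexp (2 * π * |(n₀ : ℝ)| * (w.im + w.im⁻¹)) := by
  obtain ⟨C, hC, h⟩ := growth_cusp ha hΓ.pos
  refine ⟨C, hC, fun w => ?_⟩
  obtain ⟨g, hg, -, him⟩ := hΓ.reduce w
  have h1 := h _ him
  rw [coe_smul_eq_moebius, hf g hg _ w.im_pos] at h1
  refine h1.trans ?_
  gcongr
  rw [← coe_smul_eq_moebius]
  change (g • w).im ≤ _
  have hw := w.im_pos
  by_cases h0 : g.1 1 0 = 0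
  · rw [im_smul_of_lower_zero hΓ hg h0]
    have : 0 < w.im⁻¹ := by positivity
    linarith
  · have := im_smul_le_inv hΓ hg h0 w
    rw [one_div] at this
    linarith

/-! ### Summation over integer lattices and Poisson summation -/

lemma summable_int_exp {ε : ℝ} (hε : 0 < ε) : Summable fun n : ℤ => rexp (-(ε * |(n : ℝ)|)) := by
  have h : Summable fun n : ℕ => rexp (n * (-ε)) := Real.summable_exp_nat_mul_iff.mpr (by linarith)
  refine Summable.of_nat_of_neg ?_ ?_ <;> refine h.congr fun n => ?_ <;> simp [mul_comm]

lemma summable_int2_exp {ε : ℝ} (hε : 0 < ε) :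
    Summable fun p : ℤ × ℤ => rexp (-(ε * (|(p.1 : ℝ)| + |(p.2 : ℝ)|))) := by
  have h := summable_int_exp hε
  refine (h.mul_of_nonneg h (fun _ => (exp_pos _).le) (fun _ => (exp_pos _).le)).congr fun p => ?_
  rw [← Real.exp_add]; congr 1; ring

lemma summable_int3_exp {ε : ℝ} (hε : 0 < ε) :
    Summable fun p : ℤ × ℤ × ℤ =>
      rexp (-(ε * (|(p.1 : ℝ)| + |(p.2.1 : ℝ)| + |(p.2.2 : ℝ)|))) := by
  have h := summable_int_exp hε
  have h2 := summable_int2_exp hε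
  refine (h.mul_of_nonneg h2 (fun _ => (exp_pos _).le) (fun _ => (exp_pos _).le)).congr fun p => ?_
  rw [← Real.exp_add]; congr 1; ring

lemma summable_int4_exp {ε : ℝ} (hε : 0 < ε) :
    Summable fun p : (ℤ × ℤ) × ℤ × ℤ =>
      rexp (-(ε * (|(p.1.1 : ℝ)| + |(p.1.2 : ℝ)| + |(p.2.1 : ℝ)| + |(p.2.2 : ℝ)|))) := by
  have h2 := summable_int2_exp hε
  refine (h2.mul_of_nonneg h2 (fun _ => (exp_pos _).le) (fun _ => (exp_pos _).le)).congr fun p => ?_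
  rw [← Real.exp_add]; congr 1; ring

/-- A Gaussian in one variable beats any exponential. -/
lemma linear_sub_sq_le {a : ℝ} (ha : 0 < a) (K t : ℝ) : K * t - a * t ^ 2 ≤ K ^ 2 / (4 * a) := by
  rw [le_div_iff₀ (by positivity)]
  nlinarith [sq_nonneg (2 * a * t - K)]

/-- The moments of a shifted Gaussian on the integers. -/
def gaussMoment (k : ℕ) (a : ℝ) (b : ℂ) : ℂ :=
  ∑' n : ℤ, (n : ℂ) ^ k * cexp (-π * a * n ^ 2 + 2 * π * b * n)

lemma gaussMoment_term_le (k : ℕ) {a : ℝ} (ha : 0 < a) (R : ℝ) {b : ℂ} (hb : ‖b‖ ≤ R) (n : ℤ) :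
    ‖(n : ℂ) ^ k * cexp (-π * a * n ^ 2 + 2 * π * b * n)‖ ≤
      k.factorial * rexp ((2 * π * R + 2) ^ 2 / (4 * (π * a))) * rexp (-(1 * |(n : ℝ)|)) := by
  have h1 : ‖(n : ℂ) ^ k‖ ≤ k.factorial * rexp |(n : ℝ)| := by
    rw [norm_pow, norm_intCast]
    have := Real.pow_div_factorial_le_exp |(n : ℝ)| (abs_nonneg _) k
    rwa [div_le_iff₀ (by positivity), mul_comm] at this
  have h2 : ‖cexp (-π * a * n ^ 2 + 2 * π * b * n)‖ ≤
      rexp (-(π * a) * |(n : ℝ)| ^ 2 + 2 * π * R * |(n : ℝ)|) := by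
    rw [norm_exp]
    apply exp_le_exp.mpr
    have h3 : (-(π : ℂ) * a * n ^ 2 + 2 * π * b * n).re = -(π * a) * |(n : ℝ)| ^ 2 + 2 * π * (b.re * n) := by
      have : (-(π : ℂ) * a * n ^ 2 + 2 * π * b * n) =
        ((-(π * a) * n ^ 2 : ℝ) : ℂ) + ((2 * π * n : ℝ) : ℂ) * b := by push_cast; ring
      rw [this, sq_abs, add_re, re_ofReal_mul, ofReal_re]
      ring
    rw [h3]
    have h4 : b.re * n ≤ R * |(n : ℝ)| := by
      calc b.re * n ≤ |b.re * n| := le_abs_self _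
        _ = |b.re| * |(n : ℝ)| := abs_mul _ _
        _ ≤ R * |(n : ℝ)| := by
          gcongr
          exact (abs_re_le_norm b).trans hb
    nlinarith [pi_pos]
  rw [norm_mul]
  refine (mul_le_mul h1 h2 (norm_nonneg _) (by positivity)).trans ?_
  rw [mul_assoc (k.factorial : ℝ), mul_assoc (k.factorial : ℝ)]
  refine mul_le_mul_of_nonneg_left ?_ (Nat.cast_nonneg _)
  rw [← Real.exp_add, ← Real.exp_add]
  apply exp_le_exp.mpr
  have := linear_sub_sq_le (a := π * a) (by positivity) (2 * π * R + 2) |(n : ℝ)|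
  linarith

lemma summable_gaussMoment_bound (k : ℕ) (a R : ℝ) : Summable fun n : ℤ =>
    k.factorial * rexp ((2 * π * R + 2) ^ 2 / (4 * (π * a))) * rexp (-(1 * |(n : ℝ)|)) :=
  (summable_int_exp one_pos).mul_left _

lemma summable_gaussMoment (k : ℕ) {a : ℝ} (ha : 0 < a) (b : ℂ) :
    Summable fun n : ℤ => (n : ℂ) ^ k * cexp (-π * a * n ^ 2 + 2 * π * b * n) :=
  .of_norm_bounded (summable_gaussMoment_bound k a ‖b‖) fun n => gaussMoment_term_le k ha _ le_rfl n

lemma hasDerivAt_gaussMoment (k : ℕ) {a : ℝ} (ha : 0 < a) (b : ℂ) :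
    HasDerivAt (gaussMoment k a) (2 * π * gaussMoment (k + 1) a b) b := by
  have hU : IsOpen (Metric.ball (0 : ℂ) (‖b‖ + 1)) := Metric.isOpen_ball
  have hb : b ∈ Metric.ball (0 : ℂ) (‖b‖ + 1) := by simp
  have hd : ∀ (n : ℤ) (c : ℂ), HasDerivAt (fun c : ℂ => (n : ℂ) ^ k * cexp (-π * a * n ^ 2 + 2 * π * c * n))
      ((n : ℂ) ^ k * (cexp (-π * a * n ^ 2 + 2 * π * c * n) * (2 * π * n))) c := fun n c => by
    have h1 : HasDerivAt (fun c : ℂ => -π * a * n ^ 2 + 2 * π * c * n) (2 * π * n : ℂ) c := by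
      have := (((hasDerivAt_id c).const_mul (2 * π : ℂ)).mul_const (n : ℂ)).const_add (-π * a * n ^ 2 : ℂ)
      simpa using this
    exact h1.cexp.const_mul _
  have hle : ∀ (n : ℤ) (c : ℂ), c ∈ Metric.ball (0 : ℂ) (‖b‖ + 1) →
      ‖(n : ℂ) ^ k * cexp (-π * a * n ^ 2 + 2 * π * c * n)‖ ≤ _ := fun n c hc =>
    gaussMoment_term_le k ha (‖b‖ + 1) (by simpa using (mem_ball_zero_iff.mp hc).le) n
  have hdo : ∀ n : ℤ, DifferentiableOn ℂ (fun c : ℂ => (n : ℂ) ^ k * cexp (-π * a * n ^ 2 + 2 * π * c * n))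
      (Metric.ball (0 : ℂ) (‖b‖ + 1)) := fun n c _ => (hd n c).differentiableAt.differentiableWithinAt
  have h1 := hasSum_deriv_of_summable_norm (summable_gaussMoment_bound k a (‖b‖ + 1)) hdo hU hle hb
  have h2 := (differentiableOn_tsum_of_summable_norm (summable_gaussMoment_bound k a (‖b‖ + 1)) hdo hU hle
    b hb).differentiableAt (hU.mem_nhds hb)
  have h3 : deriv (gaussMoment k a) b = 2 * π * gaussMoment (k + 1) a b := by
    have : deriv (gaussMoment k a) b = ∑' n : ℤ, _ := h1.tsum_eq.symm
    rw [this, gaussMoment, ← tsum_mul_left]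
    refine tsum_congr fun n => ?_
    rw [(hd n b).deriv]
    ring
  rw [← h3]
  exact h2.hasDerivAt

lemma gaussMoment_zero_poisson {a : ℝ} (ha : 0 < a) (b : ℂ) :
    gaussMoment 0 a b = 1 / (a : ℂ) ^ (1 / 2 : ℂ) * cexp (π * b ^ 2 / a) * gaussMoment 0 a⁻¹ (-I * b / a) := by
  have ha' : (a : ℂ) ≠ 0 := mod_cast ha.ne'
  have h := Complex.tsum_exp_neg_quadratic (a := a) (by simpa using ha) b
  simp only [gaussMoment, pow_zero, one_mul]
  rw [h, mul_assoc]
  congr 1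
  rw [← tsum_mul_left]
  refine tsum_congr fun n => ?_
  rw [← Complex.exp_add]
  congr 1
  push_cast
  field_simp
  ring_nf
  simp only [I_sq]
  ring

/-- Poisson summation for a quadratic polynomial times a Gaussian. -/
theorem tsum_quadratic_mul_gauss {a : ℝ} (ha : 0 < a) (b t : ℂ) :
    ∑' n : ℤ, (a * (n + t) ^ 2 - 1 / (2 * π)) * cexp (-π * a * n ^ 2 + 2 * π * b * n) =
      -(1 / (a * (a : ℂ) ^ (1 / 2 : ℂ))) *
        ∑' m : ℤ, (m + I * b + I * a * t) ^ 2 * cexp (-π / a * (m + I * b) ^ 2) := by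
  have ha' : (a : ℂ) ≠ 0 := mod_cast ha.ne'
  have ha'' : 0 < a⁻¹ := by positivity
  have hπ : (π : ℂ) ≠ 0 := mod_cast Real.pi_ne_zero
  set κ : ℂ := 1 / (a : ℂ) ^ (1 / 2 : ℂ) with hκ
  set E : ℂ → ℂ := fun b => cexp (π * b ^ 2 / a) with hE
  set S : ℕ → ℂ → ℂ := fun k b => gaussMoment k a⁻¹ (-I * b / a) with hS
  have hdS : ∀ k b, HasDerivAt (S k) (2 * π * S (k + 1) b * (-I / a)) b := fun k b => by
    have h1 : HasDerivAt (fun b : ℂ => -I * b / a) (-I / a) b := by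
      simpa using ((hasDerivAt_id b).const_mul (-I)).div_const (a : ℂ)
    exact (hasDerivAt_gaussMoment k ha'' (-I * b / a)).comp b h1
  have hdE : ∀ b, HasDerivAt E (E b * (2 * π * b / a)) b := fun b => by
    have h1 : HasDerivAt (fun b : ℂ => π * b ^ 2 / a) (2 * π * b / a) b := by
      have := ((hasDerivAt_pow 2 b).const_mul (π : ℂ)).div_const (a : ℂ)
      refine this.congr_deriv ?_
      push_cast; ring
    exact h1.cexp
  have e0 : gaussMoment 0 a = fun b => κ * E b * S 0 b := funext fun b => gaussMoment_zero_poisson ha b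
  have e1 : gaussMoment 1 a = fun b => κ * E b * (b / a * S 0 b + (-I / a) * S 1 b) := by
    funext b
    have h1 := hasDerivAt_gaussMoment 0 ha b
    rw [e0] at h1
    have h2 := h1.unique (((hdE b).const_mul κ).mul (hdS 0 b))
    have h3 : (2 * π : ℂ) * gaussMoment 1 a b = 2 * π * (κ * E b * (b / a * S 0 b + (-I / a) * S 1 b)) := by
      refine h2.trans ?_
      ring
    exact mul_left_cancel₀ (by simp [hπ]) h3
  have e2 : gaussMoment 2 a b = κ * E b * (b / a * (b / a * S 0 b + (-I / a) * S 1 b) +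
      (1 / a * S 0 b + b / a * S 1 b * (2 * π) * (-I / a) + (-I / a) * (2 * π * S 2 b * (-I / a))) / (2 * π)) := by
    have h1 := hasDerivAt_gaussMoment 1 ha b
    rw [e1] at h1
    have h4 : HasDerivAt (fun b : ℂ => b / a) (1 / a) b := (hasDerivAt_id b).div_const _
    have h2 := h1.unique (((hdE b).const_mul κ).mul ((h4.mul (hdS 0 b)).add ((hdS 1 b).const_mul _)))
    have h3 : (2 * π : ℂ) * gaussMoment 2 a b = 2 * π * (κ * E b * (b / a * (b / a * S 0 b + (-I / a) * S 1 b) +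
      (1 / a * S 0 b + b / a * S 1 b * (2 * π) * (-I / a) + (-I / a) * (2 * π * S 2 b * (-I / a))) / (2 * π))) := by
      refine h2.trans ?_
      field_simp
    exact mul_left_cancel₀ (by simp [hπ]) h3
  have hl : ∑' n : ℤ, (a * (n + t) ^ 2 - 1 / (2 * π)) * cexp (-π * a * n ^ 2 + 2 * π * b * n) =
      a * gaussMoment 2 a b + 2 * a * t * gaussMoment 1 a b + (a * t ^ 2 - 1 / (2 * π)) * gaussMoment 0 a b := by
    simp only [gaussMoment]
    rw [← tsum_mul_left, ← tsum_mul_left, ← tsum_mul_left,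
      ← Summable.tsum_add ((summable_gaussMoment 2 ha b).mul_left _) ((summable_gaussMoment 1 ha b).mul_left _),
      ← Summable.tsum_add (((summable_gaussMoment 2 ha b).mul_left _).add ((summable_gaussMoment 1 ha b).mul_left _))
        ((summable_gaussMoment 0 ha b).mul_left _)]
    refine tsum_congr fun n => ?_
    ring
  have hr : ∑' m : ℤ, (m + I * b + I * a * t) ^ 2 * cexp (-π / a * (m + I * b) ^ 2) =
      E b * (S 2 b + 2 * (I * b + I * a * t) * S 1 b + (I * b + I * a * t) ^ 2 * S 0 b) := by
    simp only [hS, gaussMoment]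
    rw [← tsum_mul_left, ← tsum_mul_left,
      ← Summable.tsum_add (summable_gaussMoment 2 ha'' _) ((summable_gaussMoment 1 ha'' _).mul_left _),
      ← Summable.tsum_add ((summable_gaussMoment 2 ha'' _).add ((summable_gaussMoment 1 ha'' _).mul_left _))
        ((summable_gaussMoment 0 ha'' _).mul_left _), ← tsum_mul_left]
    refine tsum_congr fun n => ?_
    have : cexp (-π / a * (n + I * b) ^ 2) =
        E b * cexp (-π * (a⁻¹ : ℝ) * n ^ 2 + 2 * π * (-I * b / a) * n) := by
      rw [hE, ← Complex.exp_add]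
      congr 1
      push_cast
      field_simp
      ring_nf
      simp only [I_sq]
      ring
    rw [this]
    ring
  rw [hl, hr, e2, e1, e0]
  have : -(1 / (a * (a : ℂ) ^ (1 / 2 : ℂ))) = -(1 / a * κ) := by
    rw [hκ, one_div_mul_one_div]
  rw [this]
  field_simp
  ring_nf
  simp only [I_sq]
  ring

/-! ### The theta kernel -/

/-- The real-valued function `Q_w = (a|w|² + b Re w + c) / Im w` of a binary quadratic form. -/
def qR (a b c : ℝ) (w : ℂ) : ℝ := (a * normSq w + b * w.re + c) / w.im

/-- The majorant `2 Q_w² + (b² - 4ac)`. -/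
def enQ (a b c : ℝ) (w : ℂ) : ℝ := 2 * qR a b c w ^ 2 + (b ^ 2 - 4 * a * c)

/-- The Kudla–Millson type kernel. -/
def kerP (N v a b c : ℝ) (w : ℂ) : ℝ :=
  (v * qR a b c w ^ 2 / N - 1 / (2 * π)) *
    rexp (-(π * v * (qR a b c w ^ 2 + (b ^ 2 - 4 * a * c)) / N))

lemma qR_eq (a b c : ℝ) (hw : 0 < w.im) :
    qR a b c w = a * w.im + (a * w.re ^ 2 + b * w.re + c) / w.im := by
  rw [qR, normSq_apply]; field_simp; ring

lemma enQ_eq (a b c : ℝ) (hw : 0 < w.im) : enQ a b c w =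
    2 * ((a * w.re ^ 2 + b * w.re + c) / w.im) ^ 2 + 2 * (a * w.im) ^ 2 + (2 * a * w.re + b) ^ 2 := by
  rw [enQ, qR_eq a b c hw]; field_simp; ring

lemma qR_sq_le (a b c : ℝ) (hw : 0 < w.im) : qR a b c w ^ 2 ≤ enQ a b c w := by
  rw [qR_eq a b c hw, enQ_eq a b c hw]
  nlinarith [sq_nonneg (a * w.im - (a * w.re ^ 2 + b * w.re + c) / w.im), sq_nonneg (2 * a * w.re + b)]

lemma enQ_nonneg (a b c : ℝ) (hw : 0 < w.im) : 0 ≤ enQ a b c w :=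
  (sq_nonneg _).trans (qR_sq_le a b c hw)

lemma abs_coeff_le (a b c : ℝ) {X : ℝ} (hX : |w.re| ≤ X) :
    |a| + |b| + |c| ≤ |a * w.re ^ 2 + b * w.re + c| + (1 + X) * |2 * a * w.re + b| +
      (1 + 2 * X + 3 * X ^ 2) * |a| := by
  have hX0 : 0 ≤ X := (abs_nonneg _).trans hX
  have ha := abs_nonneg a
  have hb' := abs_nonneg b
  have hx2 : w.re ^ 2 ≤ X ^ 2 := sq_le_sq.mpr (by rwa [abs_of_nonneg hX0])
  have h1 : |a * w.re ^ 2| ≤ X ^ 2 * |a| := by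
    rw [abs_mul, abs_of_nonneg (sq_nonneg w.re), mul_comm]; gcongr
  have h2 : |b * w.re| ≤ X * |b| := by rw [abs_mul, mul_comm]; gcongr
  have h3 : |2 * a * w.re| ≤ 2 * X * |a| := by
    rw [abs_mul, abs_mul, abs_two]; nlinarith
  have hb : |b| ≤ |2 * a * w.re + b| + 2 * X * |a| := by
    have := abs_sub (2 * a * w.re + b) (2 * a * w.re)
    rw [add_sub_cancel_left] at this
    linarith
  have hc : |c| ≤ |a * w.re ^ 2 + b * w.re + c| + X ^ 2 * |a| + X * |b| := by
    have h4 := abs_sub (a * w.re ^ 2 + b * w.re + c) (a * w.re ^ 2 + b * w.re)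
    rw [add_sub_cancel_left] at h4
    have h5 := abs_add_le (a * w.re ^ 2) (b * w.re)
    linarith
  have h6 : X * |b| ≤ X * (|2 * a * w.re + b| + 2 * X * |a|) := by gcongr
  nlinarith

lemma enQ_ge_of_bounded {X y₀ y₁ : ℝ} (hy₀ : 0 < y₀) (hy₁ : 0 < y₁) :
    ∃ C, ∀ a b c : ℝ, ∀ w : ℂ, |w.re| ≤ X → y₀ ≤ w.im → w.im ≤ y₁ →
      |a| + |b| + |c| - C ≤ enQ a b c w := by
  refine ⟨1 ^ 2 / (4 * (2 / y₁ ^ 2)) + (1 + X) ^ 2 / (4 * 1) + (1 + 2 * X + 3 * X ^ 2) ^ 2 / (4 * (2 * y₀ ^ 2)),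
    fun a b c w hX h0 h1 => ?_⟩
  have hw : 0 < w.im := hy₀.trans_le h0
  have h2 := abs_coeff_le a b c hX
  rw [enQ_eq a b c hw]
  set s := a * w.re ^ 2 + b * w.re + c
  set β := 2 * a * w.re + b
  have e1 := linear_sub_sq_le (a := 2 / y₁ ^ 2) (by positivity) 1 |s|
  have e2 := linear_sub_sq_le (a := 1) one_pos (1 + X) |β|
  have e3 := linear_sub_sq_le (a := 2 * y₀ ^ 2) (by positivity) (1 + 2 * X + 3 * X ^ 2) |a|
  have f1 : 2 / y₁ ^ 2 * |s| ^ 2 ≤ 2 * (s / w.im) ^ 2 := by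
    rw [sq_abs, div_pow, ← mul_div_assoc, div_mul_eq_mul_div]
    gcongr
  have f3 : 2 * y₀ ^ 2 * |a| ^ 2 ≤ 2 * (a * w.im) ^ 2 := by
    rw [sq_abs, mul_pow]
    have : y₀ ^ 2 ≤ w.im ^ 2 := by gcongr
    nlinarith [sq_nonneg a]
  rw [sq_abs] at e2
  linarith

lemma enQ_ge_of_compact {K : Set ℂ} (hK : IsCompact K) (hKu : K ⊆ {z | 0 < z.im}) :
    ∃ C, ∀ a b c : ℝ, ∀ w ∈ K, |a| + |b| + |c| - C ≤ enQ a b c w := by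
  rcases K.eq_empty_or_nonempty with rfl | hne
  · exact ⟨0, fun _ _ _ w hw => absurd hw (Set.notMem_empty w)⟩
  · obtain ⟨w₀, hw₀, h0⟩ := hK.exists_isMinOn hne Complex.continuous_im.continuousOn
    obtain ⟨R, hR⟩ := hK.isBounded.exists_norm_le
    have hpos : 0 < w₀.im := hKu hw₀
    have hR0 : 0 < R := hpos.trans_le ((Complex.im_le_norm w₀).trans (hR w₀ hw₀))
    obtain ⟨C, hC⟩ := enQ_ge_of_bounded (X := R) hpos hR0
    exact ⟨C, fun a b c w hw => hC a b c w ((abs_re_le_norm w).trans (hR w hw)) (h0 hw)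
      ((Complex.im_le_norm w).trans (hR w hw))⟩

lemma enQ_ge_of_cusp {c₁ : ℝ} (hc₁ : 0 < c₁) :
    ∃ C, ∀ a b c : ℝ, ∀ w : ℂ, 1 ≤ |a| → |w.re| ≤ 1 → c₁ ≤ w.im →
      w.im ^ 2 / 2 + (|a| + |b| + |c|) - C ≤ enQ a b c w := by
  refine ⟨(1 + 1) ^ 2 / (4 * 1) + (1 + 2 * 1 + 3 * 1 ^ 2) ^ 2 / (4 * (c₁ ^ 2 / 2)),
    fun a b c w ha hX h0 => ?_⟩
  have hw : 0 < w.im := hc₁.trans_le h0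
  have h2 := abs_coeff_le a b c hX
  rw [enQ_eq a b c hw]
  set s := a * w.re ^ 2 + b * w.re + c
  set β := 2 * a * w.re + b
  have e2 := linear_sub_sq_le (a := 1) one_pos (1 + 1) |β|
  have e3 := linear_sub_sq_le (a := c₁ ^ 2 / 2) (by positivity) (1 + 2 * 1 + 3 * 1 ^ 2) |a|
  have f1 : |s| ≤ 2 * (s / w.im) ^ 2 + (a * w.im) ^ 2 := by
    have h3 : |s| ≤ |s / w.im| * (|a| * w.im) := by
      rw [abs_div, abs_of_pos hw]
      field_simp
      exact le_mul_of_one_le_right (abs_nonneg s) ha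
    have h4 : (a * w.im) ^ 2 = (|a| * w.im) ^ 2 := by rw [mul_pow, mul_pow, sq_abs]
    rw [h4, ← sq_abs (s / w.im)]
    nlinarith [sq_nonneg (|s / w.im| - |a| * w.im), sq_nonneg |s / w.im|, sq_nonneg (|a| * w.im)]
  have f3 : c₁ ^ 2 / 2 * |a| ^ 2 + w.im ^ 2 / 2 ≤ (a * w.im) ^ 2 := by
    rw [mul_pow, ← sq_abs a]
    have h5 : c₁ ^ 2 ≤ w.im ^ 2 := by gcongr
    have h6 : 1 ≤ |a| ^ 2 := one_le_pow₀ ha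
    nlinarith
  rw [sq_abs] at e2
  linarith

lemma kerP_abs_le {N v : ℝ} (hN : 0 < N) (hv : 0 < v) (a b c : ℝ) (hw : 0 < w.im) :
    |kerP N v a b c w| ≤ 2 * rexp (-(π * v / (4 * N) * enQ a b c w)) *
      rexp (-(π * v / (2 * N) * (b ^ 2 - 4 * a * c))) := by
  set s := π * v / (4 * N) * enQ a b c w with hs
  have hq := qR_sq_le a b c hw
  have hs0 : 0 ≤ s := mul_nonneg (by positivity) (enQ_nonneg a b c hw)
  have hexp : rexp (-(π * v * (qR a b c w ^ 2 + (b ^ 2 - 4 * a * c)) / N)) =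
      rexp (-s) * rexp (-s) * rexp (-(π * v / (2 * N) * (b ^ 2 - 4 * a * c))) := by
    rw [← Real.exp_add, ← Real.exp_add]
    congr 1
    rw [hs, enQ]
    field_simp
    ring
  rw [kerP, abs_mul, abs_of_pos (exp_pos _), hexp, ← mul_assoc]
  refine mul_le_mul_of_nonneg_right ?_ (exp_pos _).le
  rw [← mul_assoc]
  refine mul_le_mul_of_nonneg_right ?_ (exp_pos _).le
  have h1 : |v * qR a b c w ^ 2 / N - 1 / (2 * π)| ≤ 4 / π * s + 1 / (2 * π) := by
    have h2 : v * qR a b c w ^ 2 / N ≤ 4 / π * s := by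
      rw [hs]
      have : 4 / π * (π * v / (4 * N) * enQ a b c w) = v * enQ a b c w / N := by field_simp
      rw [this]; gcongr
    have h3 : 0 ≤ v * qR a b c w ^ 2 / N := by positivity
    have h4 : 0 < 1 / (2 * π) := by positivity
    rw [abs_le]; constructor <;> linarith [div_nonneg (by norm_num : (0:ℝ) ≤ 4) pi_pos.le]
  have h5 : 4 / π * s + 1 / (2 * π) ≤ 2 * rexp s := by
    have h6 := Real.add_one_le_exp s
    have h7 : 4 / π ≤ 2 := by rw [div_le_iff₀ pi_pos]; linarith [Real.two_le_pi]
    have h8 : 1 / (2 * π) ≤ 2 := by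
      rw [div_le_iff₀ (by positivity)]; linarith [Real.two_le_pi]
    nlinarith
  calc _ ≤ 2 * rexp s * rexp (-s) := mul_le_mul_of_nonneg_right (h1.trans h5) (exp_pos _).le
    _ = 2 := by rw [mul_assoc, ← Real.exp_add, add_neg_cancel, Real.exp_zero, mul_one]

/-- A term of the theta kernel, indexed by `((a, j), (k, c))`. -/
def thetaTerm (e e' : ℕ) (τ z w : ℂ) (p : (ℤ × ℤ) × ℤ × ℤ) : ℂ :=
  qc τ ^ (p.1.2 * p.2.1 + p.1.1 * p.2.2) * qc z ^ (e' * p.1.2 + e * p.2.1) *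
    (kerP (e * e') τ.im (e * e' * p.1.1) (e * p.2.1 - e' * p.1.2) p.2.2 w : ℝ)

lemma thetaTerm_norm_le (he : 0 < e) (he' : 0 < e') (hτ : 0 < τ.im) (z : ℂ) :
    ∃ C, 0 < C ∧ ∀ w : ℂ, 0 < w.im → ∀ p, ‖thetaTerm e e' τ z w p‖ ≤
      C * rexp (-|(e' * p.1.2 + e * p.2.1 : ℝ)|) * rexp (-(π * τ.im / (4 * (e * e')) *
        enQ (e * e' * p.1.1) (e * p.2.1 - e' * p.1.2) p.2.2 w)) := by
  have he1 : (0 : ℝ) < e := mod_cast he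
  have he2 : (0 : ℝ) < e' := mod_cast he'
  set α := π * τ.im / (2 * (e * e')) with hα
  have hα0 : 0 < α := by positivity
  refine ⟨2 * rexp ((2 * π * |z.im| + 1) ^ 2 / (4 * α)), by positivity, fun w hw p => ?_⟩
  set r : ℝ := e' * p.1.2 + e * p.2.1 with hr
  have h1 := kerP_abs_le (mul_pos he1 he2) hτ (e * e' * p.1.1) (e * p.2.1 - e' * p.1.2) p.2.2 hw
  rw [thetaTerm, norm_mul, norm_mul, norm_qc_zpow, norm_qc_zpow, norm_real, norm_eq_abs]
  refine (mul_le_mul_of_nonneg_left h1 (by positivity)).trans ?_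
  set X := rexp (-(π * τ.im / (4 * (e * e')) *
        enQ (e * e' * p.1.1) (e * p.2.1 - e' * p.1.2) p.2.2 w))
  have h2 : rexp (-(2 * π * ((p.1.2 * p.2.1 + p.1.1 * p.2.2 : ℤ) : ℝ) * τ.im)) *
      rexp (-(2 * π * ((e' * p.1.2 + e * p.2.1 : ℤ) : ℝ) * z.im)) *
      rexp (-(π * τ.im / (2 * (e * e')) * (((e * p.2.1 - e' * p.1.2 : ℝ)) ^ 2 - 4 * (e * e' * p.1.1) * p.2.2))) ≤
      rexp ((2 * π * |z.im| + 1) ^ 2 / (4 * α)) * rexp (-|r|) := by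
    rw [← Real.exp_add, ← Real.exp_add, ← Real.exp_add]
    apply exp_le_exp.mpr
    have h3 := linear_sub_sq_le hα0 (2 * π * |z.im| + 1) |r|
    have h4 : -(r * z.im) ≤ |r| * |z.im| := by rw [← abs_mul]; exact neg_le_abs _
    have h5 : -(2 * π * ((p.1.2 * p.2.1 + p.1.1 * p.2.2 : ℤ) : ℝ) * τ.im) +
        -(2 * π * ((e' * p.1.2 + e * p.2.1 : ℤ) : ℝ) * z.im) +
        -(π * τ.im / (2 * (e * e')) * ((e * p.2.1 - e' * p.1.2 : ℝ) ^ 2 - 4 * (e * e' * p.1.1) * p.2.2)) =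
        -(α * |r| ^ 2) + 2 * π * -(r * z.im) := by
      rw [sq_abs, hα, hr]
      push_cast
      field_simp
      ring
    rw [h5]
    nlinarith [mul_le_mul_of_nonneg_left h4 Real.two_pi_pos.le]
  calc _ = 2 * (rexp (-(2 * π * ((p.1.2 * p.2.1 + p.1.1 * p.2.2 : ℤ) : ℝ) * τ.im)) *
      rexp (-(2 * π * ((e' * p.1.2 + e * p.2.1 : ℤ) : ℝ) * z.im)) *
      rexp (-(π * τ.im / (2 * (e * e')) * (((e * p.2.1 - e' * p.1.2 : ℝ)) ^ 2 -
        4 * (e * e' * p.1.1) * p.2.2)))) * X := by ring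
    _ ≤ 2 * (rexp ((2 * π * |z.im| + 1) ^ 2 / (4 * α)) * rexp (-|r|)) * X := by gcongr
    _ = _ := by ring

lemma abs_index_le (he : 0 < e) (he' : 0 < e') (p : (ℤ × ℤ) × ℤ × ℤ) :
    |(p.1.1 : ℝ)| + |(p.1.2 : ℝ)| + |(p.2.1 : ℝ)| + |(p.2.2 : ℝ)| ≤
      |(e' * p.1.2 + e * p.2.1 : ℝ)| + (|(e * e' * p.1.1 : ℝ)| + |(e * p.2.1 - e' * p.1.2 : ℝ)| + |(p.2.2 : ℝ)|) := by
  have he1 : (1 : ℝ) ≤ e := mod_cast he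
  have he2 : (1 : ℝ) ≤ e' := mod_cast he'
  have h1 : |(p.1.1 : ℝ)| ≤ |(e * e' * p.1.1 : ℝ)| := by
    rw [abs_mul, abs_of_pos (by positivity : (0:ℝ) < e * e')]
    exact le_mul_of_one_le_left (abs_nonneg _) (by nlinarith)
  have h2 : 2 * |(p.1.2 : ℝ)| ≤ |(e' * p.1.2 + e * p.2.1 : ℝ)| + |(e * p.2.1 - e' * p.1.2 : ℝ)| := by
    have := abs_sub (e' * p.1.2 + e * p.2.1 : ℝ) (e * p.2.1 - e' * p.1.2 : ℝ)
    have h3 : (e' * p.1.2 + e * p.2.1 : ℝ) - (e * p.2.1 - e' * p.1.2 : ℝ) = (2 * e') * p.1.2 := by ring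
    rw [h3, abs_mul, abs_of_pos (by positivity : (0:ℝ) < 2 * e')] at this
    nlinarith [abs_nonneg (p.1.2 : ℝ)]
  have h2 : 2 * |(p.2.1 : ℝ)| ≤ |(e' * p.1.2 + e * p.2.1 : ℝ)| + |(e * p.2.1 - e' * p.1.2 : ℝ)| := by
    have := abs_add_le (e' * p.1.2 + e * p.2.1 : ℝ) (e * p.2.1 - e' * p.1.2 : ℝ)
    have h3 : (e' * p.1.2 + e * p.2.1 : ℝ) + (e * p.2.1 - e' * p.1.2 : ℝ) = (2 * e) * p.2.1 := by ring
    rw [h3, abs_mul, abs_of_pos (by positivity : (0:ℝ) < 2 * e)] at this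
    nlinarith [abs_nonneg (p.2.1 : ℝ)]
  linarith

/-- Combining a linear lower bound for the majorant with the decay in the elliptic variable. -/
lemma exp_mul_exp_le {δ S r A En C : ℝ} (hδ : 0 < δ) (hr : 0 ≤ r) (hA : 0 ≤ A) (hS : S ≤ r + A)
    (h : A - C ≤ En) : rexp (-r) * rexp (-(δ * En)) ≤
      rexp (δ * C) * rexp (-(min 1 δ * S)) := by
  rw [← Real.exp_add, ← Real.exp_add]
  apply exp_le_exp.mpr
  have h1 : min 1 δ ≤ 1 := min_le_left _ _
  have h2 : min 1 δ ≤ δ := min_le_right _ _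
  have h3 : 0 < min 1 δ := lt_min one_pos hδ
  nlinarith [mul_le_mul_of_nonneg_left h hδ.le, mul_le_mul_of_nonneg_left hS h3.le]

lemma summable_thetaTerm (he : 0 < e) (he' : 0 < e') (hτ : 0 < τ.im) (z : ℂ)
    (hw : 0 < w.im) : Summable (thetaTerm e e' τ z w) := by
  have he1 : (0 : ℝ) < e := mod_cast he
  have he2 : (0 : ℝ) < e' := mod_cast he'
  obtain ⟨C, hC, h⟩ := thetaTerm_norm_le he he' hτ z
  obtain ⟨C', h'⟩ := enQ_ge_of_compact (K := {w}) isCompact_singleton (by simpa using hw)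
  set δ := π * τ.im / (4 * (e * e')) with hδ
  have hδ0 : 0 < δ := by positivity
  refine .of_norm_bounded ((summable_int4_exp (lt_min one_pos hδ0)).mul_left (C * rexp (δ * C')))
    fun p => (h w hw p).trans ?_
  rw [mul_assoc C, mul_assoc C]
  refine mul_le_mul_of_nonneg_left ?_ hC.le
  exact exp_mul_exp_le hδ0 (abs_nonneg _) (by positivity) (abs_index_le he he' p) (h' _ _ _ w rfl)

lemma thetaTerm_le_cusp (he : 0 < e) (he' : 0 < e') (hτ : 0 < τ.im) (z : ℂ)
    {c₁ : ℝ} (hc₁ : 0 < c₁) : ∃ C ε, 0 < C ∧ 0 < ε ∧ ∀ w : ℂ, |w.re| ≤ 1 → c₁ ≤ w.im → ∀ p, p.1.1 ≠ 0 →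
      ‖thetaTerm e e' τ z w p‖ ≤ C * rexp (-(ε * w.im ^ 2)) *
        rexp (-(ε * (|(p.1.1 : ℝ)| + |(p.1.2 : ℝ)| + |(p.2.1 : ℝ)| + |(p.2.2 : ℝ)|))) := by
  have he1 : (1 : ℝ) ≤ e := mod_cast he
  have he2 : (1 : ℝ) ≤ e' := mod_cast he'
  obtain ⟨C, hC, h⟩ := thetaTerm_norm_le he he' hτ z
  obtain ⟨C', h'⟩ := enQ_ge_of_cusp hc₁
  set δ := π * τ.im / (4 * (e * e')) with hδ
  have hδ0 : 0 < δ := by positivity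
  have hm0 : 0 < min 1 δ := lt_min one_pos hδ0
  refine ⟨C * rexp (δ * C'), min 1 δ / 2, by positivity, by positivity, fun w hx hy p hp => ?_⟩
  have hw : 0 < w.im := hc₁.trans_le hy
  have hp1 : (1 : ℝ) ≤ |(p.1.1 : ℝ)| := mod_cast Int.one_le_abs hp
  refine (h w hw p).trans ?_
  rw [mul_assoc, mul_assoc C, mul_assoc C]
  refine mul_le_mul_of_nonneg_left ?_ hC.le
  have ha : 1 ≤ |(e * e' * p.1.1 : ℝ)| := by
    rw [abs_mul, abs_of_pos (by positivity : (0:ℝ) < e * e')]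
    nlinarith [mul_le_mul he1 he2 zero_le_one (by linarith)]
  have h2 := h' (e * e' * p.1.1) (e * p.2.1 - e' * p.1.2) p.2.2 w ha hx hy
  have h3 := abs_index_le he he' p
  rw [← Real.exp_add, ← Real.exp_add, ← Real.exp_add]
  apply exp_le_exp.mpr
  have h4 : min 1 δ ≤ 1 := min_le_left _ _
  have h5 : min 1 δ ≤ δ := min_le_right _ _
  set A := |(e * e' * p.1.1 : ℝ)| + |(e * p.2.1 - e' * p.1.2 : ℝ)| + |(p.2.2 : ℝ)| with hA
  have hA0 : 0 ≤ A := by positivity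
  set S := |(p.1.1 : ℝ)| + |(p.1.2 : ℝ)| + |(p.2.1 : ℝ)| + |(p.2.2 : ℝ)| with hS
  have hS0 : 0 ≤ S := by positivity
  have h6 := mul_le_mul_of_nonneg_left h2 hδ0.le
  have h7 := mul_le_mul_of_nonneg_left h3 hm0.le
  have h8 : min 1 δ * (w.im ^ 2 / 2 + A) ≤ δ * (w.im ^ 2 / 2 + A) := by gcongr
  have h9 : min 1 δ * |(e' * p.1.2 + e * p.2.1 : ℝ)| ≤ 1 * |(e' * p.1.2 + e * p.2.1 : ℝ)| := by gcongr
  have h10 : 0 ≤ min 1 δ * S := by positivity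
  nlinarith

/-! ### The theta kernel in mixed form and its modular transformation -/

/-- The quadratic polynomial in the exponent of the theta kernel after Poisson summation. -/
def mlForm (e e' : ℝ) (W x : ℝ) (z M M' L L' : ℂ) : ℂ :=
  e * e' * W * (M * M') + e' / e * (L * L') - 2 * e' * x * (M' * L) - 2 * e' * z * L' +
    2 * (e * e') * x * z * M' + e * e' * z ^ 2

/-- A term of the theta kernel after Poisson summation, indexed by `((a, j), (m, l))`. -/
def mlTerm (e e' : ℕ) (τ z w : ℂ) (p : (ℤ × ℤ) × ℤ × ℤ) : ℂ :=
  (p.2.1 - p.1.1 * conj τ) ^ 2 * cexp (-(π / τ.im) * mlForm e e' (w.re ^ 2 + w.im ^ 2) w.re z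
    (p.2.1 - p.1.1 * τ) (p.2.1 - p.1.1 * conj τ) (p.2.2 - p.1.2 * τ) (p.2.2 - p.1.2 * conj τ))

lemma mlForm_re_le {e e' v : ℝ} (he1 : 0 ≤ e) (he2 : 0 ≤ e') (hv : 0 ≤ v) (x y : ℝ) (M L z : ℂ) :
    (-((π : ℂ) / v) * mlForm e e' (x ^ 2 + y ^ 2) x z M (conj M) L (conj L)).re ≤
      -(π / v) * (e * e' * (x ^ 2 + y ^ 2) * ‖M‖ ^ 2 + e' / e * ‖L‖ ^ 2 - 2 * e' * |x| * (‖M‖ * ‖L‖)) +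
        π / v * (2 * e' * ‖z‖ * ‖L‖ + 2 * (e * e') * |x| * ‖z‖ * ‖M‖ + e * e' * ‖z‖ ^ 2) := by
  have hM2 : M * conj M = ((‖M‖ ^ 2 : ℝ) : ℂ) := by rw [mul_conj, normSq_eq_norm_sq]
  have hL2 : L * conj L = ((‖L‖ ^ 2 : ℝ) : ℂ) := by rw [mul_conj, normSq_eq_norm_sq]
  have h3 : -((π : ℂ) / v) * mlForm e e' (x ^ 2 + y ^ 2) x z M (conj M) L (conj L) =
      ((-(π / v) * (e * e' * (x ^ 2 + y ^ 2) * ‖M‖ ^ 2 + e' / e * ‖L‖ ^ 2) : ℝ) : ℂ) +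
      ((π / v : ℝ) : ℂ) * (((2 * e' * x : ℝ) : ℂ) * (conj M * L) + ((2 * e' : ℝ) : ℂ) * (z * conj L) +
        ((-(2 * (e * e') * x) : ℝ) : ℂ) * (z * conj M) + ((-(e * e') : ℝ) : ℂ) * z ^ 2) := by
    rw [mlForm, hM2, hL2]
    push_cast
    ring
  rw [h3, add_re, re_ofReal_mul, ofReal_re, add_re, add_re,
    add_re, re_ofReal_mul, re_ofReal_mul, re_ofReal_mul,
    re_ofReal_mul]
  have b0 : ∀ (s : ℝ) (A : ℂ), s * A.re ≤ |s| * ‖A‖ := fun s A => by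
    refine (le_abs_self _).trans ?_
    rw [abs_mul]
    gcongr
    exact abs_re_le_norm _
  have hee : 0 ≤ e * e' := mul_nonneg he1 he2
  have b1 := b0 (2 * e' * x) (conj M * L)
  have b2 := b0 (2 * e') (z * conj L)
  have b3 := b0 (-(2 * (e * e') * x)) (z * conj M)
  have b4 := b0 (-(e * e')) (z ^ 2)
  rw [norm_mul, norm_conj, abs_mul, abs_of_nonneg (by positivity : 0 ≤ 2 * e')] at b1
  rw [norm_mul, norm_conj, abs_of_nonneg (by positivity : 0 ≤ 2 * e')] at b2
  rw [norm_mul, norm_conj, abs_neg, abs_mul, abs_of_nonneg (by positivity : 0 ≤ 2 * (e * e'))] at b3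
  rw [norm_pow, abs_neg, abs_of_nonneg hee] at b4
  have hpv : 0 ≤ π / v := by positivity
  have := mul_le_mul_of_nonneg_left (add_le_add (add_le_add (add_le_add b1 b2) b3) b4) hpv
  linarith

lemma abs_int_le_of_sub_mul (hτ : 0 < τ.im) (m a : ℤ) :
    |(a : ℝ)| + |(m : ℝ)| ≤ (1 + (1 + ‖τ‖) / τ.im) * ‖(m - a * τ : ℂ)‖ := by
  have h1 : |(a : ℝ)| * τ.im ≤ ‖(m - a * τ : ℂ)‖ := by
    have := abs_im_le_norm (m - a * τ : ℂ)
    have h2 : (m - a * τ : ℂ).im = -(a * τ.im) := by simp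
    rwa [h2, abs_neg, abs_mul, abs_of_pos hτ] at this
  have h2 : |(m : ℝ)| ≤ ‖(m - a * τ : ℂ)‖ + |(a : ℝ)| * ‖τ‖ := by
    have := norm_add_le (m - a * τ : ℂ) (a * τ)
    rwa [sub_add_cancel, norm_mul, norm_intCast, norm_intCast] at this
  have h3 : |(a : ℝ)| ≤ ‖(m - a * τ : ℂ)‖ / τ.im := by rwa [le_div_iff₀ hτ]
  have h4 : |(a : ℝ)| * ‖τ‖ ≤ ‖(m - a * τ : ℂ)‖ / τ.im * ‖τ‖ := by gcongr
  calc _ ≤ ‖(m - a * τ : ℂ)‖ / τ.im + (‖(m - a * τ : ℂ)‖ + ‖(m - a * τ : ℂ)‖ / τ.im * ‖τ‖) := by linarith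
    _ = _ := by ring

lemma mlTerm_norm_le (he : 0 < e) (he' : 0 < e') (hτ : 0 < τ.im) (z : ℂ)
    (hw : 0 < w.im) : ∃ C, ∀ p, ‖mlTerm e e' τ z w p‖ ≤
      C * rexp (-(1 * (|(p.1.1 : ℝ)| + |(p.1.2 : ℝ)| + |(p.2.1 : ℝ)| + |(p.2.2 : ℝ)|))) := by
  have he1 : (0 : ℝ) < e := mod_cast he
  have he2 : (0 : ℝ) < e' := mod_cast he'
  set v := τ.im with hv
  set D := 1 + (1 + ‖τ‖) / v with hD
  have hD0 : 0 < D := by positivity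
  set α := π / v * (e * e' * w.im ^ 2) with hα
  set β := π / v * (e' / e) with hβ
  have hα0 : 0 < α := by positivity
  have hβ0 : 0 < β := by positivity
  set K₁ := 1 + D + π / v * (2 * (e * e') * |w.re| * ‖z‖) with hK₁
  set K₂ := D + π / v * (2 * e' * ‖z‖) with hK₂
  have hK₂0 : 0 ≤ K₂ := by positivity
  refine ⟨2 * rexp ((K₁ + K₂ * (e * |w.re|)) ^ 2 / (4 * α) + K₂ ^ 2 / (4 * β) +
    π / v * (e * e' * ‖z‖ ^ 2)), fun p => ?_⟩
  obtain ⟨⟨a, j⟩, m, l⟩ := p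
  simp only [mlTerm]
  set M : ℂ := m - a * τ with hM
  set L : ℂ := l - j * τ with hL
  have hMc : (m - a * conj τ : ℂ) = conj M := by rw [hM]; simp
  have hLc : (l - j * conj τ : ℂ) = conj L := by rw [hL]; simp
  rw [hMc, hLc, norm_mul, norm_pow, norm_conj, norm_exp]
  have h1 : ‖M‖ ^ 2 ≤ 2 * rexp ‖M‖ := by
    have := Real.pow_div_factorial_le_exp ‖M‖ (norm_nonneg _) 2
    rw [div_le_iff₀ (by positivity), Nat.factorial_two] at this
    push_cast at this
    linarith
  have ha := abs_int_le_of_sub_mul hτ m a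
  have hl := abs_int_le_of_sub_mul hτ l j
  rw [← hM, ← hv, ← hD] at ha
  rw [← hL, ← hv, ← hD] at hl
  set S := |(a : ℝ)| + |(j : ℝ)| + |(m : ℝ)| + |(l : ℝ)| with hS
  have h2 := mlForm_re_le he1.le he2.le hτ.le w.re w.im M L z
  rw [← hv]
  set E := -((π : ℂ) / v) * mlForm e e' (w.re ^ 2 + w.im ^ 2) w.re z M (conj M) L (conj L) with hE
  have h5 : ‖M‖ + E.re + S ≤ (K₁ + K₂ * (e * |w.re|)) ^ 2 / (4 * α) + K₂ ^ 2 / (4 * β) +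
    π / v * (e * e' * ‖z‖ ^ 2) := by
    have q1 := linear_sub_sq_le hα0 (K₁ + K₂ * (e * |w.re|)) ‖M‖
    have q2 := linear_sub_sq_le hβ0 K₂ (‖L‖ - e * |w.re| * ‖M‖)
    have q3 : π / v * (e * e' * (w.re ^ 2 + w.im ^ 2) * ‖M‖ ^ 2 + e' / e * ‖L‖ ^ 2 -
      2 * e' * |w.re| * (‖M‖ * ‖L‖)) = α * ‖M‖ ^ 2 + β * (‖L‖ - e * |w.re| * ‖M‖) ^ 2 := by
      rw [hα, hβ, ← sq_abs w.re]
      field_simp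
      ring
    have q4 : S ≤ D * ‖M‖ + D * ‖L‖ := by rw [hS]; linarith
    have q5 : ‖M‖ + (D * ‖M‖ + D * ‖L‖) + π / v * (2 * e' * ‖z‖ * ‖L‖ + 2 * (e * e') * |w.re| * ‖z‖ * ‖M‖ +
        e * e' * ‖z‖ ^ 2) = (K₁ + K₂ * (e * |w.re|)) * ‖M‖ + K₂ * (‖L‖ - e * |w.re| * ‖M‖) +
        π / v * (e * e' * ‖z‖ ^ 2) := by
      rw [hK₁, hK₂]; ring
    linarith
  calc ‖M‖ ^ 2 * rexp E.re ≤ 2 * rexp ‖M‖ * rexp E.re := by gcongr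
    _ = 2 * rexp (‖M‖ + E.re) := by rw [Real.exp_add]; ring
    _ ≤ 2 * rexp ((K₁ + K₂ * (e * |w.re|)) ^ 2 / (4 * α) + K₂ ^ 2 / (4 * β) +
      π / v * (e * e' * ‖z‖ ^ 2) + -(1 * S)) := by
        exact mul_le_mul_of_nonneg_left (exp_le_exp.mpr (by linarith)) two_pos.le
    _ = _ := by rw [Real.exp_add]; ring

lemma summable_mlTerm (he : 0 < e) (he' : 0 < e') (hτ : 0 < τ.im) (z : ℂ)
    (hw : 0 < w.im) : Summable (mlTerm e e' τ z w) := by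
  obtain ⟨C, hC⟩ := mlTerm_norm_le he he' hτ z hw
  exact .of_norm_bounded ((summable_int4_exp one_pos).mul_left C) hC

/-- The automorphism of `ℤ²` given by a matrix of determinant one. -/
def intPairEquiv (a b c d : ℤ) (h : a * d - b * c = 1) : ℤ × ℤ ≃ ℤ × ℤ where
  toFun p := (a * p.1 - c * p.2, d * p.2 - b * p.1)
  invFun p := (d * p.1 + c * p.2, a * p.2 + b * p.1)
  left_inv p := by
    ext
    · simp only; linear_combination p.1 * h
    · simp only; linear_combination p.2 * h
  right_inv p := by
    ext
    · simp only; linear_combination p.1 * h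
    · simp only; linear_combination p.2 * h

/-- The index equivalence `((a, j), (m, l)) ≃ ((a, m), (j, l))`. -/
def indexSwap : (ℤ × ℤ) × ℤ × ℤ ≃ (ℤ × ℤ) × ℤ × ℤ := Equiv.prodProdProdComm ℤ ℤ ℤ ℤ

lemma im_fractional {a b c d : ℤ} (h : a * d - b * c = 1) (hτ : 0 < τ.im) :
    ((a * τ + b) / (c * τ + d) : ℂ).im = τ.im / normSq (c * τ + d) ∧ (c * τ + d : ℂ) ≠ 0 := by
  have hJ : (c * τ + d : ℂ) ≠ 0 := by
    intro h0
    have h1 : (c : ℝ) * τ.im = 0 := by simpa using congrArg Complex.im h0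
    have hc : c = 0 := mod_cast (mul_eq_zero.mp h1).resolve_right hτ.ne'
    rw [hc] at h0 h
    have hd : d = 0 := by simpa using h0
    simp [hd] at h
  refine ⟨?_, hJ⟩
  have hN : normSq (c * τ + d : ℂ) ≠ 0 := by simpa [Complex.normSq_eq_zero] using hJ
  have h' : (a * d - b * c : ℝ) = 1 := mod_cast h
  rw [div_im, ← sub_div]
  congr 1
  simp
  linear_combination τ.im * h'

lemma mlTerm_transform {a b c d : ℤ} (h : a * d - b * c = 1)
    (hτ : 0 < τ.im) (z w : ℂ) (p : (ℤ × ℤ) × ℤ × ℤ) :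
    mlTerm e e' ((a * τ + b) / (c * τ + d)) (z / (c * τ + d)) w p =
      (conj (c * τ + d : ℂ))⁻¹ ^ 2 * cexp (2 * π * I * (e * e') * c * z ^ 2 / (c * τ + d)) *
      mlTerm e e' τ z w (((indexSwap.trans ((intPairEquiv a b c d h).prodCongr (intPairEquiv a b c d h))).trans
        indexSwap.symm) p) := by
  obtain ⟨him, hJ⟩ := im_fractional h hτ
  obtain ⟨⟨s, j⟩, m, l⟩ := p
  set J : ℂ := c * τ + d with hJd
  have hJc : conj J ≠ 0 := by simpa using hJ
  have hcJ : conj J = c * conj τ + d := by rw [hJd]; simp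
  have hct : conj ((a * τ + b) / J) = (a * conj τ + b) / conj J := by simp
  have hv : (τ.im : ℂ) ≠ 0 := mod_cast hτ.ne'
  have hnJ : (normSq J : ℂ) = J * conj J := (mul_conj J).symm
  have hk : ∀ x y : ℤ, (y - x * ((a * τ + b) / J) : ℂ) = (((d * y - b * x : ℤ) : ℂ) - ((a * x - c * y : ℤ) : ℂ) * τ) / J := by
    intro x y; field_simp; rw [hJd]; push_cast; ring
  have hkc : ∀ x y : ℤ, (y - x * ((a * conj τ + b) / conj J) : ℂ) =
      (((d * y - b * x : ℤ) : ℂ) - ((a * x - c * y : ℤ) : ℂ) * conj τ) / conj J := by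
    intro x y; field_simp; rw [hcJ]; push_cast; ring
  simp only [mlTerm, indexSwap, intPairEquiv, Equiv.trans_apply, Equiv.prodProdProdComm_apply, 
    Equiv.prodProdProdComm_symm,
    Equiv.prodCongr_apply, Equiv.coe_fn_mk, Prod.map_apply, hct, hk, hkc, him]
  generalize ((d * m - b * s : ℤ) : ℂ) = m'
  generalize ((a * s - c * m : ℤ) : ℂ) = s'
  generalize ((d * l - b * j : ℤ) : ℂ) = l'
  generalize ((a * j - c * l : ℤ) : ℂ) = j'
  rw [mul_mul_mul_comm ((conj J)⁻¹ ^ 2), ← Complex.exp_add]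
  congr 1
  · field_simp
  · congr 1
    have hcv : 2 * I * c * τ.im = J - conj J := by
      rw [hcJ, hJd]
      have : τ - conj τ = 2 * I * τ.im := by rw [Complex.sub_conj]; push_cast; ring
      linear_combination (-(c : ℂ)) * this
    have hcz : 2 * π * I * (e * e') * c * z ^ 2 / J = π / τ.im * (e * e') * z ^ 2 * (J - conj J) / J := by
      rw [← hcv]; field_simp
    rw [hcz, mlForm, mlForm]
    push_cast
    rw [hnJ]
    field_simp
    ring

/-- The theta kernel attached to the factorisation `N = e e'`. -/
def thetaKer (e e' : ℕ) (τ z w : ℂ) : ℂ := ∑' p, thetaTerm e e' τ z w p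

/-- The intermediate term after Poisson summation in one variable. -/
def gTerm (e e' : ℕ) (τ z w : ℂ) (a j k m : ℤ) : ℂ :=
  (m - a * conj τ) ^ 2 * cexp (-(π * (e * e') * w.im ^ 2 / τ.im) * (m - a * conj τ) ^ 2 +
    2 * π * I * (e * e' * a * normSq w + (e * k - e' * j) * w.re) * (m - a * conj τ) +
    (2 * π * I * (j * k) * τ - π * τ.im * (e * k - e' * j) ^ 2 / (e * e') +
      2 * π * I * (e' * j + e * k) * z))

lemma tsum_thetaTerm_c (he : 0 < e) (he' : 0 < e') (hτ : 0 < τ.im) (z : ℂ)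
    (hw : 0 < w.im) (a j k : ℤ) {A : ℝ} (hA : A = τ.im / (e * e' * w.im ^ 2)) :
    ∑' c : ℤ, thetaTerm e e' τ z w ((a, j), (k, c)) =
      -(1 / (A * (A : ℂ) ^ (1 / 2 : ℂ))) * ∑' m : ℤ, gTerm e e' τ z w a j k m := by
  have he1 : (e : ℂ) ≠ 0 := mod_cast he.ne'
  have he2 : (e' : ℂ) ≠ 0 := mod_cast he'.ne'
  have he1' : (0 : ℝ) < e := mod_cast he
  have he2' : (0 : ℝ) < e' := mod_cast he'
  have hv : (τ.im : ℂ) ≠ 0 := mod_cast hτ.ne'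
  have hy : (w.im : ℂ) ≠ 0 := mod_cast hw.ne'
  have hA0 : 0 < A := by rw [hA]; positivity
  have hπ : (π : ℂ) ≠ 0 := mod_cast Real.pi_ne_zero
  set t : ℂ := e * e' * a * normSq w + (e * k - e' * j) * w.re with ht
  set b : ℂ := -A * t + I * a * conj τ with hb
  have hconj : conj τ = τ - 2 * I * τ.im := by
    have : τ - conj τ = 2 * I * τ.im := by rw [Complex.sub_conj]; push_cast; ring
    linear_combination -this
  set R : ℂ := 2 * π * I * (j * k) * τ - π * τ.im * (e * k - e' * j) ^ 2 / (e * e') +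
      2 * π * I * (e' * j + e * k) * z with hR
  have h1 : ∀ c : ℤ, thetaTerm e e' τ z w ((a, j), (k, c)) = cexp (R - π * A * t ^ 2) *
      ((A * (c + t) ^ 2 - 1 / (2 * π)) * cexp (-π * A * c ^ 2 + 2 * π * b * c)) := fun c => by
    have hq : (qR (e * e' * a) (e * k - e' * j) c w : ℂ) = (c + t) / w.im := by
      rw [qR, ht]; push_cast; ring
    rw [thetaTerm, kerP, qc_zpow_eq, qc_zpow_eq]
    push_cast
    rw [hq, mul_left_comm (cexp _) _ (cexp _), ← Complex.exp_add, ← Complex.exp_add,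
      mul_left_comm (cexp _) _ (cexp _), ← Complex.exp_add]
    congr 1
    · rw [hA]; push_cast; field_simp
    · congr 1
      rw [hR, hb, hconj, hA]
      push_cast
      field_simp
      ring_nf
      simp only [I_sq]
      ring
  rw [tsum_congr h1, tsum_mul_left, tsum_quadratic_mul_gauss hA0, mul_left_comm, ← tsum_mul_left]
  congr 1
  refine tsum_congr fun m => ?_
  rw [gTerm, mul_left_comm, ← Complex.exp_add]
  have hm : (m + I * b + I * A * t : ℂ) = m - a * conj τ := by
    rw [hb]; ring_nf; simp only [I_sq]; ring
  have hm' : (m + I * b : ℂ) = m - a * conj τ - I * A * t := by rw [← hm]; ring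
  rw [hm, hm', ← ht, ← hR]
  congr 2
  have hAc : (A : ℂ) ≠ 0 := mod_cast hA0.ne'
  have hA' : (π * (e * e') * w.im ^ 2 / τ.im : ℂ) = π / A := by
    rw [hA]; push_cast; field_simp
  rw [hA']
  field_simp
  ring_nf
  simp only [I_sq]
  ring

lemma tsum_gTerm_k (he : 0 < e) (he' : 0 < e') (hτ : 0 < τ.im) (z : ℂ)
    (a j m : ℤ) {B : ℝ} (hB : B = τ.im * e / e') :
    ∑' k : ℤ, gTerm e e' τ z w a j k m =
      1 / (B : ℂ) ^ (1 / 2 : ℂ) * ∑' l : ℤ, mlTerm e e' τ z w ((a, j), (m, l)) := by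
  have he1 : (e : ℂ) ≠ 0 := mod_cast he.ne'
  have he2 : (e' : ℂ) ≠ 0 := mod_cast he'.ne'
  have he1' : (0 : ℝ) < e := mod_cast he
  have he2' : (0 : ℝ) < e' := mod_cast he'
  have hv : (τ.im : ℂ) ≠ 0 := mod_cast hτ.ne'
  have hB0 : 0 < B := by rw [hB]; positivity
  have hBc : (B : ℂ) ≠ 0 := mod_cast hB0.ne'
  have hconj : conj τ = τ.re - I * τ.im := by
    apply Complex.ext <;> simp
  have hτ' : τ = τ.re + I * τ.im := by rw [mul_comm I]; exact (Complex.re_add_im τ).symm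
  set M' : ℂ := m - a * conj τ with hM'
  set β : ℂ := I * (j * τ.re + z * e + e * w.re * M') with hβ
  set X : ℂ := -(π * (e * e') * w.im ^ 2 / τ.im) * M' ^ 2 + 2 * π * I * (e * e' * a * normSq w) * M' with hX
  set P : ℂ := X - π * τ.im * (e' / e) * j ^ 2 + 2 * π * I * e' * j * (z - w.re * M') with hP
  have h1 : ∀ k : ℤ, gTerm e e' τ z w a j k m = (M' ^ 2 * cexp P) *
      cexp (-π * B * k ^ 2 + 2 * π * β * k) := fun k => by
    rw [gTerm, ← hM', mul_assoc (M' ^ 2), ← Complex.exp_add]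
    congr 2
    have hjk : 2 * π * I * (j * k) * τ = 2 * π * I * (j * k) * (τ.re + I * τ.im) := by rw [← hτ']
    rw [hP, hβ, hX, hB, hjk]
    push_cast
    generalize M' = M'
    field_simp
    ring_nf
    simp only [I_sq]
    ring
  rw [tsum_congr h1, tsum_mul_left, Complex.tsum_exp_neg_quadratic (by simpa using hB0),
    mul_left_comm, ← tsum_mul_left]
  congr 1
  refine tsum_congr fun l => ?_
  rw [mlTerm, mul_assoc (M' ^ 2), ← Complex.exp_add]
  congr 2
  simp only
  rw [← hM']
  have ha : 2 * I * (a : ℂ) * τ.im = M' - (m - a * τ) := by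
    rw [hM', hconj]
    linear_combination (-(a : ℂ)) * hτ'
  have hMt : (m - a * τ : ℂ) = M' - 2 * I * a * τ.im := by rw [ha]; ring
  have hL : (l - j * τ : ℂ) = l - j * τ.re - I * j * τ.im := by
    linear_combination (-(j : ℂ)) * hτ'
  rw [hMt, hL, hconj, mlForm, hP, hX, hβ, hB, normSq_apply]
  generalize M' = M'
  push_cast
  field_simp
  ring_nf
  simp only [I_sq, I_pow_four]
  ring

lemma summable_quadratic_mul_gauss {A : ℝ} (hA : 0 < A) (s b : ℂ) :
    Summable fun m : ℤ => (m - s) ^ 2 * cexp (-π * A * m ^ 2 + 2 * π * b * m) := by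
  have h := ((summable_gaussMoment 2 hA b).add ((summable_gaussMoment 1 hA b).mul_left (-2 * s))).add
    ((summable_gaussMoment 0 hA b).mul_left (s ^ 2))
  refine h.congr fun m => ?_
  ring

lemma summable_gTerm (he : 0 < e) (he' : 0 < e') (hτ : 0 < τ.im) (z : ℂ)
    (hw : 0 < w.im) (a j : ℤ) :
    Summable fun q : ℤ × ℤ => gTerm e e' τ z w a j q.1 q.2 := by
  have he1 : (e : ℂ) ≠ 0 := mod_cast he.ne'
  have he2 : (e' : ℂ) ≠ 0 := mod_cast he'.ne'
  have he1' : (0 : ℝ) < e := mod_cast he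
  have he2' : (0 : ℝ) < e' := mod_cast he'
  have hv : (τ.im : ℂ) ≠ 0 := mod_cast hτ.ne'
  have hτ' : τ = τ.re + I * τ.im := by rw [mul_comm I]; exact (Complex.re_add_im τ).symm
  set s : ℂ := a * conj τ with hs
  have hF := (summable_quadratic_mul_gauss (A := e * e' * w.im ^ 2 / τ.im) (by positivity) s
    (e * e' * w.im ^ 2 / τ.im * s + I * (e * e' * a * normSq w - e' * j * w.re))).norm
  have hG := (summable_gaussMoment 0 (a := τ.im * e / e') (by positivity)
    (I * (j * τ.re + z * e - e * w.re * s))).norm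
  have hFG := hG.mul_of_nonneg hF (fun _ => norm_nonneg _) (fun _ => norm_nonneg _)
  set P : ℂ := -(π * (e * e') * w.im ^ 2 / τ.im) * s ^ 2 -
    2 * π * I * (e * e' * a * normSq w - e' * j * w.re) * s - π * τ.im * (e' / e) * j ^ 2 +
    2 * π * I * e' * j * z with hP
  refine Summable.of_norm ((hFG.mul_left ‖cexp P‖).congr fun q => ?_)
  obtain ⟨k, m⟩ := q
  have h1 : gTerm e e' τ z w a j k m = cexp P * (((k : ℂ) ^ 0 *
      cexp (-π * (τ.im * e / e' : ℝ) * k ^ 2 + 2 * π * (I * (j * τ.re + z * e - e * w.re * s)) * k)) *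
      ((m - s) ^ 2 * cexp (-π * (e * e' * w.im ^ 2 / τ.im : ℝ) * m ^ 2 + 2 * π * (e * e' * w.im ^ 2 / τ.im * s +
        I * (e * e' * a * normSq w - e' * j * w.re)) * m))) * cexp ((2 * π * (e * k * w.re * m) : ℝ) * I) := by
    rw [gTerm, ← hs, pow_zero, one_mul, mul_left_comm (cexp _) ((m - s) ^ 2), mul_left_comm (cexp P), mul_assoc ((m - s) ^ 2),
      ← Complex.exp_add, ← Complex.exp_add, ← Complex.exp_add]
    congr 2
    have hjk : 2 * π * I * (j * k) * τ = 2 * π * I * (j * k) * (τ.re + I * τ.im) := by rw [← hτ']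
    rw [hjk, hP]
    push_cast
    field_simp
    ring_nf
    simp only [I_sq]
    ring
  simp only [h1, norm_mul, Complex.norm_exp_ofReal_mul_I, mul_one]

lemma poisson_factor {e e' v y : ℝ} (he : 0 < e) (he' : 0 < e') (hv : 0 < v) (hy : 0 < y) :
    (e * e' * e' * y ^ 3 / v ^ 2 : ℂ) =
      1 / ((v / (e * e' * y ^ 2) : ℝ) * ((v / (e * e' * y ^ 2) : ℝ) : ℂ) ^ (1 / 2 : ℂ)) *
        (1 / ((v * e / e' : ℝ) : ℂ) ^ (1 / 2 : ℂ)) := by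
  set A := v / (e * e' * y ^ 2) with hA
  set B := v * e / e' with hB
  have hA0 : 0 < A := by positivity
  have hB0 : 0 < B := by positivity
  have h2 : ∀ x : ℝ, 0 < x → (x : ℂ) ^ (1 / 2 : ℂ) = (√x : ℝ) := fun x hx => by
    rw [Real.sqrt_eq_rpow, Complex.ofReal_cpow hx.le]; norm_num
  rw [h2 A hA0, h2 B hB0]
  have h3 : √A * √B = v / (e' * y) := by
    rw [← Real.sqrt_mul hA0.le]
    have : A * B = (v / (e' * y)) ^ 2 := by rw [hA, hB]; field_simp
    rw [this, Real.sqrt_sq (by positivity)]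
  have h4 : e * e' * e' * y ^ 3 / v ^ 2 = 1 / (A * √A) * (1 / √B) := by
    rw [div_mul_div_comm, mul_assoc A, h3, hA]
    field_simp
  exact_mod_cast h4

lemma tsum_thetaTerm_pair (he : 0 < e) (he' : 0 < e') (hτ : 0 < τ.im) (z : ℂ)
    (hw : 0 < w.im) (a j : ℤ) {A B : ℝ} (hA : A = τ.im / (e * e' * w.im ^ 2))
    (hB : B = τ.im * e / e') :
    ∑' q : ℤ × ℤ, thetaTerm e e' τ z w ((a, j), q) =
      -(1 / (A * (A : ℂ) ^ (1 / 2 : ℂ))) * (1 / (B : ℂ) ^ (1 / 2 : ℂ) *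
        ∑' q : ℤ × ℤ, mlTerm e e' τ z w ((a, j), q)) := by
  have h1 : Summable fun q : ℤ × ℤ => thetaTerm e e' τ z w ((a, j), q) :=
    (summable_thetaTerm he he' hτ z hw).prod_factor (a, j)
  have h2 : Summable fun q : ℤ × ℤ => mlTerm e e' τ z w ((a, j), q) :=
    (summable_mlTerm he he' hτ z hw).prod_factor (a, j)
  have h3 : ∑' q : ℤ × ℤ, thetaTerm e e' τ z w ((a, j), q) =
      ∑' k : ℤ, -(1 / (A * (A : ℂ) ^ (1 / 2 : ℂ))) * ∑' m : ℤ, gTerm e e' τ z w a j k m :=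
    h1.tsum_prod.trans (tsum_congr fun k => tsum_thetaTerm_c he he' hτ z hw a j k hA)
  have h4 : ∑' (k : ℤ) (m : ℤ), gTerm e e' τ z w a j k m =
      ∑' (m : ℤ) (k : ℤ), gTerm e e' τ z w a j k m :=
    Summable.tsum_comm (f := fun m k => gTerm e e' τ z w a j k m)
      ((Equiv.prodComm ℤ ℤ).summable_iff.mpr (summable_gTerm he he' hτ z hw a j))
  have h5 : ∑' (m : ℤ) (k : ℤ), gTerm e e' τ z w a j k m =
      ∑' m : ℤ, 1 / (B : ℂ) ^ (1 / 2 : ℂ) * ∑' l : ℤ, mlTerm e e' τ z w ((a, j), (m, l)) :=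
    tsum_congr fun m => tsum_gTerm_k he he' hτ z a j m hB
  have h6 : ∑' q : ℤ × ℤ, mlTerm e e' τ z w ((a, j), q) =
      ∑' (m : ℤ) (l : ℤ), mlTerm e e' τ z w ((a, j), (m, l)) := h2.tsum_prod
  rw [h3, h6, tsum_mul_left, h4, h5, tsum_mul_left]

/-- The theta kernel in mixed form. -/
theorem thetaKer_eq (he : 0 < e) (he' : 0 < e') (hτ : 0 < τ.im) (z : ℂ)
    (hw : 0 < w.im) : thetaKer e e' τ z w =
      -(e * e' * e' * w.im ^ 3 / τ.im ^ 2) * ∑' p, mlTerm e e' τ z w p := by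
  have he1' : (0 : ℝ) < e := mod_cast he
  have he2' : (0 : ℝ) < e' := mod_cast he'
  have hc := poisson_factor he1' he2' hτ hw
  obtain ⟨A, hA⟩ : ∃ A : ℝ, A = τ.im / (e * e' * w.im ^ 2) := ⟨_, rfl⟩
  obtain ⟨B, hB⟩ : ∃ B : ℝ, B = τ.im * e / e' := ⟨_, rfl⟩
  rw [← hA, ← hB] at hc
  simp only [Complex.ofReal_natCast] at hc
  rw [hc, thetaKer, (summable_thetaTerm he he' hτ z hw).tsum_prod,
    (summable_mlTerm he he' hτ z hw).tsum_prod,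
    tsum_congr fun aj : ℤ × ℤ => tsum_thetaTerm_pair he he' hτ z hw aj.1 aj.2 hA hB,
    tsum_mul_left, tsum_mul_left]
  simp only [neg_mul, mul_assoc]

/-- The transformation law of the theta kernel in the Jacobi variables. -/
theorem thetaKer_transform (he : 0 < e) (he' : 0 < e') {a b c d : ℤ} (h : a * d - b * c = 1)
    (hτ : 0 < τ.im) (z : ℂ) (hw : 0 < w.im) :
    thetaKer e e' ((a * τ + b) / (c * τ + d)) (z / (c * τ + d)) w =
      (c * τ + d) ^ 2 * cexp (2 * π * I * (e * e') * c * z ^ 2 / (c * τ + d)) * thetaKer e e' τ z w := by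
  obtain ⟨him, hJ⟩ := im_fractional h hτ
  have hn : 0 < normSq (c * τ + d : ℂ) := Complex.normSq_pos.mpr hJ
  have him0 : 0 < ((a * τ + b) / (c * τ + d) : ℂ).im := by rw [him]; positivity
  rw [thetaKer_eq he he' him0 _ hw, thetaKer_eq he he' hτ _ hw, tsum_congr (mlTerm_transform h hτ z w),
    tsum_mul_left, Equiv.tsum_eq, him]
  have hJc : conj (c * τ + d : ℂ) ≠ 0 := (map_ne_zero _).mpr hJ
  have hv : (τ.im : ℂ) ≠ 0 := mod_cast hτ.ne'
  push_cast
  rw [← mul_conj]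
  field_simp

/-- The standard region containing the support of the partition of unity. -/
def cuspStrip (c₁ : ℝ) : Set ℍ := {w | |w.re| ≤ 1 ∧ c₁ ≤ w.im}

lemma integrable_indicator_cuspStrip {c₁ : ℝ} (hc : 0 < c₁) :
    Integrable ((cuspStrip c₁).indicator fun _ => (1 : ℝ)) := by
  set s : Set ℂ := {z | |z.re| ≤ 1 ∧ c₁ ≤ z.im} with hs
  have hsm : MeasurableSet s := (measurableSet_le (Complex.continuous_re.abs.measurable) measurable_const).inter
    (measurableSet_le measurable_const Complex.continuous_im.measurable)
  have h : (cuspStrip c₁).indicator (fun _ => (1 : ℝ)) = fun w : ℍ => s.indicator (fun _ => (1 : ℝ)) (w : ℂ) := by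
    ext w
    have : w ∈ cuspStrip c₁ ↔ (w : ℂ) ∈ s := Iff.rfl
    by_cases hw : w ∈ cuspStrip c₁
    · rw [Set.indicator_of_mem hw, Set.indicator_of_mem (this.mp hw)]
    · rw [Set.indicator_of_notMem hw, Set.indicator_of_notMem (fun h => hw (this.mpr h))]
  rw [h, integrable_uhp_iff]
  refine IntegrableOn.congr_fun (f := s.indicator fun z => (z.im ^ 2)⁻¹) ?_ ?_ isOpen_upper.measurableSet
  swap
  · intro z _
    by_cases hz : z ∈ s <;> simp [hz]
  refine Integrable.integrableOn ?_
  rw [integrable_indicator_iff hsm]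
  have h2 : IntegrableOn (fun p : ℝ × ℝ => (1 : ℝ) * (p.2 ^ 2)⁻¹) (Set.Icc (-1) 1 ×ˢ Set.Ici c₁) := by
    rw [IntegrableOn, Measure.volume_eq_prod, ← Measure.prod_restrict]
    refine Integrable.mul_prod (f := fun _ : ℝ => (1 : ℝ)) (g := fun y : ℝ => (y ^ 2)⁻¹) ?_ ?_
    · exact integrableOn_const (by simp)
    · rw [← IntegrableOn, integrableOn_Ici_iff_integrableOn_Ioi]
      have := integrableOn_Ioi_rpow_of_lt (a := -2) (by norm_num) hc
      refine this.congr_fun (fun y hy => ?_) measurableSet_Ioi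
      have : (0 : ℝ) < y := hc.trans hy
      simp only
      rw [Real.rpow_neg this.le]
      norm_cast
  have h3 := (Complex.volume_preserving_equiv_real_prod.integrableOn_comp_preimage
    Complex.measurableEquivRealProd.measurableEmbedding).mpr h2
  refine (h3.congr_fun (g := fun z : ℂ => (z.im ^ 2)⁻¹) (fun z _ => by simp) ?_).mono_set ?_
  · exact Complex.measurableEquivRealProd.measurable ((measurableSet_Icc).prod measurableSet_Ici)
  · intro z hz
    exact ⟨abs_le.mp hz.1, hz.2⟩

lemma aestronglyMeasurable_of_hasSum {ι : Type*} [Countable ι] {G : ι → ℍ → ℂ} {g : ℍ → ℂ}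
    (hG : ∀ i, AEStronglyMeasurable (G i) volume) (h : ∀ w, HasSum (fun i => G i w) (g w)) :
    AEStronglyMeasurable g volume :=
  aestronglyMeasurable_of_tendsto_ae (atTop : Filter (Finset ι))
    (f := fun s (w : ℍ) => ∑ i ∈ s, G i w)
    (fun s => Finset.aestronglyMeasurable_fun_sum s fun i _ => hG i) (.of_forall h)

/-- Termwise integration against the partition of unity for dominated families. -/
theorem hasSum_integral_rho (hΓ : OneCusp Γ c₀) {ι : Type*} [Countable ι]
    {G : ι → ℍ → ℂ} (hG : ∀ i, AEStronglyMeasurable (G i) volume) {S : ι → ℝ} (hS : Summable S)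
    (hb : ∀ i, ∀ w ∈ cuspStrip (c₀ / 2), ‖G i w‖ ≤ S i) :
    HasSum (fun i => ∫ w : ℍ, (rho Γ c₀ w : ℂ) * G i w) (∫ w : ℍ, (rho Γ c₀ w : ℂ) * ∑' i, G i w) ∧
      Integrable (fun w : ℍ => (rho Γ c₀ w : ℂ) * ∑' i, G i w) := by
  have hc : 0 < c₀ / 2 := half_pos hΓ.pos
  have hρ : Continuous fun w : ℍ => (rho Γ c₀ w : ℂ) :=
    continuous_ofReal.comp (continuous_iff_continuousAt.mpr fun w =>
      ((rho_contDiffAt hΓ w.im_pos (n := 0)).continuousAt.comp continuous_coe.continuousAt))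
  set bd : ℍ → ℝ := (cuspStrip (c₀ / 2)).indicator fun _ => 1 with hbd
  have hbi : Integrable bd := integrable_indicator_cuspStrip hc
  have hpt : ∀ i (w : ℍ), ‖(rho Γ c₀ w : ℂ) * G i w‖ ≤ S i * bd w := fun i w => by
    by_cases hw : rho Γ c₀ w = 0
    · rw [hw, ofReal_zero, zero_mul, norm_zero]
      by_cases hm : w ∈ cuspStrip (c₀ / 2)
      · simpa [hbd, hm] using (norm_nonneg _).trans (hb i w hm)
      · simp [hbd, hm]
    · have hm : w ∈ cuspStrip (c₀ / 2) := rho_support hΓ hw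
      rw [norm_mul, norm_real, Real.norm_of_nonneg (rho_nonneg hΓ w.im_pos), hbd,
        Set.indicator_of_mem hm, mul_one]
      exact (mul_le_of_le_one_left (norm_nonneg _) (rho_le_one hΓ w.im_pos)).trans (hb i w hm)
  have hsum : ∀ w : ℍ, HasSum (fun i => (rho Γ c₀ w : ℂ) * G i w) ((rho Γ c₀ w : ℂ) * ∑' i, G i w) := fun w => by
    by_cases hw : rho Γ c₀ w = 0
    · simpa [hw] using hasSum_zero
    · exact (Summable.of_norm_bounded hS fun i => hb i w (rho_support hΓ hw)).hasSum.mul_left _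
  have hmeas : ∀ i, AEStronglyMeasurable (fun w : ℍ => (rho Γ c₀ w : ℂ) * G i w) volume := fun i =>
    hρ.aestronglyMeasurable.mul (hG i)
  have hbsum : ∀ w, Summable fun i => S i * bd w := fun w => hS.mul_right _
  have hbint : Integrable fun w => ∑' i, S i * bd w := by
    simp_rw [tsum_mul_right]
    exact hbi.const_mul _
  refine ⟨hasSum_integral_of_dominated_convergence (fun i w => S i * bd w) hmeas
    (fun i => .of_forall (hpt i)) (.of_forall hbsum) hbint (.of_forall hsum), ?_⟩
  refine hbint.mono' ?_ (.of_forall fun w => ?_)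
  · exact aestronglyMeasurable_of_hasSum hmeas hsum
  · rw [← (hsum w).tsum_eq]
    exact tsum_of_norm_bounded (hbsum w).hasSum fun i => hpt i w

lemma exp_mul_exp_sq_le {ε : ℝ} (hε : 0 < ε) (K y : ℝ) :
    rexp (K * y) * rexp (-(ε * y ^ 2)) ≤ rexp (K ^ 2 / (4 * ε)) := by
  rw [← Real.exp_add]
  exact exp_le_exp.mpr (by linarith [linear_sub_sq_le hε K y])

/-- Domination of the terms of the theta kernel with non-vanishing leading coefficient. -/
lemma mul_thetaTerm_le (ha : HasQExp f a n₀)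
    (he : 0 < e) (he' : 0 < e') (hτ : 0 < τ.im) (z : ℂ) {c₁ : ℝ} (hc₁ : 0 < c₁) :
    ∃ S : (ℤ × ℤ) × ℤ × ℤ → ℝ, Summable S ∧ ∀ p, p.1.1 ≠ 0 → ∀ w ∈ cuspStrip c₁,
      ‖f w * thetaTerm e e' τ z w p‖ ≤ S p := by
  obtain ⟨C, hC, h⟩ := growth_cusp ha hc₁
  obtain ⟨C', ε, hC', hε, h'⟩ := thetaTerm_le_cusp he he' hτ z hc₁
  refine ⟨_, (summable_int4_exp hε).mul_left (C * C' * rexp ((2 * π * |(n₀ : ℝ)|) ^ 2 / (4 * ε))),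
    fun p hp w hw => ?_⟩
  have h1 := exp_mul_exp_sq_le hε (2 * π * |(n₀ : ℝ)|) w.im
  rw [norm_mul]
  refine (mul_le_mul (h w hw.2) (h' w hw.1 hw.2 p hp) (norm_nonneg _) (by positivity)).trans ?_
  calc _ = C * C' * (rexp (2 * π * |(n₀ : ℝ)| * w.im) * rexp (-(ε * w.im ^ 2))) *
        rexp (-(ε * (|(p.1.1 : ℝ)| + |(p.1.2 : ℝ)| + |(p.2.1 : ℝ)| + |(p.2.2 : ℝ)|))) := by
        rw [UpperHalfPlane.coe_im]; ring
    _ ≤ _ := by gcongr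

lemma norm_gTerm_zero (e e' : ℕ) (he : 0 < e) (he' : 0 < e') (τ z w : ℂ) (j k m : ℤ) :
    ‖gTerm e e' τ z w 0 j k m‖ = (m : ℝ) ^ 2 * rexp (-(π * (e * e') * w.im ^ 2 / τ.im * m ^ 2)) *
      rexp (-(π * τ.im * ((e * k) ^ 2 + (e' * j) ^ 2) / (e * e')) -
        2 * π * (e' * j + e * k) * z.im) := by
  have he1 : (e : ℝ) ≠ 0 := mod_cast he.ne'
  have he2 : (e' : ℝ) ≠ 0 := mod_cast he'.ne'
  have h1 : ∀ X : ℂ, gTerm e e' τ z w 0 j k m = (m : ℂ) ^ 2 * cexp (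
      ((-(π * (e * e') * w.im ^ 2 / τ.im * m ^ 2) : ℝ) : ℂ) +
      ((2 * π * ((e * k - e' * j) * w.re) * m : ℝ) : ℂ) * I +
      (((2 * π * (j * k) : ℝ) : ℂ) * (I * τ) - ((π * τ.im * (e * k - e' * j) ^ 2 / (e * e') : ℝ) : ℂ) +
      ((2 * π * (e' * j + e * k) : ℝ) : ℂ) * (I * z))) := fun X => by
    rw [gTerm]
    congr 1
    · push_cast; ring
    · congr 1; push_cast; ring
  rw [h1 0, norm_mul, norm_pow, norm_intCast, sq_abs, norm_exp, mul_assoc ((m : ℝ) ^ 2), ← Real.exp_add]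
  congr 2
  simp only [add_re, sub_re, ofReal_re, re_ofReal_mul, I_re, mul_zero, I_mul_re]
  field_simp
  ring

lemma tsum_thetaTerm_zero_le (he : 0 < e) (he' : 0 < e') (hτ : 0 < τ.im) (z : ℂ)
    {c₁ : ℝ} (hc₁ : 0 < c₁) : ∃ C ε, 0 < C ∧ 0 < ε ∧ ∀ w : ℂ, c₁ ≤ w.im → ∀ j k : ℤ,
      ‖∑' c : ℤ, thetaTerm e e' τ z w ((0, j), (k, c))‖ ≤
        C * w.im ^ 3 * rexp (-(ε * w.im ^ 2)) * rexp (-(1 * (|(j : ℝ)| + |(k : ℝ)|))) := by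
  have he1 : (0 : ℝ) < e := mod_cast he
  have he2 : (0 : ℝ) < e' := mod_cast he'
  set ε : ℝ := π * (e * e') / (2 * τ.im) with hε
  have hε0 : 0 < ε := by positivity
  set R : ℝ := 2 * π * |z.im| with hR
  set α : ℝ := π * τ.im * e / e' with hα
  set β : ℝ := π * τ.im * e' / e with hβ
  have hα0 : 0 < α := by positivity
  have hβ0 : 0 < β := by positivity
  set C₁ : ℝ := rexp ((e * R + 1) ^ 2 / (4 * α)) * rexp ((e' * R + 1) ^ 2 / (4 * β)) with hC₁
  have hs : Summable fun m : ℤ => (m : ℝ) ^ 2 * rexp (-(ε * c₁ ^ 2 * m ^ 2)) := by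
    have := (summable_gaussMoment 2 (a := ε * c₁ ^ 2 / π) (by positivity) 0).norm
    refine this.congr fun m => ?_
    rw [norm_mul, norm_pow, norm_intCast, sq_abs, norm_exp]
    congr 2
    have : (-π * (ε * c₁ ^ 2 / π : ℝ) * m ^ 2 + 2 * π * 0 * m : ℂ) = (-(ε * c₁ ^ 2 * m ^ 2) : ℝ) := by
      have : (π : ℂ) ≠ 0 := mod_cast Real.pi_ne_zero
      push_cast; field_simp; ring
    rw [this, ofReal_re]
  set M : ℝ := ∑' m : ℤ, (m : ℝ) ^ 2 * rexp (-(ε * c₁ ^ 2 * m ^ 2)) with hM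
  have hM0 : 0 ≤ M := tsum_nonneg fun m => by positivity
  set F : ℝ := (e * e' / τ.im) * √(e * e' / τ.im) with hF
  refine ⟨F * (M + 1) * C₁, ε, by positivity, hε0, fun w hw j k => ?_⟩
  have hy : 0 < w.im := hc₁.trans_le hw
  rw [tsum_thetaTerm_c he he' hτ z hy 0 j k rfl, norm_mul]
  have hpre : ‖(-(1 / ((τ.im / (e * e' * w.im ^ 2) : ℝ) * ((τ.im / (e * e' * w.im ^ 2) : ℝ) : ℂ) ^ (1 / 2 : ℂ))) : ℂ)‖ =
      F * w.im ^ 3 := by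
    have hA0 : 0 < τ.im / (e * e' * w.im ^ 2) := by positivity
    rw [norm_neg, norm_div, norm_one, norm_mul, norm_real, Real.norm_of_nonneg hA0.le,
      Complex.norm_cpow_eq_rpow_re_of_pos hA0]
    have : ((1 / 2 : ℂ)).re = 1 / 2 := by norm_num
    rw [this, ← Real.sqrt_eq_rpow, hF]
    have h2 : √(e * e' / τ.im) = w.im⁻¹ * (√(τ.im / (e * e' * w.im ^ 2)))⁻¹ := by
      rw [← Real.sqrt_inv, ← Real.sqrt_sq (inv_pos.mpr hy).le, ← Real.sqrt_mul (by positivity)]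
      congr 1
      field_simp
    rw [h2]
    have := (Real.sqrt_pos.mpr hA0).ne'
    field_simp
  rw [hpre]
  have hexp : rexp (-(π * τ.im * ((e * k) ^ 2 + (e' * j) ^ 2) / (e * e')) -
      2 * π * (e' * j + e * k) * z.im) ≤ C₁ * rexp (-(1 * (|(j : ℝ)| + |(k : ℝ)|))) := by
    rw [hC₁, ← Real.exp_add, ← Real.exp_add, exp_le_exp]
    have h1 := linear_sub_sq_le hα0 (e * R + 1) |(k : ℝ)|
    have h2 := linear_sub_sq_le hβ0 (e' * R + 1) |(j : ℝ)|
    rw [sq_abs] at h1 h2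
    have h3 : -(2 * π * (e' * j + e * k) * z.im) ≤ e' * R * |(j : ℝ)| + e * R * |(k : ℝ)| := by
      have hj : -((j : ℝ) * z.im) ≤ |(j : ℝ)| * |z.im| := by rw [← abs_mul]; exact neg_le_abs _
      have hk : -((k : ℝ) * z.im) ≤ |(k : ℝ)| * |z.im| := by rw [← abs_mul]; exact neg_le_abs _
      have hj' := mul_le_mul_of_nonneg_left hj (show 0 ≤ 2 * π * e' by positivity)
      have hk' := mul_le_mul_of_nonneg_left hk (show 0 ≤ 2 * π * e by positivity)
      rw [hR]
      linarith
    have h4 : π * τ.im * ((e * k) ^ 2 + (e' * j) ^ 2) / (e * e') = α * (k : ℝ) ^ 2 + β * (j : ℝ) ^ 2 := by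
      rw [hα, hβ]; field_simp
    rw [h4]
    linarith
  have hterm : ∀ m : ℤ, ‖gTerm e e' τ z w 0 j k m‖ ≤ (m : ℝ) ^ 2 * rexp (-(ε * c₁ ^ 2 * m ^ 2)) *
      (rexp (-(ε * w.im ^ 2)) * (C₁ * rexp (-(1 * (|(j : ℝ)| + |(k : ℝ)|))))) := fun m => by
    rw [norm_gTerm_zero e e' he he', mul_assoc ((m : ℝ) ^ 2), mul_assoc ((m : ℝ) ^ 2)]
    by_cases hm : m = 0
    · simp [hm]
    have hm1 : (1 : ℝ) ≤ (m : ℝ) ^ 2 := by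
      have : 1 ≤ m ^ 2 := by have := pow_pos (abs_pos.mpr hm) 2; rw [sq_abs] at this; omega
      exact_mod_cast this
    refine mul_le_mul_of_nonneg_left ?_ (sq_nonneg (m : ℝ))
    rw [← mul_assoc (rexp _) (rexp _), ← Real.exp_add (-(ε * c₁ ^ 2 * m ^ 2))]
    refine mul_le_mul (exp_le_exp.mpr ?_) hexp (exp_pos _).le (exp_pos _).le
    have h1 : π * (e * e') * w.im ^ 2 / τ.im * (m : ℝ) ^ 2 = ε * w.im ^ 2 * (m : ℝ) ^ 2 + ε * w.im ^ 2 * (m : ℝ) ^ 2 := by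
      rw [hε]; field_simp; ring
    have h2 : ε * c₁ ^ 2 * (m : ℝ) ^ 2 ≤ ε * w.im ^ 2 * (m : ℝ) ^ 2 := by gcongr
    have h3 : ε * w.im ^ 2 ≤ ε * w.im ^ 2 * (m : ℝ) ^ 2 := le_mul_of_one_le_right (by positivity) hm1
    linarith
  have hsum := tsum_of_norm_bounded (hs.mul_right _).hasSum hterm
  rw [tsum_mul_right, ← hM] at hsum
  calc _ ≤ F * w.im ^ 3 * (M * (rexp (-(ε * w.im ^ 2)) * (C₁ * rexp (-(1 * (|(j : ℝ)| + |(k : ℝ)|)))))) := by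
        gcongr
    _ ≤ F * w.im ^ 3 * ((M + 1) * (rexp (-(ε * w.im ^ 2)) * (C₁ * rexp (-(1 * (|(j : ℝ)| + |(k : ℝ)|)))))) := by
        have : M ≤ M + 1 := by linarith
        gcongr
    _ = _ := by ring

/-- Domination of the terms of the theta kernel with vanishing leading coefficient. -/
lemma mul_tsum_thetaTerm_zero_le (ha : HasQExp f a n₀)
    (he : 0 < e) (he' : 0 < e') (hτ : 0 < τ.im) (z : ℂ) {c₁ : ℝ} (hc₁ : 0 < c₁) :
    ∃ S : ℤ × ℤ → ℝ, Summable S ∧ ∀ p : ℤ × ℤ, ∀ w ∈ cuspStrip c₁,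
      ‖f w * ∑' c : ℤ, thetaTerm e e' τ z w ((0, p.1), (p.2, c))‖ ≤ S p := by
  obtain ⟨C, hC, h⟩ := growth_cusp ha hc₁
  obtain ⟨C', ε, hC', hε, h'⟩ := tsum_thetaTerm_zero_le he he' hτ z hc₁
  refine ⟨_, (summable_int2_exp one_pos).mul_left
    (6 * C * C' * rexp ((2 * π * |(n₀ : ℝ)| + 1) ^ 2 / (4 * ε))), fun p w hw => ?_⟩
  have hy : 0 < w.im := w.im_pos
  have h1 := exp_mul_exp_sq_le hε (2 * π * |(n₀ : ℝ)| + 1) w.im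
  have h3 : w.im ^ 3 ≤ 6 * rexp w.im := by
    have := Real.pow_div_factorial_le_exp w.im hy.le 3
    rw [div_le_iff₀ (by positivity)] at this
    simpa [Nat.factorial, mul_comm] using this
  rw [norm_mul]
  refine (mul_le_mul (h w hw.2) (h' w hw.2 p.1 p.2) (norm_nonneg _) (by positivity)).trans ?_
  rw [UpperHalfPlane.coe_im]
  calc _ ≤ C * rexp (2 * π * |(n₀ : ℝ)| * w.im) * (C' * (6 * rexp w.im) * rexp (-(ε * w.im ^ 2)) *
        rexp (-(1 * (|(p.1 : ℝ)| + |(p.2 : ℝ)|)))) := by gcongr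
    _ = 6 * C * C' * (rexp ((2 * π * |(n₀ : ℝ)| + 1) * w.im) * rexp (-(ε * w.im ^ 2))) *
        rexp (-(1 * (|(p.1 : ℝ)| + |(p.2 : ℝ)|))) := by
        rw [add_mul (2 * π * |(n₀ : ℝ)|), one_mul w.im, Real.exp_add]; ring
    _ ≤ _ := by gcongr

/-- The index `(n, r)` to which a term of the theta kernel contributes. -/
def fib (e e' : ℕ) (p : (ℤ × ℤ) × ℤ × ℤ) : ℤ × ℤ :=
  (p.1.2 * p.2.1 + p.1.1 * p.2.2, e' * p.1.2 + e * p.2.1)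

/-- The indices with nonvanishing leading coefficient. -/
abbrev NonCusp := {p : (ℤ × ℤ) × ℤ × ℤ // p.1.1 ≠ 0}

lemma tsum_split {h : (ℤ × ℤ) × ℤ × ℤ → ℂ} (hh : Summable h) :
    ∑' p, h p = ∑' p : NonCusp, h p + ∑' q : ℤ × ℤ, ∑' c : ℤ, h ((0, q.1), (q.2, c)) := by
  rw [← hh.tsum_subtype_add_tsum_subtype_compl {p | p.1.1 ≠ 0}]
  congr 1
  have hinj : Function.Injective fun t : (ℤ × ℤ) × ℤ => (((0, t.1.1), (t.1.2, t.2)) : (ℤ × ℤ) × ℤ × ℤ) := by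
    rintro ⟨⟨j, k⟩, c⟩ ⟨⟨j', k'⟩, c'⟩ h
    simp_all
  have hs := (hh.comp_injective hinj).tsum_prod
  simp only [Function.comp_def] at hs
  rw [← hs, tsum_subtype, ← hinj.tsum_eq]
  · refine tsum_congr fun t => ?_
    rw [Set.indicator_of_mem]
    simp
  · rintro ⟨⟨a, j⟩, k, c⟩ hp
    have ha : a = 0 := by
      by_contra ha
      exact hp (Set.indicator_of_notMem (by simpa using ha) _)
    exact ⟨((j, k), c), by simp [ha]⟩

/-- The `(n, r)`-part of the theta kernel. -/
def thetaCoeff (e e' : ℕ) (τ z w : ℂ) (x : ℤ × ℤ) : ℂ :=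
  ∑' p, if fib e e' p = x then thetaTerm e e' τ z w p else 0

lemma continuous_thetaTerm (e e' : ℕ) (τ z : ℂ) (p : (ℤ × ℤ) × ℤ × ℤ) :
    Continuous fun w : ℍ => thetaTerm e e' τ z w p := by
  unfold thetaTerm kerP qR
  refine continuous_const.mul (continuous_ofReal.comp ?_)
  have h1 : Continuous fun w : ℍ => ((e * e' * p.1.1 : ℝ) * normSq (w : ℂ) + (e * p.2.1 - e' * p.1.2 : ℝ) * (w : ℂ).re +
      p.2.2) / (w : ℂ).im := by
    refine Continuous.div ?_ (Complex.continuous_im.comp continuous_coe) fun w => w.im_pos.ne'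
    have := Complex.continuous_normSq.comp continuous_coe
    have h2 := Complex.continuous_re.comp continuous_coe
    exact ((continuous_const.mul this).add (continuous_const.mul h2)).add continuous_const
  exact ((continuous_const.mul (h1.pow 2)).div_const _ |>.sub continuous_const).mul
    (Real.continuous_exp.comp ((continuous_const.mul ((h1.pow 2).add continuous_const)).div_const _).neg)

lemma hasSum_if_fiber {ι X : Type*} {F : ι → ℂ} {s : ℂ} (h : HasSum F s) (g : ι → X) [DecidableEq X] :
    HasSum (fun x => ∑' i, if g i = x then F i else 0) s := by
  refine hasSum_of_forall_eq (h.tsum_fiberwise g) fun x => ?_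
  rw [tsum_subtype (g ⁻¹' {x}) F]
  refine tsum_congr fun i => ?_
  by_cases hi : g i = x <;> simp [hi]

lemma hasSum_integral_nonCusp (hΓ : OneCusp Γ c₀) (hfc : Continuous fun w : ℍ => f w) (ha : HasQExp f a n₀)
    (he : 0 < e) (he' : 0 < e') (hτ : 0 < τ.im) (z : ℂ) (P : NonCusp → Prop) [DecidablePred P] :
    HasSum (fun p : NonCusp => if P p then ∫ w : ℍ, (rho Γ c₀ w : ℂ) * (f w * thetaTerm e e' τ z w p) else 0)
      (∫ w : ℍ, (rho Γ c₀ w : ℂ) * (f w * ∑' p : NonCusp, if P p then thetaTerm e e' τ z w p else 0)) ∧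
    Integrable (fun w : ℍ => (rho Γ c₀ w : ℂ) * (f w * ∑' p : NonCusp, if P p then thetaTerm e e' τ z w p else 0)) := by
  obtain ⟨S, hS, hb⟩ := mul_thetaTerm_le ha he he' hτ z (half_pos hΓ.pos)
  have h := hasSum_integral_rho hΓ (ι := NonCusp)
    (G := fun p w => f w * if P p then thetaTerm e e' τ z w p else 0) (fun p => ?_)
    (hS.comp_injective Subtype.val_injective) (fun p w hw => ?_)
  · simp only [tsum_mul_left] at h
    refine ⟨hasSum_of_forall_eq h.1 fun p => ?_, h.2⟩
    by_cases hp : P p <;> simp [hp]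
  · by_cases hp : P p
    · simp only [hp, if_true]
      exact (hfc.mul (continuous_thetaTerm e e' τ z p)).aestronglyMeasurable
    · simpa [hp] using aestronglyMeasurable_const
  · have := hb p.1 p.2 w hw
    by_cases hp : P p
    · simpa [hp] using this
    · simpa [hp] using (norm_nonneg _).trans this

lemma hasSum_integral_cusp (hΓ : OneCusp Γ c₀) (hfc : Continuous fun w : ℍ => f w) (ha : HasQExp f a n₀)
    (he : 0 < e) (he' : 0 < e') (hτ : 0 < τ.im) (z : ℂ) (P : ℤ × ℤ → Prop) [DecidablePred P] :
    HasSum (fun q : ℤ × ℤ => if P q then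
        ∫ w : ℍ, (rho Γ c₀ w : ℂ) * (f w * ∑' c : ℤ, thetaTerm e e' τ z w ((0, q.1), (q.2, c))) else 0)
      (∫ w : ℍ, (rho Γ c₀ w : ℂ) * (f w * ∑' q : ℤ × ℤ, if P q then
        ∑' c : ℤ, thetaTerm e e' τ z w ((0, q.1), (q.2, c)) else 0)) ∧
    Integrable (fun w : ℍ => (rho Γ c₀ w : ℂ) * (f w * ∑' q : ℤ × ℤ, if P q then
        ∑' c : ℤ, thetaTerm e e' τ z w ((0, q.1), (q.2, c)) else 0)) := by
  obtain ⟨S, hS, hb⟩ := mul_tsum_thetaTerm_zero_le ha he he' hτ z (half_pos hΓ.pos)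
  have h := hasSum_integral_rho hΓ (ι := ℤ × ℤ)
    (G := fun q w => f w * if P q then ∑' c : ℤ, thetaTerm e e' τ z w ((0, q.1), (q.2, c)) else 0) (fun q => ?_)
    hS (fun q w hw => ?_)
  · simp only [tsum_mul_left] at h
    refine ⟨hasSum_of_forall_eq h.1 fun p => ?_, h.2⟩
    by_cases hp : P p <;> simp [hp]
  · by_cases hp : P q
    · have h1 : AEStronglyMeasurable (fun w : ℍ => ∑' c : ℤ, thetaTerm e e' τ z w ((0, q.1), (q.2, c))) volume :=
        aestronglyMeasurable_of_hasSum (G := fun c (w : ℍ) => thetaTerm e e' τ z w ((0, q.1), (q.2, c)))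
          (fun c => (continuous_thetaTerm e e' τ z _).aestronglyMeasurable) fun w =>
          (((summable_thetaTerm he he' hτ z w.im_pos).prod_factor (0, q.1)).prod_factor q.2).hasSum
      simp only [hp, if_true]
      exact hfc.aestronglyMeasurable.mul h1
    · simpa [hp] using aestronglyMeasurable_const
  · have := hb q w hw
    by_cases hp : P q
    · simpa [hp] using this
    · simpa [hp] using (norm_nonneg _).trans this

lemma summable_if_thetaTerm (z : ℂ) (he : 0 < e) (he' : 0 < e') (hτ : 0 < τ.im) (hw : 0 < w.im) (x : ℤ × ℤ) :
    Summable fun p => if fib e e' p = x then thetaTerm e e' τ z w p else 0 := by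
  refine Summable.of_norm_bounded (summable_thetaTerm he he' hτ z hw).norm fun p => ?_
  split_ifs <;> simp

lemma thetaCoeff_split (z : ℂ) (he : 0 < e) (he' : 0 < e') (hτ : 0 < τ.im) (hw : 0 < w.im) (x : ℤ × ℤ) :
    thetaCoeff e e' τ z w x =
      (∑' p : NonCusp, if fib e e' p.1 = x then thetaTerm e e' τ z w p else 0) +
        ∑' q : ℤ × ℤ, if (q.1 * q.2, e' * q.1 + e * q.2) = x then
          ∑' c : ℤ, thetaTerm e e' τ z w ((0, q.1), (q.2, c)) else 0 := by
  rw [thetaCoeff, tsum_split (summable_if_thetaTerm z he he' hτ hw x)]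
  congr 1
  refine tsum_congr fun q => ?_
  have : ∀ c, fib e e' ((0, q.1), (q.2, c)) = (q.1 * q.2, e' * q.1 + e * q.2) := fun c => by simp [fib]
  simp only [this]
  split_ifs
  · rfl
  · exact tsum_zero

/-- The integral of the theta kernel, expanded in the Jacobi variables. -/
theorem hasSum_integral_thetaCoeff (hΓ : OneCusp Γ c₀) (hfc : Continuous fun w : ℍ => f w) (ha : HasQExp f a n₀)
    (he : 0 < e) (he' : 0 < e') (hτ : 0 < τ.im) (z : ℂ) :
    HasSum (fun x => ∫ w : ℍ, (rho Γ c₀ w : ℂ) * (f w * thetaCoeff e e' τ z w x))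
      (∫ w : ℍ, (rho Γ c₀ w : ℂ) * (f w * thetaKer e e' τ z w)) ∧
    ∀ x, Integrable fun w : ℍ => (rho Γ c₀ w : ℂ) * (f w * thetaCoeff e e' τ z w x) := by
  have h1 := hasSum_integral_nonCusp hΓ hfc ha he he' hτ z (fun _ => True)
  have h2 := hasSum_integral_cusp hΓ hfc ha he he' hτ z (fun _ => True)
  have h1x := fun x => hasSum_integral_nonCusp hΓ hfc ha he he' hτ z (fun p => fib e e' p.1 = x)
  have h2x := fun x => hasSum_integral_cusp hΓ hfc ha he he' hτ z
    (fun q => (q.1 * q.2, e' * q.1 + e * q.2) = x)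
  simp only [if_true] at h1 h2
  have hK : ∀ w : ℍ, (rho Γ c₀ w : ℂ) * (f w * thetaKer e e' τ z w) =
      (rho Γ c₀ w : ℂ) * (f w * ∑' p : NonCusp, thetaTerm e e' τ z w p) +
        (rho Γ c₀ w : ℂ) * (f w * ∑' q : ℤ × ℤ, ∑' c : ℤ, thetaTerm e e' τ z w ((0, q.1), (q.2, c))) := fun w => by
    rw [thetaKer, tsum_split (summable_thetaTerm he he' hτ z w.im_pos)]
    ring
  have hKx : ∀ x (w : ℍ), (rho Γ c₀ w : ℂ) * (f w * thetaCoeff e e' τ z w x) =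
      (rho Γ c₀ w : ℂ) * (f w * ∑' p : NonCusp, if fib e e' p.1 = x then thetaTerm e e' τ z w p else 0) +
        (rho Γ c₀ w : ℂ) * (f w * ∑' q : ℤ × ℤ, if (q.1 * q.2, e' * q.1 + e * q.2) = x then
          ∑' c : ℤ, thetaTerm e e' τ z w ((0, q.1), (q.2, c)) else 0) := fun x w => by
    rw [thetaCoeff_split z he he' hτ w.im_pos]
    ring
  simp_rw [hK, hKx]
  refine ⟨?_, fun x => (h1x x).2.add (h2x x).2⟩
  rw [integral_add h1.2 h2.2]
  refine hasSum_of_forall_eq ((hasSum_if_fiber h1.1 fun p => fib e e' p.1).add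
    (hasSum_if_fiber h2.1 fun q => (q.1 * q.2, e' * q.1 + e * q.2))) fun x => ?_
  rw [integral_add (h1x x).2 (h2x x).2, ← (h1x x).1.tsum_eq, ← (h2x x).1.tsum_eq]

lemma hasSum_integral_definite (hΓ : OneCusp Γ c₀) (hfc : Continuous fun w : ℍ => f w) (ha : HasQExp f a n₀)
    (he : 0 < e) (he' : 0 < e') (hτ : 0 < τ.im) (z : ℂ) {x : ℤ × ℤ} (hx : x.2 ^ 2 - 4 * (e * e') * x.1 < 0) :
    HasSum (fun p : {p // fib e e' p = x} => ∫ w : ℍ, (rho Γ c₀ w : ℂ) * (f w * thetaTerm e e' τ z w p))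
      (∫ w : ℍ, (rho Γ c₀ w : ℂ) * (f w * thetaCoeff e e' τ z w x)) := by
  have hne : ∀ p, fib e e' p = x → p.1.1 ≠ 0 := by
    rintro ⟨⟨a, j⟩, k, c⟩ h ha
    simp only at ha
    subst ha
    rw [← h] at hx
    simp only [fib] at hx
    nlinarith [sq_nonneg ((e : ℤ) * k - e' * j)]
  have h1 := (hasSum_integral_nonCusp hΓ hfc ha he he' hτ z (fun p => fib e e' p.1 = x)).1
  have h3 : ∀ w : ℍ, thetaCoeff e e' τ z w x =
      ∑' p : NonCusp, if fib e e' p.1 = x then thetaTerm e e' τ z w p else 0 := fun w => by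
    have hinj : Function.Injective (Subtype.val : NonCusp → _) := Subtype.val_injective
    rw [thetaCoeff, ← hinj.tsum_eq (f := fun p => if fib e e' p = x then thetaTerm e e' τ z w p else 0)]
    intro p hp
    have : fib e e' p = x := by by_contra h; simp [h] at hp
    exact ⟨⟨p, hne p this⟩, rfl⟩
  simp_rw [h3]
  have hinj : Function.Injective fun p : {p // fib e e' p = x} => (⟨p.1, hne p.1 p.2⟩ : NonCusp) :=
    fun p q h => Subtype.ext (by simpa using h)
  refine hasSum_of_forall_eq ((hinj.hasSum_iff ?_).mpr h1) fun p => by simp [p.2]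
  intro p hp
  rw [if_neg]
  exact fun h => hp ⟨⟨p.1, h⟩, rfl⟩

/-! ### The action on quadratic forms -/

/-- The value `Q_w` of a form given by a real matrix. -/
def qMat (M : Mat₂) (w : ℂ) : ℝ :=
  (M 0 0 * normSq w + (M 0 1 + M 1 0) * w.re + M 1 1) / w.im

/-- The Kudla–Millson type kernel of a form given by a real matrix. -/
def kerM (N v : ℝ) (M : Mat₂) (w : ℂ) : ℝ :=
  (v * qMat M w ^ 2 / N - 1 / (2 * π)) *
    rexp (-(π * v * (qMat M w ^ 2 - 4 * M.det) / N))

/-- The action of `SL(2, ℝ)` on matrices of quadratic forms. -/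
def actM (M : Mat₂) (g : SL2R) : Mat₂ := (g.1)ᵀ * M * g.1

lemma actM_mul (M : Mat₂) (g h : SL2R) : actM M (g * h) = actM (actM M g) h := by
  simp [actM, Matrix.mul_assoc]

lemma actM_one (M : Mat₂) : actM M 1 = M := by simp [actM]

lemma actM_injective (g : SL2R) : Function.Injective fun M => actM M g := fun M M' h => by
  have := congrArg (fun M => actM M g⁻¹) h
  simpa [← actM_mul, actM_one] using this

lemma det_actM (M : Mat₂) (g : SL2R) : (actM M g).det = M.det := by
  simp [actM, Matrix.det_mul]

lemma actM_apply (M : Mat₂) (g : SL2R) : actM M g =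
    !![g.1 0 0 ^ 2 * M 0 0 + g.1 0 0 * g.1 1 0 * (M 0 1 + M 1 0) + g.1 1 0 ^ 2 * M 1 1,
       g.1 0 0 * g.1 0 1 * M 0 0 + g.1 0 0 * g.1 1 1 * M 0 1 + g.1 1 0 * g.1 0 1 * M 1 0 + g.1 1 0 * g.1 1 1 * M 1 1;
       g.1 0 0 * g.1 0 1 * M 0 0 + g.1 0 0 * g.1 1 1 * M 1 0 + g.1 1 0 * g.1 0 1 * M 0 1 + g.1 1 0 * g.1 1 1 * M 1 1,
       g.1 0 1 ^ 2 * M 0 0 + g.1 0 1 * g.1 1 1 * (M 0 1 + M 1 0) + g.1 1 1 ^ 2 * M 1 1] := by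
  ext i j
  fin_cases i <;> fin_cases j <;> simp [actM, Matrix.mul_apply, Fin.sum_univ_two] <;> ring

lemma moebius_re (g : SL2R) (hz : 0 < z.im) : (moebius g z).re * normSq (autF g z) =
    g.1 0 0 * g.1 1 0 * normSq z + (g.1 0 0 * g.1 1 1 + g.1 0 1 * g.1 1 0) * z.re + g.1 0 1 * g.1 1 1 := by
  have hn : normSq (autF g z) ≠ 0 := by simpa using autF_ne_zero g hz
  rw [moebius_eq, Complex.div_re]
  field_simp
  simp [autF, normSq_apply]
  ring

lemma moebius_normSq (g : SL2R) (hz : 0 < z.im) : normSq (moebius g z) * normSq (autF g z) =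
    g.1 0 0 ^ 2 * normSq z + 2 * g.1 0 0 * g.1 0 1 * z.re + g.1 0 1 ^ 2 := by
  have hn : normSq (autF g z) ≠ 0 := by simpa using autF_ne_zero g hz
  rw [moebius_eq, normSq_div]
  field_simp
  simp [normSq_apply]
  ring

lemma normSq_autF (g : SL2R) (z : ℂ) : normSq (autF g z) =
    g.1 1 0 ^ 2 * normSq z + 2 * g.1 1 0 * g.1 1 1 * z.re + g.1 1 1 ^ 2 := by
  simp [autF, normSq_apply]
  ring

lemma qMat_actM (M : Mat₂) (g : SL2R) (hw : 0 < w.im) :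
    qMat (actM M g) w = qMat M (moebius g w) := by
  have hn : normSq (autF g w) ≠ 0 := by simpa using autF_ne_zero g hw
  have h1 := moebius_re g hw
  have h2 := moebius_normSq g hw
  have h3 := normSq_autF g w
  rw [qMat, qMat, im_moebius g hw, div_div_eq_mul_div, actM_apply]
  congr 1
  simp
  linear_combination -(M 0 0) * h2 - (M 0 1 + M 1 0) * h1 - M 1 1 * h3

lemma kerM_actM (N v : ℝ) (M : Mat₂) (g : SL2R) (hw : 0 < w.im) :
    kerM N v (actM M g) w = kerM N v M (moebius g w) := by
  rw [kerM, kerM, qMat_actM M g hw, det_actM]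

lemma qMat_neg (M : Mat₂) (w : ℂ) : qMat (-M) w = -qMat M w := by
  simp only [qMat, Matrix.neg_apply]; ring

lemma kerM_neg (N v : ℝ) (M : Mat₂) (w : ℂ) : kerM N v (-M) w = kerM N v M w := by
  rw [kerM, kerM, qMat_neg, Matrix.det_neg]
  simp

lemma formMat_det (a b c : ℤ) : (formMat a b c).det = a * c - b ^ 2 / 4 := by
  simp [formMat, det_fin_two]; ring

lemma qMat_formMat (a b c : ℤ) (w : ℂ) : qMat (formMat a b c) w = qR a b c w := by
  simp [qMat, formMat, qR]

lemma kerM_formMat (N v : ℝ) (a b c : ℤ) (w : ℂ) : kerM N v (formMat a b c) w = kerP N v a b c w := by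
  rw [kerM, kerP, qMat_formMat, formMat_det]
  ring_nf

lemma formMat_injective {a b c a' b' c' : ℤ} (h : formMat a b c = formMat a' b' c') :
    a = a' ∧ b = b' ∧ c = c' := by
  have h0 := congrFun (congrFun h 0) 0
  have h1 := congrFun (congrFun h 0) 1
  have h2 := congrFun (congrFun h 1) 1
  simp [formMat] at h0 h1 h2
  exact ⟨h0, h1, h2⟩

lemma neg_formMat (a b c : ℤ) : -formMat a b c = formMat (-a) (-b) (-c) := by
  ext i j
  fin_cases i <;> fin_cases j <;> simp [formMat] <;> ring

/-- The forms contributing to the `r`-part of the theta kernel for `e`. -/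
def SE (e e' : ℕ) (r D : ℤ) : Set (Mat₂) :=
  {M | ∃ a b c : ℤ, M = formMat (e * e' * a) b c ∧ b ^ 2 - 4 * (e * e') * a * c = D ∧
    2 * (e' : ℤ) ∣ r - b ∧ 2 * (e : ℤ) ∣ r + b}

/-- The matrix attached to an index of the theta kernel. -/
def matOf (e e' : ℕ) (p : (ℤ × ℤ) × ℤ × ℤ) : Mat₂ :=
  formMat (e * e' * p.1.1) (e * p.2.1 - e' * p.1.2) p.2.2

lemma thetaTerm_eq (e e' : ℕ) (τ z w : ℂ) (p : (ℤ × ℤ) × ℤ × ℤ) : thetaTerm e e' τ z w p =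
    qc τ ^ (fib e e' p).1 * qc z ^ (fib e e' p).2 * (kerM (e * e') τ.im (matOf e e' p) w : ℝ) := by
  rw [matOf, kerM_formMat, thetaTerm, fib]
  push_cast
  rfl

/-- The index set of the `(n, r)`-part of the theta kernel, as a set of matrices. -/
def fibEquiv {e e' : ℕ} (he : 0 < e) (he' : 0 < e') (x : ℤ × ℤ) :
    {p // fib e e' p = x} ≃ SE e e' x.2 (x.2 ^ 2 - 4 * (e * e') * x.1) := by
  refine Equiv.ofBijective (fun p => ⟨matOf e e' p.1, ?_⟩) ⟨?_, ?_⟩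
  · obtain ⟨⟨⟨a, j⟩, k, c⟩, rfl⟩ := p
    refine ⟨a, _, c, rfl, ?_, ⟨j, ?_⟩, ⟨k, ?_⟩⟩ <;> simp only [fib] <;> ring
  · rintro ⟨⟨⟨a, j⟩, k, c⟩, h⟩ ⟨⟨⟨a', j'⟩, k', c'⟩, h'⟩ hM
    have hM := formMat_injective (Subtype.ext_iff.mp hM)
    have h2 := congrArg Prod.snd (h.trans h'.symm)
    simp only [fib] at h2 hM
    have he1 : (e : ℤ) ≠ 0 := mod_cast he.ne'
    have he2 : (e' : ℤ) ≠ 0 := mod_cast he'.ne'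
    have ha : a = a' := by simpa [he.ne', he'.ne'] using hM.1
    have hk : k = k' := mul_left_cancel₀ he1 (by linarith [hM.2.1])
    have hj : j = j' := mul_left_cancel₀ he2 (by linarith [hM.2.1])
    simp [ha, hk, hj, hM.2.2]
  · rintro ⟨M, a, b, c, rfl, hD, ⟨j, hj⟩, ⟨k, hk⟩⟩
    have he1 : (e : ℤ) ≠ 0 := mod_cast he.ne'
    have he2 : (e' : ℤ) ≠ 0 := mod_cast he'.ne'
    have hb : (e : ℤ) * k - e' * j = b := by linarith
    have hr : (e' : ℤ) * j + e * k = x.2 := by linarith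
    refine ⟨⟨((a, j), (k, c)), ?_⟩, ?_⟩
    · refine Prod.ext ?_ hr
      have h4 : (4 * (e * e') : ℤ) ≠ 0 := by simp [he.ne', he'.ne']
      refine mul_left_cancel₀ h4 ?_
      simp only [fib]
      rw [← hb, ← hr] at hD
      linear_combination -hD
    · simp only [matOf, hb]

lemma fibEquiv_coe (he : 0 < e) (he' : 0 < e') (x : ℤ × ℤ) (p : {p // fib e e' p = x}) :
    (fibEquiv he he' x p : Mat₂) = matOf e e' p.1 := rfl

lemma actM_formMat (he : 0 < e) {x y z w : ℤ}
    (hg : g.1 = (Real.sqrt e)⁻¹ • !![(x : ℝ) * e, (y : ℝ); (z : ℝ) * (e * e' : ℕ), (w : ℝ) * e]) (a b c : ℤ) :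
    actM (formMat (e * e' * a) b c) g =
      formMat (e * e' * (a * x ^ 2 * e + b * x * z + c * z ^ 2 * e'))
        (2 * (e * e') * a * x * y + b * (e * x * w + e' * y * z) + 2 * c * (e * e') * z * w)
        (e' * a * y ^ 2 + b * y * w + c * e * w ^ 2) := by
  have he1 : (0 : ℝ) < e := mod_cast he
  have hs : (Real.sqrt e)⁻¹ * (Real.sqrt e)⁻¹ = (e : ℝ)⁻¹ := by
    rw [← mul_inv, Real.mul_self_sqrt he1.le]
  have hee : (e : ℝ)⁻¹ * e = 1 := inv_mul_cancel₀ he1.ne'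
  rw [actM_apply, hg]
  ext i j
  fin_cases i <;> fin_cases j <;> simp [formMat]
  · linear_combination ((x : ℝ) ^ 2 * e ^ 2 * (e * e' * a) + x * z * e ^ 2 * e' * b + z ^ 2 * e ^ 2 * e' ^ 2 * c) * hs +
      ((x : ℝ) ^ 2 * e * (e * e' * a) + x * z * e * e' * b + z ^ 2 * e * e' ^ 2 * c) * hee
  · linear_combination ((x : ℝ) * y * e * (e * e' * a) + x * w * e ^ 2 * b / 2 + z * y * e * e' * b / 2 + z * w * e ^ 2 * e' * c) * hs +
      ((x : ℝ) * y * (e * e' * a) + x * w * e * b / 2 + z * y * e' * b / 2 + z * w * e * e' * c) * hee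
  · linear_combination ((x : ℝ) * y * e * (e * e' * a) + x * w * e ^ 2 * b / 2 + z * y * e * e' * b / 2 + z * w * e ^ 2 * e' * c) * hs +
      ((x : ℝ) * y * (e * e' * a) + x * w * e * b / 2 + z * y * e' * b / 2 + z * w * e * e' * c) * hee
  · linear_combination ((y : ℝ) ^ 2 * (e * e' * a) + y * w * e * b + w ^ 2 * e ^ 2 * c) * hs +
      ((y : ℝ) ^ 2 * (e' * a) + y * w * b + w ^ 2 * e * c) * hee

lemma atkinLehner_det' (he : 0 < e) {x y z w : ℤ}
    (hg : g.1 = (Real.sqrt e)⁻¹ • !![(x : ℝ) * e, (y : ℝ); (z : ℝ) * (e * e' : ℕ), (w : ℝ) * e]) :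
    (e : ℤ) * x * w - e' * y * z = 1 := by
  have := atkinLehner_det he (Dvd.intro _ rfl) hg
  rwa [Nat.mul_div_cancel_left _ he] at this

lemma actM_mem_SE (he : 0 < e) (hg : g ∈ atkinLehnerSet (e * e') e)
    {r D : ℤ} {M : Mat₂} (hM : M ∈ SE 1 (e * e') r D) : actM M g ∈ SE e e' r D := by
  obtain ⟨x, y, z, w, hg⟩ := hg
  obtain ⟨a, b, c, rfl, hD, ⟨j, hj⟩, ⟨k, hk⟩⟩ := hM
  have hd := atkinLehner_det' he hg
  have h := actM_formMat he hg a b c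
  push_cast at h hj hk hD ⊢
  rw [one_mul, h]
  refine ⟨_, _, _, rfl, ?_, ⟨e * j - e * a * x * y - e * c * z * w - y * z * b, ?_⟩,
    ⟨e' * j + e' * a * x * y + e' * c * z * w + x * w * b, ?_⟩⟩
  · rw [← hD]
    linear_combination (b ^ 2 - 4 * (e * e') * a * c) * (e * x * w - e' * y * z + 1) * hd
  · linear_combination hj - b * hd
  · linear_combination hj - b * hd

lemma actM_mem_SE_one (he : 0 < e) (hc : Nat.Coprime e e')
    (hg : g ∈ atkinLehnerSet (e * e') e) {r D : ℤ} {M : Mat₂}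
    (hM : M ∈ SE e e' r D) : actM M g ∈ SE 1 (e * e') r D := by
  obtain ⟨x, y, z, w, hg⟩ := hg
  obtain ⟨a, b, c, rfl, hD, ⟨j, hj⟩, ⟨k, hk⟩⟩ := hM
  have hd := atkinLehner_det' he hg
  rw [actM_formMat he hg a b c]
  have h1 : 2 * ((e * e' : ℕ) : ℤ) ∣ r - (2 * (e * e') * a * x * y + b * (e * x * w + e' * y * z) + 2 * c * (e * e') * z * w) := by
    have hb : r = 2 * e * k - b := by linarith
    have hb' : r = 2 * e' * j + b := by linarith
    have hcop : IsCoprime (e : ℤ) (e' : ℤ) := Nat.isCoprime_iff_coprime.mpr hc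
    have hr : r - (2 * (e * e') * a * x * y + b * (e * x * w + e' * y * z) + 2 * c * (e * e') * z * w) =
        2 * (j * e' - e * e' * a * x * y - e' * y * z * b - c * e * e' * z * w) := by
      linear_combination hb' - b * hd
    have hr' : j * e' - e * e' * a * x * y - e' * y * z * b - c * e * e' * z * w =
        e * (k - e' * a * x * y - x * w * b - c * e' * z * w) := by
      refine mul_left_cancel₀ two_ne_zero ?_
      linear_combination hb - hb' + 2 * b * hd
    rw [hr, Nat.cast_mul]
    refine mul_dvd_mul_left 2 (hcop.mul_dvd ⟨_, hr'⟩ ⟨j - e * a * x * y - y * z * b - c * e * z * w, by ring⟩)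
  refine ⟨a * x ^ 2 * e + b * x * z + c * z ^ 2 * e', _, _, by push_cast; rw [one_mul], ?_, h1, ?_⟩
  · rw [← hD]
    push_cast
    linear_combination (b ^ 2 - 4 * (e * e') * a * c) * (e * x * w - e' * y * z + 1) * hd
  · refine ⟨r - (j * e' - e * e' * a * x * y - e' * y * z * b - c * e * e' * z * w), ?_⟩
    push_cast
    linear_combination -hj + b * hd

lemma eq_of_sq_mul_eq {e f : ℕ} (he : Squarefree e) (hf : Squarefree f) {x y : ℤ} (hx : x ≠ 0)
    (h : x ^ 2 * e = y ^ 2 * f) : e = f := by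
  have he0 := he.ne_zero
  have hf0 := hf.ne_zero
  have hy : y ≠ 0 := by
    rintro rfl
    simp [hx, he0] at h
  have h' : x.natAbs ^ 2 * e = y.natAbs ^ 2 * f := by
    zify
    simpa using h
  have hx' : x.natAbs ≠ 0 := by simpa using hx
  have hy' : y.natAbs ≠ 0 := by simpa using hy
  refine Nat.eq_of_factorization_eq he0 hf0 fun p => ?_
  have := congrArg (fun n => Nat.factorization n p) h'
  simp only [Nat.factorization_mul (pow_ne_zero 2 hx') he0, Nat.factorization_mul (pow_ne_zero 2 hy') hf0,
    Nat.factorization_pow, Finsupp.add_apply, Finsupp.smul_apply, smul_eq_mul] at this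
  have h1 := he.natFactorization_le_one p
  have h2 := hf.natFactorization_le_one p
  lia

lemma atkinLehner_unique {N e f : ℕ} (hN : Squarefree N) (he : e ∣ N) (hf : f ∣ N)
    (hg : g ∈ atkinLehnerSet N e) (hg' : g ∈ atkinLehnerSet N f) : e = f := by
  obtain ⟨x, y, z, w, hg⟩ := hg
  obtain ⟨x', y', z', w', hg'⟩ := hg'
  have he0 := Nat.pos_of_ne_zero (hN.squarefree_of_dvd he).ne_zero
  have hf0 := Nat.pos_of_ne_zero (hN.squarefree_of_dvd hf).ne_zero
  have he1 : (0 : ℝ) < e := mod_cast he0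
  have hf1 : (0 : ℝ) < f := mod_cast hf0
  have hd := atkinLehner_det he0 he hg
  have hsq : ∀ u v : ℝ, (√(e : ℝ))⁻¹ * u = (√(f : ℝ))⁻¹ * v → u ^ 2 * f = v ^ 2 * e := fun u v h => by
    have := congrArg (· ^ 2) h
    simp only [mul_pow, inv_pow, Real.sq_sqrt he1.le, Real.sq_sqrt hf1.le] at this
    field_simp at this
    linarith
  have h := hg.symm.trans hg'
  by_cases hx : x = 0
  · have hy : y ≠ 0 := by
      rintro rfl
      simp [hx] at hd
    have h1 := congrFun (congrFun h 0) 1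
    simp at h1
    refine (eq_of_sq_mul_eq (hN.squarefree_of_dvd hf) (hN.squarefree_of_dvd he) (x := y) (y := y') hy ?_).symm
    exact_mod_cast hsq _ _ h1
  · have h1 := congrFun (congrFun h 0) 0
    simp at h1
    have h2 := hsq _ _ h1
    refine eq_of_sq_mul_eq (hN.squarefree_of_dvd he) (hN.squarefree_of_dvd hf) (x := x) (y := x') hx ?_
    have : (x : ℝ) ^ 2 * e = x' ^ 2 * f := by
      have : ((e : ℝ) * f) * (x ^ 2 * e) = (e * f) * (x' ^ 2 * f) := by linear_combination h2
      exact mul_left_cancel₀ (mul_pos he1 hf1).ne' this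
    exact_mod_cast this

lemma one_mul_atkinLehner {g h : SL2R} (hg : g ∈ atkinLehnerSet N 1) (he : e ∣ N)
    (hh : h ∈ atkinLehnerSet N e) : g * h ∈ atkinLehnerSet N e := by
  obtain ⟨x, y, z, w, hg⟩ := hg
  obtain ⟨x', y', z', w', hh⟩ := hh
  obtain ⟨e', rfl⟩ := he
  refine ⟨x * x' + y * z' * e', x * y' + y * w' * e, z * x' * e + w * z', z * e' * y' + w * w', ?_⟩
  rw [Matrix.SpecialLinearGroup.coe_mul, hg, hh]
  ext i j
  fin_cases i <;> fin_cases j <;> simp [Matrix.mul_apply, Fin.sum_univ_two] <;> ring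

lemma atkinLehner_mul_self (he0 : 0 < e) {g h : SL2R} (he : e ∣ N)
    (hg : g ∈ atkinLehnerSet N e) (hh : h ∈ atkinLehnerSet N e) : g * h ∈ atkinLehnerSet N 1 := by
  obtain ⟨x, y, z, w, hg⟩ := hg
  obtain ⟨x', y', z', w', hh⟩ := hh
  obtain ⟨e', rfl⟩ := he
  have he1 : (0 : ℝ) < e := mod_cast he0
  have hs : (√(e : ℝ))⁻¹ * (√(e : ℝ))⁻¹ = (e : ℝ)⁻¹ := by
    rw [← mul_inv, Real.mul_self_sqrt he1.le]
  have hee : (e : ℝ)⁻¹ * e = 1 := inv_mul_cancel₀ he1.ne'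
  refine ⟨x * x' * e + y * z' * e', x * y' + y * w', z * x' + w * z', z * e' * y' + w * w' * e, ?_⟩
  rw [Matrix.SpecialLinearGroup.coe_mul, hg, hh]
  ext i j
  fin_cases i <;> fin_cases j <;> simp [Matrix.mul_apply, Fin.sum_univ_two]
  · linear_combination ((x : ℝ) * e * x' * e + y * z' * e * e') * hs + ((x : ℝ) * x' * e + y * z' * e') * hee
  · linear_combination ((x : ℝ) * e * y' + y * w' * e) * hs + ((x : ℝ) * y' + y * w') * hee
  · linear_combination ((z : ℝ) * e * e' * x' * e + w * e * z' * e * e') * hs +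
      ((z : ℝ) * e * e' * x' + w * z' * e * e') * hee
  · linear_combination ((z : ℝ) * e * e' * y' + w * w' * e * e) * hs + ((z : ℝ) * e' * y' + w * w' * e) * hee

lemma exists_mem_atkinLehner (he : 0 < e) (he' : 0 < e') (hc : Nat.Coprime e e') :
    ∃ g : SL2R, g ∈ atkinLehnerSet (e * e') e := by
  obtain ⟨u, v, huv⟩ := Nat.isCoprime_iff_coprime.mpr hc
  obtain ⟨g, hg, -⟩ := exists_atkinLehner (N := e * e') (e := e) (Nat.mul_pos he he') (Dvd.intro _ rfl)
    (x := u) (y := -v) (z := 1) (w := 1) (by rw [Nat.mul_div_cancel_left _ he]; linear_combination huv)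
  exact ⟨g, hg⟩

/-! ### A mean value property -/

lemma integrableOn_of_continuousOn_bound {X : Type*} [TopologicalSpace X] [MeasurableSpace X] [OpensMeasurableSpace X]
    {μ : Measure X} {s : Set X} (hs : MeasurableSet s) (hμ : μ s ≠ ⊤) [SecondCountableTopology X]
    {E : Type*} [NormedAddCommGroup E] {G : X → E} (hG : ContinuousOn G s) {B : ℝ} (hB : ∀ x ∈ s, ‖G x‖ ≤ B) : IntegrableOn G s μ := by
  have : IsFiniteMeasure (μ.restrict s) := ⟨by simpa using hμ.lt_top⟩
  exact Integrable.of_bound (hG.aestronglyMeasurable hs) B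
    ((ae_restrict_iff' hs).mpr (.of_forall hB))

/-- Integration over the unit disc in polar coordinates. -/
lemma integral_ball_polar {G : ℂ → ℂ} (hG : ContinuousOn G (Metric.ball 0 1)) {B : ℝ}
    (hB : ∀ u ∈ Metric.ball (0 : ℂ) 1, ‖G u‖ ≤ B) :
    ∫ u in Metric.ball (0 : ℂ) 1, G u =
      ∫ r in Set.Ioo (0 : ℝ) 1, ∫ θ in Set.Ioo (-π) π, (r : ℂ) * G (circleMap 0 r θ) := by
  have hpol : ∀ p : ℝ × ℝ, Complex.polarCoord.symm p = circleMap 0 p.1 p.2 := fun p => by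
    rw [Complex.polarCoord_symm_apply, circleMap, Complex.exp_mul_I]
    simp
  have hmem : ∀ p ∈ Set.Ioo (0 : ℝ) 1 ×ˢ Set.Ioo (-π) π, circleMap 0 p.1 p.2 ∈ Metric.ball (0 : ℂ) 1 := by
    rintro p ⟨⟨h0, h1⟩, -⟩
    simp [abs_of_pos h0, h1]
  have hcm : Continuous fun p : ℝ × ℝ => circleMap 0 p.1 p.2 := by unfold circleMap; fun_prop
  have h_int : IntegrableOn (fun p : ℝ × ℝ => (p.1 : ℂ) * G (circleMap 0 p.1 p.2))
      (Set.Ioo (0 : ℝ) 1 ×ˢ Set.Ioo (-π) π) (volume.prod volume) := by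
    refine integrableOn_of_continuousOn_bound (measurableSet_Ioo.prod measurableSet_Ioo) ?_
      (ContinuousOn.mul (by fun_prop) (hG.comp hcm.continuousOn hmem)) (B := B) fun p hp => ?_
    · rw [Measure.prod_prod]
      simp
    · rw [norm_mul]
      have h1 := hB _ (hmem p hp)
      have h2 : ‖(p.1 : ℂ)‖ ≤ 1 := by
        simpa [abs_of_pos hp.1.1] using hp.1.2.le
      nlinarith [norm_nonneg (G (circleMap 0 p.1 p.2)), norm_nonneg (p.1 : ℂ)]
  rw [← integral_indicator Metric.isOpen_ball.measurableSet, ← Complex.integral_comp_polarCoord_symm,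
    ← setIntegral_prod _ h_int]
  rw [← integral_indicator (measurableSet_Ioo.prod measurableSet_Ioo),
    ← integral_indicator polarCoord.open_target.measurableSet]
  refine integral_congr_ae (.of_forall fun p => ?_)
  by_cases hp : p ∈ polarCoord.target
  · have hp' := hp
    rw [polarCoord_target] at hp'
    rw [Set.indicator_of_mem hp, hpol]
    by_cases h1 : p.1 < 1
    · have hp2 : p ∈ Set.Ioo (0 : ℝ) 1 ×ˢ Set.Ioo (-π) π := ⟨⟨hp'.1, h1⟩, hp'.2⟩
      rw [Set.indicator_of_mem hp2, Set.indicator_of_mem (hmem p hp2)]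
      simp
    · rw [Set.indicator_of_notMem, Set.indicator_of_notMem (s := Set.Ioo (0 : ℝ) 1 ×ˢ Set.Ioo (-π) π)]
      · simp
      · exact fun h => h1 h.1.2
      · have : (0 : ℝ) < p.1 := hp'.1
        simpa [abs_of_pos this] using h1
  · rw [Set.indicator_of_notMem hp, Set.indicator_of_notMem]
    rw [polarCoord_target] at hp
    exact fun h => hp ⟨h.1.1, h.2⟩

lemma integral_circle_mean {G : ℂ → ℂ} (hG : DifferentiableOn ℂ G (Metric.ball 0 1)) {r : ℝ}
    (h0 : 0 < r) (h1 : r < 1) :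
    ∫ θ in Set.Ioo (-π) π, G (circleMap 0 r θ) = 2 * π * G 0 := by
  have hsub : Metric.closedBall (0 : ℂ) |r| ⊆ Metric.ball 0 1 := by
    rw [abs_of_pos h0]; exact Metric.closedBall_subset_ball h1
  have h := DiffContOnCl.circleAverage (f := G) (c := 0) (R := r)
    ((hG.mono hsub).diffContOnCl_ball subset_rfl)
  rw [Real.circleAverage_def] at h
  have hp : Function.Periodic (fun θ => G (circleMap 0 r θ)) (2 * π) := fun θ => by
    simp only [periodic_circleMap 0 r θ]
  have h2 := hp.intervalIntegral_add_eq 0 (-π)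
  rw [zero_add, show -π + 2 * π = π by ring] at h2
  rw [← integral_Ioc_eq_integral_Ioo, ← intervalIntegral.integral_of_le (by linarith [pi_pos]), ← h2, ← h]
  have : (π : ℂ) ≠ 0 := mod_cast Real.pi_ne_zero
  rw [Complex.real_smul]
  push_cast
  field_simp

/-- The hyperbolic cosine of the distance to `i`, in the disc model. -/
def coshD (r : ℝ) : ℝ := (1 + r ^ 2) / (1 - r ^ 2)

lemma one_le_coshD {r : ℝ} (h0 : 0 ≤ r) (h1 : r < 1) : 1 ≤ coshD r := by
  have : 0 < 1 - r ^ 2 := by nlinarith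
  rw [coshD, le_div_iff₀ this]; nlinarith

/-- The radial weight. -/
def radW (A r : ℝ) : ℝ :=
  4 / (1 - r ^ 2) ^ 2 * ((A * coshD r ^ 2 - 1 / (2 * π)) * rexp (-(π * A * (coshD r ^ 2 - 1))))

lemma radW_bound {A : ℝ} (hA : 0 < A) {K : ℝ} : ∃ B, ∀ r, 0 ≤ r → r < 1 →
    |radW A r| * rexp (K * coshD r) ≤ B := by
  refine ⟨(A + 1) * rexp (π * A + (4 + K) ^ 2 / (4 * (π * A))), fun r h0 h1 => ?_⟩
  have hr : 0 < 1 - r ^ 2 := by nlinarith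
  have ht := one_le_coshD h0 h1
  set t := coshD r with htd
  have h4 : 4 / (1 - r ^ 2) ^ 2 = (t + 1) ^ 2 := by
    rw [htd, coshD]; field_simp; ring
  have hpi := Real.pi_gt_three
  have he1 : (t + 1) ^ 2 ≤ rexp (2 * t) := by
    rw [two_mul, Real.exp_add, ← sq]
    exact pow_le_pow_left₀ (by linarith) (Real.add_one_le_exp t) 2
  have he2 : |A * t ^ 2 - 1 / (2 * π)| ≤ (A + 1) * rexp (2 * t) := by
    have h5 : 1 / (2 * π) ≤ 1 := by rw [div_le_one (by positivity)]; linarith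
    have h6 : 0 ≤ 1 / (2 * π) := by positivity
    have h7 : t ^ 2 ≤ rexp (2 * t) := le_trans (by nlinarith) he1
    have h8 : (1 : ℝ) ≤ rexp (2 * t) := Real.one_le_exp (by linarith)
    rw [abs_le]
    constructor <;> nlinarith
  rw [radW, h4, abs_mul, abs_mul, abs_of_nonneg (sq_nonneg (t + 1)), Real.abs_exp]
  calc (t + 1) ^ 2 * (|A * t ^ 2 - 1 / (2 * π)| * rexp (-(π * A * (t ^ 2 - 1)))) * rexp (K * t)
      ≤ rexp (2 * t) * ((A + 1) * rexp (2 * t) * rexp (-(π * A * (t ^ 2 - 1)))) * rexp (K * t) := by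
        gcongr
    _ = (A + 1) * rexp (π * A + ((4 + K) * t - π * A * t ^ 2)) := by
        rw [show π * A + ((4 + K) * t - π * A * t ^ 2) = 2 * t + 2 * t + -(π * A * (t ^ 2 - 1)) + K * t by ring,
          Real.exp_add, Real.exp_add, Real.exp_add]
        ring
    _ ≤ _ := by
        gcongr
        exact linear_sub_sq_le (by positivity) _ _

lemma coshD_hasDerivAt {r : ℝ} (h1 : r ^ 2 ≠ 1) : HasDerivAt coshD (4 * r / (1 - r ^ 2) ^ 2) r := by
  have hne : 1 - r ^ 2 ≠ 0 := fun h => h1 (by linarith)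
  have h2 : HasDerivAt (fun r : ℝ => r ^ 2) (2 * r) r := by simpa using hasDerivAt_pow 2 r
  have := (h2.const_add 1).div (h2.const_sub 1) hne
  refine HasDerivAt.congr_deriv this ?_
  field_simp
  ring

lemma integral_radW {A : ℝ} (hA : 0 < A) :
    ∫ r in Set.Ioo (0 : ℝ) 1, ((r * radW A r : ℝ) : ℂ) * (2 * π) = 1 := by
  rw [integral_mul_const, integral_complex_ofReal]
  have hd : ∀ r ∈ Set.Ioo (0 : ℝ) 1, HasDerivAt (fun r => -(coshD r / (2 * π)) * rexp (-(π * A * (coshD r ^ 2 - 1))))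
      (r * radW A r) r := by
    rintro r ⟨h0, h1⟩
    have hr : r ^ 2 ≠ 1 := by nlinarith
    have hne : 1 - r ^ 2 ≠ 0 := fun h => hr (by linarith)
    have h := coshD_hasDerivAt hr
    have hpi := Real.pi_ne_zero
    have := (h.div_const (2 * π)).neg.mul ((((h.pow 2).sub_const 1).const_mul (π * A)).neg.exp)
    refine HasDerivAt.congr_deriv this ?_
    rw [radW]
    simp only [Nat.cast_ofNat, Nat.add_one_sub_one, pow_one, Pi.pow_apply, Pi.neg_apply]
    field_simp
    ring
  obtain ⟨B, hB⟩ := radW_bound hA (K := 0)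
  have hc : ContinuousOn (radW A) (Set.Ioo 0 1) := by
    have hne : ∀ x ∈ Set.Ioo (0 : ℝ) 1, 1 - x ^ 2 ≠ 0 := by
      rintro x ⟨h0, h1⟩ h
      nlinarith
    unfold radW coshD
    fun_prop (disch := first | assumption | (intro x hx; exact pow_ne_zero 2 (hne x hx)))
  have h_int : IntervalIntegrable (fun r => r * radW A r) volume 0 1 := by
    rw [intervalIntegrable_iff_integrableOn_Ioo_of_le zero_le_one]
    refine integrableOn_of_continuousOn_bound measurableSet_Ioo (by simp)
      (continuousOn_id.mul hc) (B := B) fun r hr => ?_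
    have := hB r hr.1.le hr.2
    simp only [zero_mul, Real.exp_zero, mul_one] at this
    rw [norm_eq_abs, abs_mul, abs_of_pos hr.1]
    nlinarith [hr.2, abs_nonneg (radW A r)]
  have hlim0 : Tendsto (fun r => -(coshD r / (2 * π)) * rexp (-(π * A * (coshD r ^ 2 - 1)))) (𝓝[>] 0)
      (𝓝 (-(1 / (2 * π)))) := by
    have hc0 : ContinuousAt coshD 0 := (coshD_hasDerivAt (r := 0) (by norm_num)).continuousAt
    have : ContinuousAt (fun r => -(coshD r / (2 * π)) * rexp (-(π * A * (coshD r ^ 2 - 1)))) 0 := by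
      fun_prop
    have h := this.tendsto
    simp only [show coshD 0 = 1 by simp [coshD]] at h
    rw [show -(1 / (2 * π)) * rexp (-(π * A * (1 ^ 2 - 1))) = -(1 / (2 * π)) by simp] at h
    exact h.mono_left nhdsWithin_le_nhds
  have hcosh : Tendsto coshD (𝓝[<] 1) atTop := by
    have h1 : Tendsto (fun r : ℝ => 1 - r ^ 2) (𝓝[<] 1) (𝓝[>] 0) := by
      refine tendsto_nhdsWithin_iff.mpr ⟨?_, ?_⟩
      · have : Tendsto (fun r : ℝ => 1 - r ^ 2) (𝓝 1) (𝓝 (1 - 1 ^ 2)) := by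
          apply Continuous.tendsto; fun_prop
        simpa using this.mono_left nhdsWithin_le_nhds
      · have : Set.Ioo (0 : ℝ) 1 ∈ 𝓝[<] (1 : ℝ) := Ioo_mem_nhdsLT one_pos
        filter_upwards [this] with r hr
        simp only [Set.mem_Ioi]
        nlinarith [hr.1, hr.2]
    have h2 : Tendsto (fun r : ℝ => 1 + r ^ 2) (𝓝[<] 1) (𝓝 (1 + 1 ^ 2)) := by
      refine Tendsto.mono_left ?_ nhdsWithin_le_nhds
      apply Continuous.tendsto; fun_prop
    have := h2.pos_mul_atTop (by norm_num) (tendsto_inv_nhdsGT_zero.comp h1)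
    exact this
  have hlim1 : Tendsto (fun r => -(coshD r / (2 * π)) * rexp (-(π * A * (coshD r ^ 2 - 1)))) (𝓝[<] 1)
      (𝓝 0) := by
    have key : Tendsto (fun t : ℝ => -(t / (2 * π)) * rexp (-(π * A * (t ^ 2 - 1)))) atTop (𝓝 0) := by
      have h3 : Tendsto (fun t : ℝ => t ^ 1 * rexp (-t)) atTop (𝓝 0) :=
        Real.tendsto_pow_mul_exp_neg_atTop_nhds_zero 1
      have h4 := h3.const_mul (rexp (π * A + 1 ^ 2 / (4 * (π * A))))
      rw [mul_zero] at h4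
      refine squeeze_zero_norm' ?_ h4
      filter_upwards [eventually_ge_atTop 1] with t ht
      have hpi := Real.pi_gt_three
      have h5 := linear_sub_sq_le (a := π * A) (by positivity) 1 t
      rw [norm_mul, norm_neg, norm_eq_abs, norm_eq_abs, Real.abs_exp, abs_of_pos (by positivity)]
      have h6 : t / (2 * π) ≤ t := div_le_self (by linarith) (by linarith)
      calc t / (2 * π) * rexp (-(π * A * (t ^ 2 - 1)))
          ≤ t * rexp (π * A + 1 ^ 2 / (4 * (π * A)) + -t) := by
            gcongr
            linarith
        _ = _ := by rw [Real.exp_add]; ring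
    exact key.comp hcosh
  have := intervalIntegral.integral_eq_sub_of_hasDerivAt_of_tendsto one_pos hd h_int hlim0 hlim1
  rw [intervalIntegral.integral_of_le zero_le_one, integral_Ioc_eq_integral_Ioo] at this
  rw [this]
  have hpi : (π : ℂ) ≠ 0 := mod_cast Real.pi_ne_zero
  push_cast
  field_simp
  ring

/-- The Cayley transform. -/
def cay (u : ℂ) : ℂ := I * (1 + u) / (1 - u)

/-- The hyperbolic cosine of the distance to `i`. -/
def tH (w : ℂ) : ℝ := (normSq w + 1) / (2 * w.im)

lemma one_sub_ne_zero_of_mem {u : ℂ} (hu : u ∈ Metric.ball (0 : ℂ) 1) : 1 - u ≠ 0 := by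
  intro h
  have : u = 1 := by linear_combination -h
  simp [this] at hu

lemma cay_im {u : ℂ} (hu : 1 - u ≠ 0) : (cay u).im = (1 - ‖u‖ ^ 2) / normSq (1 - u) := by
  have hn : normSq (1 - u) ≠ 0 := by simpa using hu
  rw [cay, div_im, ← normSq_eq_norm_sq]
  field_simp
  simp [normSq_apply]
  ring

lemma normSq_cay {u : ℂ} (hu : 1 - u ≠ 0) : normSq (cay u) + 1 = 2 * (1 + ‖u‖ ^ 2) / normSq (1 - u) := by
  have hn : normSq (1 - u) ≠ 0 := by simpa using hu
  rw [cay, normSq_div, ← normSq_eq_norm_sq]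
  field_simp
  simp [normSq_apply]
  ring

lemma norm_sq_lt_one {u : ℂ} (hu : u ∈ Metric.ball (0 : ℂ) 1) : 0 < 1 - ‖u‖ ^ 2 := by
  have h1 : ‖u‖ < 1 := by simpa using hu
  nlinarith [norm_nonneg u]

lemma cay_im_pos {u : ℂ} (hu : u ∈ Metric.ball (0 : ℂ) 1) : 0 < (cay u).im := by
  rw [cay_im (one_sub_ne_zero_of_mem hu)]
  exact div_pos (norm_sq_lt_one hu) (normSq_pos.mpr (one_sub_ne_zero_of_mem hu))

lemma tH_cay {u : ℂ} (hu : u ∈ Metric.ball (0 : ℂ) 1) : tH (cay u) = coshD ‖u‖ := by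
  have h1 := one_sub_ne_zero_of_mem hu
  have hn : normSq (1 - u) ≠ 0 := by simpa using h1
  have h2 := (norm_sq_lt_one hu).ne'
  rw [tH, normSq_cay h1, cay_im h1, coshD]
  field_simp

lemma cay_image : cay '' Metric.ball (0 : ℂ) 1 = {z : ℂ | 0 < z.im} := by
  ext w
  constructor
  · rintro ⟨u, hu, rfl⟩
    exact cay_im_pos hu
  · intro (hw : 0 < w.im)
    have hne : w + I ≠ 0 := fun h => by
      have := congrArg Complex.im h
      simp at this
      linarith
    refine ⟨(w - I) / (w + I), ?_, ?_⟩
    · rw [mem_ball_zero_iff, norm_div, div_lt_one (norm_pos_iff.mpr hne)]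
      rw [← sq_lt_sq₀ (norm_nonneg _) (norm_nonneg _), ← normSq_eq_norm_sq, ← normSq_eq_norm_sq]
      simp [normSq_apply]
      nlinarith
    · have h2 : 1 - (w - I) / (w + I) = 2 * I / (w + I) := by field_simp; ring
      rw [cay, h2]
      field_simp
      ring

lemma cay_injOn : Set.InjOn cay (Metric.ball (0 : ℂ) 1) := by
  intro u hu v hv h
  have h1 := one_sub_ne_zero_of_mem hu
  have h2 := one_sub_ne_zero_of_mem hv
  rw [cay, cay, div_eq_div_iff h1 h2] at h
  have : 2 * I * (u - v) = 0 := by linear_combination h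
  simpa [sub_eq_zero] using this

lemma cay_hasDerivAt {u : ℂ} (hu : 1 - u ≠ 0) : HasDerivAt cay (2 * I / (1 - u) ^ 2) u := by
  have h := (((hasDerivAt_id u).const_add 1).const_mul I).div ((hasDerivAt_id u).const_sub 1) hu
  refine HasDerivAt.congr_deriv h ?_
  simp only [id]
  field_simp
  ring

lemma det_restrictScalars_toSpanSingleton (c : ℂ) :
    ((ContinuousLinearMap.toSpanSingleton ℂ c).restrictScalars ℝ : ℂ →L[ℝ] ℂ).det = normSq c := by
  rw [← Algebra.norm_complex_apply, Algebra.norm_apply, ContinuousLinearMap.det]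
  congr 1
  ext <;> simp [mul_comm]

/-- The change of variables from the upper half plane to the disc. -/
lemma uhp_to_disc (Φ : ℂ → ℂ) :
    (Integrable (fun w : ℍ => Φ w) ↔
      IntegrableOn (fun u : ℂ => ((4 / (1 - ‖u‖ ^ 2) ^ 2 : ℝ) : ℂ) * Φ (cay u)) (Metric.ball 0 1)) ∧
    ∫ w : ℍ, Φ w = ∫ u in Metric.ball (0 : ℂ) 1, ((4 / (1 - ‖u‖ ^ 2) ^ 2 : ℝ) : ℂ) * Φ (cay u) := by
  have hder : ∀ u ∈ Metric.ball (0 : ℂ) 1, HasFDerivWithinAt cay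
      ((ContinuousLinearMap.toSpanSingleton ℂ (2 * I / (1 - u) ^ 2)).restrictScalars ℝ) (Metric.ball 0 1) u := fun u hu =>
    ((cay_hasDerivAt (one_sub_ne_zero_of_mem hu)).hasFDerivAt.restrictScalars ℝ).hasFDerivWithinAt
  have hm : MeasurableSet (Metric.ball (0 : ℂ) 1) := Metric.isOpen_ball.measurableSet
  have hcongr : ∀ u ∈ Metric.ball (0 : ℂ) 1,
      |((ContinuousLinearMap.toSpanSingleton ℂ (2 * I / (1 - u) ^ 2)).restrictScalars ℝ : ℂ →L[ℝ] ℂ).det| •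
        (((cay u).im ^ 2)⁻¹ : ℝ) • Φ (cay u) = ((4 / (1 - ‖u‖ ^ 2) ^ 2 : ℝ) : ℂ) * Φ (cay u) := fun u hu => by
    have h1 := one_sub_ne_zero_of_mem hu
    have hn : normSq (1 - u) ≠ 0 := by simpa using h1
    have h2 := (norm_sq_lt_one hu).ne'
    rw [det_restrictScalars_toSpanSingleton, abs_of_nonneg (normSq_nonneg _), smul_smul, Complex.real_smul,
      cay_im h1, normSq_div, map_mul, map_pow]
    congr 2
    simp only [normSq_I, mul_one, show normSq 2 = 4 by norm_num [normSq_apply]]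
    field_simp
  constructor
  · rw [integrable_uhp_iff, ← cay_image,
      integrableOn_image_iff_integrableOn_abs_det_fderiv_smul volume hm hder cay_injOn]
    exact integrableOn_congr_fun hcongr hm
  · rw [integral_uhp, ← cay_image, integral_image_eq_integral_abs_det_fderiv_smul volume hm hder cay_injOn]
    exact setIntegral_congr_fun hm hcongr

/-- A weighted mean value property on the upper half plane. -/
lemma mean_value_I {F : ℂ → ℂ} (hF : DifferentiableOn ℂ F {z | 0 < z.im}) {C K A : ℝ} (hA : 0 < A)
    (hb : ∀ w : ℂ, 0 < w.im → ‖F w‖ ≤ C * rexp (K * tH w)) :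
    Integrable (fun w : ℍ => F w * (((A * tH w ^ 2 - 1 / (2 * π)) * rexp (-(π * A * (tH w ^ 2 - 1))) : ℝ) : ℂ)) ∧
    ∫ w : ℍ, F w * (((A * tH w ^ 2 - 1 / (2 * π)) * rexp (-(π * A * (tH w ^ 2 - 1))) : ℝ) : ℂ) = F I := by
  have hcd : DifferentiableOn ℂ cay (Metric.ball 0 1) := fun u hu =>
    (cay_hasDerivAt (one_sub_ne_zero_of_mem hu)).differentiableAt.differentiableWithinAt
  have hFc : DifferentiableOn ℂ (fun u => F (cay u)) (Metric.ball 0 1) := hF.comp hcd fun u hu => cay_im_pos hu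
  have hcongr : ∀ u ∈ Metric.ball (0 : ℂ) 1, ((4 / (1 - ‖u‖ ^ 2) ^ 2 : ℝ) : ℂ) * (F (cay u) *
      (((A * tH (cay u) ^ 2 - 1 / (2 * π)) * rexp (-(π * A * (tH (cay u) ^ 2 - 1))) : ℝ) : ℂ)) =
      F (cay u) * (radW A ‖u‖ : ℝ) := fun u hu => by
    rw [tH_cay hu, radW]
    push_cast
    ring
  have hm : MeasurableSet (Metric.ball (0 : ℂ) 1) := Metric.isOpen_ball.measurableSet
  have hC : 0 ≤ C := by
    have := (norm_nonneg _).trans (hb I (by simp))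
    exact nonneg_of_mul_nonneg_left this (exp_pos _)
  obtain ⟨B, hB⟩ := radW_bound hA (K := K)
  have hcW : ContinuousOn (fun u : ℂ => F (cay u) * (radW A ‖u‖ : ℝ)) (Metric.ball 0 1) := by
    refine hFc.continuousOn.mul (continuous_ofReal.comp_continuousOn ?_)
    have hne : ∀ u ∈ Metric.ball (0 : ℂ) 1, 1 - ‖u‖ ^ 2 ≠ 0 := fun u hu => (norm_sq_lt_one hu).ne'
    unfold radW coshD
    fun_prop (disch := first | assumption | (intro x hx; exact pow_ne_zero 2 (hne x hx)))
  have hbd : ∀ u ∈ Metric.ball (0 : ℂ) 1, ‖F (cay u) * (radW A ‖u‖ : ℝ)‖ ≤ C * B := fun u hu => by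
    have h1 := hb _ (cay_im_pos hu)
    have h2 := hB ‖u‖ (norm_nonneg u) (by simpa using hu)
    rw [tH_cay hu] at h1
    rw [norm_mul, norm_real, norm_eq_abs]
    calc _ ≤ C * rexp (K * coshD ‖u‖) * |radW A ‖u‖| := by gcongr
      _ = C * (|radW A ‖u‖| * rexp (K * coshD ‖u‖)) := by ring
      _ ≤ _ := by gcongr
  have h := uhp_to_disc (fun w => F w * (((A * tH w ^ 2 - 1 / (2 * π)) * rexp (-(π * A * (tH w ^ 2 - 1))) : ℝ) : ℂ))
  constructor
  · rw [h.1, integrableOn_congr_fun hcongr hm]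
    exact integrableOn_of_continuousOn_bound hm measure_ball_lt_top.ne hcW hbd
  · rw [h.2, setIntegral_congr_fun hm hcongr, integral_ball_polar hcW hbd]
    have hin : ∀ r ∈ Set.Ioo (0 : ℝ) 1, ∫ θ in Set.Ioo (-π) π, (r : ℂ) *
        (F (cay (circleMap 0 r θ)) * (radW A ‖circleMap 0 r θ‖ : ℝ)) =
        (((r * radW A r : ℝ) : ℂ) * (2 * π)) * F I := by
      rintro r ⟨h0, h1⟩
      have hc0 : cay 0 = I := by simp [cay]
      have := integral_circle_mean hFc h0 h1
      rw [hc0] at this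
      have hn : ∀ θ, ‖circleMap 0 r θ‖ = r := fun θ => by simp [abs_of_pos h0]
      simp only [hn]
      rw [integral_const_mul, integral_mul_const, this]
      push_cast
      ring
    rw [setIntegral_congr_fun measurableSet_Ioo hin, integral_mul_const, integral_radW hA, one_mul]

/-- The mean value property at the CM point of a positive definite form. -/
theorem mean_value_form (hf : DifferentiableOn ℂ f {z | 0 < z.im}) {C K : ℝ} (hK : 0 ≤ K)
    (hb : ∀ w : ℍ, ‖f w‖ ≤ C * rexp (K * (w.im + w.im⁻¹))) {N v : ℝ} (hN : 0 < N) (hv : 0 < v)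
    {a b c : ℤ} (ha : 0 < a) (hd : b ^ 2 - 4 * a * c < 0) :
    Integrable (fun w : ℍ => f w * (kerM N v (formMat a b c) w : ℝ)) ∧
    ∫ w : ℍ, f w * (kerM N v (formMat a b c) w : ℝ) = f (cmPointC (formMat a b c)) := by
  set d : ℝ := 4 * a * c - b ^ 2 with hdd
  have hd0 : 0 < d := by
    have : ((b ^ 2 - 4 * a * c : ℤ) : ℝ) < 0 := mod_cast hd
    push_cast at this
    linarith
  have ha0 : (0 : ℝ) < a := mod_cast ha
  set s : ℝ := Real.sqrt d / (2 * a) with hs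
  have hs0 : 0 < s := by positivity
  have hsq : √s * √s = s := Real.mul_self_sqrt hs0.le
  have hsp : 0 < √s := Real.sqrt_pos.mpr hs0
  set u : ℝ := -b / (2 * a) with hu
  let h : SL2R := ⟨!![√s, u / √s; 0, 1 / √s], by rw [det_fin_two_of]; field_simp; ring⟩
  have hm : ∀ w : ℂ, moebius h w = s * w + u := fun w => by
    have hspc : ((√s : ℝ) : ℂ) ≠ 0 := mod_cast hsp.ne'
    have hsqc : ((√s : ℝ) : ℂ) * (√s : ℝ) = s := mod_cast hsq
    simp only [moebius, h, of_apply, cons_val', cons_val_zero, cons_val_one,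
      cons_val_fin_one]
    push_cast
    field_simp
    linear_combination w * hsqc
  have hqt : ∀ w : ℂ, 0 < w.im → qMat (formMat a b c) (s * w + u) = Real.sqrt d * tH w := fun w hw => by
    have hsd : Real.sqrt d = 2 * a * s := by rw [hs]; field_simp
    have hdd' : s ^ 2 = d / (4 * a ^ 2) := by rw [hs, div_pow, Real.sq_sqrt hd0.le]; ring
    rw [qMat_formMat, qR, tH, hsd]
    simp only [add_re, add_im, Complex.mul_re, Complex.mul_im, ofReal_re, Complex.ofReal_im,
      zero_mul, sub_zero, add_zero, normSq_apply]
    rw [mul_div_assoc', div_eq_div_iff (by positivity) (by positivity)]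
    have h4 : (4 * a ^ 2 : ℝ) * s ^ 2 = 4 * a * c - b ^ 2 := by rw [hdd', hdd]; field_simp
    have h5 : 2 * a * u = -b := by rw [hu]; field_simp
    have h6 : (4 * a : ℝ) * ((a * ((s * w.re + u) * (s * w.re + u) + s * w.im * (s * w.im)) + b * (s * w.re + u) + c)) =
        4 * a ^ 2 * s ^ 2 * (w.re * w.re + w.im * w.im + 1) := by
      linear_combination -h4 + (4 * a * s * w.re + 2 * a * u + b) * h5
    have h7 : (4 * a : ℝ) ≠ 0 := by positivity
    refine mul_left_cancel₀ h7 ?_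
    linear_combination (2 * w.im) * h6
  set A : ℝ := v * d / N with hA
  have hA0 : 0 < A := by positivity
  have hker : ∀ w : ℂ, 0 < w.im → kerM N v (formMat a b c) (s * w + u) =
      (A * tH w ^ 2 - 1 / (2 * π)) * rexp (-(π * A * (tH w ^ 2 - 1))) := fun w hw => by
    have hdet : (4 : ℝ) * (formMat a b c).det = d := by rw [formMat_det, hdd]; ring
    rw [kerM, hqt w hw, hdet, mul_pow, Real.sq_sqrt hd0.le, hA]
    congr 2 <;> ring
  have him : ∀ w : ℂ, 0 < w.im → 0 < ((s : ℂ) * w + u).im := fun w hw => by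
    simp; positivity
  have hb' : ∀ w : ℂ, 0 < w.im → ‖f (s * w + u)‖ ≤ C * rexp ((K * (2 * s + 2 / s)) * tH w) := fun w hw => by
    have hC : 0 ≤ C := by
      have := (norm_nonneg _).trans (hb UpperHalfPlane.I)
      exact nonneg_of_mul_nonneg_left this (exp_pos _)
    have h1 := hb ⟨s * w + u, him w hw⟩
    refine h1.trans ?_
    have h2 : UpperHalfPlane.im ⟨s * w + u, him w hw⟩ = s * w.im := by simp [UpperHalfPlane.im]
    rw [h2]
    have ht1 : w.im ≤ 2 * tH w := by
      rw [tH, mul_div_assoc', le_div_iff₀ (by positivity), normSq_apply]; nlinarith [sq_nonneg w.re]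
    have ht2 : w.im⁻¹ ≤ 2 * tH w := by
      rw [tH, mul_div_assoc', le_div_iff₀ (by positivity)]
      have := normSq_nonneg w
      field_simp
      linarith
    have h3 : s * w.im + (s * w.im)⁻¹ ≤ (2 * s + 2 / s) * tH w := by
      rw [mul_inv]
      calc s * w.im + s⁻¹ * w.im⁻¹ ≤ s * (2 * tH w) + s⁻¹ * (2 * tH w) := by gcongr
        _ = _ := by field_simp
    rw [mul_assoc K]
    gcongr
  have hF : DifferentiableOn ℂ (fun w => f (s * w + u)) {z | 0 < z.im} :=
    hf.comp (f := fun w : ℂ => (s : ℂ) * w + u) (by fun_prop) fun w hw => him w hw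
  obtain ⟨h1, h2⟩ := mean_value_I hF hA0 hb'
  have hcoe : ∀ w : ℍ, ((h • w : ℍ) : ℂ) = s * w + u := fun w => by rw [coe_smul_eq_moebius, hm]
  have hmp : MeasurePreserving (fun w : ℍ => h • w) volume volume :=
    measurePreserving_smul h (volume : Measure ℍ)
  have hme : MeasurableEmbedding (fun w : ℍ => h • w) := measurableEmbedding_const_smul h
  have hcongr : ∀ w : ℍ, f (h • w : ℍ) * (kerM N v (formMat a b c) (h • w : ℍ) : ℝ) = f (s * w + u) *
      (((A * tH w ^ 2 - 1 / (2 * π)) * rexp (-(π * A * (tH w ^ 2 - 1))) : ℝ) : ℂ) := fun w => by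
    rw [hcoe, hker w w.coe_im_pos]
  constructor
  · rw [← hmp.integrable_comp_emb hme]
    refine h1.congr (.of_forall fun w => (hcongr w).symm)
  · rw [← hmp.integral_comp hme]
    simp only [hcongr]
    rw [h2]
    congr 1
    rw [cmPointC, formMat_det]
    have h8 : √((a : ℝ) * c - b ^ 2 / 4) = √d / 2 := by
      rw [show (a : ℝ) * c - b ^ 2 / 4 = d / 2 ^ 2 by rw [hdd]; ring, Real.sqrt_div' _ (by positivity),
        Real.sqrt_sq (by norm_num)]
    rw [h8, hs, hu]
    have : (a : ℂ) ≠ 0 := mod_cast ha.ne'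
    simp [formMat]
    field_simp
    ring

/-- A chosen Atkin–Lehner matrix `W_e` of level `N`. -/
def alMat (N e : ℕ) : SL2R :=
  Classical.epsilon (· ∈ atkinLehnerSet N e)

lemma coprime_of_squarefree_mul (hN : Squarefree N) (he : e ∣ N) : Nat.Coprime e (N / e) := by
  rw [← Nat.mul_div_cancel' he] at hN
  exact Nat.coprime_of_squarefree_mul hN

lemma alMat_mem (hN : Squarefree N) (he : e ∣ N) : alMat N e ∈ atkinLehnerSet N e := by
  have hN0 := Nat.pos_of_ne_zero hN.ne_zero
  have h := exists_mem_atkinLehner (Nat.pos_of_dvd_of_pos he hN0)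
    (Nat.div_pos (Nat.le_of_dvd hN0 he) (Nat.pos_of_dvd_of_pos he hN0)) (coprime_of_squarefree_mul hN he)
  rw [Nat.mul_div_cancel' he] at h
  exact Classical.epsilon_spec h

/-- A partition of unity for `Γ₀(N)` induced by the one for the Fricke group. -/
def chi (N : ℕ) (w : ℂ) : ℝ :=
  ∑ e ∈ N.divisors, rho (FrickeGroup N) (1 / (2 * N)) (moebius (alMat N e) w)

lemma alMat_mul_mem (hN : Squarefree N) (he : e ∣ N) (hg : g ∈ atkinLehnerSet N 1) :
    alMat N e * g ∈ atkinLehnerSet N e := by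
  have h := one_mul_atkinLehner (mem_atkinLehner_inv hg) he (mem_atkinLehner_inv (alMat_mem hN he))
  simpa using mem_atkinLehner_inv h

lemma hasSum_chi (hN : Squarefree N) (hw : 0 < w.im) :
    HasSum (fun g : Gamma0SL2R N => chi N (moebius g.1 w)) 1 := by
  have hN0 := Nat.pos_of_ne_zero hN.ne_zero
  have hd : ∀ e : N.divisors, e.1 ∣ N := fun e => Nat.dvd_of_mem_divisors e.2
  have hm : ∀ g : Gamma0SL2R N, g.1 ∈ atkinLehnerSet N 1 := fun g => mem_gamma0SL2R_iff.mp g.2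
  let Φ : Gamma0SL2R N × N.divisors → FrickeGroup N := fun p =>
    ⟨alMat N p.2 * p.1.1, atkinLehner_subset_fricke hN (hd p.2) (alMat_mul_mem hN (hd p.2) (hm p.1))⟩
  have hΦ : Function.Bijective Φ := by
    constructor
    · rintro ⟨g, e⟩ ⟨g', e'⟩ h
      have h1 : alMat N e * g.1 = alMat N e' * g'.1 := congrArg Subtype.val h
      have h2 : e.1 = e'.1 := atkinLehner_unique hN (hd e) (hd e') (alMat_mul_mem hN (hd e) (hm g))
        (by rw [h1]; exact alMat_mul_mem hN (hd e') (hm g'))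
      rw [h2] at h1
      exact Prod.ext (Subtype.ext (mul_left_cancel h1)) (Subtype.ext h2)
    · intro g
      obtain ⟨e, he, hg⟩ := mem_fricke hN0 g.2
      refine ⟨(⟨(alMat N e)⁻¹ * g.1, ?_⟩, ⟨e, Nat.mem_divisors.mpr ⟨he, hN.ne_zero⟩⟩), ?_⟩
      · exact mem_gamma0SL2R_iff.mpr (atkinLehner_mul_self (Nat.pos_of_dvd_of_pos he hN0) he
          (mem_atkinLehner_inv (alMat_mem hN he)) hg)
      · exact Subtype.ext (by simp [Φ])
  have h := (Equiv.ofBijective Φ hΦ).hasSum_iff.mpr (hasSum_rho (oneCusp_fricke hN) hw)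
  refine h.prod_fiberwise fun g => ?_
  have h3 : chi N (moebius g.1 w) = ∑ e : N.divisors, rho (FrickeGroup N) (1 / (2 * N))
      (moebius (Φ (g, e)) w) := by
    rw [chi, ← Finset.sum_coe_sort]
    refine Finset.sum_congr rfl fun e _ => ?_
    simp only [Φ]
    rw [moebius_mul _ _ hw]
  rw [h3]
  exact hasSum_fintype _

lemma chi_nonneg (hN : Squarefree N) (hw : 0 < w.im) : 0 ≤ chi N w :=
  Finset.sum_nonneg fun _ _ => rho_nonneg (oneCusp_fricke hN) (im_moebius_pos _ hw)

lemma continuous_rho_moebius (hΓ : OneCusp Γ c₀) (g : SL2R) :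
    Continuous fun w : ℍ => rho Γ c₀ (moebius g w) := by
  rw [continuous_iff_continuousAt]
  intro w
  have h1 : ContinuousAt (rho Γ c₀) ((g • w : ℍ) : ℂ) :=
    (rho_contDiffAt (n := 0) hΓ (g • w).im_pos).continuousAt
  have h2 : ContinuousAt (fun w : ℍ => ((g • w : ℍ) : ℂ)) w :=
    (continuous_coe.comp (continuous_const_smul g)).continuousAt
  have := ContinuousAt.comp (f := fun w : ℍ => ((g • w : ℍ) : ℂ)) h1 h2
  refine this.congr (.of_forall fun x => ?_)
  simp only [Function.comp, coe_smul_eq_moebius]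

lemma continuous_chi (hN : Squarefree N) : Continuous fun w : ℍ => chi N w := by
  unfold chi
  exact continuous_finsetSum _ fun e _ => continuous_rho_moebius (oneCusp_fricke hN) _

lemma integrable_rho_mul (hΓ : OneCusp Γ c₀) (g : SL2R) {Φ : ℍ → ℂ}
    (hΦ : Integrable Φ) : Integrable fun w : ℍ => (rho Γ c₀ (moebius g w) : ℂ) * Φ w := by
  refine hΦ.bdd_mul (c := 1) ?_ (.of_forall fun w => ?_)
  · exact (continuous_ofReal.comp (continuous_rho_moebius hΓ g)).aestronglyMeasurable
  · rw [norm_real, Real.norm_of_nonneg (rho_nonneg hΓ (im_moebius_pos g w.im_pos))]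
    exact rho_le_one hΓ (im_moebius_pos g w.im_pos)

lemma integral_smul_comp (g : SL2R) (Φ : ℍ → ℂ) : ∫ w : ℍ, Φ (g • w) = ∫ w : ℍ, Φ w :=
  (measurePreserving_smul g (volume : Measure ℍ)).integral_comp (measurableEmbedding_const_smul g) Φ

/-- `M ↦ M ∘ W_e⁻¹` as an equivalence between the lattice cosets attached to `1` and to `e`. -/
def seEquiv {e e' : ℕ} (he : 0 < e) (hc : Nat.Coprime e e') {g : SL2R} (hg : g ∈ atkinLehnerSet (e * e') e)
    (r D : ℤ) : SE 1 (e * e') r D ≃ SE e e' r D where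
  toFun M := ⟨actM M.1 g⁻¹, actM_mem_SE he (mem_atkinLehner_inv hg) M.2⟩
  invFun M := ⟨actM M.1 g, actM_mem_SE_one he hc hg M.2⟩
  left_inv M := Subtype.ext (by simp [← actM_mul, actM_one])
  right_inv M := Subtype.ext (by simp [← actM_mul, actM_one])

lemma hasSum_integral_SE (hN : Squarefree N)
    (hfc : Continuous fun w : ℍ => f w) (hf : ∀ g ∈ FrickeGroup N, ∀ z : ℂ, 0 < z.im → f (moebius g z) = f z)
    (ha : HasQExp f a n₀) (hee : e * e' = N) (hτ : 0 < τ.im) (z : ℂ) {x : ℤ × ℤ}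
    (hx : x.2 ^ 2 - 4 * N * x.1 < 0) :
    HasSum (fun M : SE 1 N x.2 (x.2 ^ 2 - 4 * N * x.1) => qc τ ^ x.1 * qc z ^ x.2 *
        ∫ w : ℍ, (rho (FrickeGroup N) (1 / (2 * N)) (moebius (alMat N e) w) : ℂ) * (f w * (kerM N τ.im M.1 w : ℝ)))
      (∫ w : ℍ, (rho (FrickeGroup N) (1 / (2 * N)) w : ℂ) * (f w * thetaCoeff e e' τ z w x)) := by
  subst hee
  have hN0 := Nat.pos_of_ne_zero hN.ne_zero
  have he : 0 < e := Nat.pos_of_mul_pos_right hN0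
  have he' : 0 < e' := Nat.pos_of_mul_pos_left hN0
  have hed : e ∣ e * e' := dvd_mul_right _ _
  have hc : Nat.Coprime e e' := Nat.coprime_of_squarefree_mul hN
  have hal := alMat_mem hN hed
  push_cast at hx ⊢
  have h := hasSum_integral_definite (oneCusp_fricke hN) hfc ha he he' hτ z hx
  have h2 := ((fibEquiv he he' x).symm.hasSum_iff.mpr h)
  have h3 := (seEquiv he hc hal x.2 (x.2 ^ 2 - 4 * (e * e') * x.1)).hasSum_iff.mpr h2
  refine hasSum_of_forall_eq (by push_cast at h3; exact h3) fun M => ?_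
  simp only [Function.comp]
  have h4 : ∀ w : ℍ, thetaTerm e e' τ z w ((fibEquiv he he' x).symm (seEquiv he hc hal x.2 _ M)).1 =
      qc τ ^ x.1 * qc z ^ x.2 * (kerM (e * e') τ.im (actM M.1 (alMat (e * e') e)⁻¹) w : ℝ) := fun w => by
    rw [thetaTerm_eq, ((fibEquiv he he' x).symm _).2, ← fibEquiv_coe he he' x, Equiv.apply_symm_apply]
    rfl
  simp only [h4]
  rw [← integral_const_mul]
  symm
  rw [← integral_smul_comp (alMat (e * e') e)]
  refine integral_congr_ae (.of_forall fun w => ?_)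
  simp only [coe_smul_eq_moebius]
  rw [hf _ (atkinLehner_subset_fricke hN hed hal) _ w.im_pos, kerM_actM _ _ _ _ (im_moebius_pos _ w.im_pos),
    ← moebius_mul _ _ w.im_pos, inv_mul_cancel, moebius_one]
  push_cast
  ring

lemma mem_QdNh_iff {d : ℤ} {h : ℤ} {M : Mat₂} :
    M ∈ QdNh d N h ↔ M ∈ SE 1 N h (-d) ∧ 0 < M 0 0 := by
  constructor
  · rintro ⟨a, b, c, rfl, ha, hd, ⟨a', rfl⟩, hb⟩
    have h1 := (ZMod.intCast_eq_intCast_iff_dvd_sub b h (2 * N)).mp hb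
    push_cast at h1
    have h2 : (2 : ℤ) ∣ h - b := (dvd_mul_right _ _).trans h1
    refine ⟨⟨a', b, c, by simp, by push_cast; linarith, h1, by push_cast; omega⟩, ?_⟩
    · exact Int.cast_pos (R := ℝ).mpr ha
  · rintro ⟨⟨a, b, c, rfl, hd, h1, -⟩, ha⟩
    refine ⟨N * a, b, c, by simp, ?_, by push_cast at hd; linarith, dvd_mul_right _ _, ?_⟩
    · simpa [formMat, -Int.cast_mul, -mul_pos_iff_of_pos_left] using ha
    · exact (ZMod.intCast_eq_intCast_iff_dvd_sub b h (2 * N)).mpr (by push_cast; exact h1)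

lemma actM_mem_QdNh {d : ℤ} (hd : 0 < d) {h : ℤ} {M : Mat₂} (hM : M ∈ QdNh d N h)
    (hg : g ∈ Gamma0SL2R N) : actM M g ∈ QdNh d N h := by
  have h1 := mem_QdNh_iff.mp hM
  refine mem_QdNh_iff.mpr ⟨?_, ?_⟩
  · have := actM_mem_SE (e := 1) (e' := N) one_pos (g := g) (by rw [one_mul]; exact mem_gamma0SL2R_iff.mp hg)
      (by rw [one_mul]; exact h1.1)
    exact this
  · obtain ⟨a, b, c, rfl, ha, hdd, -, -⟩ := hM
    have hg1 := det_eq_one g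
    have hdR : (4 : ℝ) * a * c - b ^ 2 = d := mod_cast (by linarith : 4 * a * c - b ^ 2 = d)
    have haR : (0 : ℝ) < a := mod_cast ha
    have hd0 : (0 : ℝ) < d := mod_cast hd
    rw [actM_apply]
    simp only [formMat, of_apply, cons_val', cons_val_zero, cons_val_one,
      cons_val_fin_one]
    have key : 4 * a * (g.1 0 0 ^ 2 * a + g.1 0 0 * g.1 1 0 * (b / 2 + b / 2) + g.1 1 0 ^ 2 * c) =
        (2 * a * g.1 0 0 + b * g.1 1 0) ^ 2 + d * g.1 1 0 ^ 2 := by rw [← hdR]; ring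
    refine pos_of_mul_pos_right (a := 4 * (a : ℝ)) ?_ (by positivity)
    rw [key]
    by_cases h0 : g.1 1 0 = 0
    · have : g.1 0 0 ≠ 0 := fun h => by rw [h, h0] at hg1; norm_num at hg1
      rw [h0]
      have h3 : 0 < (2 * (a : ℝ) * g.1 0 0) ^ 2 := by positivity
      linarith
    · have : 0 < (d : ℝ) * g.1 1 0 ^ 2 := by positivity
      positivity

lemma integrable_form (hf : DifferentiableOn ℂ f {z | 0 < z.im}) {C K : ℝ} (hK : 0 ≤ K)
    (hb : ∀ w : ℍ, ‖f w‖ ≤ C * rexp (K * (w.im + w.im⁻¹))) {N v : ℝ} (hN : 0 < N) (hv : 0 < v)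
    {a b c : ℤ} (hd : b ^ 2 - 4 * a * c < 0) :
    Integrable (fun w : ℍ => f w * (kerM N v (formMat a b c) w : ℝ)) := by
  rcases lt_trichotomy a 0 with ha | ha | ha
  · have h := (mean_value_form hf hK hb hN hv (a := -a) (b := -b) (c := -c) (by omega) (by linarith)).1
    simpa only [← neg_formMat, kerM_neg] using h
  · subst ha
    nlinarith [sq_nonneg b]
  · exact (mean_value_form hf hK hb hN hv ha hd).1

/-- The orbital integral of a form against the partition of unity of `Γ₀(N)`. -/
def orbInt (f : ℂ → ℂ) (N : ℕ) (v : ℝ) (M : Mat₂) : ℂ :=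
  ∫ w : ℍ, (chi N w : ℂ) * (f w * (kerM N v M w : ℝ))

lemma orbInt_neg (f : ℂ → ℂ) (N : ℕ) (v : ℝ) (M : Mat₂) :
    orbInt f N v (-M) = orbInt f N v M := by simp only [orbInt, kerM_neg]

lemma hasSum_orbInt (hN : Squarefree N)
    (hfd : DifferentiableOn ℂ f {z | 0 < z.im})
    (hf : ∀ g ∈ FrickeGroup N, ∀ z : ℂ, 0 < z.im → f (moebius g z) = f z)
    (ha : HasQExp f a n₀) (hτ : 0 < τ.im) (z : ℂ) {x : ℤ × ℤ}
    (hx : x.2 ^ 2 - 4 * N * x.1 < 0) :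
    HasSum (fun M : SE 1 N x.2 (x.2 ^ 2 - 4 * N * x.1) => qc τ ^ x.1 * qc z ^ x.2 * orbInt f N τ.im M.1)
      (∑ e ∈ N.divisors, ∫ w : ℍ, (rho (FrickeGroup N) (1 / (2 * N)) w : ℂ) *
        (f w * thetaCoeff e (N / e) τ z w x)) := by
  have hN0 := Nat.pos_of_ne_zero hN.ne_zero
  have hfc : Continuous fun w : ℍ => f w :=
    hfd.continuousOn.comp_continuous continuous_coe fun w => w.im_pos
  obtain ⟨C, -, hC⟩ := growth_upper (oneCusp_fricke hN) ha hf
  have h := hasSum_sum fun e (he : e ∈ N.divisors) =>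
    hasSum_integral_SE hN hfc hf ha (Nat.mul_div_cancel' (Nat.dvd_of_mem_divisors he)) hτ z hx
  refine hasSum_of_forall_eq h fun M => ?_
  rw [← Finset.mul_sum]
  congr 1
  obtain ⟨M, α, β, γ, rfl, hd, -, -⟩ := M
  have h_int := integrable_form hfd (by positivity) hC (N := N) (v := τ.im) (by exact_mod_cast hN0) hτ
    (a := 1 * N * α) (b := β) (c := γ) (by push_cast at hd; push_cast; linarith)
  rw [← integral_finsetSum _ fun e _ => by
    simpa using integrable_rho_mul (oneCusp_fricke hN) (alMat N e) h_int]
  rw [orbInt]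
  refine integral_congr_ae (.of_forall fun w => ?_)
  simp only [chi]
  push_cast
  rw [Finset.sum_mul]

lemma formRel_equivalence (Γ : Subgroup SL2R) (S : Set (Mat₂)) :
    Equivalence (formRel Γ S) where
  refl Q := ⟨1, Γ.one_mem, by simp⟩
  symm := by
    rintro Q Q' ⟨g, hg, h⟩
    refine ⟨g⁻¹, Γ.inv_mem hg, ?_⟩
    change Q.1 = actM Q'.1 g⁻¹
    rw [h]
    change Q.1 = actM (actM Q.1 g) g⁻¹
    rw [← actM_mul, mul_inv_cancel, actM_one]
  trans := by
    rintro Q Q' Q'' ⟨g, hg, h⟩ ⟨g', hg', h'⟩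
    refine ⟨g * g', Γ.mul_mem hg hg', ?_⟩
    change Q''.1 = actM Q.1 (g * g')
    rw [h', h, actM_mul]
    rfl

lemma quot_formRel_eq_iff {S : Set (Mat₂)} {Q Q' : S} :
    Quot.mk (formRel Γ S) Q = Quot.mk (formRel Γ S) Q' ↔ formRel Γ S Q Q' := by
  rw [Quot.eq, (formRel_equivalence Γ S).eqvGen_iff]

lemma cmPoint_re_im {a b c : ℤ} (ha : 0 < a) :
    (cmPointC (formMat a b c)).re = -b / (2 * a) ∧
    (cmPointC (formMat a b c)).im = √(formMat a b c).det / a := by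
  have h : cmPointC (formMat a b c) = ((-b / (2 * a) : ℝ) : ℂ) + ((√(formMat a b c).det / a : ℝ) : ℂ) * I := by
    have : (a : ℂ) ≠ 0 := mod_cast ha.ne'
    simp only [cmPointC, formMat, of_apply, cons_val', cons_val_zero, cons_val_one,
      cons_val_fin_one]
    push_cast
    field_simp
  rw [h]
  simp only [add_re, ofReal_re, mul_re, I_re, mul_zero, ofReal_im, I_im, sub_zero, add_zero, add_im,
    mul_im, mul_one, zero_add, and_self]

lemma qMat_cmPoint {a b c : ℤ} (ha : 0 < a) (hd : b ^ 2 - 4 * a * c < 0) :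
    0 < (cmPointC (formMat a b c)).im ∧
    qMat (formMat a b c) (cmPointC (formMat a b c)) ^ 2 = 4 * (formMat a b c).det := by
  obtain ⟨h1, h2⟩ := cmPoint_re_im (b := b) (c := c) ha
  have haR : (0 : ℝ) < a := mod_cast ha
  have hdet : 0 < (formMat a b c).det := by
    rw [formMat_det]
    have : (b : ℝ) ^ 2 - 4 * a * c < 0 := mod_cast hd
    linarith
  set s := √(formMat a b c).det with hs
  have hs2 : s ^ 2 = a * c - b ^ 2 / 4 := by rw [hs, Real.sq_sqrt hdet.le, formMat_det]
  have hs0 : 0 < s := Real.sqrt_pos.mpr hdet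
  refine ⟨by rw [h2]; positivity, ?_⟩
  have h3 : qMat (formMat a b c) (cmPointC (formMat a b c)) = 2 * s := by
    rw [qMat_formMat, qR, normSq_apply, h1, h2, div_eq_iff (by positivity)]
    field_simp
    linear_combination 4 * hs2 - 8 * hs2
  rw [h3, mul_pow, hs2, formMat_det]
  norm_num

lemma finite_quot_formRel (hN : Squarefree N) {d : ℤ} (hd : 0 < d) (h : ℤ) :
    Finite (Quot (formRel (Gamma0SL2R N) (QdNh d N h))) := by
  have hN0 := Nat.pos_of_ne_zero hN.ne_zero
  obtain ⟨C, hC⟩ := enQ_ge_of_cusp (c₁ := 1 / (2 * N)) (by positivity)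
  set B : ℤ := ⌈(d : ℝ) + C⌉ with hB
  have key : ∀ M : QdNh d N h, ∃ e : ℕ, e ∣ N ∧ ∃ g ∈ atkinLehnerSet N e, ∃ t : ℤ × ℤ × ℤ,
      t ∈ Set.Icc (-B) B ×ˢ Set.Icc (-B) B ×ˢ Set.Icc (-B) B ∧ actM M.1 g = formMat t.1 t.2.1 t.2.2 := by
    intro M
    have hM := mem_QdNh_iff.mp M.2
    obtain ⟨α, β, γ, hMe, hα, hdd, hNα, -⟩ := M.2
    obtain ⟨hw, hq⟩ := qMat_cmPoint (b := β) (c := γ) hα (by linarith)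
    obtain ⟨g, hg, hre, him⟩ := (oneCusp_fricke hN).reduce ⟨_, hw⟩
    obtain ⟨e, he, hge⟩ := mem_fricke hN0 hg
    have he0 : 0 < e := Nat.pos_of_dvd_of_pos he hN0
    have hge' := mem_atkinLehner_inv hge
    have h1 := actM_mem_SE (e := e) (e' := N / e) he0 (g := g⁻¹)
      (by rwa [Nat.mul_div_cancel' he]) (by rw [Nat.mul_div_cancel' he]; exact hM.1)
    obtain ⟨a, b, c, hf, hD, -, -⟩ := h1
    have heN : ((e : ℤ) * (N / e : ℕ)) = N := mod_cast Nat.mul_div_cancel' he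
    rw [heN] at hf hD
    set w' : ℍ := g • ⟨_, hw⟩ with hw'
    have hq' : qMat (actM M.1 g⁻¹) w' ^ 2 = d := by
      rw [qMat_actM _ _ w'.im_pos, ← coe_smul_eq_moebius, hw', inv_smul_smul, hMe]
      change qMat _ (cmPointC _) ^ 2 = _
      rw [hq, formMat_det]
      have : (β : ℝ) ^ 2 - 4 * α * γ = -d := mod_cast hdd
      linarith
    rw [hf, qMat_formMat] at hq'
    have ha0 : a ≠ 0 := by
      rintro rfl
      nlinarith [sq_nonneg b]
    have ha1 : (1 : ℝ) ≤ |((N * a : ℤ) : ℝ)| := by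
      exact_mod_cast Int.one_le_abs (mul_ne_zero (by exact_mod_cast hN0.ne') ha0)
    have h2 := hC ((N * a : ℤ) : ℝ) b c w' ha1 (le_trans hre (by norm_num)) him
    rw [enQ, hq'] at h2
    have hD' : (b : ℝ) ^ 2 - 4 * ((N * a : ℤ) : ℝ) * c = -d := mod_cast (by linarith)
    rw [hD'] at h2
    have h3 : |((N * a : ℤ) : ℝ)| + |(b : ℝ)| + |(c : ℝ)| ≤ B := by
      have := Int.le_ceil ((d : ℝ) + C)
      have h4 : 0 ≤ (w' : ℂ).im ^ 2 / 2 := by positivity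
      linarith
    have h3' : |(N * a : ℤ)| + |b| + |c| ≤ B := mod_cast h3
    refine ⟨e, he, g⁻¹, hge', (N * a, b, c), ?_, hf⟩
    have := abs_nonneg (N * a : ℤ)
    have := abs_nonneg b
    have := abs_nonneg c
    exact ⟨⟨by linarith [neg_abs_le (N * a : ℤ)], by linarith [le_abs_self (N * a : ℤ)]⟩,
      ⟨by linarith [neg_abs_le b], by linarith [le_abs_self b]⟩,
      ⟨by linarith [neg_abs_le c], by linarith [le_abs_self c]⟩⟩
  choose e he g hg t ht hfm using key
  have hfin : Finite (N.divisors × ↥(Set.Icc (-B) B ×ˢ Set.Icc (-B) B ×ˢ Set.Icc (-B) B)) := by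
    have : ((Set.Icc (-B) B ×ˢ Set.Icc (-B) B ×ˢ Set.Icc (-B) B)).Finite :=
      (Set.finite_Icc _ _).prod ((Set.finite_Icc _ _).prod (Set.finite_Icc _ _))
    have := this.to_subtype
    infer_instance
  refine Finite.of_injective (fun O : Quot (formRel (Gamma0SL2R N) (QdNh d N h)) =>
    ((⟨e O.out, Nat.mem_divisors.mpr ⟨he _, hN.ne_zero⟩⟩, ⟨t O.out, ht _⟩) :
      N.divisors × ↥(Set.Icc (-B) B ×ˢ Set.Icc (-B) B ×ˢ Set.Icc (-B) B))) fun O O' hOO => ?_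
  have h1 : e O.out = e O'.out := congrArg (fun p => p.1.1) hOO
  have h2 : t O.out = t O'.out := congrArg (fun p => p.2.1) hOO
  rw [← Quot.out_eq O, ← Quot.out_eq O', quot_formRel_eq_iff]
  refine ⟨g O.out * (g O'.out)⁻¹, mem_gamma0SL2R_iff.mpr (atkinLehner_mul_self
    (Nat.pos_of_dvd_of_pos (he _) hN0) (he O.out) (hg _) (by rw [h1]; exact mem_atkinLehner_inv (hg _))), ?_⟩
  change _ = actM _ _
  rw [actM_mul, hfm, h2, ← hfm, ← actM_mul, mul_inv_cancel, actM_one]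

/-- The stabilizer of a form in `Γ`. -/
abbrev StabSL (Γ : Subgroup SL2R) (M : Mat₂) : Type :=
  { g : SL2R // g ∈ Γ ∧ (g.1)ᵀ * M * g.1 = M }

lemma card_stab_eq (M : Mat₂) :
    Nat.card (StabSL (Gamma0SL2R N) M) = 2 * stabOrder (Gamma0SL2R N) M := by
  have hneg : (-1 : SL2R) ∈ Gamma0SL2R N := by
    rw [mem_gamma0SL2R_iff]
    refine ⟨-1, 0, 0, -1, ?_⟩
    ext i j
    fin_cases i <;> fin_cases j <;> simp
  let H : Subgroup SL2R :=
    { carrier := {g | g ∈ Gamma0SL2R N ∧ actM M g = M}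
      one_mem' := ⟨one_mem _, actM_one M⟩
      mul_mem' := fun {g h} hg hh => ⟨mul_mem hg.1 hh.1, by rw [actM_mul, hg.2, hh.2]⟩
      inv_mem' := fun {g} hg => ⟨inv_mem hg.1, by
        conv_lhs => rw [← hg.2]
        rw [← actM_mul, mul_inv_cancel, actM_one]⟩ }
  have hmem : (-1 : SL2R) ∈ H := ⟨hneg, by simp [actM]⟩
  have h2 : 2 ∣ Nat.card H := by
    have h3 : orderOf (⟨-1, hmem⟩ : H) = 2 := by
      refine orderOf_eq_prime (Subtype.ext (by simp)) fun h => ?_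
      have h4 := congrArg (fun g : SL2R => g.1 0 0) (congrArg Subtype.val h)
      norm_num at h4
    have h5 := orderOf_dvd_natCard (⟨-1, hmem⟩ : H)
    rwa [h3] at h5
  rw [stabOrder]
  exact (Nat.mul_div_cancel' h2).symm

lemma hasSum_orbit (hN : Squarefree N) {C K : ℝ} (hK : 0 ≤ K)
    (hb : ∀ w : ℍ, ‖f w‖ ≤ C * rexp (K * (w.im + w.im⁻¹))) (hfd : DifferentiableOn ℂ f {z | 0 < z.im})
    (hf : ∀ g ∈ FrickeGroup N, ∀ z : ℂ, 0 < z.im → f (moebius g z) = f z) (hv : 0 < v)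
    {d h : ℤ} (hd : 0 < d) (Q : QdNh d N h) :
    HasSum (fun g : Gamma0SL2R N => orbInt f N v (actM Q.1 g.1)) (f (cmPointC Q.1)) := by
  have hN0 := Nat.pos_of_ne_zero hN.ne_zero
  obtain ⟨M, α, β, γ, rfl, hα, hdd, -, -⟩ := Q
  obtain ⟨h1, h2⟩ := mean_value_form hfd hK hb (N := N) (v := v) (by exact_mod_cast hN0) hv hα
    (b := β) (c := γ) (by linarith)
  have : Countable (Gamma0SL2R N) :=
    have := (oneCusp_fricke hN).countable
    (Subgroup.inclusion_injective (gamma0_le_fricke N)).countable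
  have h3 := (hasSum_integral_unfold (Γ := Gamma0SL2R N) (χ := fun w : ℍ => chi N w)
    (continuous_chi hN).measurable (fun w => chi_nonneg hN w.im_pos)
    (fun w => hasSum_of_forall_eq (hasSum_chi hN w.im_pos) fun g => by
      rw [← coe_smul_eq_moebius]; rfl) h1).1
  rw [h2] at h3
  refine hasSum_of_forall_eq h3 fun g => ?_
  rw [orbInt]
  refine integral_congr_ae (.of_forall fun w => ?_)
  simp only
  rw [kerM_actM _ _ _ _ w.im_pos]
  change _ = (chi N w : ℂ) * (f ((g.1 • w : ℍ) : ℂ) * (kerM N v _ ((g.1 • w : ℍ) : ℂ) : ℝ))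
  rw [coe_smul_eq_moebius, hf _ (gamma0_le_fricke N g.2) _ w.im_pos]

lemma tsum_class (hN : Squarefree N) {C K : ℝ} (hK : 0 ≤ K)
    (hb : ∀ w : ℍ, ‖f w‖ ≤ C * rexp (K * (w.im + w.im⁻¹))) (hfd : DifferentiableOn ℂ f {z | 0 < z.im})
    (hf : ∀ g ∈ FrickeGroup N, ∀ z : ℂ, 0 < z.im → f (moebius g z) = f z) (hv : 0 < v)
    {d h : ℤ} (hd : 0 < d) (Q : QdNh d N h) :
    ∑' b : (Quot.mk (formRel (Gamma0SL2R N) (QdNh d N h))) ⁻¹' {Quot.mk _ Q}, orbInt f N v b.1.1 =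
      f (cmPointC Q.1) / stabOrder (Gamma0SL2R N) Q.1 / 2 := by
  have hsum := hasSum_orbit hN hK hb hfd hf hv hd Q
  let Φ : Gamma0SL2R N → (Quot.mk (formRel (Gamma0SL2R N) (QdNh d N h))) ⁻¹' {Quot.mk _ Q} := fun g =>
    ⟨⟨actM Q.1 g.1, actM_mem_QdNh hd Q.2 g.2⟩,
      (quot_formRel_eq_iff.mpr ⟨g.1, g.2, rfl⟩ : Quot.mk (formRel _ _) Q = Quot.mk _ _).symm⟩
  have hΦ : ∀ g, (Φ g).1.1 = actM Q.1 g.1 := fun g => rfl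
  have hfib : ∀ b, Nonempty (Φ ⁻¹' {b} ≃ StabSL (Gamma0SL2R N) Q.1) := fun b => by
    obtain ⟨g₀, hg₀, hb0⟩ := quot_formRel_eq_iff.mp (b.2 : Quot.mk _ b.1 = Quot.mk _ Q).symm
    change b.1.1 = actM Q.1 g₀ at hb0
    have hfac : ∀ g, Φ g = b ↔ actM Q.1 g.1 = actM Q.1 g₀ := fun g => by
      rw [← hb0, ← hΦ, ← Subtype.ext_iff, ← Subtype.ext_iff]
    refine ⟨⟨fun g => ⟨g.1.1 * g₀⁻¹, mul_mem g.1.2 (inv_mem hg₀), ?_⟩,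
      fun s => ⟨⟨s.1 * g₀, mul_mem s.2.1 hg₀⟩, ?_⟩, fun g => ?_, fun s => ?_⟩⟩
    · change actM _ _ = _
      rw [actM_mul, (hfac _).mp g.2, ← actM_mul, mul_inv_cancel, actM_one]
    · refine (hfac _).mpr ?_
      change actM Q.1 (s.1 * g₀) = _
      rw [actM_mul]
      congr 1
      exact s.2.2
    · exact Subtype.ext (Subtype.ext (by simp))
    · exact Subtype.ext (by simp)
  have hconst : ∀ b, ∀ g : Φ ⁻¹' {b}, orbInt f N v (actM Q.1 g.1.1) = orbInt f N v b.1.1 := fun b g => by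
    rw [← hΦ, show Φ g.1 = b from g.2]
  by_cases hs : Nat.card (StabSL (Gamma0SL2R N) Q.1) = 0
  · have hst : stabOrder (Gamma0SL2R N) Q.1 = 0 := by rw [stabOrder, hs]
    rw [hst, Nat.cast_zero, div_zero, zero_div]
    have hinf : Infinite (StabSL (Gamma0SL2R N) Q.1) := by
      rcases Nat.card_eq_zero.mp hs with h | h
      · exact (h.false ⟨1, one_mem _, by simp⟩).elim
      · exact h
    refine (tsum_congr fun b => ?_).trans tsum_zero
    have h1 : Summable fun g : Φ ⁻¹' {b} => orbInt f N v b.1.1 := by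
      refine (summable_congr fun g => ?_).mp (hsum.summable.subtype (Φ ⁻¹' {b}))
      exact hconst b g
    have : Infinite (Φ ⁻¹' {b}) := (hfib b).some.infinite_iff.mpr hinf
    exact (summable_const_iff (orbInt f N v b.1.1)).mp h1
  · have h1 := (hsum.tsum_fiberwise Φ).tsum_eq
    have h2 : ∀ b, ∑' g : Φ ⁻¹' {b}, orbInt f N v (actM Q.1 g.1.1) =
        (Nat.card (StabSL (Gamma0SL2R N) Q.1) : ℂ) * orbInt f N v b.1.1 := fun b => by
      rw [tsum_congr (hconst b), tsum_const, Nat.card_congr (hfib b).some, nsmul_eq_mul]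
    rw [tsum_congr h2, tsum_mul_left] at h1
    rw [← h1, card_stab_eq]
    rw [card_stab_eq] at hs
    have : (stabOrder (Gamma0SL2R N) Q.1 : ℂ) ≠ 0 := by
      intro h
      exact hs (by rw [Nat.cast_eq_zero.mp h])
    push_cast
    field_simp

lemma tsum_orbInt (hN : Squarefree N) {C K : ℝ} (hK : 0 ≤ K)
    (hb : ∀ w : ℍ, ‖f w‖ ≤ C * rexp (K * (w.im + w.im⁻¹))) (hfd : DifferentiableOn ℂ f {z | 0 < z.im})
    (hf : ∀ g ∈ FrickeGroup N, ∀ z : ℂ, 0 < z.im → f (moebius g z) = f z) (hv : 0 < v)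
    {d h : ℤ} (hd : 0 < d) (hs : Summable fun M : QdNh d N h => orbInt f N v M.1) :
    ∑' M : QdNh d N h, orbInt f N v M.1 = classTrace (Gamma0SL2R N) f (QdNh d N h) / 2 := by
  have := finite_quot_formRel hN hd h
  have h1 := (hs.hasSum.tsum_fiberwise (Quot.mk (formRel (Gamma0SL2R N) (QdNh d N h)))).tsum_eq
  rw [← h1, classTrace, ← tsum_eq_finsum (L := SummationFilter.unconditional _) (Set.toFinite _), ← tsum_div_const]
  refine tsum_congr fun O => ?_
  rw [← tsum_class hN hK hb hfd hf hv hd, Quot.out_eq]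

lemma hasSum_SE_split {d r : ℤ} (hd : 0 < d) {F : Mat₂ → ℂ}
    (hF : ∀ M, F (-M) = F M) {B : ℂ} (h : HasSum (fun M : SE 1 N r (-d) => F M.1) B) :
    Summable (fun M : QdNh d N r => F M.1) ∧ Summable (fun M : QdNh d N (-r) => F M.1) ∧
      B = ∑' M : QdNh d N r, F M.1 + ∑' M : QdNh d N (-r), F M.1 := by
  have hneg : ∀ {r : ℤ} {M : Mat₂}, M ∈ SE 1 N r (-d) → -M ∈ SE 1 N (-r) (-d) := by
    rintro r M ⟨α, β, γ, rfl, h1, h2, h3⟩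
    refine ⟨-α, -β, -γ, by rw [neg_formMat, mul_neg], by linarith, ?_, ?_⟩
    · rw [show -r - -β = -(r - β) by ring]; exact h2.neg_right
    · rw [show -r + -β = -(r + β) by ring]; exact h3.neg_right
  have hne : ∀ {r : ℤ} {M : Mat₂}, M ∈ SE 1 N r (-d) → M 0 0 ≠ 0 := by
    rintro r M ⟨α, β, γ, rfl, h1, -, -⟩ h0
    have h2 : ((1 : ℕ) * N * α : ℤ) = 0 := by
      have : (((1 : ℕ) * N * α : ℤ) : ℝ) = 0 := h0
      exact_mod_cast this
    have h3 : β ^ 2 = -d := by linear_combination h1 + 4 * γ * h2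
    nlinarith [sq_nonneg β]
  obtain ⟨Φ, hl, hr⟩ : ∃ Φ : QdNh d N r ⊕ QdNh d N (-r) → SE 1 N r (-d),
      (∀ M, (Φ (Sum.inl M)).1 = M.1) ∧ ∀ M, (Φ (Sum.inr M)).1 = -M.1 :=
    ⟨Sum.elim (fun M => ⟨M.1, (mem_QdNh_iff.mp M.2).1⟩)
      (fun M => ⟨-M.1, by have h1 := hneg (mem_QdNh_iff.mp M.2).1; rwa [neg_neg] at h1⟩), fun _ => rfl, fun _ => rfl⟩
  have hΦ : Function.Bijective Φ := by
    constructor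
    · rintro (M | M) (M' | M') h <;> have h1 := Subtype.ext_iff.mp h <;> simp only [hl, hr] at h1 <;>
        have h2 := (mem_QdNh_iff.mp M.2).2 <;> have h3 := (mem_QdNh_iff.mp M'.2).2
      · rw [Subtype.ext h1]
      · rw [h1, Matrix.neg_apply] at h2
        linarith
      · rw [← h1, Matrix.neg_apply] at h3
        linarith
      · rw [Subtype.ext (neg_injective h1)]
    · intro M
      rcases lt_or_gt_of_ne (hne M.2) with h0 | h0
      · exact ⟨Sum.inr ⟨-M.1, mem_QdNh_iff.mpr ⟨hneg M.2, by rw [Matrix.neg_apply]; linarith⟩⟩,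
          Subtype.ext (by rw [hr, neg_neg])⟩
      · exact ⟨Sum.inl ⟨M.1, mem_QdNh_iff.mpr ⟨M.2, h0⟩⟩, Subtype.ext (by rw [hl])⟩
  have h2 : HasSum (fun i => F (Φ i).1) B := (Equiv.ofBijective Φ hΦ).hasSum_iff.mpr h
  have hs1 : Summable fun M : QdNh d N r => F M.1 :=
    (summable_congr fun M => by simp only [Function.comp, hl]).mp (h2.summable.comp_injective Sum.inl_injective)
  have hs2 : Summable fun M : QdNh d N (-r) => F M.1 :=
    (summable_congr fun M => by simp only [Function.comp, hr, hF]).mp (h2.summable.comp_injective Sum.inr_injective)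
  refine ⟨hs1, hs2, h2.unique (HasSum.sum (hasSum_of_forall_eq hs1.hasSum fun M => ?_)
    (hasSum_of_forall_eq hs2.hasSum fun M => ?_))⟩
  · simp only [Function.comp, hl]
  · simp only [Function.comp, hr, hF]

/-- The coefficients of the theta lift at indices of negative discriminant. -/
theorem coeff_definite (hN : Squarefree N)
    (hfd : DifferentiableOn ℂ f {z | 0 < z.im})
    (hf : ∀ g ∈ FrickeGroup N, ∀ z : ℂ, 0 < z.im → f (moebius g z) = f z)
    (ha : HasQExp f a n₀) (hτ : 0 < τ.im) (z : ℂ) {x : ℤ × ℤ} {d : ℤ} (hd : 0 < d)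
    (hx : 4 * N * x.1 - x.2 ^ 2 = d) :
    ∑ e ∈ N.divisors, ∫ w : ℍ, (rho (FrickeGroup N) (1 / (2 * N)) w : ℂ) *
        (f w * thetaCoeff e (N / e) τ z w x) =
      (classTrace (Gamma0SL2R N) f (QdNh d N x.2) + classTrace (Gamma0SL2R N) f (QdNh d N (-x.2))) / 2 *
        (qc τ ^ x.1 * qc z ^ x.2) := by
  obtain ⟨C, -, hC⟩ := growth_upper (oneCusp_fricke hN) ha hf
  have hK : 0 ≤ 2 * π * |(n₀ : ℝ)| := by positivity
  have h := hasSum_orbInt hN hfd hf ha hτ z (x := x) (by linarith)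
  rw [show x.2 ^ 2 - 4 * N * x.1 = -d by linarith] at h
  have hq0 : qc τ ^ x.1 * qc z ^ x.2 ≠ 0 :=
    mul_ne_zero (zpow_ne_zero _ (exp_ne_zero _)) (zpow_ne_zero _ (exp_ne_zero _))
  generalize qc τ ^ x.1 * qc z ^ x.2 = q at h hq0 ⊢
  have h1 := hasSum_of_forall_eq (g := fun M : SE 1 N x.2 (-d) => orbInt f N τ.im M.1) (h.mul_left q⁻¹)
    fun M => (inv_mul_cancel_left₀ hq0 _).symm
  obtain ⟨hs1, hs2, h5⟩ := hasSum_SE_split hd (orbInt_neg f N τ.im) h1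
  rw [tsum_orbInt hN hK hC hfd hf hτ hd hs1, tsum_orbInt hN hK hC hfd hf hτ hd hs2,
    inv_mul_eq_iff_eq_mul₀ hq0] at h5
  rw [h5]
  ring

/-! ### A primitive of the kernel for forms of nonnegative discriminant -/

/-- The polynomial attached to a form. -/
def polyM (M : Mat₂) (w : ℂ) : ℂ :=
  M 0 0 * w ^ 2 + (M 0 1 + M 1 0) * w + M 1 1

/-- The profile of the primitive. -/
def profile (N v q : ℝ) : ℝ := q * rexp (-(π * v * q ^ 2 / N))

/-- A `∂/∂w̄`-primitive of the kernel of a form. -/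
def psiM (N v : ℝ) (M : Mat₂) (w : ℂ) : ℂ :=
  -(I / π) * rexp (4 * π * v * M.det / N) * (profile N v (qMat M w) : ℝ) * (polyM M w)⁻¹

lemma qMat_contDiffAt (M : Mat₂) (hw : 0 < w.im) :
    ContDiffAt ℝ 1 (qMat M) w := by
  have hre : ContDiffAt ℝ 1 (fun w : ℂ => w.re) w := reCLM.contDiff.contDiffAt
  have him : ContDiffAt ℝ 1 (fun w : ℂ => w.im) w := imCLM.contDiff.contDiffAt
  have h : ContDiffAt ℝ 1 (fun w : ℂ => (M 0 0 * (w.re * w.re + w.im * w.im) + (M 0 1 + M 1 0) * w.re + M 1 1) /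
      w.im) w := by
    refine ContDiffAt.div ?_ him hw.ne'
    exact ((contDiffAt_const.mul ((hre.mul hre).add (him.mul him))).add (contDiffAt_const.mul hre)).add
      contDiffAt_const
  exact h

lemma dbar_ofReal_comp {q : ℂ → ℝ} {h : ℝ → ℝ} {h' : ℝ} (hq : DifferentiableAt ℝ q w)
    (hh : HasDerivAt h h' (q w)) : dbar (fun w => (h (q w) : ℂ)) w =
      h' * dbar (fun w => (q w : ℂ)) w := by
  have h1 : HasFDerivAt (fun w => (q w : ℂ)) (ofRealCLM.comp (fderiv ℝ q w)) w :=
    ofRealCLM.hasFDerivAt.comp w hq.hasFDerivAt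
  have h2 : HasFDerivAt (fun w => (h (q w) : ℂ)) (ofRealCLM.comp (h' • fderiv ℝ q w)) w :=
    ofRealCLM.hasFDerivAt.comp w (hh.comp_hasFDerivAt w hq.hasFDerivAt)
  rw [dbar, dbar, h1.fderiv, h2.fderiv]
  simp
  ring

lemma dbar_qMat (M : Mat₂) (hw : 0 < w.im) :
    dbar (fun w => (qMat M w : ℂ)) w = -(I / 2) * polyM M w / (w.im : ℂ) ^ 2 := by
  have hre : HasFDerivAt (fun w : ℂ => w.re) reCLM w := reCLM.hasFDerivAt
  have him : HasFDerivAt (fun w : ℂ => w.im) imCLM w := imCLM.hasFDerivAt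
  have hn := (((((hre.mul hre).add (him.mul him)).const_mul (M 0 0)).add
    (hre.const_mul (M 0 1 + M 1 0))).add_const (M 1 1))
  have h := hn.mul ((hasDerivAt_inv hw.ne').comp_hasFDerivAt w him)
  have h1 := ofRealCLM.hasFDerivAt.comp w h
  have e : (fun w => (qMat M w : ℂ)) = _ := rfl
  have h2 : HasFDerivAt (fun w => (qMat M w : ℂ)) _ w := h1
  rw [dbar, h2.fderiv]
  have hw' : (w.im : ℂ) ≠ 0 := mod_cast hw.ne'
  simp [polyM]
  field_simp
  have e : w = w.re + w.im * I := (re_add_im w).symm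
  generalize w.re = x at *
  generalize w.im = y at *
  subst e
  ring_nf
  simp only [I_sq, I_pow_three]
  ring

lemma hasDerivAt_profile (N v q : ℝ) : HasDerivAt (profile N v)
    ((1 - 2 * π * v * q ^ 2 / N) * rexp (-(π * v * q ^ 2 / N))) q := by
  have h : HasDerivAt (fun q : ℝ => -(π * v * q ^ 2 / N)) (-(π * v * (2 * q) / N)) q := by
    have := (((hasDerivAt_pow 2 q).const_mul (π * v)).div_const N).neg
    exact this.congr_deriv (by simp)
  exact ((hasDerivAt_id q).mul h.exp).congr_deriv (by simp; ring)

lemma profile_contDiff (N v : ℝ) : ContDiff ℝ 1 (profile N v) := by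
  unfold profile
  exact contDiff_id.mul (Real.contDiff_exp.comp
    ((contDiff_const.mul (contDiff_id.pow 2)).div_const _).neg)

lemma normSq_polyM (M : Mat₂) (hM : M 0 1 = M 1 0) (hw : 0 < w.im) :
    normSq (polyM M w) = w.im ^ 2 * (qMat M w ^ 2 - 4 * M.det) := by
  rw [polyM, qMat, det_fin_two, normSq_apply, ← hM]
  field_simp
  simp [normSq_apply, pow_two]
  ring

lemma polyM_contDiffAt (M : Mat₂) (w : ℂ) : ContDiffAt ℝ 1 (polyM M) w := by
  unfold polyM
  have h : ContDiffAt ℂ 1 (fun w : ℂ => (M 0 0 * w ^ 2 + (M 0 1 + M 1 0) * w + M 1 1 : ℂ)) w := by fun_prop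
  exact h.restrict_scalars ℝ

lemma polyM_differentiableAt (M : Mat₂) (w : ℂ) :
    DifferentiableAt ℂ (polyM M) w := by
  unfold polyM
  fun_prop

lemma psiM_contDiffAt (N v : ℝ) (M : Mat₂) (hw : 0 < w.im)
    (h0 : polyM M w ≠ 0) : ContDiffAt ℝ 1 (psiM N v M) w := by
  unfold psiM
  have h1 : ContDiffAt ℝ 1 (fun w => (profile N v (qMat M w) : ℂ)) w :=
    (ofRealCLM.contDiff.comp (profile_contDiff N v)).contDiffAt.comp w (qMat_contDiffAt M hw)
  exact (contDiffAt_const.mul h1).mul ((polyM_contDiffAt M w).inv h0)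

lemma dbar_psiM (N v : ℝ) (M : Mat₂) (hw : 0 < w.im)
    (h0 : polyM M w ≠ 0) : dbar (psiM N v M) w = (kerM N v M w : ℂ) / (w.im : ℂ) ^ 2 := by
  have hq := (qMat_contDiffAt M hw).differentiableAt (by simp)
  have h1 : ContDiffAt ℝ 1 (fun w => (profile N v (qMat M w) : ℂ)) w :=
    (ofRealCLM.contDiff.comp (profile_contDiff N v)).contDiffAt.comp w (qMat_contDiffAt M hw)
  have e : psiM N v M = fun w => (-(I / π) * rexp (4 * π * v * M.det / N) * (polyM M w)⁻¹) *
      (profile N v (qMat M w) : ℂ) := by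
    funext w; simp only [psiM]; ring
  have hh : DifferentiableAt ℂ (fun w => -(I / π) * rexp (4 * π * v * M.det / N) * (polyM M w)⁻¹) w :=
    ((polyM_differentiableAt M w).inv h0).const_mul _
  rw [e, dbar_mul (hh.restrictScalars ℝ) (h1.differentiableAt (by simp)), dbar_holo hh,
    dbar_ofReal_comp hq (hasDerivAt_profile N v _), dbar_qMat M hw, kerM,
    show -(π * v * (qMat M w ^ 2 - 4 * M.det) / N) =
      4 * π * v * M.det / N + -(π * v * qMat M w ^ 2 / N) by ring, Real.exp_add]
  have hπ : (π : ℂ) ≠ 0 := mod_cast Real.pi_ne_zero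
  have hw' : (w.im : ℂ) ≠ 0 := mod_cast hw.ne'
  push_cast
  field_simp
  ring_nf
  simp only [I_sq]
  ring

lemma polyM_moebius (M : Mat₂) (g : SL2R) (hw : 0 < w.im) :
    polyM M (moebius g w) * autF g w ^ 2 = polyM (actM M g) w := by
  have hn := autF_ne_zero g hw
  rw [polyM, polyM, moebius_eq, actM_apply]
  field_simp
  simp [autF]
  ring

lemma psiM_moebius (N v : ℝ) (M : Mat₂) (g : SL2R) (hw : 0 < w.im) :
    psiM N v M (moebius g w) = autF g w ^ 2 * psiM N v (actM M g) w := by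
  have hn := autF_ne_zero g hw
  rw [psiM, psiM, ← polyM_moebius M g hw, qMat_actM M g hw, det_actM, mul_inv]
  field_simp

lemma psiM_neg (N v : ℝ) (M : Mat₂) (w : ℂ) : psiM N v (-M) w = psiM N v M w := by
  have h1 : polyM (-M) w = -polyM M w := by simp [polyM]; ring
  have h2 : profile N v (-qMat M w) = -profile N v (qMat M w) := by simp [profile]
  rw [psiM, psiM, h1, qMat_neg, h2, Matrix.det_neg, inv_neg]
  simp

lemma norm_psiM_le {N v : ℝ} {M : Mat₂} (hM : M 0 1 = M 1 0) (hd : M.det ≤ 0)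
    (hw : 0 < w.im) (h0 : polyM M w ≠ 0) :
    ‖psiM N v M w‖ ≤ w.im⁻¹ * rexp (-(π * v * (qMat M w ^ 2 - 4 * M.det) / N)) := by
  have h1 : ‖polyM M w‖ ^ 2 = w.im ^ 2 * (qMat M w ^ 2 - 4 * M.det) := by
    rw [← normSq_polyM M hM hw, normSq_eq_norm_sq]
  have hp : 0 < ‖polyM M w‖ := norm_pos_iff.mpr h0
  have h2 : |qMat M w| * w.im ≤ ‖polyM M w‖ := by
    refine abs_le_of_sq_le_sq' ?_ hp.le |>.2
    rw [h1, mul_pow, sq_abs]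
    nlinarith [sq_nonneg w.im]
  rw [show -(π * v * (qMat M w ^ 2 - 4 * M.det) / N) =
      4 * π * v * M.det / N + -(π * v * qMat M w ^ 2 / N) by ring, Real.exp_add, psiM, profile]
  simp only [norm_mul, norm_neg, norm_div, norm_I, norm_real, norm_eq_abs, Real.abs_exp,
    norm_inv, abs_of_pos pi_pos]
  have hb : (1 / π) * (|qMat M w| * ‖polyM M w‖⁻¹) ≤ w.im⁻¹ := by
    have hπ : 1 / π ≤ 1 := by
      rw [div_le_one pi_pos]; linarith [Real.pi_gt_three]
    have h3 : |qMat M w| * ‖polyM M w‖⁻¹ ≤ w.im⁻¹ := by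
      rw [← div_eq_mul_inv, div_le_iff₀ hp, inv_mul_eq_div, le_div_iff₀ hw]
      exact h2
    calc _ ≤ 1 * (|qMat M w| * ‖polyM M w‖⁻¹) := by gcongr
      _ ≤ _ := by rw [one_mul]; exact h3
  calc _ = (1 / π) * (|qMat M w| * ‖polyM M w‖⁻¹) * (rexp (4 * π * v * M.det / N) *
        rexp (-(π * v * qMat M w ^ 2 / N))) := by ring
    _ ≤ _ := by gcongr

/-! ### The lattice of forms of given discriminant -/

/-- The nonzero forms `[Na, b, c]` of discriminant `D`. -/
def LN (N : ℕ) (D : ℤ) : Set (Mat₂) :=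
  {M | (∃ a b c : ℤ, M = formMat (N * a) b c ∧ b ^ 2 - 4 * N * a * c = D) ∧ M ≠ 0}

lemma exists_LN_coeff (N : ℕ) (D : ℤ) : ∃ φ : LN N D → ℤ × ℤ × ℤ, Function.Injective φ ∧
    ∀ M, M.1 = formMat (N * (φ M).1) (φ M).2.1 (φ M).2.2 ∧
      (φ M).2.1 ^ 2 - 4 * N * (φ M).1 * (φ M).2.2 = D := by
  choose a b c h using fun M : LN N D => M.2.1
  refine ⟨fun M => (a M, b M, c M), fun M M' hMM => ?_, h⟩
  simp only [Prod.mk.injEq] at hMM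
  apply Subtype.ext
  rw [(h M).1, (h M').1, hMM.1, hMM.2.1, hMM.2.2]

lemma countable_LN (N : ℕ) (D : ℤ) : Countable (LN N D) := by
  obtain ⟨φ, hφ, -⟩ := exists_LN_coeff N D
  exact hφ.countable

lemma LN_symm {M} (h : M ∈ LN N D) : M 0 1 = M 1 0 := by
  obtain ⟨⟨a, b, c, rfl, -⟩, -⟩ := h
  simp [formMat]

lemma LN_det {M} (h : M ∈ LN N D) : 4 * M.det = -D := by
  obtain ⟨⟨a, b, c, rfl, h⟩, -⟩ := h
  rw [formMat_det, ← h]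
  push_cast
  ring

lemma polyM_ne_zero (hD : 0 ≤ D) {M} (h : M ∈ LN N D) (hw : 0 < w.im) :
    polyM M w ≠ 0 := by
  intro h0
  have h1 := normSq_polyM M (LN_symm h) hw
  have h2 := LN_det h
  have hDR : (0 : ℝ) ≤ D := mod_cast hD
  rw [h0, map_zero] at h1
  have h3 : qMat M w ^ 2 - 4 * M.det = 0 := by
    rcases mul_eq_zero.mp h1.symm with h | h
    · exact absurd h (by positivity)
    · exact h
  have h4 : qMat M w = 0 := by nlinarith [sq_nonneg (qMat M w)]
  have h5 : (D : ℝ) = 0 := by nlinarith [sq_nonneg (qMat M w)]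
  have h6 : D = 0 := mod_cast h5
  have hs := LN_symm h
  have e1 : M.det = 0 := by linarith
  rw [det_fin_two, ← hs] at e1
  rw [qMat, div_eq_zero_iff, or_iff_left hw.ne', ← hs, normSq_apply] at h4
  apply h.2
  have k1 : M 0 0 = 0 := by
    have : (M 0 0 * w.re + M 0 1) ^ 2 + (M 0 0 * w.im) ^ 2 = 0 := by linear_combination M 0 0 * h4 - e1
    have h7 : (M 0 0 * w.im) ^ 2 = 0 := by nlinarith [sq_nonneg (M 0 0 * w.re + M 0 1), sq_nonneg (M 0 0 * w.im)]
    have h8 := pow_eq_zero_iff (two_ne_zero) |>.mp h7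
    exact (mul_eq_zero.mp h8).resolve_right hw.ne'
  have k2 : M 0 1 = 0 := by
    rw [k1] at e1
    have : M 0 1 ^ 2 = 0 := by linarith [e1]
    exact pow_eq_zero_iff two_ne_zero |>.mp this
  have k3 : M 1 1 = 0 := by rw [k1, k2] at h4; linarith
  ext i j
  fin_cases i <;> fin_cases j <;> simp [k1, k2, k3, ← hs]

lemma neg_mem_LN {M} (h : M ∈ LN N D) : -M ∈ LN N D := by
  obtain ⟨⟨a, b, c, rfl, h⟩, h0⟩ := h
  refine ⟨⟨-a, -b, -c, ?_, by linarith⟩, neg_ne_zero.mpr h0⟩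
  rw [neg_formMat, mul_neg]

lemma actM_mem_LN (hN : 0 < N) {M} (h : M ∈ LN N D)
    (hg : g ∈ FrickeGroup N) : actM M g ∈ LN N D := by
  obtain ⟨e, ⟨e', rfl⟩, x, y, z, w, hg⟩ := mem_fricke hN hg
  have hd := LN_det h
  have h0 : actM M g ≠ 0 := fun h0 => h.2 (actM_injective g (by simpa [actM] using h0))
  obtain ⟨⟨a, b, c, rfl, -⟩, -⟩ := h
  have hact := actM_formMat (Nat.pos_of_mul_pos_right hN) hg a b c
  have hdet := det_actM (formMat ((e * e' : ℕ) * a) b c) g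
  push_cast at h0 hd hdet ⊢
  rw [hact] at h0 hdet ⊢
  refine ⟨⟨_, _, _, by push_cast; rfl, ?_⟩, h0⟩
  rw [← hdet, formMat_det] at hd
  have : ∀ X Y : ℤ, (X : ℝ) = Y → X = Y := fun X Y h => by exact_mod_cast h
  apply this
  push_cast at hd ⊢
  linarith

/-- The action of the Fricke group on the forms. -/
def actLN {N : ℕ} (hN : 0 < N) (D : ℤ) {g : SL2R} (hg : g ∈ FrickeGroup N) : LN N D ≃ LN N D where
  toFun M := ⟨actM M g, actM_mem_LN hN M.2 hg⟩
  invFun M := ⟨actM M g⁻¹, actM_mem_LN hN M.2 (inv_mem hg)⟩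
  left_inv M := Subtype.ext (by simp [← actM_mul, actM_one])
  right_inv M := Subtype.ext (by simp [← actM_mul, actM_one])

lemma tsum_psiM_moebius (hN : 0 < N) (D : ℤ) (v : ℝ) (hg : g ∈ FrickeGroup N)
    (hw : 0 < w.im) : ∑' M : LN N D, psiM N v M.1 (moebius g w) =
      autF g w ^ 2 * ∑' M : LN N D, psiM N v M.1 w := by
  rw [← tsum_mul_left, ← (actLN hN D hg).tsum_eq fun M => autF g w ^ 2 * psiM N v M.1 w]
  exact tsum_congr fun M => psiM_moebius N v M.1 g hw

lemma norm_psiM_le_enQ (hN : 0 < N) (hD : 0 ≤ D) (hv : 0 < v) {M} (hM : M ∈ LN N D)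
    {a b c : ℤ} (h : M = formMat (N * a) b c) (hw : 0 < w.im) :
    ‖psiM N v M w‖ ≤ w.im⁻¹ * rexp (-(π * v / (4 * N) * enQ (N * a) b c w)) := by
  have hd := LN_det hM
  have hDR : (0 : ℝ) ≤ D := mod_cast hD
  refine (norm_psiM_le (LN_symm hM) (by linarith) hw (polyM_ne_zero hD hM hw)).trans ?_
  have h1 : enQ (N * a) b c w = 2 * qMat M w ^ 2 + D := by
    rw [h, enQ, qMat_formMat]
    rw [h, formMat_det] at hd
    push_cast at hd ⊢
    linarith
  have hN' : (0 : ℝ) < N := mod_cast hN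
  gcongr
  rw [h1, hd, div_mul_eq_mul_div, div_le_div_iff₀ (by positivity) (by positivity)]
  have : 0 < π * v * N := by positivity
  nlinarith [mul_nonneg this.le (sq_nonneg (qMat M w)), mul_nonneg this.le hDR]

lemma abs_kerM_le_enQ (hN : 0 < N) (hD : 0 ≤ D) (hv : 0 < v) {M} (hM : M ∈ LN N D)
    {a b c : ℤ} (h : M = formMat (N * a) b c) (hw : 0 < w.im) :
    |kerM N v M w| ≤ 2 * rexp (-(π * v / (4 * N) * enQ (N * a) b c w)) := by
  have hd := LN_det hM
  have hDR : (0 : ℝ) ≤ D := mod_cast hD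
  have hN' : (0 : ℝ) < N := mod_cast hN
  have h1 := kerP_abs_le hN' hv (N * a : ℤ) b c hw
  rw [h, kerM_formMat]
  push_cast at h1 ⊢
  refine h1.trans (mul_le_of_le_one_right (by positivity) ?_)
  rw [Real.exp_le_one_iff, neg_nonpos]
  rw [h, formMat_det] at hd
  push_cast at hd
  have : (b : ℝ) ^ 2 - 4 * (N * a) * c = D := by linarith
  rw [this]
  positivity

/-! ### The regularised integral for forms of nonnegative discriminant -/

/-- The sum of the kernels over the nonzero forms of discriminant `D`. -/
def kerLN (N : ℕ) (D : ℤ) (v : ℝ) (w : ℂ) : ℂ := ∑' M : LN N D, (kerM N v M.1 w : ℂ)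

/-- The sum of the primitives over the nonzero forms of discriminant `D`. -/
def psiLN (N : ℕ) (D : ℤ) (v : ℝ) (w : ℂ) : ℂ := ∑' M : LN N D, psiM N v M.1 w

lemma LN_compact_bound (hN : 0 < N) (hD : 0 ≤ D) (hv : 0 < v) {K : Set ℂ}
    (hK : IsCompact K) (hKu : K ⊆ {z | 0 < z.im}) : ∃ B : LN N D → ℝ, Summable B ∧
      (∀ M, 0 ≤ B M) ∧ ∀ M : LN N D, ∀ w ∈ K, ‖psiM N v M.1 w‖ ≤ B M ∧ |kerM N v M.1 w| ≤ B M := by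
  obtain ⟨φ, hφ, hφM⟩ := exists_LN_coeff N D
  obtain ⟨C, hC⟩ := enQ_ge_of_compact hK hKu
  have hN' : (1 : ℝ) ≤ N := mod_cast hN
  set ε := π * v / (4 * N) with hε
  have hεp : 0 < ε := by positivity
  have hci : ContinuousOn (fun w : ℂ => w.im⁻¹) K :=
    continuous_im.continuousOn.inv₀ fun w hw => (hKu hw).ne'
  obtain ⟨B, hB⟩ := hK.exists_bound_of_continuousOn hci
  have hs := (summable_int3_exp hεp).comp_injective hφ
  refine ⟨fun M => (max B 2 * rexp (ε * C)) * rexp (-(ε * (|((φ M).1 : ℝ)| + |((φ M).2.1 : ℝ)| +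
    |((φ M).2.2 : ℝ)|))), hs.mul_left _, fun M => by positivity, fun M w hw => ?_⟩
  have hw0 : 0 < w.im := hKu hw
  have he : rexp (-(ε * enQ (N * (φ M).1) (φ M).2.1 (φ M).2.2 w)) ≤ rexp (ε * C) *
      rexp (-(ε * (|((φ M).1 : ℝ)| + |((φ M).2.1 : ℝ)| + |((φ M).2.2 : ℝ)|))) := by
    rw [← Real.exp_add]
    gcongr
    have h1 := hC (N * (φ M).1) (φ M).2.1 (φ M).2.2 w hw
    have h2 : |((φ M).1 : ℝ)| ≤ |(N * (φ M).1 : ℝ)| := by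
      rw [abs_mul, Nat.abs_cast]
      exact le_mul_of_one_le_left (abs_nonneg _) hN'
    nlinarith
  have h1 := norm_psiM_le_enQ hN hD hv M.2 (hφM M).1 hw0
  have h2 := abs_kerM_le_enQ hN hD hv M.2 (hφM M).1 hw0
  have h3 : w.im⁻¹ ≤ max B 2 := ((le_abs_self _).trans (hB w hw)).trans (le_max_left _ _)
  constructor
  · refine h1.trans ?_
    simp only [mul_assoc (max B 2)]
    gcongr
  · refine h2.trans ?_
    simp only [mul_assoc (max B 2)]
    gcongr
    exact le_max_right _ _

lemma stokes_LN (hN : Squarefree N) (hD : 0 ≤ D) (hv : 0 < v)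
    (hfd : DifferentiableOn ℂ f {z | 0 < z.im})
    (hf : ∀ g ∈ FrickeGroup N, ∀ z : ℂ, 0 < z.im → f (moebius g z) = f z) {L : ℂ}
    (hL : Tendsto (fun y : ℝ => ∫ x in (0 : ℝ)..1, f (x + y * I) * psiLN N D v (x + y * I))
      atTop (𝓝 L)) :
    Tendsto (fun Y : ℝ => ∫ w : ℍ, (eta (FrickeGroup N) (1 / (2 * N)) Y w : ℂ) *
      (f w * kerLN N D v w)) atTop (𝓝 (I / 4 * L)) := by
  have hN0 : 0 < N := Nat.pos_of_ne_zero hN.ne_zero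
  have hΓ := oneCusp_fricke hN
  have := countable_LN N D
  have hfa : ∀ {w : ℂ}, 0 < w.im → DifferentiableAt ℂ f w := fun hw =>
    hfd.differentiableAt (isOpen_upper.mem_nhds hw)
  have hdb : ∀ (M : LN N D) {w : ℂ}, 0 < w.im → dbar (fun w => f w * psiM N v M.1 w) w =
      f w * ((kerM N v M.1 w : ℂ) / (w.im : ℂ) ^ 2) := fun M w hw => by
    have h0 := polyM_ne_zero hD M.2 hw
    rw [dbar_mul ((hfa hw).restrictScalars ℝ)
      ((psiM_contDiffAt N v M.1 hw h0).differentiableAt (by simp)), dbar_holo (hfa hw), zero_mul, add_zero,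
      dbar_psiM N v M.1 hw h0]
  have key := stokes_limit hΓ (ψ := fun (M : LN N D) w => f w * psiM N v M.1 w) (L := L) ?_ ?_ ?_ ?_
  · refine key.congr fun Y => ?_
    rw [integral_uhp (fun w => (eta (FrickeGroup N) (1 / (2 * N)) Y w : ℂ) * (f w * kerLN N D v w)),
      ← integral_indicator isOpen_upper.measurableSet]
    congr 1
    funext w
    by_cases hw : 0 < w.im
    · rw [Set.indicator_of_mem (show w ∈ {z : ℂ | 0 < z.im} from hw)]
      rw [tsum_congr fun M => hdb M hw, tsum_mul_left, tsum_div_const, kerLN, real_smul]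
      push_cast
      ring
    · rw [Set.indicator_of_notMem (show w ∉ {z : ℂ | 0 < z.im} from hw)]
      have : eta (FrickeGroup N) (1 / (2 * N)) Y w = 0 := by
        by_contra h
        have := (eta_support hΓ h).2.1
        exact hw (lt_of_lt_of_le (half_pos hΓ.pos) this)
      rw [this]
      simp
  · intro M w hw
    have h1 : ContDiffAt ℝ 1 f w :=
      ((hfd.contDiffOn isOpen_upper).contDiffAt (isOpen_upper.mem_nhds hw)).restrict_scalars ℝ
    exact h1.mul (psiM_contDiffAt N v M.1 hw (polyM_ne_zero hD M.2 hw))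
  · intro K hK hKu
    obtain ⟨B, hBs, hB0, hB⟩ := LN_compact_bound hN0 hD hv hK hKu
    obtain ⟨A, hA⟩ := hK.exists_bound_of_continuousOn (hfd.continuousOn.mono hKu)
    have hci : ContinuousOn (fun w : ℂ => ((w.im : ℂ) ^ 2)⁻¹) K :=
      ((continuous_ofReal.comp Complex.continuous_im).pow 2).continuousOn.inv₀ fun w hw =>
        pow_ne_zero _ (ofReal_ne_zero.mpr (show 0 < w.im from hKu hw).ne')
    obtain ⟨A', hA'⟩ := hK.exists_bound_of_continuousOn hci
    refine ⟨fun M => |A| * max 1 |A'| * B M, hBs.mul_left _, fun M w hw => ?_⟩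
    have e1 : ‖f w‖ ≤ |A| := (hA w hw).trans (le_abs_self _)
    have e2 := hB M w hw
    have e3 := hB0 M
    constructor
    · rw [norm_mul]
      calc _ ≤ |A| * B M := mul_le_mul e1 e2.1 (norm_nonneg _) (abs_nonneg _)
        _ = |A| * 1 * B M := by ring
        _ ≤ |A| * max 1 |A'| * B M := by gcongr; exact le_max_left _ _
    · rw [hdb M (hKu hw), norm_mul, div_eq_mul_inv, norm_mul, norm_real, norm_eq_abs]
      calc _ ≤ |A| * (B M * max 1 |A'|) := by
            gcongr
            · exact e2.2
            · exact (hA' w hw).trans ((le_abs_self _).trans (le_max_right _ _))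
        _ = _ := by ring
  · intro g hg w hw
    rw [tsum_mul_left, tsum_mul_left, hf g hg w hw, tsum_psiM_moebius hN0 D v hg hw]
    ring
  · refine hL.congr fun y => ?_
    congr 1
    funext x
    rw [tsum_mul_left, psiLN]

lemma tendsto_integral_eta (hΓ : OneCusp Γ c₀) {Φ : ℂ → ℂ}
    (hΦ : Integrable fun w : ℍ => (rho Γ c₀ w : ℂ) * Φ w) :
    Tendsto (fun Y : ℝ => ∫ w : ℍ, (eta Γ c₀ Y w : ℂ) * Φ w) atTop
      (𝓝 (∫ w : ℍ, (rho Γ c₀ w : ℂ) * Φ w)) := by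
  have e : ∀ (Y : ℝ) (w : ℍ), (eta Γ c₀ Y w : ℂ) * Φ w =
      ((1 - smoothTransition ((w : ℂ).im - Y) : ℝ) : ℂ) * ((rho Γ c₀ w : ℂ) * Φ w) := fun Y w => by
    rw [eta]; push_cast; ring
  simp_rw [e]
  refine tendsto_integral_filter_of_dominated_convergence (fun w => ‖(rho Γ c₀ w : ℂ) * Φ w‖) ?_ ?_
    hΦ.norm ?_
  · refine .of_forall fun Y => ?_
    refine Continuous.aestronglyMeasurable ?_ |>.mul hΦ.aestronglyMeasurable
    refine continuous_ofReal.comp (continuous_const.sub (smoothTransition.continuous.comp ?_))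
    exact (Complex.continuous_im.comp continuous_coe).sub continuous_const
  · refine .of_forall fun Y => .of_forall fun w => ?_
    rw [norm_mul]
    refine mul_le_of_le_one_left (norm_nonneg _) ?_
    rw [norm_real, norm_eq_abs, abs_le]
    constructor <;> linarith [smoothTransition.nonneg ((w : ℂ).im - Y),
      smoothTransition.le_one ((w : ℂ).im - Y)]
  · refine .of_forall fun w => ?_
    refine tendsto_const_nhds.congr' ?_
    filter_upwards [eventually_ge_atTop (w : ℂ).im] with Y hY
    rw [smoothTransition.zero_of_nonpos (by linarith)]
    simp

/-! ### Counting the Atkin–Lehner translates -/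

/-- All forms `[Na, b, c]` of discriminant `D`. -/
def LD (N : ℕ) (D : ℤ) : Set (Mat₂) :=
  {M | ∃ a b c : ℤ, M = formMat (N * a) b c ∧ b ^ 2 - 4 * N * a * c = D}

/-- The multiplicity with which a form of discriminant `r ^ 2 - 4 * p₁ * p₂ * n` occurs. -/
def mult (p₁ p₂ : ℕ) (r : ℤ) : ℂ :=
  (1 + if (p₁ : ℤ) ∣ r then 1 else 0) * (1 + if (p₂ : ℤ) ∣ r then 1 else 0)

lemma divisors_mul_primes (h₁ : p₁.Prime) (h₂ : p₂.Prime) :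
    (p₁ * p₂).divisors = {1, p₁, p₂, p₁ * p₂} := by
  ext d
  simp only [Nat.mem_divisors, Finset.mem_insert, Finset.mem_singleton]
  constructor
  · rintro ⟨h, -⟩
    obtain ⟨x, y, hx, hy, rfl⟩ := (Nat.dvd_mul).mp h
    rcases (Nat.dvd_prime h₁).mp hx with rfl | rfl <;> rcases (Nat.dvd_prime h₂).mp hy with rfl | rfl <;> simp
  · have : p₁ * p₂ ≠ 0 := mul_ne_zero h₁.ne_zero h₂.ne_zero
    rintro (rfl | rfl | rfl | rfl) <;> simp [this, h₁.ne_zero, h₂.ne_zero]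

lemma sum_divisors_mul_primes (h₁ : p₁.Prime) (h₂ : p₂.Prime) (hne : p₁ ≠ p₂) (F : ℕ → ℂ) :
    ∑ e ∈ (p₁ * p₂).divisors, F e = F 1 + F p₁ + F p₂ + F (p₁ * p₂) := by
  have a1 := h₁.one_lt
  have a2 := h₂.one_lt
  have b1 : (1 : ℕ) ≠ p₁ := by omega
  have b2 : (1 : ℕ) ≠ p₂ := by omega
  have b3 : 1 ≠ p₁ * p₂ := by nlinarith
  have b4 : p₁ ≠ p₁ * p₂ := by nlinarith
  have b5 : p₂ ≠ p₁ * p₂ := by nlinarith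
  rw [divisors_mul_primes h₁ h₂, Finset.sum_insert (by simp [*]), Finset.sum_insert (by simp [*]),
    Finset.sum_insert (by simp [*]), Finset.sum_singleton]
  ring

lemma ite_dvd_add {p : ℕ} (hp : p.Prime) {s t : ℤ} (h : (p : ℤ) ∣ s * t) :
    ((if (p : ℤ) ∣ s then 1 else 0 : ℂ) + if (p : ℤ) ∣ t then 1 else 0) =
      1 + if (p : ℤ) ∣ s + t then 1 else 0 := by
  rcases (Nat.prime_iff_prime_int.mp hp).dvd_or_dvd h with h | h
  · simp [h, Int.dvd_add_right]
  · simp [h, Int.dvd_add_left, add_comm]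

lemma formMat_mem_SE (he : 0 < e * e') {a b c r D : ℤ}
    (hD : b ^ 2 - 4 * (e * e' : ℕ) * a * c = D) : formMat ((e * e' : ℕ) * a) b c ∈ SE e e' r D ↔
      2 * (e' : ℤ) ∣ r - b ∧ 2 * (e : ℤ) ∣ r + b := by
  constructor
  · rintro ⟨a', b', c', h, -, h1, h2⟩
    obtain ⟨-, rfl, -⟩ := formMat_injective h
    exact ⟨h1, h2⟩
  · rintro ⟨h1, h2⟩
    exact ⟨a, b, c, by push_cast; rfl, by rw [← hD]; push_cast; ring, h1, h2⟩

lemma SE_subset_LD {r D : ℤ} : SE e e' r D ⊆ LD (e * e') D := by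
  rintro M ⟨a, b, c, rfl, h, -, -⟩
  exact ⟨a, b, c, by push_cast; rfl, by rw [← h]; push_cast; ring⟩

open scoped Classical in
lemma sum_mem_SE (h₁ : p₁.Prime) (h₂ : p₂.Prime) (hne : p₁ ≠ p₂) (n r : ℤ)
    {M} (hM : M ∈ LD (p₁ * p₂) (r ^ 2 - 4 * (p₁ * p₂ : ℕ) * n)) :
    ∑ e ∈ (p₁ * p₂).divisors, (if M ∈ SE e (p₁ * p₂ / e) r (r ^ 2 - 4 * (p₁ * p₂ : ℕ) * n) then 1 else 0 : ℂ) =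
      mult p₁ p₂ r := by
  obtain ⟨a, b, c, rfl, hD⟩ := hM
  have hpos : 0 < p₁ * p₂ := mul_pos h₁.pos h₂.pos
  have hpar : (2 : ℤ) ∣ r - b := by
    have : (2 : ℤ) ∣ (r - b) * (r + b) := ⟨2 * ((p₁ * p₂ : ℕ) * (n - a * c)), by linear_combination -hD⟩
    rcases Int.prime_two.dvd_or_dvd this with h | h
    · exact h
    · omega
  obtain ⟨s, hs⟩ := hpar
  obtain ⟨t, ht⟩ : (2 : ℤ) ∣ r + b := by omega
  have hst : s * t = (p₁ * p₂ : ℕ) * (n - a * c) := by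
    have : (2 * s) * (2 * t) = 4 * ((p₁ * p₂ : ℕ) * (n - a * c)) := by
      rw [← hs, ← ht]; linear_combination -hD
    linarith
  have hcop : IsCoprime (p₁ : ℤ) p₂ :=
    Nat.isCoprime_iff_coprime.mpr ((Nat.coprime_primes h₁ h₂).mpr hne)
  have hdv : ∀ x : ℤ, ((p₁ : ℤ) * p₂) ∣ x ↔ (p₁ : ℤ) ∣ x ∧ (p₂ : ℤ) ∣ x := fun x =>
    ⟨fun h => ⟨dvd_of_mul_right_dvd h, dvd_of_mul_left_dvd h⟩, fun h => hcop.mul_dvd h.1 h.2⟩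
  have k : ∀ e e' : ℕ, e * e' = p₁ * p₂ →
      (formMat ((p₁ * p₂ : ℕ) * a) b c ∈ SE e e' r (r ^ 2 - 4 * (p₁ * p₂ : ℕ) * n) ↔
        (e' : ℤ) ∣ s ∧ (e : ℤ) ∣ t) := by
    intro e e' h
    rw [← h] at hD hpos ⊢
    rw [formMat_mem_SE hpos hD, hs, ht, mul_dvd_mul_iff_left two_ne_zero, mul_dvd_mul_iff_left two_ne_zero]
  rw [sum_divisors_mul_primes h₁ h₂ hne, Nat.div_one, Nat.mul_div_cancel_left _ h₁.pos,
    Nat.mul_div_cancel _ h₂.pos, Nat.div_self hpos]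
  simp only [k 1 (p₁ * p₂) (one_mul _), k p₁ p₂ rfl, k p₂ p₁ (mul_comm _ _), k (p₁ * p₂) 1 (mul_one _)]
  have e1 := ite_dvd_add h₁ (s := s) (t := t) (hst ▸ Dvd.intro _ (by push_cast; ring : (p₁ : ℤ) * (p₂ * (n - a * c)) = _))
  have e2 := ite_dvd_add h₂ (s := s) (t := t) (hst ▸ Dvd.intro _ (by push_cast; ring : (p₂ : ℤ) * (p₁ * (n - a * c)) = _))
  have hr : r = s + t := by omega
  rw [mult, hr, ← e1, ← e2]
  push_cast
  simp only [hdv, one_dvd, and_true, true_and]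
  by_cases A : (p₁ : ℤ) ∣ s <;> by_cases B : (p₁ : ℤ) ∣ t <;> by_cases C : (p₂ : ℤ) ∣ s <;>
    by_cases D : (p₂ : ℤ) ∣ t <;> simp [A, B, C, D] <;> norm_num

open scoped Classical in
lemma hasSum_thetaCoeff (he : 0 < e) (he' : 0 < e') (hτ : 0 < τ.im) (z : ℂ)
    (hw : 0 < w.im) (x : ℤ × ℤ) : HasSum (fun M =>
      (if M ∈ SE e e' x.2 (x.2 ^ 2 - 4 * (e * e') * x.1) then 1 else 0) *
        (qc τ ^ x.1 * qc z ^ x.2 * (kerM (e * e') τ.im M w : ℝ))) (thetaCoeff e e' τ z w x) := by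
  have h1 := (summable_if_thetaTerm (z := z) he he' hτ hw x).hasSum
  have h2 : HasSum (Set.indicator {p | fib e e' p = x} (thetaTerm e e' τ z w)) (thetaCoeff e e' τ z w x) :=
    hasSum_of_forall_eq h1 fun p => by simp [Set.indicator_apply]
  have h3 := (fibEquiv he he' x).symm.hasSum_iff.mpr (hasSum_subtype_iff_indicator.mpr h2)
  have h4 : HasSum ((fun M => qc τ ^ x.1 * qc z ^ x.2 * (kerM (e * e') τ.im M w : ℂ)) ∘
      ((↑) : SE e e' x.2 (x.2 ^ 2 - 4 * (e * e') * x.1) → _)) (thetaCoeff e e' τ z w x) := by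
    refine hasSum_of_forall_eq h3 fun M => ?_
    simp only [Function.comp_apply]
    have hp := ((fibEquiv he he' x).symm M).2
    rw [thetaTerm_eq, hp, ← fibEquiv_coe he he' x, Equiv.apply_symm_apply]
  refine hasSum_of_forall_eq (hasSum_subtype_iff_indicator.mp h4) fun M => ?_
  simp [Set.indicator_apply]

lemma sum_thetaCoeff (h₁ : p₁.Prime) (h₂ : p₂.Prime) (hne : p₁ ≠ p₂) (hτ : 0 < τ.im)
    (z : ℂ) (hw : 0 < w.im) (x : ℤ × ℤ) :
    ∑ e ∈ (p₁ * p₂).divisors, thetaCoeff e (p₁ * p₂ / e) τ z w x = qc τ ^ x.1 * qc z ^ x.2 * (mult p₁ p₂ x.2 *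
      ∑' M : LD (p₁ * p₂) (x.2 ^ 2 - 4 * (p₁ * p₂ : ℕ) * x.1), (kerM (p₁ * p₂ : ℕ) τ.im M.1 w : ℂ)) := by
  classical
  set D := x.2 ^ 2 - 4 * (p₁ * p₂ : ℕ) * x.1 with hD
  have key : HasSum (fun M => qc τ ^ x.1 * qc z ^ x.2 * (mult p₁ p₂ x.2 *
      (LD (p₁ * p₂) D).indicator (fun M => (kerM (p₁ * p₂ : ℕ) τ.im M w : ℂ)) M))
      (∑ e ∈ (p₁ * p₂).divisors, thetaCoeff e (p₁ * p₂ / e) τ z w x) := by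
    refine hasSum_of_forall_eq (hasSum_sum (f := fun e M => (if M ∈ SE e (p₁ * p₂ / e) x.2 D then 1 else 0) *
        (qc τ ^ x.1 * qc z ^ x.2 * (kerM (p₁ * p₂ : ℕ) τ.im M w : ℂ))) fun e he => ?_) fun M => ?_
    · have hen := Nat.dvd_of_mem_divisors he
      have h0 : 0 < p₁ * p₂ := mul_pos h₁.pos h₂.pos
      have hee : e * (p₁ * p₂ / e) = p₁ * p₂ := Nat.mul_div_cancel' hen
      have h := hasSum_thetaCoeff (Nat.pos_of_dvd_of_pos hen h0)
        (Nat.div_pos (Nat.le_of_dvd h0 hen) (Nat.pos_of_dvd_of_pos hen h0)) hτ z hw x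
      have c1 : ((e : ℝ) * (p₁ * p₂ / e : ℕ)) = (p₁ * p₂ : ℕ) := mod_cast hee
      have c2 : ((e : ℤ) * (p₁ * p₂ / e : ℕ)) = (p₁ * p₂ : ℕ) := mod_cast hee
      rw [c1, c2] at h
      exact h
    · rw [← Finset.sum_mul]
      by_cases hM : M ∈ LD (p₁ * p₂) D
      · rw [sum_mem_SE h₁ h₂ hne x.1 x.2 hM, Set.indicator_of_mem hM]
        ring
      · rw [Set.indicator_of_notMem hM, Finset.sum_eq_zero]
        · simp
        · intro e he
          rw [if_neg]
          intro hS
          have := SE_subset_LD hS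
          rw [Nat.mul_div_cancel' (Nat.dvd_of_mem_divisors he)] at this
          exact hM this
  rw [← key.tsum_eq, tsum_mul_left, tsum_mul_left, tsum_subtype _ fun M => (kerM (p₁ * p₂ : ℕ) τ.im M w : ℂ)]

/-! ### Coefficients of nonnegative discriminant as limits -/

lemma LD_eq_LN (hD : D ≠ 0) : LD N D = LN N D := by
  ext M
  refine ⟨fun h => ⟨h, ?_⟩, fun h => h.1⟩
  rintro rfl
  obtain ⟨a, b, c, h, h'⟩ := h
  have h0 : formMat 0 0 0 = 0 := by
    ext i j
    fin_cases i <;> fin_cases j <;> simp [formMat]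
  obtain ⟨h1, h2, h3⟩ := formMat_injective (h0.trans h)
  rw [← h2, ← h3] at h'
  exact hD (by rw [← h']; ring)

lemma LD_zero (N : ℕ) : LD N 0 = insert 0 (LN N 0) := by
  ext M
  constructor
  · intro h
    by_cases h0 : M = 0
    · exact Or.inl h0
    · exact Or.inr ⟨h, h0⟩
  · rintro (rfl | h)
    · refine ⟨0, 0, 0, ?_, by ring⟩
      ext i j
      fin_cases i <;> fin_cases j <;> simp [formMat]
    · exact h.1

lemma kerM_zero (N v : ℝ) (w : ℂ) : kerM N v 0 w = -(1 / (2 * π)) := by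
  simp [kerM, qMat]

/-- The sum of the kernels over all forms of discriminant `D`. -/
def kerLD (N : ℕ) (D : ℤ) (v : ℝ) (w : ℂ) : ℂ := ∑' M : LD N D, (kerM N v M.1 w : ℂ)

lemma kerLD_of_ne (hD : D ≠ 0) (v : ℝ) (w : ℂ) : kerLD N D v w = kerLN N D v w := by
  rw [kerLD, kerLN, LD_eq_LN hD]

lemma kerLD_zero (hN : 0 < N) (hv : 0 < v) (hw : 0 < w.im) :
    kerLD N 0 v w = kerLN N 0 v w - 1 / (2 * π) := by
  classical
  obtain ⟨B, hB, -, hb⟩ := LN_compact_bound hN (D := 0) le_rfl hv (K := {w}) isCompact_singleton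
    (by simpa using hw)
  have hs : Summable fun M : LN N 0 => (kerM N v M.1 w : ℂ) :=
    Summable.of_norm_bounded hB fun M => by
      rw [norm_real]; exact (hb M w rfl).2
  have h0 : (0 : Mat₂) ∉ LN N 0 := fun h => h.2 rfl
  have h1 : HasSum ((LN N 0).indicator fun M => (kerM N v M w : ℂ)) (kerLN N 0 v w) :=
    hasSum_subtype_iff_indicator.mp hs.hasSum
  have h2 := h1.add (hasSum_pi_single (0 : Mat₂) (kerM N v 0 w : ℂ))
  rw [kerLD, tsum_subtype (LD N 0) fun M => (kerM N v M w : ℂ)]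
  have h3 : HasSum ((LD N 0).indicator fun M => (kerM N v M w : ℂ)) (kerLN N 0 v w + kerM N v 0 w) := by
    refine hasSum_of_forall_eq h2 fun M => ?_
    rw [LD_zero]
    by_cases hM : M = 0
    · subst hM
      simp [h0]
    · simp [Set.indicator_apply, hM]
  rw [h3.tsum_eq, kerM_zero]
  push_cast
  ring

lemma mult_ne_zero (p₁ p₂ : ℕ) (r : ℤ) : mult p₁ p₂ r ≠ 0 := by
  rw [mult]
  split_ifs <;> norm_num

lemma qc_ne_zero' (z : ℂ) : qc z ≠ 0 := exp_ne_zero _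

lemma sum_integral_thetaCoeff (h₁ : p₁.Prime) (h₂ : p₂.Prime) (hne : p₁ ≠ p₂)
    (hΓ : OneCusp Γ c₀)
    (hfc : Continuous fun w : ℍ => f w) (ha : HasQExp f a n₀) (hτ : 0 < τ.im) (z : ℂ) (x : ℤ × ℤ) :
    Integrable (fun w : ℍ => (rho Γ c₀ w : ℂ) *
      (f w * kerLD (p₁ * p₂) (x.2 ^ 2 - 4 * (p₁ * p₂ : ℕ) * x.1) τ.im w)) ∧
    ∑ e ∈ (p₁ * p₂).divisors, ∫ w : ℍ, (rho Γ c₀ w : ℂ) * (f w * thetaCoeff e (p₁ * p₂ / e) τ z w x) =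
      qc τ ^ x.1 * qc z ^ x.2 * (mult p₁ p₂ x.2 * ∫ w : ℍ, (rho Γ c₀ w : ℂ) *
        (f w * kerLD (p₁ * p₂) (x.2 ^ 2 - 4 * (p₁ * p₂ : ℕ) * x.1) τ.im w)) := by
  have h_int : ∀ e ∈ (p₁ * p₂).divisors, Integrable fun w : ℍ =>
      (rho Γ c₀ w : ℂ) * (f w * thetaCoeff e (p₁ * p₂ / e) τ z w x) := fun e he => by
    have hen := Nat.dvd_of_mem_divisors he
    have h0 : 0 < p₁ * p₂ := mul_pos h₁.pos h₂.pos
    exact (hasSum_integral_thetaCoeff hΓ hfc ha (Nat.pos_of_dvd_of_pos hen h0)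
      (Nat.div_pos (Nat.le_of_dvd h0 hen) (Nat.pos_of_dvd_of_pos hen h0)) hτ z).2 x
  have hsum : ∀ w : ℍ, ∑ e ∈ (p₁ * p₂).divisors,
      (rho Γ c₀ w : ℂ) * (f w * thetaCoeff e (p₁ * p₂ / e) τ z w x) =
      (qc τ ^ x.1 * qc z ^ x.2 * mult p₁ p₂ x.2) * ((rho Γ c₀ w : ℂ) *
        (f w * kerLD (p₁ * p₂) (x.2 ^ 2 - 4 * (p₁ * p₂ : ℕ) * x.1) τ.im w)) := fun w => by
    rw [← Finset.mul_sum, ← Finset.mul_sum, sum_thetaCoeff h₁ h₂ hne hτ z w.im_pos, kerLD]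
    ring
  have hc : qc τ ^ x.1 * qc z ^ x.2 * mult p₁ p₂ x.2 ≠ 0 :=
    mul_ne_zero (mul_ne_zero (zpow_ne_zero _ (qc_ne_zero' _)) (zpow_ne_zero _ (qc_ne_zero' _)))
      (mult_ne_zero _ _ _)
  constructor
  · have h := integrable_finsetSum _ h_int
    simp_rw [hsum] at h
    exact (integrable_const_mul_iff (IsUnit.mk0 _ hc) _).mp h
  · rw [← integral_finsetSum _ h_int]
    simp_rw [hsum]
    rw [integral_const_mul]
    ring

/-- The coefficients of positive discriminant. -/
lemma coeff_indefinite (h₁ : p₁.Prime) (h₂ : p₂.Prime) (hne : p₁ ≠ p₂)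
    (hN : Squarefree (p₁ * p₂))
    (hfd : DifferentiableOn ℂ f {z | 0 < z.im})
    (hf : ∀ g ∈ FrickeGroup (p₁ * p₂), ∀ z : ℂ, 0 < z.im → f (moebius g z) = f z)
    (ha : HasQExp f a n₀) (hτ : 0 < τ.im) (z : ℂ) {x : ℤ × ℤ} (hD : 0 < D)
    (hx : x.2 ^ 2 - 4 * (p₁ * p₂ : ℕ) * x.1 = D) {L : ℂ}
    (hL : Tendsto (fun y : ℝ => ∫ t in (0 : ℝ)..1, f (t + y * I) * psiLN (p₁ * p₂) D τ.im (t + y * I))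
      atTop (𝓝 L)) :
    ∑ e ∈ (p₁ * p₂).divisors, ∫ w : ℍ, (rho (FrickeGroup (p₁ * p₂)) (1 / (2 * (p₁ * p₂ : ℕ))) w : ℂ) *
      (f w * thetaCoeff e (p₁ * p₂ / e) τ z w x) =
      mult p₁ p₂ x.2 * (I / 4 * L) * (qc τ ^ x.1 * qc z ^ x.2) := by
  have hfc : Continuous fun w : ℍ => f w :=
    hfd.continuousOn.comp_continuous continuous_coe fun w => w.im_pos
  have hΓ := oneCusp_fricke hN
  obtain ⟨h1, h2⟩ := sum_integral_thetaCoeff h₁ h₂ hne hΓ hfc ha hτ z x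
  rw [hx] at h1 h2
  have h3 := stokes_LN hN hD.le hτ hfd hf hL
  have h4 := tendsto_integral_eta hΓ (Φ := fun w => f w * kerLD (p₁ * p₂) D τ.im w) h1
  simp only [kerLD_of_ne hD.ne'] at h2 h4
  rw [h2, tendsto_nhds_unique h4 h3]
  ring

lemma continuous_cutoff (Y : ℝ) :
    Continuous fun w : ℍ => ((1 - smoothTransition ((w : ℂ).im - Y) : ℝ) : ℂ) :=
  continuous_ofReal.comp (continuous_const.sub (smoothTransition.continuous.comp
    ((Complex.continuous_im.comp continuous_coe).sub continuous_const)))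

lemma norm_cutoff_le (Y t : ℝ) : ‖((1 - smoothTransition (t - Y) : ℝ) : ℂ)‖ ≤ 1 := by
  rw [norm_real, norm_eq_abs, abs_le]
  constructor <;> linarith [smoothTransition.nonneg (t - Y), smoothTransition.le_one (t - Y)]

lemma integrable_eta_of_rho {Φ : ℂ → ℂ}
    (hΦ : Integrable fun w : ℍ => (rho Γ c₀ w : ℂ) * Φ w) (Y : ℝ) :
    Integrable fun w : ℍ => (eta Γ c₀ Y w : ℂ) * Φ w := by
  have e : (fun w : ℍ => (eta Γ c₀ Y w : ℂ) * Φ w) = fun w : ℍ =>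
      ((1 - smoothTransition ((w : ℂ).im - Y) : ℝ) : ℂ) * ((rho Γ c₀ w : ℂ) * Φ w) := by
    funext w
    rw [eta]; push_cast; ring
  rw [e]
  refine hΦ.mono ((continuous_cutoff Y).aestronglyMeasurable.mul hΦ.aestronglyMeasurable)
    (.of_forall fun w => ?_)
  rw [norm_mul]
  exact mul_le_of_le_one_left (norm_nonneg _) (norm_cutoff_le Y _)

lemma integrable_eta_mul (hΓ : OneCusp Γ c₀)
    (hfc : Continuous fun w : ℍ => f w) (ha : HasQExp f a n₀) (Y : ℝ) :
    Integrable fun w : ℍ => (eta Γ c₀ Y w : ℂ) * f w := by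
  obtain ⟨C, hC0, hC⟩ := growth_cusp ha (half_pos hΓ.pos)
  have h := (hasSum_integral_rho hΓ (ι := Unit)
    (G := fun _ w => ((1 - smoothTransition ((w : ℂ).im - Y) : ℝ) : ℂ) * f w)
    (S := fun _ => C * rexp (2 * π * |(n₀ : ℝ)| * (Y + 1)))
    (fun _ => ((continuous_cutoff Y).mul hfc).aestronglyMeasurable) (hasSum_fintype _).summable ?_).2
  · refine h.congr (.of_forall fun w => ?_)
    simp only [tsum_fintype, Finset.univ_unique, Finset.sum_const, Finset.card_singleton, one_smul]
    rw [eta]; push_cast; ring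
  · intro _ w hw
    rw [norm_mul]
    rcases le_total (w : ℂ).im (Y + 1) with hY | hY
    · calc _ ≤ 1 * ‖f w‖ := by gcongr; exact norm_cutoff_le Y _
        _ ≤ C * rexp (2 * π * |(n₀ : ℝ)| * (w : ℂ).im) := by rw [one_mul]; exact hC w hw.2
        _ ≤ _ := by gcongr
    · rw [smoothTransition.one_of_one_le (by linarith)]
      simp only [sub_self, ofReal_zero, norm_zero, zero_mul]
      positivity

/-- The coefficients of discriminant zero. -/
lemma coeff_isotropic (h₁ : p₁.Prime) (h₂ : p₂.Prime) (hne : p₁ ≠ p₂)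
    (hN : Squarefree (p₁ * p₂))
    (hfd : DifferentiableOn ℂ f {z | 0 < z.im})
    (hf : ∀ g ∈ FrickeGroup (p₁ * p₂), ∀ z : ℂ, 0 < z.im → f (moebius g z) = f z)
    (ha : HasQExp f a n₀)
    (hL : ∀ v : ℝ, 0 < v → Tendsto
      (fun y : ℝ => ∫ t in (0 : ℝ)..1, f (t + y * I) * psiLN (p₁ * p₂) 0 v (t + y * I))
      atTop (𝓝 0)) : ∃ κ₀ : ℂ, ∀ τ : ℂ, 0 < τ.im → ∀ z : ℂ, ∀ x : ℤ × ℤ,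
        x.2 ^ 2 - 4 * (p₁ * p₂ : ℕ) * x.1 = 0 →
    ∑ e ∈ (p₁ * p₂).divisors, ∫ w : ℍ, (rho (FrickeGroup (p₁ * p₂)) (1 / (2 * (p₁ * p₂ : ℕ))) w : ℂ) *
      (f w * thetaCoeff e (p₁ * p₂ / e) τ z w x) = κ₀ * (qc τ ^ x.1 * qc z ^ x.2) := by
  have hfc : Continuous fun w : ℍ => f w :=
    hfd.continuousOn.comp_continuous continuous_coe fun w => w.im_pos
  have hΓ := oneCusp_fricke hN
  have hN0 : 0 < p₁ * p₂ := mul_pos h₁.pos h₂.pos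
  have key : ∀ τ : ℂ, 0 < τ.im → Tendsto (fun Y : ℝ => -(1 / (2 * π) : ℂ) *
      ∫ w : ℍ, (eta (FrickeGroup (p₁ * p₂)) (1 / (2 * (p₁ * p₂ : ℕ))) Y w : ℂ) * f w) atTop
      (𝓝 (∫ w : ℍ, (rho (FrickeGroup (p₁ * p₂)) (1 / (2 * (p₁ * p₂ : ℕ))) w : ℂ) *
        (f w * kerLD (p₁ * p₂) 0 τ.im w))) := by
    intro τ hτ
    obtain ⟨h1, -⟩ := sum_integral_thetaCoeff h₁ h₂ hne hΓ hfc ha hτ 0 (0, 0)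
    simp only [ne_eq, OfNat.ofNat_ne_zero, not_false_eq_true, zero_pow, mul_zero, sub_zero] at h1
    have h3 := stokes_LN hN le_rfl hτ hfd hf (hL _ hτ)
    have h4 := tendsto_integral_eta hΓ (Φ := fun w => f w * kerLD (p₁ * p₂) 0 τ.im w) h1
    have h5 := h4.sub h3
    rw [mul_zero, sub_zero] at h5
    refine h5.congr fun Y => ?_
    have i1 : Integrable fun w : ℍ => (eta (FrickeGroup (p₁ * p₂)) (1 / (2 * (p₁ * p₂ : ℕ))) Y w : ℂ) *
        (f w * kerLD (p₁ * p₂) 0 τ.im w) :=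
      integrable_eta_of_rho (Φ := fun w => f w * kerLD (p₁ * p₂) 0 τ.im w) h1 Y
    have i2 := (integrable_eta_mul hΓ hfc ha Y).const_mul (1 / (2 * π) : ℂ)
    have e : ∀ w : ℍ, (eta (FrickeGroup (p₁ * p₂)) (1 / (2 * (p₁ * p₂ : ℕ))) Y w : ℂ) *
        (f w * kerLN (p₁ * p₂) 0 τ.im w) = (eta (FrickeGroup (p₁ * p₂)) (1 / (2 * (p₁ * p₂ : ℕ))) Y w : ℂ) *
        (f w * kerLD (p₁ * p₂) 0 τ.im w) + (1 / (2 * π) : ℂ) *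
          ((eta (FrickeGroup (p₁ * p₂)) (1 / (2 * (p₁ * p₂ : ℕ))) Y w : ℂ) * f w) := fun w => by
      rw [kerLD_zero hN0 hτ w.im_pos]
      ring
    rw [integral_congr_ae (.of_forall e), integral_add i1 i2, integral_const_mul]
    ring
  refine ⟨4 * ∫ w : ℍ, (rho (FrickeGroup (p₁ * p₂)) (1 / (2 * (p₁ * p₂ : ℕ))) w : ℂ) *
        (f w * kerLD (p₁ * p₂) 0 I.im w), fun τ hτ z x hx => ?_⟩
  obtain ⟨-, h2⟩ := sum_integral_thetaCoeff h₁ h₂ hne hΓ hfc ha hτ z x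
  have hm : mult p₁ p₂ x.2 = 4 := by
    have hx' : x.2 ^ 2 = 4 * ((p₁ : ℤ) * p₂) * x.1 := by push_cast at hx; linarith
    have d1 : (p₁ : ℤ) ∣ x.2 := (Nat.prime_iff_prime_int.mp h₁).dvd_of_dvd_pow
      (n := 2) ⟨4 * p₂ * x.1, by rw [hx']; ring⟩
    have d2 : (p₂ : ℤ) ∣ x.2 := (Nat.prime_iff_prime_int.mp h₂).dvd_of_dvd_pow
      (n := 2) ⟨4 * p₁ * x.1, by rw [hx']; ring⟩
    simp only [mult, d1, d2, if_true]
    norm_num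
  rw [hx] at h2
  rw [h2, hm, tendsto_nhds_unique (key τ hτ) (key I (by simp))]
  ring

/-! ### Asymptotics of a Gaussian-type Fourier integral -/

lemma ofReal_add_I_ne_zero (t : ℝ) : (t : ℂ) + I ≠ 0 := fun h => by
  simpa using congrArg Complex.im h

lemma norm_inv_ofReal_add_I_le (t : ℝ) : ‖((t : ℂ) + I)⁻¹‖ ≤ 1 := by
  rw [norm_inv]
  refine inv_le_one_of_one_le₀ ?_
  simpa using abs_im_le_norm ((t : ℂ) + I)

/-- The one-sided exponential asymptotics of the Fourier transform of
`t exp (-π A t²) / (t + i)`, whose main term is the residue at `t = -i`. -/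
lemma tendsto_exp_mul_gaussian_pole {A : ℝ} (hA : 0 < A) :
    Tendsto (fun Y : ℝ => cexp (2 * π * Y) *
      ∫ t : ℝ, cexp (-(2 * π * I * Y * t)) * (t * cexp (-(π * A * t ^ 2)) / (t + I)))
      atTop (𝓝 (-(2 * π) * cexp (π * A))) := by
  have hAc : (A : ℂ) ≠ 0 := ofReal_ne_zero.2 hA.ne'
  have hAre : 0 < (A : ℂ).re := by simpa
  have hπA : (-(π / A : ℂ)).re < 0 := by
    rw [← ofReal_div, ← ofReal_neg, ofReal_re]
    exact neg_neg_of_pos (div_pos pi_pos hA)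
  obtain ⟨g, hg⟩ : ∃ g : ℝ → ℂ, ∀ t : ℝ, g t = cexp (-π * A * (t : ℂ) ^ 2) := ⟨_, fun _ => rfl⟩
  obtain ⟨F, hF⟩ : ∃ F : ℝ → ℂ, ∀ t, F t = g t * ((t : ℂ) + I)⁻¹ := ⟨_, fun _ => rfl⟩
  have hgi : Integrable g := by
    have := integrable_cexp_quadratic (b := π * A) (by
      rw [← ofReal_mul, ofReal_re]; exact mul_pos pi_pos hA) 0 0
    simpa [funext hg] using this
  have hFi : Integrable F := by
    have h1 : Continuous fun t : ℝ => ((t : ℂ) + I)⁻¹ :=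
      (by fun_prop : Continuous fun t : ℝ => (t : ℂ) + I).inv₀ ofReal_add_I_ne_zero
    have := hgi.mul_bdd (c := 1) h1.aestronglyMeasurable
      (.of_forall norm_inv_ofReal_add_I_le)
    simpa [funext hF] using this
  have hxF : ∀ t : ℝ, (t : ℂ) * F t = g t - I * F t := fun t => by
    rw [hF]; field_simp [ofReal_add_I_ne_zero t]; ring
  have hxFi : Integrable fun t : ℝ => t • F t := by
    simp only [real_smul, hxF]
    exact hgi.sub (hFi.const_mul I)
  have hlin : ∀ w : ℝ, 𝓕 (fun t : ℝ => (t : ℂ) * F t) w = 𝓕 g w - I * 𝓕 F w := fun w => by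
    have hc : ∀ {u : ℝ → ℂ}, Integrable u → Integrable fun t : ℝ => Real.fourierChar (-(t * w)) • u t :=
      fun hu => by simpa [mul_comm] using (Real.fourierIntegral_convergent_iff w).2 hu
    have h1 : ∀ t : ℝ, Real.fourierChar (-(t * w)) • (g t - I * F t) =
        Real.fourierChar (-(t * w)) • g t - I * (Real.fourierChar (-(t * w)) • F t) := fun t => by
      simp only [Circle.smul_def, smul_eq_mul]; ring
    simp only [Real.fourier_real_eq, hxF, h1]
    rw [integral_sub (hc hgi) ((hc hFi).const_mul I), integral_const_mul]
  have hgf : ∀ s : ℝ, cexp (2 * π * s) * 𝓕 g s =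
      1 / (A : ℂ) ^ (1 / 2 : ℂ) * cexp (-(π / A) * s ^ 2 + 2 * π * s + 0) := fun s => by
    rw [funext hg, fourier_gaussian_pi hAre, mul_left_comm, ← Complex.exp_add]
    congr 2; ring
  have hder : ∀ Y : ℝ, HasDerivAt (fun Y : ℝ => cexp (2 * π * Y) * 𝓕 F Y)
      (-(2 * π * I) * (cexp (2 * π * Y) * 𝓕 g Y)) Y := fun Y => by
    have h1 : HasDerivAt (fun Y : ℝ => cexp (2 * π * Y)) (cexp (2 * π * Y) * (2 * π)) Y := by
      have := ((hasDerivAt_id (Y : ℂ)).const_mul (2 * π : ℂ)).cexp.comp_ofReal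
      simpa using this
    have h2 := Real.hasDerivAt_fourier hFi hxFi Y
    have h3 : 𝓕 (fun x : ℝ => (-2 * π * I * x) • F x) Y = -2 * π * I * (𝓕 g Y - I * 𝓕 F Y) := by
      rw [← hlin, Real.fourier_real_eq, Real.fourier_real_eq, ← integral_const_mul]
      congr 1; ext v
      simp only [smul_eq_mul, Circle.smul_def]; ring
    refine (h1.mul h2).congr_deriv ?_
    rw [h3]
    linear_combination (2 * π * cexp (2 * π * Y) * 𝓕 F Y) * I_sq
  have h_int : Integrable fun Y : ℝ => -(2 * π * I) * (cexp (2 * π * Y) * 𝓕 g Y) := by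
    simp only [hgf]
    exact ((integrable_cexp_quadratic' hπA _ _).const_mul _).const_mul _
  have hval : ∫ Y : ℝ, -(2 * π * I) * (cexp (2 * π * Y) * 𝓕 g Y) = -(2 * π * I) * cexp (π * A) := by
    simp only [hgf]
    rw [integral_const_mul, integral_const_mul, integral_cexp_quadratic hπA, neg_neg,
      div_div_cancel₀ (ofReal_ne_zero.2 Real.pi_ne_zero), ← mul_assoc (1 / _), one_div,
      inv_mul_cancel₀ (by simp [Complex.cpow_eq_zero_iff, hAc]), one_mul]
    congr 2; field_simp; ring
  have hbot : Tendsto (fun Y : ℝ => cexp (2 * π * Y) * 𝓕 F Y) atBot (𝓝 0) := by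
    have h0 : Tendsto (fun Y : ℝ => rexp (2 * π * Y) * ∫ t, ‖F t‖) atBot (𝓝 0) := by
      have : Tendsto (fun Y : ℝ => rexp (2 * π * Y)) atBot (𝓝 0) :=
        Real.tendsto_exp_atBot.comp (Filter.tendsto_id.const_mul_atBot (by positivity))
      simpa using this.mul_const (∫ t, ‖F t‖)
    refine squeeze_zero_norm (fun Y => ?_) h0
    rw [norm_mul, norm_exp]
    refine mul_le_mul (by simp) ?_ (norm_nonneg _) (exp_pos _).le
    rw [Real.fourier_real_eq]
    exact (norm_integral_le_integral_norm _).trans (by simp)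
  have htop : Tendsto (fun Y : ℝ => cexp (2 * π * Y) * 𝓕 F Y) atTop
      (𝓝 (-(2 * π * I) * cexp (π * A))) := by
    have h := tendsto_limUnder_of_hasDerivAt_of_integrableOn_Ioi (a := 0)
      (fun x _ => hder x) h_int.integrableOn
    have := integral_of_hasDerivAt_of_tendsto hder h_int hbot h
    rw [hval, sub_zero] at this
    rwa [this]
  have hg0 : Tendsto (fun Y : ℝ => cexp (2 * π * Y) * 𝓕 g Y) atTop (𝓝 0) := by
    simp only [hgf]
    suffices h : Tendsto (fun s : ℝ => cexp (-(π / A) * s ^ 2 + 2 * π * s + 0))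
        atTop (𝓝 0) by simpa using h.const_mul (1 / (A : ℂ) ^ (1 / 2 : ℂ))
    refine tendsto_zero_iff_norm_tendsto_zero.2 ?_
    have h1 : Tendsto (fun s : ℝ => s * (2 * π + -(π / A) * s)) atTop atBot :=
      Filter.tendsto_id.atTop_mul_atBot₀ (Filter.tendsto_atBot_add_const_left _ _
        (Filter.tendsto_id.const_mul_atTop_of_neg (neg_neg_of_pos (div_pos pi_pos hA))))
    refine (Real.tendsto_exp_atBot.comp h1).congr fun s => ?_
    rw [norm_exp, Function.comp_apply]
    congr 1
    rw [show (-(π / A) * s ^ 2 + 2 * π * s + 0 : ℂ) = ((s * (2 * π + -(π / A) * s) : ℝ) : ℂ) by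
      push_cast; ring, ofReal_re]
  have := hg0.sub (htop.const_mul I)
  refine (this.congr fun Y => ?_).trans (le_of_eq ?_)
  · rw [mul_left_comm, ← mul_sub, ← hlin, Real.fourier_real_eq_integral_exp_smul]
    congr 2; ext t
    rw [smul_eq_mul, hF, hg]
    congr 1
    · congr 1; push_cast; ring
    · rw [div_eq_mul_inv]; ring_nf
  · congr 1
    linear_combination (2 * π * cexp (π * A)) * I_sq

/-! ### Reduction of the boundary integral to forms with vanishing first coefficient -/

/-- The part of `psiLN` coming from forms with vanishing first coefficient. -/
def psiLN0 (N : ℕ) (D : ℤ) (v : ℝ) (w : ℂ) : ℂ :=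
  ∑' M : LN N D, if M.1 0 0 = 0 then psiM N v M.1 w else 0

lemma summable_psiM (hN : 0 < N) (hD : 0 ≤ D) (hv : 0 < v) (hw : 0 < w.im) :
    Summable fun M : LN N D => ‖psiM N v M.1 w‖ := by
  obtain ⟨B, hBs, -, hB⟩ := LN_compact_bound hN hD hv (isCompact_singleton (x := w)) (by simpa)
  exact Summable.of_nonneg_of_le (fun _ => norm_nonneg _) (fun M => (hB M w rfl).1) hBs

lemma continuousOn_psiM (hD : 0 ≤ D) (M : LN N D) :
    ContinuousOn (psiM N v M.1) {w : ℂ | 0 < w.im} := fun _ hw =>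
  (psiM_contDiffAt N v M.1 hw (polyM_ne_zero hD M.2 hw)).continuousAt.continuousWithinAt

lemma continuousOn_psi (hN : 0 < N) (hD : 0 ≤ D) (hv : 0 < v) {K : Set ℂ} (hK : IsCompact K)
    (hKu : K ⊆ {w | 0 < w.im}) :
    ContinuousOn (psiLN N D v) K ∧ ContinuousOn (psiLN0 N D v) K := by
  obtain ⟨B, hBs, hB0, hB⟩ := LN_compact_bound hN hD hv hK hKu
  refine ⟨continuousOn_tsum (fun M => (continuousOn_psiM hD M).mono hKu) hBs fun M w hw =>
    (hB M w hw).1, continuousOn_tsum (fun M => ?_) hBs fun M w hw => ?_⟩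
  · by_cases h : M.1 0 0 = 0
    · simpa only [if_pos h] using (continuousOn_psiM hD M).mono hKu
    · simpa only [if_neg h] using continuousOn_const
  · by_cases h : M.1 0 0 = 0
    · simpa only [if_pos h] using (hB M w hw).1
    · simpa only [if_neg h, norm_zero] using hB0 M

lemma psiLN_sub_le (hN : 0 < N) (hD : 0 ≤ D) (hv : 0 < v) : ∃ C, 0 ≤ C ∧ ∀ w : ℂ, |w.re| ≤ 1 → 1 ≤ w.im →
    ‖psiLN N D v w - psiLN0 N D v w‖ ≤ C * rexp (-(π * v / (8 * N) * w.im ^ 2)) := by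
  obtain ⟨φ, hφ, hφM⟩ := exists_LN_coeff N D
  obtain ⟨C₀, hC₀⟩ := enQ_ge_of_cusp (c₁ := 1) one_pos
  have hNr : (1 : ℝ) ≤ N := mod_cast hN
  set δ := π * v / (4 * N) with hδ
  have hδ0 : 0 < δ := by positivity
  obtain ⟨S, hS⟩ := (summable_int3_exp hδ0).comp_injective hφ
  refine ⟨rexp (δ * C₀) * S, mul_nonneg (exp_pos _).le
    (hS.nonneg fun M => (exp_pos _).le), fun w hw1 hw2 => ?_⟩
  have hw : 0 < w.im := by linarith
  have hsum := (summable_psiM (D := D) hN hD hv hw).of_norm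
  have hsum0 : Summable fun M : LN N D => if M.1 0 0 = 0 then psiM N v M.1 w else 0 :=
    Summable.of_norm_bounded (summable_psiM (D := D) hN hD hv hw) fun M => by
      split_ifs <;> simp
  rw [psiLN, psiLN0, ← hsum.tsum_sub hsum0]
  refine (tsum_of_norm_bounded (hS.mul_left
    (rexp (δ * C₀) * rexp (-(π * v / (8 * N) * w.im ^ 2)))) fun M => ?_).trans_eq (by ring)
  obtain ⟨hM, -⟩ := hφM M
  have hpos : 0 ≤ rexp (δ * C₀) * rexp (-(π * v / (8 * N) * w.im ^ 2)) *
      ((fun p : ℤ × ℤ × ℤ => rexp (-(δ * (|(p.1 : ℝ)| + |(p.2.1 : ℝ)| + |(p.2.2 : ℝ)|)))) ∘ φ) M :=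
    mul_nonneg (mul_pos (exp_pos _) (exp_pos _)).le (exp_pos _).le
  split_ifs with h0
  · simpa using hpos
  rw [sub_zero]
  refine (norm_psiM_le_enQ hN hD hv M.2 hM hw).trans ?_
  have ha : (φ M).1 ≠ 0 := fun h => h0 (by rw [hM, h]; simp [formMat])
  have ha1 : (1 : ℝ) ≤ |((φ M).1 : ℝ)| := mod_cast Int.one_le_abs ha
  have hNa : |((φ M).1 : ℝ)| ≤ |(N : ℝ) * (φ M).1| := by
    rw [abs_mul, Nat.abs_cast]; nlinarith
  have := hC₀ (N * (φ M).1) (φ M).2.1 (φ M).2.2 w (ha1.trans hNa) hw1 hw2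
  rw [Function.comp_apply, ← Real.exp_add, ← Real.exp_add]
  refine (mul_le_of_le_one_left (exp_pos _).le (inv_le_one_of_one_le₀ hw2)).trans
    (exp_le_exp.2 ?_)
  have h8 : π * v / (8 * N) * w.im ^ 2 = δ * (w.im ^ 2 / 2) := by rw [hδ]; field_simp; norm_num
  rw [h8]
  nlinarith [mul_le_mul_of_nonneg_left this hδ0.le, mul_le_mul_of_nonneg_left hNa hδ0.le]

lemma psiLN0_le (hN : 0 < N) (hD : 0 ≤ D) (hv : 0 < v) : ∃ C, 0 ≤ C ∧ ∀ w : ℂ, |w.re| ≤ 1 → 1 ≤ w.im →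
    ‖psiLN0 N D v w‖ ≤ C * w.im := by
  obtain ⟨φ, hφ, hφM⟩ := exists_LN_coeff N D
  have hNr : (0 : ℝ) < N := mod_cast hN
  have hDr : (0 : ℝ) ≤ D := mod_cast hD
  obtain ⟨α, hα⟩ : ∃ α, α = π * v / N := ⟨_, rfl⟩
  have hα0 : 0 < α := by rw [hα]; positivity
  obtain ⟨C₁, hC₁⟩ : ∃ C₁, C₁ = (1 + 2 * D + 2 / α) * rexp D := ⟨_, rfl⟩
  have hs : Summable fun p : ℤ × ℤ × ℤ => rexp (-(1 * |(p.1 : ℝ)|)) *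
      (rexp (-(1 * |(p.2.1 : ℝ)|)) * (1 / (1 + (p.2.2 : ℝ) ^ 2))) := by
    have hc : Summable fun c : ℤ => 1 / (1 + (c : ℝ) ^ 2) := by
      refine Summable.of_norm_bounded_eventually (g := fun c : ℤ => 1 / (c : ℝ) ^ 2)
        (Real.summable_one_div_int_pow.2 one_lt_two) ?_
      filter_upwards [(Set.finite_singleton (0 : ℤ)).compl_mem_cofinite] with c hc
      have : (c : ℝ) ≠ 0 := mod_cast hc
      rw [Real.norm_of_nonneg (by positivity)]
      exact one_div_le_one_div_of_le (by positivity) (by linarith)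
    exact (summable_int_exp one_pos).mul_of_nonneg
      ((summable_int_exp one_pos).mul_of_nonneg hc (fun _ => (exp_pos _).le)
        fun _ => by positivity) (fun _ => (exp_pos _).le)
        fun _ => mul_nonneg (exp_pos _).le (by positivity)
  obtain ⟨S, hS⟩ := hs.comp_injective hφ
  refine ⟨C₁ * S, mul_nonneg (by rw [hC₁]; positivity)
    (hS.nonneg fun M => ?_), fun w hw1 hw2 => ?_⟩
  rotate_left
  · have hw : 0 < w.im := by linarith
    refine (tsum_of_norm_bounded (hS.mul_left (C₁ * w.im)) fun M => ?_).trans_eq (by ring)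
    obtain ⟨hM, hMD⟩ := hφM M
    split_ifs with h0
    · have ha : (φ M).1 = 0 := by
        rw [hM] at h0
        have : (N : ℝ) * (φ M).1 = 0 := by simpa [formMat] using h0
        exact_mod_cast (mul_eq_zero.1 this).resolve_left hNr.ne'
      have hdet := LN_det M.2
      refine (norm_psiM_le (LN_symm M.2) (by linarith) hw (polyM_ne_zero hD M.2 hw)).trans ?_
      rw [Function.comp_apply, ha]
      obtain ⟨b, hb⟩ : ∃ b, b = (φ M).2.1 := ⟨_, rfl⟩
      obtain ⟨c, hc⟩ : ∃ c, c = (φ M).2.2 := ⟨_, rfl⟩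
      rw [ha, ← hb, ← hc] at hM
      rw [ha, ← hb] at hMD
      rw [← hb, ← hc]
      have hbD : (b : ℝ) ^ 2 = D := mod_cast (by linarith : b ^ 2 = D)
      have hbabs : |(b : ℝ)| ≤ D := by
        rw [← hbD, ← sq_abs]
        rcases eq_or_ne b 0 with rfl | h
        · simp
        · have : (1 : ℝ) ≤ |(b : ℝ)| := mod_cast Int.one_le_abs h
          nlinarith
      have hq : qMat M.1 w = (b * w.re + c) / w.im := by
        rw [hM, qMat]; simp [formMat]
      obtain ⟨s, hs0⟩ : ∃ s, s = b * w.re + c := ⟨_, rfl⟩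
      have hcs : (c : ℝ) ^ 2 ≤ 2 * s ^ 2 + 2 * D := by
        have h1 : w.re ^ 2 ≤ 1 := by rw [← sq_abs]; nlinarith [abs_nonneg w.re]
        have h2 : (b * w.re) ^ 2 ≤ D := by rw [mul_pow, hbD]; nlinarith
        have : (c : ℝ) = s - b * w.re := by rw [hs0]; ring
        rw [this]; nlinarith [sq_nonneg (s + b * w.re)]
      rw [hq, ← hs0]
      have hexp : rexp (-(π * v * ((s / w.im) ^ 2 - 4 * M.1.det) / N)) ≤
          w.im ^ 2 / (1 + α * s ^ 2) := by
        have h1 : π * v * ((s / w.im) ^ 2 - 4 * M.1.det) / N = α * ((s / w.im) ^ 2 + D) := by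
          rw [hdet, hα]; ring
        rw [h1, Real.exp_neg, inv_le_comm₀ (exp_pos _) (by positivity), inv_div]
        refine le_trans ?_ (Real.add_one_le_exp _)
        rw [div_le_iff₀ (by positivity)]
        have : (α * ((s / w.im) ^ 2 + D) + 1) * w.im ^ 2 = α * s ^ 2 + (α * D + 1) * w.im ^ 2 := by
          field_simp; ring
        rw [this]
        nlinarith [mul_nonneg hα0.le hDr, mul_nonneg (mul_nonneg hα0.le hDr) (sq_nonneg w.im)]
      have hfin : w.im⁻¹ * (w.im ^ 2 / (1 + α * s ^ 2)) ≤
          w.im * ((1 + 2 * D + 2 / α) * (1 / (1 + (c : ℝ) ^ 2))) := by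
        rw [show w.im⁻¹ * (w.im ^ 2 / (1 + α * s ^ 2)) = w.im * (1 / (1 + α * s ^ 2)) by field_simp]
        refine mul_le_mul_of_nonneg_left ?_ hw.le
        rw [mul_one_div, div_le_div_iff₀ (by positivity) (by positivity)]
        have : (1 + 2 * D + 2 / α) * (1 + α * s ^ 2) =
          1 + 2 * D + 2 / α + (1 + 2 * D) * (α * s ^ 2) + 2 * s ^ 2 := by field_simp; ring
        rw [this]
        have h3 : 0 ≤ (1 + 2 * D) * (α * s ^ 2) := by positivity
        have h4 : 0 ≤ 2 / α := by positivity
        linarith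
      refine (mul_le_mul_of_nonneg_left hexp (inv_nonneg.2 hw.le)).trans (hfin.trans ?_)
      have he : 1 ≤ rexp D * rexp (-(1 * |(b : ℝ)|)) := by
        rw [← Real.exp_add]; exact Real.one_le_exp (by linarith)
      have h5 : 0 ≤ w.im * ((1 + 2 * D + 2 / α) * (1 / (1 + (c : ℝ) ^ 2))) := by positivity
      refine (le_mul_of_one_le_left h5 he).trans_eq ?_
      rw [hC₁]; simp; ring
    · simp only [norm_zero]
      refine mul_nonneg (by rw [hC₁]; positivity) ?_
      simp only [Function.comp_apply]; positivity
  · simp only [Function.comp_apply]; positivity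

/-! ### The boundary limit in terms of the principal part -/

/-- Only the principal part of `f` and the forms with vanishing first coefficient contribute
to the boundary limit. -/
lemma tendsto_cusp (hN : 0 < N) (hD : 0 ≤ D) (hv : 0 < v)
    (hfd : DifferentiableOn ℂ f {z | 0 < z.im}) (ha : HasQExp f a n₀) (ha0 : a 0 = 0) {ℓ : ℕ → ℂ}
    (hℓ : ∀ m : ℕ, 1 ≤ m → Tendsto (fun y : ℝ => ∫ t in (0 : ℝ)..1,
      qc (t + y * I) ^ (-(m : ℤ)) * psiLN0 N D v (t + y * I)) atTop (𝓝 (ℓ m))) :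
    Tendsto (fun y : ℝ => ∫ t in (0 : ℝ)..1, f (t + y * I) * psiLN N D v (t + y * I))
      atTop (𝓝 (∑ m ∈ Finset.Icc 1 n₀.natAbs, a (-(m : ℤ)) * ℓ m)) := by
  obtain ⟨C₁, hC₁, h₁⟩ := growth_cusp ha one_pos
  obtain ⟨C₂, hC₂, h₂⟩ := sub_principalPart_le ha ha0 one_pos
  obtain ⟨C₃, hC₃, h₃⟩ := psiLN_sub_le (D := D) hN hD hv
  obtain ⟨C₄, hC₄, h₄⟩ := psiLN0_le (D := D) hN hD hv
  have hNr : (0 : ℝ) < N := mod_cast hN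
  obtain ⟨ε, hε⟩ : ∃ ε, ε = π * v / (8 * N) := ⟨_, rfl⟩
  have hε0 : 0 < ε := by rw [hε]; positivity
  rw [← hε] at h₃
  have hmain := tendsto_finsetSum (Finset.Icc 1 n₀.natAbs) fun m hm =>
    (hℓ m (Finset.mem_Icc.1 hm).1).const_mul (a (-(m : ℤ)))
  obtain ⟨E, hE⟩ : ∃ E, E = rexp ((2 * π * |(n₀ : ℝ)| + 1) ^ 2 / (4 * ε)) := ⟨_, rfl⟩
  have h0 := (Real.tendsto_pow_mul_exp_neg_atTop_nhds_zero 1).const_mul (C₁ * C₃ * E + C₂ * C₄)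
  rw [mul_zero] at h0
  refine hmain.congr_dist (squeeze_zero' (.of_forall fun _ => dist_nonneg) ?_ h0)
  filter_upwards [eventually_ge_atTop 1] with y hy
  have hy0 : 0 < y := by linarith
  have him : ∀ t : ℝ, ((t : ℂ) + y * I).im = y := fun t => by simp
  have hre : ∀ t : ℝ, ((t : ℂ) + y * I).re = t := fun t => by simp
  have hline : Continuous fun t : ℝ => (t : ℂ) + y * I := by fun_prop
  have hmap : Set.MapsTo (fun t : ℝ => (t : ℂ) + y * I) (Set.uIcc 0 1)
      ((fun t : ℝ => (t : ℂ) + y * I) '' Set.uIcc 0 1) := Set.mapsTo_image _ _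
  have hKu : (fun t : ℝ => (t : ℂ) + y * I) '' Set.uIcc 0 1 ⊆ {z | 0 < z.im} := by
    rintro _ ⟨t, -, rfl⟩
    simpa using hy0
  obtain ⟨hc1, hc2⟩ := continuousOn_psi (D := D) hN hD hv (isCompact_uIcc.image hline) hKu
  have hψ := hc1.comp hline.continuousOn hmap
  have hψ0 := hc2.comp hline.continuousOn hmap
  have hfc : ContinuousOn (fun t : ℝ => f (t + y * I)) (Set.uIcc 0 1) :=
    (hfd.continuousOn.mono hKu).comp hline.continuousOn hmap
  have hqc : ∀ m : ℕ, Continuous fun t : ℝ => qc (t + y * I) ^ (-(m : ℤ)) := fun m => by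
    refine Continuous.zpow₀ (by unfold qc; fun_prop) _ fun t => Or.inl (exp_ne_zero _)
  have hI1 : IntervalIntegrable (fun t : ℝ => f (t + y * I) * psiLN N D v (t + y * I)) volume 0 1 :=
    (hfc.mul hψ).intervalIntegrable
  have hI2 : ∀ m : ℕ, IntervalIntegrable (fun t : ℝ => a (-(m : ℤ)) *
      (qc (t + y * I) ^ (-(m : ℤ)) * psiLN0 N D v (t + y * I))) volume 0 1 := fun m =>
    (continuousOn_const.mul ((hqc m).continuousOn.mul hψ0)).intervalIntegrable
  have hsum : ∑ m ∈ Finset.Icc 1 n₀.natAbs, a (-(m : ℤ)) * ∫ t in (0 : ℝ)..1,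
      qc (t + y * I) ^ (-(m : ℤ)) * psiLN0 N D v (t + y * I) =
      ∫ t in (0 : ℝ)..1, principalPart a n₀ (t + y * I) * psiLN0 N D v (t + y * I) := by
    simp only [← intervalIntegral.integral_const_mul, principalPart, Finset.sum_mul]
    rw [← intervalIntegral.integral_finsetSum fun m _ => hI2 m]
    simp only [mul_assoc]
  have hI3 : IntervalIntegrable (fun t : ℝ => principalPart a n₀ (t + y * I) *
      psiLN0 N D v (t + y * I)) volume 0 1 := by
    simp only [principalPart, Finset.sum_mul, mul_assoc]
    have := IntervalIntegrable.sum (Finset.Icc 1 n₀.natAbs) fun m _ => hI2 m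
    rwa [Finset.sum_fn] at this
  rw [hsum, dist_comm, dist_eq_norm, ← intervalIntegral.integral_sub hI1 hI3]
  refine (intervalIntegral.norm_integral_le_of_norm_le_const
    (C := (C₁ * C₃ * E + C₂ * C₄) * (y ^ 1 * rexp (-y))) fun t ht => ?_).trans_eq (by simp)
  rw [Set.uIoc_of_le zero_le_one] at ht
  have habs : |((t : ℂ) + y * I).re| ≤ 1 := by rw [hre, abs_le]; constructor <;> linarith [ht.1, ht.2]
  have him1 : 1 ≤ ((t : ℂ) + y * I).im := by rwa [him]
  have b1 := h₁ _ him1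
  have b2 := h₂ _ him1
  have b3 := h₃ _ habs him1
  have b4 := h₄ _ habs him1
  rw [him] at b1 b2 b3 b4
  rw [show f (t + y * I) * psiLN N D v (t + y * I) - principalPart a n₀ (t + y * I) *
    psiLN0 N D v (t + y * I) = f (t + y * I) * (psiLN N D v (t + y * I) - psiLN0 N D v (t + y * I)) +
      (f (t + y * I) - principalPart a n₀ (t + y * I)) * psiLN0 N D v (t + y * I) by ring]
  have e1 : rexp (2 * π * |(n₀ : ℝ)| * y) * rexp (-(ε * y ^ 2)) ≤ E * rexp (-y) := by
    have := exp_mul_exp_sq_le hε0 (2 * π * |(n₀ : ℝ)| + 1) y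
    rw [← hE] at this
    refine le_trans (le_of_eq ?_) (mul_le_mul_of_nonneg_right this (exp_pos (-y)).le)
    simp only [← Real.exp_add]; congr 1; ring
  have e2 : rexp (-(2 * π * y)) ≤ rexp (-y) :=
    exp_le_exp.2 (by nlinarith [Real.pi_gt_three])
  have hE0 : 0 ≤ E := hE ▸ (exp_pos _).le
  refine (norm_add_le _ _).trans ?_
  rw [norm_mul, norm_mul]
  have k1 := mul_le_mul b1 b3 (norm_nonneg _) (by positivity)
  have k2 := mul_le_mul b2 b4 (norm_nonneg _) (by positivity)
  have k3 := mul_le_mul_of_nonneg_left e1 (mul_nonneg hC₁ hC₃)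
  have k4 := mul_le_mul_of_nonneg_left e2 (mul_nonneg (mul_nonneg hC₂ hC₄) hy0.le)
  have k5 : C₁ * C₃ * (E * rexp (-y)) ≤ C₁ * C₃ * (E * rexp (-y)) * y :=
    le_mul_of_one_le_right (by positivity) hy
  linarith

/-! ### Evaluation of the boundary limits -/

/-- The model of the boundary integrand. -/
def hCusp (A u : ℝ) : ℂ := u * cexp (-(π * A * (u : ℂ) ^ 2)) / (u + I)

lemma integrable_hCusp {A : ℝ} (hA : 0 < A) : Integrable (hCusp A) := by
  have hg : Integrable fun u : ℝ => (u : ℂ) * cexp (-(π * A : ℝ) * (u : ℂ) ^ 2) := by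
    have := integrable_mul_cexp_neg_mul_sq (b := ((π * A : ℝ) : ℂ)) (by
      rw [ofReal_re]; positivity)
    exact this
  have h1 : Continuous fun t : ℝ => ((t : ℂ) + I)⁻¹ :=
    (by fun_prop : Continuous fun t : ℝ => (t : ℂ) + I).inv₀ ofReal_add_I_ne_zero
  refine (hg.mul_bdd (c := 1) h1.aestronglyMeasurable
    (.of_forall norm_inv_ofReal_add_I_le)).congr
    (.of_forall fun u => ?_)
  simp only [hCusp, div_eq_mul_inv]
  push_cast
  ring_nf

lemma psiM_cusp {N κ : ℕ} (hN : 0 < N) (hκ : 0 < κ) (v : ℝ) (c : ℤ) {y : ℝ} (hy : 0 < y) (t : ℝ) :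
    psiM N v (formMat 0 κ c) (t + y * I) = -(I / π) * cexp (-(π * (v * κ ^ 2 / N : ℝ))) / y *
      hCusp (v * κ ^ 2 / N) ((t + c / κ) / y) := by
  have hyc : (y : ℂ) ≠ 0 := ofReal_ne_zero.2 hy.ne'
  have hκc : (κ : ℂ) ≠ 0 := Nat.cast_ne_zero.2 hκ.ne'
  have hκr : (κ : ℝ) ≠ 0 := Nat.cast_ne_zero.2 hκ.ne'
  obtain ⟨u, hu⟩ : ∃ u, u = (t + c / κ) / y := ⟨_, rfl⟩
  have hc : (c : ℝ) = κ * (y * u - t) := by rw [hu]; field_simp; ring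
  have hdet : (formMat 0 κ c).det = -(κ : ℝ) ^ 2 / 4 := by
    rw [formMat, det_fin_two_of]; push_cast; ring
  have hq : qMat (formMat 0 κ c) (t + y * I) = κ * u := by
    rw [qMat]
    simp only [formMat, of_apply, cons_val', cons_val_zero,
      cons_val_one, Matrix.empty_val', cons_val_fin_one, hc]
    simp
    field_simp
    ring
  have hp : polyM (formMat 0 κ c) (t + y * I) = κ * y * (u + I) := by
    rw [polyM]
    simp only [formMat, of_apply, cons_val', cons_val_zero,
      cons_val_one, Matrix.empty_val', cons_val_fin_one, hc]
    push_cast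
    ring
  have h1 := ofReal_add_I_ne_zero u
  rw [← hu, psiM, hdet, hq, hp, profile, hCusp]
  have e1 : ((rexp (4 * π * v * (-(κ : ℝ) ^ 2 / 4) / N) : ℝ) : ℂ) =
      cexp (-(π * (v * κ ^ 2 / N : ℝ))) := by
    push_cast; congr 1; ring
  have e2 : ((κ * u * rexp (-(π * v * (κ * u) ^ 2 / N)) : ℝ) : ℂ) =
      κ * u * cexp (-(π * (v * κ ^ 2 / N : ℝ) * (u : ℂ) ^ 2)) := by
    push_cast; congr 2; ring
  rw [e1, e2]
  field_simp

lemma formMat_mem_LN (N : ℕ) {κ : ℕ} (hκ : 0 < κ) (c : ℤ) : formMat 0 κ c ∈ LN N ((κ : ℤ) ^ 2) :=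
  ⟨⟨0, κ, c, by simp, by ring⟩, fun h => by
    have := congrFun (congrFun h 0) 1; simp [formMat] at this; exact hκ.ne' this⟩

lemma formMat_inj_right {a b c c' : ℤ} (h : formMat a b c = formMat a b c') : c = c' := by
  have := congrFun (congrFun h 1) 1; simpa [formMat] using this

lemma tsum_cusp {N κ : ℕ} (hN : 0 < N) (hκ : 0 < κ) (hv : 0 < v) (hw : 0 < w.im) :
    HasSum (fun c : ℤ => psiM N v (formMat 0 κ c) w) (psiLN0 N ((κ : ℤ) ^ 2) v w / 2) := by
  have hκr : (κ : ℝ) ≠ 0 := Nat.cast_ne_zero.2 hκ.ne'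
  have hmem := formMat_mem_LN N hκ
  obtain ⟨Φ, hl, hr⟩ : ∃ Φ : ℤ ⊕ ℤ → LN N ((κ : ℤ) ^ 2), (∀ c, (Φ (.inl c)).1 = formMat 0 κ c) ∧
      ∀ c, (Φ (.inr c)).1 = -formMat 0 κ c :=
    ⟨Sum.elim (fun c => ⟨_, hmem c⟩) fun c => ⟨_, neg_mem_LN (hmem c)⟩, fun _ => rfl, fun _ => rfl⟩
  have hneg : ∀ c c' : ℤ, formMat 0 κ c ≠ -formMat 0 κ c' := fun c c' h => by
    have := congrFun (congrFun h 0) 1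
    simp [formMat] at this
    have h2 : (0 : ℝ) < κ := mod_cast hκ
    linarith
  have hinj : Function.Injective Φ := by
    rintro (c | c) (c' | c') h <;> have h' := congrArg Subtype.val h <;>
      simp only [hl, hr] at h'
    · rw [formMat_inj_right h']
    · exact absurd h' (hneg _ _)
    · exact absurd h'.symm (hneg _ _)
    · rw [formMat_inj_right (neg_injective h')]
  have hD : (0 : ℤ) ≤ (κ : ℤ) ^ 2 := sq_nonneg _
  have hs : Summable fun c : ℤ => psiM N v (formMat 0 κ c) w := by
    have := ((summable_psiM hN hD hv hw).of_norm.comp_injective hinj).comp_injective Sum.inl_injective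
    refine this.congr fun c => ?_
    simp only [Function.comp_apply, hl]
  have h2 : HasSum (fun p => if (Φ p).1 0 0 = 0 then psiM N v (Φ p).1 w else 0)
      ((∑' c : ℤ, psiM N v (formMat 0 κ c) w) + ∑' c : ℤ, psiM N v (formMat 0 κ c) w) :=
    HasSum.sum (hasSum_of_forall_eq hs.hasSum fun c => by simp [hl, formMat])
      (hasSum_of_forall_eq hs.hasSum fun c => by
        rw [Function.comp_apply, hr, psiM_neg, if_pos (by simp [formMat])])
  have h3 : psiLN0 N ((κ : ℤ) ^ 2) v w = _ := (hinj.tsum_eq fun M hM => ?_).symm.trans h2.tsum_eq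
  · rw [h3, add_self_div_two]; exact hs.hasSum
  · have h0 : M.1 0 0 = 0 := by by_contra h; simp [h] at hM
    obtain ⟨⟨a, b, c, hMf, hdisc⟩, -⟩ := M.2
    have ha : a = 0 := by
      rw [hMf] at h0
      simpa [formMat, hN.ne'] using h0
    rw [ha, mul_zero, zero_mul, sub_zero] at hdisc
    rw [ha, mul_zero] at hMf
    rcases sq_eq_sq_iff_eq_or_eq_neg.1 hdisc with h | h
    · exact ⟨.inl c, Subtype.ext (by rw [hl, hMf, h])⟩
    · exact ⟨.inr (-c), Subtype.ext (by rw [hr, hMf, h]; ext i j; fin_cases i <;> fin_cases j <;> simp [formMat, neg_div])⟩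

lemma geom_sum_root {κ : ℕ} (hκ : 0 < κ) (m : ℕ) :
    ∑ r : Fin κ, cexp (2 * π * I * (m * (r : ℕ) / κ)) = if κ ∣ m then (κ : ℂ) else 0 := by
  have hκc : (κ : ℂ) ≠ 0 := Nat.cast_ne_zero.2 hκ.ne'
  have h1 : ∀ r : ℕ, cexp (2 * π * I * (m * (r : ℕ) / κ)) = cexp (2 * π * I * (m / κ)) ^ r := fun r => by
    rw [← Complex.exp_nat_mul]; congr 1; ring
  have hk : cexp (2 * π * I * (m / κ)) ^ κ = 1 := by
    rw [← Complex.exp_nat_mul, Complex.exp_eq_one_iff]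
    exact ⟨m, by push_cast; field_simp⟩
  simp only [h1]
  rw [Fin.sum_univ_eq_sum_range fun r => cexp (2 * π * I * (m / κ)) ^ r]
  split_ifs with h
  · obtain ⟨j, rfl⟩ := h
    have : cexp (2 * π * I * ((κ * j : ℕ) / κ)) = 1 :=
      Complex.exp_eq_one_iff.2 ⟨j, by push_cast; field_simp⟩
    rw [this]; simp
  · have hne : cexp (2 * π * I * (m / κ)) ≠ 1 := fun h1 => h <| by
      obtain ⟨j, hj⟩ := Complex.exp_eq_one_iff.1 h1
      have : (m : ℂ) = κ * j := by
        have h2 := Complex.two_pi_I_ne_zero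
        field_simp at hj
        linear_combination hj
      exact Int.natCast_dvd_natCast.1 ⟨j, by exact_mod_cast this⟩
    rw [geom_sum_eq hne, hk]; simp

lemma tendsto_cusp_sq {N κ : ℕ} (hN : 0 < N) (hκ : 0 < κ) (hv : 0 < v) {m : ℕ} (hm : 1 ≤ m) :
    Tendsto (fun y : ℝ => ∫ t in (0 : ℝ)..1,
      qc (t + y * I) ^ (-(m : ℤ)) * psiLN0 N ((κ : ℤ) ^ 2) v (t + y * I)) atTop
      (𝓝 (if κ ∣ m then 4 * I * κ else 0)) := by
  have hκr : (0 : ℝ) < κ := Nat.cast_pos.2 hκ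
  have hNr : (0 : ℝ) < N := Nat.cast_pos.2 hN
  have hκc : (κ : ℂ) ≠ 0 := Nat.cast_ne_zero.2 hκ.ne'
  have hD : (0 : ℤ) ≤ (κ : ℤ) ^ 2 := sq_nonneg _
  obtain ⟨A, hA⟩ : ∃ A : ℝ, A = v * κ ^ 2 / N := ⟨_, rfl⟩
  have hA0 : 0 < A := by rw [hA]; positivity
  obtain ⟨C, hC⟩ : ∃ C : ℂ, C = -(I / π) * cexp (-(π * A)) := ⟨_, rfl⟩
  have key : ∀ y : ℝ, 0 < y → ∫ t in (0 : ℝ)..1,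
      qc (t + y * I) ^ (-(m : ℤ)) * psiLN0 N ((κ : ℤ) ^ 2) v (t + y * I) =
      2 * C * (if κ ∣ m then (κ : ℂ) else 0) * (cexp (2 * π * (m * y : ℝ)) *
        ∫ u : ℝ, cexp (-(2 * π * I * (m * y : ℝ) * u)) * (u * cexp (-(π * A * u ^ 2)) / (u + I))) := by
    intro y hy
    have hyc : (y : ℂ) ≠ 0 := ofReal_ne_zero.2 hy.ne'
    obtain ⟨X, hX⟩ : ∃ X : ℤ → ℝ → ℂ, ∀ c t, X c t = qc (t + y * I) ^ (-(m : ℤ)) *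
      (2 * psiM N v (formMat 0 κ c) (t + y * I)) := ⟨_, fun _ _ => rfl⟩
    have hX' : ∀ c t, X c t = cexp (2 * π * (m * y : ℝ)) * (2 * C / y) *
        (cexp (-(2 * π * I * m * t)) * hCusp A ((t + c / κ) / y)) := fun c t => by
      rw [hX, psiM_cusp hN hκ v c hy, ← hA, ← hC, qc, ← exp_int_mul,
        show ((-(m : ℤ) : ℤ) : ℂ) * (2 * π * I * (t + y * I)) = 2 * π * (m * y : ℝ) + -(2 * π * I * m * t) by
          push_cast; linear_combination (-(2 * π * m * y)) * I_sq, Complex.exp_add]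
      ring
    have hXc : ∀ c, Continuous (X c) := fun c => by
      simp only [funext (hX' c), hCusp]
      refine continuous_const.mul ((by fun_prop : Continuous _).mul
        (Continuous.div (by fun_prop) (by fun_prop) fun t => ofReal_add_I_ne_zero _))
    have hsum : HasSum (fun c => ∫ t in (0 : ℝ)..1, X c t) (∫ t in (0 : ℝ)..1,
        qc (t + y * I) ^ (-(m : ℤ)) * psiLN0 N ((κ : ℤ) ^ 2) v (t + y * I)) := by
      have hline : Continuous fun t : ℝ => (t : ℂ) + y * I := by fun_prop
      obtain ⟨B, hBs, hB0, hB⟩ := LN_compact_bound (D := (κ : ℤ) ^ 2) hN hD hv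
        (isCompact_uIcc.image hline : IsCompact (_ '' Set.uIcc (0 : ℝ) 1)) (by
          rintro _ ⟨t, -, rfl⟩
          simpa using hy)
      have hinj : Function.Injective fun c : ℤ => (⟨_, formMat_mem_LN N hκ c⟩ : LN N ((κ : ℤ) ^ 2)) :=
        fun c c' h => formMat_inj_right (congrArg Subtype.val h)
      have hBc := (hBs.comp_injective hinj).mul_left (rexp (2 * π * m * y) * 2)
      refine intervalIntegral.hasSum_integral_of_dominated_convergence (fun c _ => _)
        (fun c => (hXc c).aestronglyMeasurable) (fun c => .of_forall fun t ht => ?_)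
        (.of_forall fun _ _ => hBc) intervalIntegrable_const
        (.of_forall fun t _ => ?_)
      · rw [hX, norm_mul, norm_mul, norm_qc_zpow, Complex.norm_two, ← mul_assoc]
        refine mul_le_mul (le_of_eq ?_) (hB ⟨_, formMat_mem_LN N hκ c⟩ _
          ⟨t, Set.uIoc_subset_uIcc ht, rfl⟩).1 (norm_nonneg _) (by positivity)
        simp
      · rw [← mul_div_cancel₀ (psiLN0 N ((κ : ℤ) ^ 2) v (t + y * I)) (two_ne_zero' ℂ)]
        exact hasSum_of_forall_eq (((tsum_cusp hN hκ hv (w := t + y * I) (by simpa)).mul_left 2).mul_left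
          (qc (t + y * I) ^ (-(m : ℤ)))) (fun c => hX c t)
    obtain ⟨J, hJ⟩ : ∃ J : ℂ, J = ∫ u : ℝ, cexp (-(2 * π * I * (m * y : ℝ) * u)) * hCusp A u := ⟨_, rfl⟩
    have hr : ∀ r : Fin κ, HasSum (fun n : ℤ => ∫ t in (0 : ℝ)..1, X (n * κ + (r : ℕ)) t)
        (cexp (2 * π * (m * y : ℝ)) * (2 * C) * cexp (2 * π * I * (m * (r : ℕ) / κ)) * J) := fun r => by
      obtain ⟨H, hH⟩ : ∃ H : ℝ → ℂ, ∀ u, H u = cexp (2 * π * I * (m * (r : ℕ) / κ)) *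
        (cexp (-(2 * π * I * (m * y : ℝ) * u)) * hCusp A u) := ⟨_, fun _ => rfl⟩
      have hHi : Integrable H := by
        simp only [funext hH]
        refine ((integrable_hCusp hA0).bdd_mul (c := 1) (by fun_prop)
          (.of_forall fun u => ?_)).const_mul _
        rw [norm_exp]; simp
      have hXH : ∀ t, X (r : ℕ) t = cexp (2 * π * (m * y : ℝ)) * (2 * C / y) * H ((t + (r : ℕ) / κ) / y) := fun t => by
        rw [hX', hH, ← mul_assoc (cexp (2 * π * I * (m * (r : ℕ) / κ))), ← Complex.exp_add]
        push_cast
        congr 4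
        field_simp
        ring
      have hXi : Integrable (X (r : ℕ)) := by
        simp only [funext hXH]
        exact ((hHi.comp_div hy.ne').comp_add_right ((r : ℕ) / κ : ℝ)).const_mul _
      have h_int : ∫ t, X (r : ℕ) t =
          cexp (2 * π * (m * y : ℝ)) * (2 * C) * cexp (2 * π * I * (m * (r : ℕ) / κ)) * J := by
        simp only [hXH]
        rw [integral_const_mul, integral_add_right_eq_self (fun t => H (t / y)),
          Measure.integral_comp_div, abs_of_pos hy, real_smul, funext hH, integral_const_mul, ← hJ]
        field_simp
      rw [← h_int]
      refine hasSum_of_forall_eq hXi.hasSum_intervalIntegral_comp_add_int fun n => ?_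
      refine intervalIntegral.integral_congr fun t _ => ?_
      simp only [hX']
      congr 2
      · rw [Complex.exp_eq_exp_iff_exists_int]
        exact ⟨m * n, by push_cast; ring⟩
      · congr 2; push_cast; field_simp; ring
    have : NeZero κ := ⟨hκ.ne'⟩
    have hpr := ((Equiv.prodComm _ _).trans (Int.divModEquiv κ).symm).hasSum_iff.2 hsum
    have htot := (hpr.prod_fiberwise fun r => hr r).unique (hasSum_fintype _)
    rw [htot, ← geom_sum_root hκ m, Finset.mul_sum, Finset.sum_mul]
    refine Finset.sum_congr rfl fun r _ => ?_
    rw [hJ]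
    simp only [hCusp]
    ring
  have hlim := ((tendsto_exp_mul_gaussian_pole hA0).comp
    (Filter.tendsto_id.const_mul_atTop (by exact_mod_cast hm : (0 : ℝ) < m))).const_mul
    (2 * C * (if κ ∣ m then (κ : ℂ) else 0))
  refine (hlim.congr' ?_).trans (le_of_eq ?_)
  · filter_upwards [eventually_gt_atTop 0] with y hy
    rw [key y hy]; rfl
  · congr 1
    have : cexp (-(π * A)) * cexp (π * A) = 1 := by rw [← Complex.exp_add]; simp
    have hπ : (π : ℂ) ≠ 0 := ofReal_ne_zero.2 Real.pi_ne_zero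
    rw [hC]
    split_ifs
    · field_simp
      linear_combination 4 * this
    · simp

/-! ### The Fourier coefficients of the theta lift -/

lemma coeff_of_LN_zero (hN : 0 < N) {M} (hM : M ∈ LN N D) (h0 : M 0 0 = 0) :
    ∃ b c : ℤ, M = formMat 0 b c ∧ b ^ 2 = D := by
  obtain ⟨⟨a, b, c, hMf, hdisc⟩, -⟩ := hM
  have ha : a = 0 := by
    rw [hMf] at h0
    simpa [formMat, hN.ne'] using h0
  rw [ha, mul_zero, zero_mul, sub_zero] at hdisc
  rw [ha, mul_zero] at hMf
  exact ⟨b, c, hMf, hdisc⟩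

lemma psiLN0_nonsquare (hN : 0 < N) (hD : ¬ IsSquare D) (v : ℝ) (w : ℂ) :
    psiLN0 N D v w = 0 := by
  rw [psiLN0, tsum_congr (g := fun _ => 0), tsum_zero]
  intro M
  refine if_neg fun h0 => hD ?_
  obtain ⟨b, c, -, hb⟩ := coeff_of_LN_zero hN M.2 h0
  exact ⟨b, by rw [← hb, sq]⟩

lemma psiLN0_isotropic (hN : 0 < N) (v t y : ℝ) :
    psiLN0 N 0 v (t + y * I) = psiLN0 N 0 v (y * I) := by
  refine tsum_congr fun M => ?_
  split_ifs with h0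
  · obtain ⟨b, c, hM, hb⟩ := coeff_of_LN_zero hN M.2 h0
    obtain rfl : b = 0 := by simpa using hb
    simp [hM, psiM, qMat, polyM, formMat]
  · rfl

lemma integral_qc_zpow (y : ℝ) {n : ℤ} (hn : n ≠ 0) :
    ∫ t in (0 : ℝ)..1, qc (t + y * I) ^ n = 0 := by
  have hc : 2 * π * I * n ≠ 0 := mul_ne_zero Complex.two_pi_I_ne_zero (Int.cast_ne_zero.2 hn)
  have h : ∀ t : ℝ, qc (t + y * I) ^ n = qc (y * I) ^ n * cexp (2 * π * I * n * t) := fun t => by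
    rw [qc, qc, ← exp_int_mul, ← exp_int_mul, ← Complex.exp_add]
    congr 1; ring
  simp only [h, intervalIntegral.integral_const_mul]
  rw [integral_exp_mul_complex hc]
  have h1 : cexp (2 * π * I * n * (1 : ℝ)) = 1 :=
    Complex.exp_eq_one_iff.2 ⟨n, by push_cast; ring⟩
  rw [h1]; simp

lemma two_pow_card_primeFactors_gcd (h₁ : p₁.Prime) (h₂ : p₂.Prime) (hne : p₁ ≠ p₂)
    {κ : ℕ} (hκ : 0 < κ) :
    (2 : ℂ) ^ (Nat.gcd (p₁ * p₂) κ).primeFactors.card =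
      (1 + if p₁ ∣ κ then 1 else 0) * (1 + if p₂ ∣ κ then 1 else 0) := by
  have hpf : (Nat.gcd (p₁ * p₂) κ).primeFactors = ({p₁, p₂} : Finset ℕ).filter (· ∣ κ) := by
    ext p
    simp only [Nat.mem_primeFactors, Finset.mem_filter, Finset.mem_insert, Finset.mem_singleton,
      Nat.dvd_gcd_iff]
    constructor
    · rintro ⟨hp, ⟨hpN, hpκ⟩, -⟩
      refine ⟨(hp.dvd_mul.1 hpN).imp (Nat.prime_dvd_prime_iff_eq hp h₁).1
        (Nat.prime_dvd_prime_iff_eq hp h₂).1, hpκ⟩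
    · rintro ⟨rfl | rfl, hpκ⟩
      · exact ⟨h₁, ⟨dvd_mul_right _ _, hpκ⟩, Nat.gcd_ne_zero_right hκ.ne'⟩
      · exact ⟨h₂, ⟨dvd_mul_left _ _, hpκ⟩, Nat.gcd_ne_zero_right hκ.ne'⟩
  rw [hpf]
  by_cases k1 : p₁ ∣ κ <;> by_cases k2 : p₂ ∣ κ <;>
    simp [Finset.filter_insert, Finset.filter_singleton, k1, k2, hne] <;> norm_num

lemma mult_eq_two_pow (h₁ : p₁.Prime) (h₂ : p₂.Prime) (hne : p₁ ≠ p₂) {κ : ℕ} (hκ : 0 < κ)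
    {r n : ℤ} (h : r ^ 2 - 4 * (p₁ * p₂ : ℕ) * n = (κ : ℤ) ^ 2) :
    mult p₁ p₂ r = 2 ^ (Nat.gcd (p₁ * p₂) κ).primeFactors.card := by
  have hd : ∀ p : ℕ, p.Prime → p ∣ p₁ * p₂ → ((p : ℤ) ∣ r ↔ p ∣ κ) := fun p hp hpN => by
    have hp' := Nat.prime_iff_prime_int.1 hp
    have h1 : (p : ℤ) ∣ 4 * (p₁ * p₂ : ℕ) * n :=
      ((Int.natCast_dvd_natCast.2 hpN).mul_left 4).mul_right n
    have h2 : (p : ℤ) ∣ r ^ 2 ↔ (p : ℤ) ∣ (κ : ℤ) ^ 2 := by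
      rw [← h]; exact (dvd_sub_left h1).symm
    rw [← hp'.dvd_pow_iff_dvd two_ne_zero, h2, hp'.dvd_pow_iff_dvd two_ne_zero, Int.natCast_dvd_natCast]
  rw [two_pow_card_primeFactors_gcd h₁ h₂ hne hκ, mult, if_congr (hd p₁ h₁ (dvd_mul_right _ _)) rfl rfl,
    if_congr (hd p₂ h₂ (dvd_mul_left _ _)) rfl rfl]

lemma finsum_subtype_eq_sum_filter {P : ℕ → Prop} [DecidablePred P] (hP : ∀ m, P m → 0 < m) {g : ℕ → ℂ}
    {M : ℕ} (hg : ∀ m, M < m → g m = 0) :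
    ∑ᶠ m : {m : ℕ // P m}, g m = ∑ m ∈ (Finset.Icc 1 M).filter P, g m := by
  rw [finsum_subtype_eq_finsum_cond (f := g) P]
  refine finsum_mem_eq_sum_of_inter_support_eq _ ?_
  ext m
  simp only [Set.mem_inter_iff, Set.mem_ofPred_eq, Function.mem_support, Finset.coe_filter, Finset.mem_Icc]
  exact ⟨fun ⟨h, hm⟩ => ⟨⟨⟨hP m h, not_lt.1 fun hlt => hm (hg m hlt)⟩, h⟩, hm⟩, fun ⟨⟨_, h⟩, hm⟩ => ⟨h, hm⟩⟩

lemma finsum_dvd (ha : ∀ n < n₀, a n = 0) (κ : ℕ) :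
    ∑ᶠ m : {m : ℕ // 0 < m ∧ κ ∣ m}, a (-(m.1 : ℤ)) =
      ∑ m ∈ Finset.Icc 1 n₀.natAbs, if κ ∣ m then a (-(m : ℤ)) else 0 := by
  rw [finsum_subtype_eq_sum_filter (g := fun m => a (-(m : ℤ))) (M := n₀.natAbs) (fun m h => h.1)
    fun m hm => ha _ (by omega), Finset.sum_filter]
  refine Finset.sum_congr rfl fun m hm => ?_
  simp [Nat.pos_of_ne_zero, Nat.one_le_iff_ne_zero.1 (Finset.mem_Icc.1 hm).1]

/-- The coefficients of the theta lift are the traces `T`, up to the undetermined coefficient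
at index zero. -/
theorem lift_coeff (h₁ : p₁.Prime) (h₂ : p₂.Prime) (hne : p₁ ≠ p₂)
    (hfd : DifferentiableOn ℂ f {z | 0 < z.im})
    (hf : ∀ g ∈ FrickeGroup (p₁ * p₂), ∀ z : ℂ, 0 < z.im → f (moebius g z) = f z)
    (ha : HasQExp f a n₀) (ha0 : a 0 = 0) {T : ℤ → ℂ}
    (hTpos : ∀ d : ℤ, 0 < d → ∀ h : ℤ,
      ((h : ZMod (4 * (p₁ * p₂))) ^ 2 = ((-d : ℤ) : ZMod (4 * (p₁ * p₂)))) →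
      T d = classTrace (Gamma0SL2R (p₁ * p₂)) f (QdNh d (p₁ * p₂) h))
    (hTneg : ∀ κ : ℕ, 0 < κ →
      T (-(κ : ℤ) ^ 2) = -(2 : ℂ) ^ ((Nat.gcd (p₁ * p₂) κ).primeFactors.card) * (κ : ℂ) *
        ∑ᶠ m : {m : ℕ // 0 < m ∧ κ ∣ m}, a (-(m.1 : ℤ)))
    (hTneg' : ∀ d : ℤ, d < 0 → (¬ ∃ κ : ℕ, 0 < κ ∧ d = -(κ : ℤ) ^ 2) → T d = 0) :
    ∃ κ₀ : ℂ, ∀ τ : ℂ, 0 < τ.im → ∀ z : ℂ, ∀ x : ℤ × ℤ,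
      ∑ e ∈ (p₁ * p₂).divisors, ∫ w : ℍ, (rho (FrickeGroup (p₁ * p₂)) (1 / (2 * (p₁ * p₂ : ℕ))) w : ℂ) *
        (f w * thetaCoeff e (p₁ * p₂ / e) τ z w x) =
      (if 4 * (p₁ * p₂ : ℕ) * x.1 - x.2 ^ 2 = 0 then κ₀ else T (4 * (p₁ * p₂ : ℕ) * x.1 - x.2 ^ 2)) *
        (qc τ ^ x.1 * qc z ^ x.2) := by
  have hN : Squarefree (p₁ * p₂) :=
    (Nat.squarefree_mul ((Nat.coprime_primes h₁ h₂).2 hne)).2 ⟨h₁.squarefree, h₂.squarefree⟩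
  have hN0 : 0 < p₁ * p₂ := Nat.mul_pos h₁.pos h₂.pos
  have hzero : ∀ v : ℝ, 0 < v → Tendsto
      (fun y : ℝ => ∫ t in (0 : ℝ)..1, f (t + y * I) * psiLN (p₁ * p₂) 0 v (t + y * I))
      atTop (𝓝 0) := fun v hv => by
    have := tendsto_cusp (ℓ := fun _ => 0) hN0 le_rfl hv hfd ha ha0 fun m hm => by
      simp only [psiLN0_isotropic hN0, intervalIntegral.integral_mul_const, 
        integral_qc_zpow _ (neg_ne_zero.2 (Nat.cast_ne_zero.2 (Nat.one_le_iff_ne_zero.1 hm))), zero_mul]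
      exact tendsto_const_nhds
    simpa using this
  obtain ⟨κ₀, hκ₀⟩ := coeff_isotropic h₁ h₂ hne hN hfd hf ha hzero
  refine ⟨κ₀, fun τ hτ z x => ?_⟩
  obtain ⟨d, hd⟩ : ∃ d, 4 * (p₁ * p₂ : ℕ) * x.1 - x.2 ^ 2 = d := ⟨_, rfl⟩
  rw [hd]
  rcases lt_trichotomy d 0 with h | rfl | h
  · rw [if_neg h.ne]
    have hx : x.2 ^ 2 - 4 * (p₁ * p₂ : ℕ) * x.1 = -d := by rw [← hd]; ring
    by_cases hsq : ∃ κ : ℕ, 0 < κ ∧ d = -(κ : ℤ) ^ 2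
    · obtain ⟨κ, hκ, rfl⟩ := hsq
      rw [neg_neg] at hx
      have hL := tendsto_cusp hN0 (sq_nonneg _) hτ hfd ha ha0 fun m hm =>
        tendsto_cusp_sq (κ := κ) hN0 hκ hτ hm
      rw [coeff_indefinite h₁ h₂ hne hN hfd hf ha hτ z (by positivity) hx hL,
        mult_eq_two_pow h₁ h₂ hne hκ hx, hTneg κ hκ, finsum_dvd ha.1]
      congr 1
      simp only [Finset.mul_sum]
      refine Finset.sum_congr rfl fun m _ => ?_
      split_ifs
      · linear_combination (2 ^ (Nat.gcd (p₁ * p₂) κ).primeFactors.card * κ * a (-(m : ℤ))) * I_sq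
      · simp
    · have hns : ¬ IsSquare (-d) := by
        rintro ⟨k, hk⟩
        refine hsq ⟨k.natAbs, Int.natAbs_pos.2 ?_, ?_⟩
        · rintro rfl; simp at hk; omega
        · rw [Int.natAbs_sq]; linarith [sq k]
      have hL := tendsto_cusp (ℓ := fun _ => 0) hN0 (by omega : 0 ≤ -d) hτ hfd ha ha0 fun m hm => by
        simp only [psiLN0_nonsquare hN0 hns, mul_zero, intervalIntegral.integral_zero]
        exact tendsto_const_nhds
      rw [coeff_indefinite h₁ h₂ hne hN hfd hf ha hτ z (by omega) hx hL, hTneg' d h hsq]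
      simp
  · rw [if_pos rfl]
    exact hκ₀ τ hτ z x (by linarith)
  · rw [if_neg h.ne']
    rw [coeff_definite hN hfd hf ha hτ z h hd]
    have hz : ((x.2 : ℤ) : ZMod (4 * (p₁ * p₂))) ^ 2 = ((-d : ℤ) : ZMod (4 * (p₁ * p₂))) := by
      rw [← hd, ← Int.cast_pow, ZMod.intCast_eq_intCast_iff_dvd_sub]
      exact ⟨-x.1, by push_cast; ring⟩
    rw [← hTpos d h x.2 hz, ← hTpos d h (-x.2) (by rw [Int.cast_neg, neg_sq]; exact hz),
      add_self_div_two]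

/-- The theta lift of `f`. -/
def thetaLift (N : ℕ) (f : ℂ → ℂ) (τ z : ℂ) : ℂ :=
  ∑ e ∈ N.divisors, ∫ w : ℍ, (rho (FrickeGroup N) (1 / (2 * N)) w : ℂ) * (f w * thetaKer e (N / e) τ z w)

lemma thetaLift_transform (N : ℕ) (f : ℂ → ℂ) {a b c d : ℤ} (h : a * d - b * c = 1)
    (hτ : 0 < τ.im) (z : ℂ) :
    thetaLift N f ((a * τ + b) / (c * τ + d)) (z / (c * τ + d)) =
      (c * τ + d) ^ 2 * cexp (2 * π * I * N * c * z ^ 2 / (c * τ + d)) * thetaLift N f τ z := by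
  rw [thetaLift, thetaLift, Finset.mul_sum]
  refine Finset.sum_congr rfl fun e he => ?_
  have hdvd := Nat.dvd_of_mem_divisors he
  have he0 := Nat.pos_of_mem_divisors he
  have he' : 0 < N / e := Nat.div_pos (Nat.le_of_dvd (Nat.pos_of_ne_zero (Nat.mem_divisors.1 he).2) hdvd) he0
  have hee : (e : ℂ) * (N / e : ℕ) = N := mod_cast Nat.mul_div_cancel' hdvd
  rw [← integral_const_mul]
  refine integral_congr_ae (.of_forall fun w => ?_)
  simp only
  rw [thetaKer_transform he0 he' h hτ z w.im_pos, hee]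
  ring

lemma one_add_abs_mul_exp_le {s δ t A B : ℝ} (hδ : 0 < δ) (hA : A + δ ≤ t) (hB : t + δ ≤ B) :
    (1 + |s|) * rexp (-(s * t)) ≤ (1 + δ⁻¹) * (rexp (-(s * A)) + rexp (-(s * B))) := by
  have h1 : 1 + |s| ≤ (1 + δ⁻¹) * rexp (|s| * δ) := by
    have h2 := Real.add_one_le_exp (|s| * δ)
    have h3 : (1 + δ⁻¹) * (|s| * δ + 1) ≤ (1 + δ⁻¹) * rexp (|s| * δ) := by gcongr
    have h4 : (1 + δ⁻¹) * (|s| * δ + 1) = |s| * δ + 1 + |s| + δ⁻¹ := by field_simp; ring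
    have : 0 ≤ |s| * δ := by positivity
    have : 0 < δ⁻¹ := by positivity
    linarith
  have h2 : rexp (|s| * δ) * rexp (-(s * t)) ≤ rexp (-(s * A)) + rexp (-(s * B)) := by
    rw [← Real.exp_add]
    rcases abs_cases s with ⟨h, hs⟩ | ⟨h, hs⟩ <;> rw [h]
    · refine le_add_of_le_of_nonneg (exp_le_exp.2 ?_) (exp_pos _).le
      nlinarith
    · refine le_add_of_nonneg_of_le (exp_pos _).le (exp_le_exp.2 ?_)
      nlinarith
  calc (1 + |s|) * rexp (-(s * t)) ≤ (1 + δ⁻¹) * rexp (|s| * δ) * rexp (-(s * t)) := by gcongr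
    _ = (1 + δ⁻¹) * (rexp (|s| * δ) * rexp (-(s * t))) := by ring
    _ ≤ _ := by gcongr

lemma hasFDerivAt_monomial (c : ℂ) (x : ℤ × ℤ) (p : ℂ × ℂ) :
    HasFDerivAt (fun p : ℂ × ℂ => c * (qc p.1 ^ x.1 * qc p.2 ^ x.2))
      ((c * (qc p.1 ^ x.1 * qc p.2 ^ x.2) * (2 * π * I)) •
        ((x.1 : ℂ) • ContinuousLinearMap.fst ℂ ℂ ℂ + (x.2 : ℂ) • ContinuousLinearMap.snd ℂ ℂ ℂ)) p := by
  simp only [qc_zpow_eq, ← Complex.exp_add]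
  have h1 : HasFDerivAt (fun p : ℂ × ℂ => 2 * π * I * x.1 * p.1 + 2 * π * I * x.2 * p.2) _ p :=
    ((hasFDerivAt_fst (𝕜 := ℂ) (p := p)).const_mul (2 * π * I * (x.1 : ℂ))).add
      ((hasFDerivAt_snd (𝕜 := ℂ) (p := p)).const_mul (2 * π * I * (x.2 : ℂ)))
  refine (h1.cexp.const_mul c).congr_fderiv ?_
  ext <;> simp <;> ring

lemma differentiableOn_fourierSeries {c : ℤ × ℤ → ℂ} {F : ℂ → ℂ → ℂ}
    (hF : ∀ τ : ℂ, 0 < τ.im → ∀ z, HasSum (fun x => c x * (qc τ ^ x.1 * qc z ^ x.2)) (F τ z)) :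
    DifferentiableOn ℂ (fun p : ℂ × ℂ => F p.1 p.2) ({τ : ℂ | 0 < τ.im} ×ˢ Set.univ) := by
  rintro ⟨τ₀, z₀⟩ ⟨hτ₀ : 0 < τ₀.im, -⟩
  obtain ⟨y, hy⟩ : ∃ y, y = τ₀.im / 4 := ⟨_, rfl⟩
  have hy0 : 0 < y := by linarith
  obtain ⟨U, hU⟩ : ∃ U : Set (ℂ × ℂ), U = Metric.ball (τ₀, z₀) y := ⟨_, rfl⟩
  have hmem : ∀ p ∈ U, |p.1.im - τ₀.im| < y ∧ |p.2.im - z₀.im| < y := fun p hp => by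
    rw [hU, Metric.mem_ball, Prod.dist_eq, max_lt_iff] at hp
    rw [← Complex.sub_im, ← Complex.sub_im]
    exact ⟨(abs_im_le_norm _).trans_lt (by simpa [dist_eq_norm] using hp.1),
      (abs_im_le_norm _).trans_lt (by simpa [dist_eq_norm] using hp.2)⟩
  obtain ⟨E, hE⟩ : ∃ E : ℤ → ℝ → ℝ, ∀ n t, E n t = rexp (-(2 * π * n * t)) := ⟨_, fun _ _ => rfl⟩
  obtain ⟨S, hS⟩ : ∃ S : ℤ × ℤ → ℝ, ∀ x, S x = ‖c x‖ *
      ((E x.1 (τ₀.im - 2 * y) + E x.1 (τ₀.im + 2 * y)) * (E x.2 (z₀.im - 2 * y) + E x.2 (z₀.im + 2 * y))) :=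
    ⟨_, fun _ => rfl⟩
  have hcorner : ∀ s t : ℝ, 0 < s → Summable fun x : ℤ × ℤ => ‖c x‖ * (E x.1 s * E x.2 t) := fun s t hs => by
    have h := (hF (s * I) (by simpa using hs) (t * I)).summable.norm
    simpa only [norm_mul, norm_qc_zpow, hE, re_ofReal_mul, im_ofReal_mul, Complex.I_im, mul_one] using h
  have hSs : Summable S := by
    have h1 : 0 < τ₀.im - 2 * y := by linarith
    have h2 : 0 < τ₀.im + 2 * y := by linarith
    refine (((hcorner _ (z₀.im - 2 * y) h1).add (hcorner _ (z₀.im + 2 * y) h1)).add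
      ((hcorner _ (z₀.im - 2 * y) h2).add (hcorner _ (z₀.im + 2 * y) h2))).congr fun x => ?_
    rw [hS]; ring
  have hk : ∀ (n : ℤ) (t₀ t : ℝ), |t - t₀| < y →
      (1 + 2 * π * |(n : ℝ)|) * E n t ≤ (1 + y⁻¹) * (E n (t₀ - 2 * y) + E n (t₀ + 2 * y)) := fun n t₀ t h => by
    obtain ⟨h1, h2⟩ := abs_lt.1 h
    have := one_add_abs_mul_exp_le (s := 2 * π * n) (A := t₀ - 2 * y) (t := t) (B := t₀ + 2 * y) hy0
      (by linarith) (by linarith)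
    rw [abs_mul, abs_of_pos Real.two_pi_pos] at this
    simpa only [hE] using this
  have hder := hasFDerivAt_tsum_of_isPreconnected (𝕜 := ℂ)
    (f := fun (x : ℤ × ℤ) (p : ℂ × ℂ) => c x * (qc p.1 ^ x.1 * qc p.2 ^ x.2))
    (hSs.mul_left ((1 + y⁻¹) * (1 + y⁻¹))) (s := U) (by rw [hU]; exact Metric.isOpen_ball)
    (by rw [hU]; exact (convex_ball _ _).isPreconnected) (fun x p _ => hasFDerivAt_monomial (c x) x p)
    (fun x p hp => ?_) (x₀ := (τ₀, z₀)) (by rw [hU]; exact Metric.mem_ball_self hy0)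
    (hF τ₀ hτ₀ z₀).summable (x := (τ₀, z₀)) (by rw [hU]; exact Metric.mem_ball_self hy0)
  · have hev : (fun p : ℂ × ℂ => F p.1 p.2) =ᶠ[𝓝 (τ₀, z₀)]
        fun p => ∑' x : ℤ × ℤ, c x * (qc p.1 ^ x.1 * qc p.2 ^ x.2) := by
      filter_upwards [(continuous_fst.tendsto (τ₀, z₀)).eventually (isOpen_upper.mem_nhds hτ₀)] with p hp
      exact ((hF p.1 hp p.2).tsum_eq).symm
    exact (hder.congr_of_eventuallyEq hev).differentiableAt.differentiableWithinAt
  · obtain ⟨m1, m2⟩ := hmem p hp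
    have k1 := hk x.1 _ _ m1
    have k2 := hk x.2 _ _ m2
    have hL : ‖(x.1 : ℂ) • ContinuousLinearMap.fst ℂ ℂ ℂ + (x.2 : ℂ) • ContinuousLinearMap.snd ℂ ℂ ℂ‖ ≤
        |(x.1 : ℝ)| + |(x.2 : ℝ)| := by
      refine (norm_add_le _ _).trans ?_
      rw [norm_smul, norm_smul, norm_intCast, norm_intCast]
      refine add_le_add (mul_le_of_le_one_right (abs_nonneg _) (ContinuousLinearMap.norm_fst_le ..))
        (mul_le_of_le_one_right (abs_nonneg _) (ContinuousLinearMap.norm_snd_le ..))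
    have hE0 : ∀ n t, 0 < E n t := fun n t => by rw [hE]; exact exp_pos _
    rw [norm_smul]
    simp only [norm_mul, norm_qc_zpow, ← hE, Complex.norm_I, norm_real, Complex.norm_ofNat,
      Real.norm_of_nonneg pi_pos.le, mul_one, hS]
    have hprod := mul_le_mul k1 k2 (by have := hE0 x.2 p.2.im; positivity)
      (by have := hE0 x.1 (τ₀.im - 2 * y); have := hE0 x.1 (τ₀.im + 2 * y); positivity)
    have e1 := hE0 x.1 p.1.im
    have e2 := hE0 x.2 p.2.im
    have hπ := pi_pos
    calc _ ≤ ‖c x‖ * (E x.1 p.1.im * E x.2 p.2.im) * (2 * π) * (|(x.1 : ℝ)| + |(x.2 : ℝ)|) := by gcongr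
      _ = ‖c x‖ * (E x.1 p.1.im * E x.2 p.2.im) * (2 * π * |(x.1 : ℝ)| + 2 * π * |(x.2 : ℝ)|) := by ring
      _ ≤ ‖c x‖ * (E x.1 p.1.im * E x.2 p.2.im) * ((1 + 2 * π * |(x.1 : ℝ)|) * (1 + 2 * π * |(x.2 : ℝ)|)) := by
        gcongr
        have : 0 ≤ 2 * π * |(x.1 : ℝ)| * (2 * π * |(x.2 : ℝ)|) := by positivity
        linarith
      _ = ‖c x‖ * ((1 + 2 * π * |(x.1 : ℝ)|) * E x.1 p.1.im * ((1 + 2 * π * |(x.2 : ℝ)|) * E x.2 p.2.im)) := by ring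
      _ ≤ ‖c x‖ * _ := mul_le_mul_of_nonneg_left hprod (norm_nonneg _)
      _ = _ := by ring

lemma hasSum_integral_fourierSeries {c : ℤ × ℤ → ℂ} {F : ℂ → ℂ → ℂ}
    (hF : ∀ τ : ℂ, 0 < τ.im → ∀ z, HasSum (fun x => c x * (qc τ ^ x.1 * qc z ^ x.2)) (F τ z))
    {y : ℝ} (hy : 0 < y) :
    HasSum (fun r : ℤ => c (0, r)) (∫ t in (0 : ℝ)..1, F (t + y * I) 0) := by
  have him : ∀ t : ℝ, ((t : ℂ) + y * I).im = y := fun t => by simp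
  have h0 : qc 0 = 1 := by simp [qc]
  have h := intervalIntegral.hasSum_integral_of_dominated_convergence
    (μ := volume) (a := (0 : ℝ)) (b := 1) (F := fun (x : ℤ × ℤ) (t : ℝ) => c x * (qc (t + y * I) ^ x.1 * qc 0 ^ x.2))
    (fun x _ => ‖c x * (qc (y * I) ^ x.1 * qc 0 ^ x.2)‖) (f := fun t : ℝ => F (t + y * I) 0) (fun x => ?_) (fun x => ?_)
    (.of_forall fun t _ => (hF (y * I) (by simpa using hy) 0).summable.norm)
    (by simp) (.of_forall fun t _ => hF (t + y * I) (by rw [him]; exact hy) 0)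
  · refine hasSum_of_forall_eq (((Prod.mk_right_injective (0 : ℤ)).hasSum_iff
      (f := fun x : ℤ × ℤ => if x.1 = 0 then c x else 0) fun x hx => if_neg fun h => ?_).2 ?_) fun r => ?_
    · exact hx ⟨x.2, Prod.ext h.symm rfl⟩
    · refine hasSum_of_forall_eq h fun x => ?_
      rw [intervalIntegral.integral_const_mul, intervalIntegral.integral_mul_const]
      split_ifs with hx
      · simp [hx, h0]
      · simp [integral_qc_zpow y hx]
    · simp
  · exact (Continuous.aestronglyMeasurable (by simp only [qc_zpow_eq]; fun_prop))
  · refine .of_forall fun t _ => ?_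
    simp [norm_qc_zpow, -norm_zpow]

lemma hasSum_constant_term {c : ℤ × ℤ → ℂ} {F : ℂ → ℂ → ℂ}
    (hF : ∀ τ : ℂ, 0 < τ.im → ∀ z, HasSum (fun x => c x * (qc τ ^ x.1 * qc z ^ x.2)) (F τ z))
    (hw : ∀ a b c d : ℤ, a * d - b * c = 1 → ∀ τ : ℂ, 0 < τ.im →
      F ((a * τ + b) / (c * τ + d)) 0 = (c * τ + d) ^ 2 * F τ 0) :
    HasSum (fun r : ℤ => c (0, r)) 0 := by
  have hd : DifferentiableOn ℂ (fun τ => F τ 0) {τ | 0 < τ.im} :=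
    (differentiableOn_fourierSeries hF).comp (f := fun τ : ℂ => (τ, (0 : ℂ))) (by fun_prop)
      fun τ hτ => ⟨hτ, Set.mem_univ _⟩
  have hda : ∀ z : ℂ, 0 < z.im → DifferentiableAt ℂ (fun τ => F τ 0) z := fun z hz =>
    hd.differentiableAt (isOpen_upper.mem_nhds hz)
  have hI := fun (y : ℝ) (hy : 0 < y) => hasSum_integral_fourierSeries hF hy
  have hlim := stokes_limit (oneCusp_fricke (N := 1) squarefree_one) (ι := Unit) (ψ := fun _ τ => F τ 0)
    (L := ∑' r : ℤ, c (0, r)) (fun _ z hz => ?_) (fun K hK hKs => ?_) (fun g hg z hz => ?_) ?_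
  · have h0 : ∀ Y : ℝ, (∫ z : ℂ, (eta (FrickeGroup 1) (1 / (2 * (1 : ℕ))) Y z : ℂ) *
        ∑' _ : Unit, dbar (fun τ => F τ 0) z) = 0 := fun Y => by
      refine integral_eq_zero_of_ae (.of_forall fun z => ?_)
      by_cases hz : 0 < z.im
      · simp [dbar_holo (hda z hz)]
      · have he : eta (FrickeGroup 1) (1 / (2 * (1 : ℕ))) Y z = 0 :=
          not_not.1 fun h => hz ((half_pos (oneCusp_fricke squarefree_one).pos).trans_le
            (eta_support (oneCusp_fricke squarefree_one) h).2.1)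
        beta_reduce
        rw [he, Complex.ofReal_zero, zero_mul, Pi.zero_apply]
    simp only [h0] at hlim
    have h1 := tendsto_nhds_unique hlim tendsto_const_nhds
    have h2 : ∑' r : ℤ, c (0, r) = 0 := by
      simpa using h1
    rw [← h2]
    exact (hI 1 one_pos).summable.hasSum
  · exact ((hd.contDiffOn isOpen_upper).contDiffAt (isOpen_upper.mem_nhds hz)).restrict_scalars ℝ
  · obtain ⟨B, hB⟩ := hK.exists_bound_of_continuousOn (hd.continuousOn.mono hKs)
    refine ⟨fun _ => B, Summable.of_finite, fun _ z hz => ⟨hB z hz, ?_⟩⟩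
    rw [dbar_holo (hda z (hKs hz)), norm_zero]
    exact (norm_nonneg _).trans (hB z hz)
  · obtain ⟨e, he, x, y, u, v, hg⟩ := mem_fricke one_pos hg
    obtain rfl := Nat.dvd_one.1 he
    have hdet := g.2
    simp only [Nat.cast_one, Real.sqrt_one, inv_one, one_smul, mul_one] at hg
    rw [hg, det_fin_two_of] at hdet
    have := hw x y u v (by exact_mod_cast hdet) z hz
    simpa [moebius, autF, hg] using this
  · refine tendsto_const_nhds.congr' ?_
    filter_upwards [eventually_gt_atTop 0] with y hy
    simpa using (hI y hy).tsum_eq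

lemma mul_sigmaQ_div {p m : ℕ} (hp : 0 < p) (hm : 0 < m) :
    (p : ℂ) * sigmaQ ((m : ℚ) / p) = ∑ κ ∈ m.divisors, if p ∣ κ then (κ : ℂ) else 0 := by
  have hp0 : (p : ℚ) ≠ 0 := Nat.cast_ne_zero.2 hp.ne'
  by_cases h : p ∣ m
  · obtain ⟨k, rfl⟩ := h
    have hk : 0 < k := Nat.pos_of_mul_pos_left hm
    have e : ((p * k : ℕ) : ℚ) / p = k := by push_cast; field_simp
    have h1 : sigmaQ (k : ℚ) = ∑ d ∈ k.divisors, (d : ℂ) := by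
      rw [sigmaQ, if_pos ⟨Nat.cast_pos.2 hk, Rat.den_natCast k⟩, Rat.num_natCast, Int.toNat_natCast]
    rw [e, h1, ← Finset.sum_filter, Finset.mul_sum]
    refine Finset.sum_bij (fun d _ => p * d) (fun d hd => ?_) (fun _ _ _ _ h => Nat.eq_of_mul_eq_mul_left hp h)
      (fun κ hκ => ?_) fun d _ => (Nat.cast_mul p d).symm
    · simp only [Finset.mem_filter, Nat.mem_divisors] at hd ⊢
      exact ⟨⟨Nat.mul_dvd_mul_left p hd.1, hm.ne'⟩, dvd_mul_right _ _⟩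
    · simp only [Finset.mem_filter, Nat.mem_divisors] at hκ
      obtain ⟨⟨h1, -⟩, d, rfl⟩ := hκ
      exact ⟨d, Nat.mem_divisors.2 ⟨Nat.dvd_of_mul_dvd_mul_left hp h1, hk.ne'⟩, rfl⟩
  · rw [Finset.sum_eq_zero fun κ hκ => if_neg fun h' => h (h'.trans (Nat.mem_divisors.1 hκ).1), sigmaQ,
      if_neg, mul_zero]
    rintro ⟨-, hd⟩
    refine h ?_
    have h2 : ((m : ℚ) / p).num * p = m := by
      have := Rat.coe_int_num_of_den_eq_one hd
      have h3 : (((m : ℚ) / p).num : ℚ) * p = m := by rw [this]; field_simp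
      exact_mod_cast h3
    exact Int.natCast_dvd_natCast.1 ⟨_, by rw [mul_comm]; exact h2.symm⟩

lemma sigmaQ_sum (h₁ : p₁.Prime) (h₂ : p₂.Prime) (hne : p₁ ≠ p₂) {m : ℕ} (hm : 0 < m) :
    sigmaQ (m : ℚ) + (p₁ : ℂ) * (p₂ : ℂ) * sigmaQ ((m : ℚ) / (p₁ * p₂)) + (p₁ : ℂ) * sigmaQ ((m : ℚ) / p₁) +
      (p₂ : ℂ) * sigmaQ ((m : ℚ) / p₂) =
    ∑ κ ∈ m.divisors, (2 : ℂ) ^ (Nat.gcd (p₁ * p₂) κ).primeFactors.card * κ := by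
  have e1 := mul_sigmaQ_div one_pos hm
  have e2 := mul_sigmaQ_div (Nat.mul_pos h₁.pos h₂.pos) hm
  simp only [Nat.cast_one, div_one, one_mul, one_dvd, if_true] at e1
  push_cast at e2
  rw [e1, e2, mul_sigmaQ_div h₁.pos hm, mul_sigmaQ_div h₂.pos hm, ← Finset.sum_add_distrib,
    ← Finset.sum_add_distrib, ← Finset.sum_add_distrib]
  refine Finset.sum_congr rfl fun κ hκ => ?_
  rw [two_pow_card_primeFactors_gcd h₁ h₂ hne (Nat.pos_of_mem_divisors hκ)]
  have hiff : p₁ * p₂ ∣ κ ↔ p₁ ∣ κ ∧ p₂ ∣ κ :=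
    ⟨fun h => ⟨(dvd_mul_right _ _).trans h, (dvd_mul_left _ _).trans h⟩,
      fun h => ((Nat.coprime_primes h₁ h₂).2 hne).mul_dvd_of_dvd_of_dvd h.1 h.2⟩
  by_cases k1 : p₁ ∣ κ <;> by_cases k2 : p₂ ∣ κ <;> simp [hiff, k1, k2] <;> ring

lemma trace_neg_sum (h₁ : p₁.Prime) (h₂ : p₂.Prime) (hne : p₁ ≠ p₂)
    (ha : ∀ n < n₀, a n = 0) {T : ℤ → ℂ}
    (hT0 : T 0 = 2 * ∑ᶠ n : {n : ℕ // 0 < n},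
      a (-(n.1 : ℤ)) * (sigmaQ (n.1 : ℚ) + (p₁ : ℂ) * (p₂ : ℂ) * sigmaQ ((n.1 : ℚ) / (p₁ * p₂)) +
        (p₁ : ℂ) * sigmaQ ((n.1 : ℚ) / p₁) + (p₂ : ℂ) * sigmaQ ((n.1 : ℚ) / p₂)))
    (hTneg : ∀ κ : ℕ, 0 < κ →
      T (-(κ : ℤ) ^ 2) = -(2 : ℂ) ^ ((Nat.gcd (p₁ * p₂) κ).primeFactors.card) * (κ : ℂ) *
        ∑ᶠ m : {m : ℕ // 0 < m ∧ κ ∣ m}, a (-(m.1 : ℤ))) :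
    T 0 = -2 * ∑ κ ∈ Finset.Icc 1 n₀.natAbs, T (-(κ : ℤ) ^ 2) := by
  rw [hT0, finsum_subtype_eq_sum_filter (P := fun n => 0 < n)
    (g := fun n => a (-(n : ℤ)) * (sigmaQ (n : ℚ) + (p₁ : ℂ) * (p₂ : ℂ) * sigmaQ ((n : ℚ) / (p₁ * p₂)) +
        (p₁ : ℂ) * sigmaQ ((n : ℚ) / p₁) + (p₂ : ℂ) * sigmaQ ((n : ℚ) / p₂)))
    (M := n₀.natAbs) (fun _ h => h) (fun m hm => by rw [ha _ (by omega), zero_mul]),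
    Finset.filter_true_of_mem (p := fun n => 0 < n) fun n hn => (Finset.mem_Icc.1 hn).1, neg_mul, ← mul_neg, ← Finset.sum_neg_distrib]
  congr 1
  have h : ∀ κ ∈ Finset.Icc 1 n₀.natAbs, -T (-(κ : ℤ) ^ 2) = ∑ m ∈ Finset.Icc 1 n₀.natAbs,
      if κ ∣ m then a (-(m : ℤ)) * ((2 : ℂ) ^ (Nat.gcd (p₁ * p₂) κ).primeFactors.card * κ) else 0 := fun κ hκ => by
    rw [hTneg κ (Finset.mem_Icc.1 hκ).1, finsum_dvd ha, neg_mul, neg_mul, neg_neg, Finset.mul_sum]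
    refine Finset.sum_congr rfl fun m _ => ?_
    split_ifs <;> ring
  rw [Finset.sum_congr rfl h, Finset.sum_comm]
  refine Finset.sum_congr rfl fun m hm => ?_
  have hm' := Finset.mem_Icc.1 hm
  rw [sigmaQ_sum h₁ h₂ hne hm'.1, Finset.mul_sum, ← Finset.sum_filter]
  refine Finset.sum_congr ?_ fun _ _ => rfl
  ext κ
  simp only [Nat.mem_divisors, Finset.mem_filter, Finset.mem_Icc]
  exact ⟨fun h => ⟨⟨Nat.pos_of_dvd_of_pos h.1 hm'.1, (Nat.le_of_dvd hm'.1 h.1).trans hm'.2⟩, h.1⟩,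
    fun h => ⟨h.2, by omega⟩⟩

lemma trace_neg_eq_zero (ha : ∀ n < n₀, a n = 0) {T : ℤ → ℂ}
    (hTneg : ∀ κ : ℕ, 0 < κ →
      T (-(κ : ℤ) ^ 2) = -(2 : ℂ) ^ ((Nat.gcd N κ).primeFactors.card) * (κ : ℂ) *
        ∑ᶠ m : {m : ℕ // 0 < m ∧ κ ∣ m}, a (-(m.1 : ℤ))) {κ : ℕ} (hκ : n₀.natAbs < κ) :
    T (-(κ : ℤ) ^ 2) = 0 := by
  rw [hTneg κ (by omega), finsum_dvd ha, Finset.sum_eq_zero, mul_zero]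
  intro m hm
  rw [if_neg fun h => ?_]
  have h1 := Finset.mem_Icc.1 hm
  have := Nat.le_of_dvd h1.1 h
  omega

theorem hasSum_thetaLift (h₁ : p₁.Prime) (h₂ : p₂.Prime) (hne : p₁ ≠ p₂)
    (hfd : DifferentiableOn ℂ f {z | 0 < z.im})
    (hf : ∀ g ∈ FrickeGroup (p₁ * p₂), ∀ z : ℂ, 0 < z.im → f (moebius g z) = f z)
    (ha : HasQExp f a n₀) (ha0 : a 0 = 0) {T : ℤ → ℂ}
    (hTpos : ∀ d : ℤ, 0 < d → ∀ h : ℤ,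
      ((h : ZMod (4 * (p₁ * p₂))) ^ 2 = ((-d : ℤ) : ZMod (4 * (p₁ * p₂)))) →
      T d = classTrace (Gamma0SL2R (p₁ * p₂)) f (QdNh d (p₁ * p₂) h))
    (hT0 : T 0 = 2 * ∑ᶠ n : {n : ℕ // 0 < n},
      a (-(n.1 : ℤ)) * (sigmaQ (n.1 : ℚ) + (p₁ : ℂ) * (p₂ : ℂ) * sigmaQ ((n.1 : ℚ) / (p₁ * p₂)) +
        (p₁ : ℂ) * sigmaQ ((n.1 : ℚ) / p₁) + (p₂ : ℂ) * sigmaQ ((n.1 : ℚ) / p₂)))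
    (hTneg : ∀ κ : ℕ, 0 < κ →
      T (-(κ : ℤ) ^ 2) = -(2 : ℂ) ^ ((Nat.gcd (p₁ * p₂) κ).primeFactors.card) * (κ : ℂ) *
        ∑ᶠ m : {m : ℕ // 0 < m ∧ κ ∣ m}, a (-(m.1 : ℤ)))
    (hTneg' : ∀ d : ℤ, d < 0 → (¬ ∃ κ : ℕ, 0 < κ ∧ d = -(κ : ℤ) ^ 2) → T d = 0)
    (hτ : 0 < τ.im) (z : ℂ) :
    HasSum (fun x : ℤ × ℤ => T (4 * (p₁ * p₂ : ℕ) * x.1 - x.2 ^ 2) * (qc τ ^ x.1 * qc z ^ x.2))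
      (thetaLift (p₁ * p₂) f τ z) := by
  have hN : Squarefree (p₁ * p₂) :=
    (Nat.squarefree_mul ((Nat.coprime_primes h₁ h₂).2 hne)).2 ⟨h₁.squarefree, h₂.squarefree⟩
  have hfc : Continuous fun w : ℍ => f w :=
    hfd.continuousOn.comp_continuous continuous_coe fun w => w.im_pos
  obtain ⟨κ₀, hκ₀⟩ := lift_coeff h₁ h₂ hne hfd hf ha ha0 hTpos hTneg hTneg'
  obtain ⟨c, hc⟩ : ∃ c : ℤ × ℤ → ℂ, ∀ x, c x = if 4 * (p₁ * p₂ : ℕ) * x.1 - x.2 ^ 2 = 0 then κ₀ else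
    T (4 * (p₁ * p₂ : ℕ) * x.1 - x.2 ^ 2) := ⟨_, fun _ => rfl⟩
  simp only [← hc] at hκ₀
  have hF : ∀ τ : ℂ, 0 < τ.im → ∀ z, HasSum (fun x => c x * (qc τ ^ x.1 * qc z ^ x.2))
      (thetaLift (p₁ * p₂) f τ z) := fun τ hτ z => by
    refine hasSum_of_forall_eq (hasSum_sum fun e he => ?_) fun x => (hκ₀ τ hτ z x).symm
    have hd := Nat.mem_divisors.1 he
    exact (hasSum_integral_thetaCoeff (oneCusp_fricke hN) hfc ha (Nat.pos_of_mem_divisors he)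
      (Nat.div_pos (Nat.le_of_dvd (Nat.pos_of_ne_zero hd.2) hd.1) (Nat.pos_of_mem_divisors he)) hτ z).1
  have hconst := hasSum_constant_term hF fun a b c d h τ hτ => by
    simpa using thetaLift_transform (p₁ * p₂) f h hτ 0
  have hcpos : ∀ κ : ℕ, 0 < κ → c (0, (κ : ℤ)) = T (-(κ : ℤ) ^ 2) ∧ c (0, -(κ : ℤ)) = T (-(κ : ℤ) ^ 2) :=
    fun κ hκ => by
      have : (κ : ℤ) ≠ 0 := by omega
      constructor <;> simp [hc, this, hκ.ne']
  have hnat := hconst.nat_add_neg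
  have hfin : HasSum (fun n : ℕ => c (0, (n : ℤ)) + c (0, -(n : ℤ)))
      (∑ n ∈ Finset.range (n₀.natAbs + 1), (c (0, (n : ℤ)) + c (0, -(n : ℤ)))) :=
    hasSum_sum_of_ne_finset_zero fun n hn => by
      have hn' : n₀.natAbs < n := by
        have := Finset.mem_range.not.1 hn
        omega
      obtain ⟨e1, e2⟩ := hcpos n (by omega)
      rw [e1, e2, trace_neg_eq_zero ha.1 hTneg hn', add_zero]
  have hval := hnat.unique hfin
  have hκT : κ₀ = T 0 := by
    rw [Finset.sum_range_succ', Finset.sum_congr rfl fun k _ => by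
      rw [(hcpos (k + 1) k.succ_pos).1, (hcpos (k + 1) k.succ_pos).2]] at hval
    have hIcc : Finset.Icc 1 n₀.natAbs = Finset.Ico 1 (n₀.natAbs + 1) := by ext; simp
    rw [trace_neg_sum h₁ h₂ hne ha.1 hT0 hTneg, hIcc, Finset.sum_Ico_eq_sum_range]
    simp only [Nat.add_sub_cancel, add_comm 1]
    have hc0 : c (0, 0) = κ₀ := by simp [hc]
    simp only [Nat.cast_zero, neg_zero, hc0, Finset.sum_add_distrib, zero_add] at hval
    linear_combination -hval
  refine hasSum_of_forall_eq (hF τ hτ z) fun x => ?_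
  rw [hc]
  split_ifs with h
  · rw [h, hκT]
  · rfl

lemma elliptic_of_hasSum {T : ℤ → ℂ} {F : ℂ → ℂ → ℂ}
    (hF : ∀ z, HasSum (fun x : ℤ × ℤ => T (4 * N * x.1 - x.2 ^ 2) * (qc τ ^ x.1 * qc z ^ x.2)) (F τ z))
    (l m : ℤ) (z : ℂ) :
    cexp (2 * π * I * N * ((l : ℂ) ^ 2 * τ + 2 * l * z)) * F τ (z + l * τ + m) = F τ z := by
  let σ : ℤ × ℤ ≃ ℤ × ℤ :=
    { toFun := fun x => (x.1 + l * x.2 + N * l ^ 2, x.2 + 2 * N * l)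
      invFun := fun x => (x.1 - l * x.2 + N * l ^ 2, x.2 - 2 * N * l)
      left_inv := fun x => by ext <;> simp; ring
      right_inv := fun x => by ext <;> simp; ring }
  refine ((hF (z + l * τ + m)).mul_left _).unique (hasSum_of_forall_eq (σ.hasSum_iff.2 (hF z)) fun x => ?_)
  have hd : 4 * (N : ℤ) * (x.1 + l * x.2 + N * l ^ 2) - (x.2 + 2 * N * l) ^ 2 = 4 * N * x.1 - x.2 ^ 2 := by ring
  change _ = T (4 * N * (x.1 + l * x.2 + N * l ^ 2) - (x.2 + 2 * N * l) ^ 2) *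
    (qc τ ^ (x.1 + l * x.2 + N * l ^ 2) * qc z ^ (x.2 + 2 * N * l))
  rw [hd, mul_left_comm]
  congr 1
  simp only [qc_zpow_eq, ← Complex.exp_add]
  refine Complex.exp_eq_exp_iff_exists_int.2 ⟨x.2 * m, ?_⟩
  push_cast
  ring

end

end TraceLift

/-- **Theorem 3.2.** Let `N = p₁p₂` with `p₁ ≠ p₂` prime and let `f = Σ a(n) qⁿ` be a weakly
holomorphic modular function on `Γ₀*(N)` with `a(0) = 0`. With the modular traces `t_f`
(extended to index `0` and negative indices as in the paper),
`Σ_{n,r} t_f(4Nn - r²) qⁿ ζʳ` is a weakly holomorphic Jacobi form of weight `2`, index `N`. -/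
theorem trace_generating_function_jacobi_pq (p₁ p₂ : ℕ) (hp₁ : p₁.Prime) (hp₂ : p₂.Prime)
    (hne : p₁ ≠ p₂) (N : ℕ) (hNpq : N = p₁ * p₂)
    (f : ℂ → ℂ) (hf : IsWeaklyHolModularFn (FrickeGroup N) f)
    (a : ℤ → ℂ) (n₀ : ℤ) (ha : HasQExp f a n₀) (ha0 : a 0 = 0)
    (T : ℤ → ℂ)
    (hTpos : ∀ d : ℤ, 0 < d → ∀ h : ℤ, ((h : ZMod (4 * N)) ^ 2 = ((-d : ℤ) : ZMod (4 * N))) →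
      T d = classTrace (Gamma0SL2R N) f (QdNh d N h))
    (hTpos' : ∀ d : ℤ, 0 < d →
      (¬ ∃ h : ℤ, (h : ZMod (4 * N)) ^ 2 = ((-d : ℤ) : ZMod (4 * N))) → T d = 0)
    (hT0 : T 0 = 2 * ∑ᶠ n : {n : ℕ // 0 < n},
      a (-(n.1 : ℤ)) * (sigmaQ (n.1 : ℚ) + (p₁ : ℂ) * (p₂ : ℂ) * sigmaQ ((n.1 : ℚ) / (p₁ * p₂)) +
        (p₁ : ℂ) * sigmaQ ((n.1 : ℚ) / p₁) + (p₂ : ℂ) * sigmaQ ((n.1 : ℚ) / p₂)))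
    (hTneg : ∀ κ : ℕ, 0 < κ →
      T (-(κ : ℤ) ^ 2) = -(2 : ℂ) ^ ((Nat.gcd N κ).primeFactors.card) * (κ : ℂ) *
        ∑ᶠ m : {m : ℕ // 0 < m ∧ κ ∣ m}, a (-(m.1 : ℤ)))
    (hTneg' : ∀ d : ℤ, d < 0 → (¬ ∃ κ : ℕ, 0 < κ ∧ d = -(κ : ℤ) ^ 2) → T d = 0) :
    ∃ φ : WeakJacobiForm 2 N, ∀ τ z : ℂ, 0 < τ.im →
      HasSum (fun pr : ℤ × ℤ => T (4 * N * pr.1 - pr.2 ^ 2) * qc τ ^ pr.1 * qc z ^ pr.2)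
        (φ.toFun τ z) := by
  subst hNpq
  have hF : ∀ τ : ℂ, 0 < τ.im → ∀ z, HasSum
      (fun x : ℤ × ℤ => T (4 * (p₁ * p₂ : ℕ) * x.1 - x.2 ^ 2) * (qc τ ^ x.1 * qc z ^ x.2))
      (TraceLift.thetaLift (p₁ * p₂) f τ z) := fun τ hτ z =>
    TraceLift.hasSum_thetaLift hp₁ hp₂ hne hf.1 hf.2.1 ha ha0 hTpos hT0 hTneg hTneg' hτ z
  have hexp : ∀ τ z : ℂ, 0 < τ.im → HasSum
      (fun x : ℤ × ℤ => T (4 * (p₁ * p₂ : ℕ) * x.1 - x.2 ^ 2) * qc τ ^ x.1 * qc z ^ x.2)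
      (TraceLift.thetaLift (p₁ * p₂) f τ z) := fun τ z hτ =>
    TraceLift.hasSum_of_forall_eq (hF τ hτ z) fun x => mul_assoc _ _ _
  refine ⟨{ toFun := TraceLift.thetaLift (p₁ * p₂) f
            holo := TraceLift.differentiableOn_fourierSeries hF
            slash_inv := fun a b c d h τ z hτ => ?_
            elliptic := fun l m τ z hτ => TraceLift.elliptic_of_hasSum (hF τ hτ) l m z
            coeff := fun n r => T (4 * (p₁ * p₂ : ℕ) * n - r ^ 2)
            coeff_neg_finite := ?_
            expansion := hexp }, hexp⟩
  · rw [TraceLift.thetaLift_transform _ f h hτ z]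
    have hne0 : (c : ℂ) * τ + d ≠ 0 := fun h0 => by
      have him := congrArg Complex.im h0
      have hre := congrArg Complex.re h0
      simp only [Complex.add_im, Complex.mul_im, Complex.intCast_re, Complex.intCast_im, zero_mul, add_zero,
        Complex.zero_im, mul_eq_zero, hτ.ne', or_false, Int.cast_eq_zero] at him
      simp [him] at hre
      simp [him, hre] at h
    have he : cexp (-(2 * Real.pi * I * (p₁ * p₂ : ℕ) * c * z ^ 2) / (c * τ + d)) *
        cexp (2 * Real.pi * I * (p₁ * p₂ : ℕ) * c * z ^ 2 / (c * τ + d)) = 1 := by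
      rw [← Complex.exp_add, neg_div, neg_add_cancel, Complex.exp_zero]
    have hz : ((c : ℂ) * τ + d) ^ (-2 : ℤ) * (c * τ + d) ^ 2 = 1 := by
      rw [_root_.zpow_neg]; exact inv_mul_cancel₀ (pow_ne_zero 2 hne0)
    calc _ = (((c : ℂ) * τ + d) ^ (-2 : ℤ) * (c * τ + d) ^ 2) *
          (cexp (-(2 * Real.pi * I * (p₁ * p₂ : ℕ) * c * z ^ 2) / (c * τ + d)) *
            cexp (2 * Real.pi * I * (p₁ * p₂ : ℕ) * c * z ^ 2 / (c * τ + d))) *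
          TraceLift.thetaLift (p₁ * p₂) f τ z := by ring
      _ = _ := by rw [he, hz, one_mul, one_mul]
  · refine (Set.finite_Icc (-(n₀.natAbs : ℤ) ^ 2) 0).subset ?_
    rintro n ⟨hn, r, hr⟩
    refine ⟨?_, hn.le⟩
    have hN : (1 : ℤ) ≤ (p₁ * p₂ : ℕ) := by exact_mod_cast Nat.mul_pos hp₁.pos hp₂.pos
    have hneg : 4 * ((p₁ * p₂ : ℕ) : ℤ) * n - r ^ 2 < 0 := by nlinarith [sq_nonneg r]
    obtain ⟨κ, -, hκ⟩ := not_not.1 fun h => hr (hTneg' _ hneg h)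
    have hle : κ ≤ n₀.natAbs := by
      by_contra! hlt
      exact hr (hκ ▸ TraceLift.trace_neg_eq_zero ha.1 hTneg hlt)
    have hsq : (κ : ℤ) ^ 2 ≤ (n₀.natAbs : ℤ) ^ 2 := by gcongr
    nlinarith [sq_nonneg r]
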